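/- Let L be a positive-definite integral ternary lattice and p an odd prime with ord_p(d_L) = 1. For any n ∈ ℕ that is locally represented by L, and for any f ∈ ℕ with gcd(f,p) = 1 and H(4 d_L n / f²) ≠ 0, one has r(np², gen(L)) / r(n, gen(L)) = (H(4 d_L n p² / f²) + S_p*(L)·p·H(4 d_L n / f²)) / (H(4 d_L n / f²) + S_p*(L)·p·H(4 d_L n / (f² p²))). -/

import Mathlib

open scoped BigOperators Classical
open Matrix Filter

noncomputable section

/-! ## Binary quadratic forms, class numbers, and Hurwitz class numbers -/

/-- `(a,b,c)` represents the primitive positive-definite binary quadratic form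
`a x² + b x y + c y²` of discriminant `d`. -/
def IsPrimPosDefBQF (d : ℤ) (f : ℤ × ℤ × ℤ) : Prop :=
  f.2.1 ^ 2 - 4 * f.1 * f.2.2 = d ∧ Int.gcd f.1 (Int.gcd f.2.1 f.2.2) = 1 ∧ 0 < f.1

/-- `SL₂(ℤ)`-equivalence of binary quadratic forms. -/
def BQFEquiv (f g : ℤ × ℤ × ℤ) : Prop :=
  ∃ M : Matrix.SpecialLinearGroup (Fin 2) ℤ,
    g.1 = f.1 * M 0 0 ^ 2 + f.2.1 * M 0 0 * M 1 0 + f.2.2 * M 1 0 ^ 2 ∧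
    g.2.1 = 2 * f.1 * M 0 0 * M 0 1 + f.2.1 * (M 0 0 * M 1 1 + M 0 1 * M 1 0) +
        2 * f.2.2 * M 1 0 * M 1 1 ∧
    g.2.2 = f.1 * M 0 1 ^ 2 + f.2.1 * M 0 1 * M 1 1 + f.2.2 * M 1 1 ^ 2

/-- The class number `h(d)`: the number of `SL₂(ℤ)`-classes of primitive positive-definite
binary quadratic forms of discriminant `d`. -/
def classNum (d : ℤ) : ℕ :=
  Nat.card (Quot fun f g : {f : ℤ × ℤ × ℤ // IsPrimPosDefBQF d f} => BQFEquiv f.1 g.1)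

/-- The number of automorphs `w_d`. -/
def wAut (d : ℤ) : ℕ := if d = -3 then 6 else if d = -4 then 4 else 2

def hurwitzNat (N : ℕ) : ℚ :=
  if 0 < N ∧ (N % 4 = 0 ∨ N % 4 = 3) then
    ∑ f ∈ N.divisors.filter fun f => f ^ 2 ∣ N,
      (classNum (-((N / f ^ 2 : ℕ) : ℤ)) : ℚ) / ((wAut (-((N / f ^ 2 : ℕ) : ℤ)) : ℚ) / 2)
  else 0

/-- Hurwitz class number, with the convention `H(x) = 0` unless `x` is a positive integer
congruent to `0` or `3 (mod 4)`. -/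
def hurwitz (x : ℚ) : ℚ := if x.den = 1 ∧ 0 ≤ x.num then hurwitzNat x.num.toNat else 0

/-! ## Kronecker symbol and fundamental discriminants -/

def kron2 (a : ℤ) : ℤ := if a % 2 = 0 then 0 else if a % 8 = 1 ∨ a % 8 = 7 then 1 else -1

/-- The Kronecker symbol `(a / n)` for `n ∈ ℕ`. -/
def kroneckerSym (a : ℤ) (n : ℕ) : ℤ :=
  kron2 a ^ padicValNat 2 n * jacobiSym a (n / 2 ^ padicValNat 2 n)

/-- Fundamental discriminants. -/
def IsFundamentalDisc (d : ℤ) : Prop :=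
  d % 4 = 1 ∧ Squarefree d ∨ d % 4 = 0 ∧ Squarefree (d / 4) ∧ (d / 4 % 4 = 2 ∨ d / 4 % 4 = 3)

/-! ## Ternary quadratic lattices via Gram matrices -/

abbrev TernMat := Matrix (Fin 3) (Fin 3) ℤ

/-- The quadratic form attached to a Gram matrix. -/
def quadVal {R : Type*} [CommRing R] {k : ℕ} (M : Matrix (Fin k) (Fin k) R) (x : Fin k → R) : R :=
  ∑ i, ∑ j, x i * M i j * x j

/-- `A` is the Gram matrix of a positive-definite integral ternary lattice. -/
def IsLat (A : TernMat) : Prop := A.IsSymm ∧ ∀ x : Fin 3 → ℤ, x ≠ 0 → 0 < quadVal A x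

/-- The number of representations of `n` by the lattice with Gram matrix `A`. -/
def rRep (n : ℤ) (A : TernMat) : ℕ := Nat.card {x : Fin 3 → ℤ // quadVal A x = n}

/-- Isometry of ternary lattices via their Gram matrices. -/
def LatIsom (A B : TernMat) : Prop := ∃ U : TernMat, IsUnit U.det ∧ Uᵀ * A * U = B

/-- The number of automorphs `o(L)`. -/
def numAut (A : TernMat) : ℕ := Nat.card {U : TernMat // IsUnit U.det ∧ Uᵀ * A * U = A}

def padicMat (p : ℕ) [Fact p.Prime] {k : ℕ} (A : Matrix (Fin k) (Fin k) ℤ) :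
    Matrix (Fin k) (Fin k) ℤ_[p] := A.map Int.cast

/-- Isometry of `ℤ_p`-lattices given by Gram matrices. -/
def PadicIsomP (p : ℕ) [Fact p.Prime] {k : ℕ} (M N : Matrix (Fin k) (Fin k) ℤ_[p]) : Prop :=
  ∃ U : Matrix (Fin k) (Fin k) ℤ_[p], IsUnit U.det ∧ Uᵀ * M * U = N

/-- `A ⊗ ℤ_p ≅ B ⊗ ℤ_p`. -/
def PadicLatIsom (p : ℕ) (hp : p.Prime) (A B : TernMat) : Prop :=
  letI : Fact p.Prime := ⟨hp⟩
  PadicIsomP p (padicMat p A) (padicMat p B)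

/-- `B` is (the Gram matrix of a lattice) in the genus of `A`. -/
def InGenus (A B : TernMat) : Prop :=
  IsLat B ∧ ∀ (p : ℕ) (hp : p.Prime), PadicLatIsom p hp A B

/-- The mass `w(L)` of the genus of `A`. -/
def massOf (A : TernMat) : ℝ :=
  ∑ᶠ c : Quot fun B C : {B : TernMat // InGenus A B} => LatIsom B.1 C.1,
    ((numAut (Quot.out c).1 : ℝ))⁻¹

/-- The Siegel–Weil average `r(n, gen(L))`. -/
def rGenus (n : ℤ) (A : TernMat) : ℝ :=
  (massOf A)⁻¹ *
    ∑ᶠ c : Quot fun B C : {B : TernMat // InGenus A B} => LatIsom B.1 C.1,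
      (rRep n (Quot.out c).1 : ℝ) / (numAut (Quot.out c).1 : ℝ)

/-! ## Local invariants -/

/-- `L_p` is isotropic. -/
def IsotropicP (p : ℕ) [Fact p.Prime] (A : TernMat) : Prop :=
  ∃ x : Fin 3 → ℤ_[p], x ≠ 0 ∧ quadVal (padicMat p A) x = 0

/-- The modified Hasse symbol `S_p*(L)`: `1` if `L_p` is isotropic, `-1` if anisotropic. -/
def SpStar (p : ℕ) (A : TernMat) : ℤ :=
  if h : p.Prime then
    letI : Fact p.Prime := ⟨h⟩
    if IsotropicP p A then 1 else -1
  else 1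

/-- The lattice is even: all represented numbers are even. -/
def IsEvenLat (A : TernMat) : Prop := ∀ x : Fin 3 → ℤ, 2 ∣ quadVal A x

/-- The lattice is primitive: its scale ideal is `ℤ`. -/
def IsPrimitiveLat (A : TernMat) : Prop :=
  Finset.univ.gcd (fun ij : Fin 3 × Fin 3 => (A ij.1 ij.2).natAbs) = 1

/-- Stability at a prime `p`. -/
def StableAt (A : TernMat) (p : ℕ) : Prop :=
  padicValInt p A.det ≤ 1 ∧ (p = 2 → (padicValInt 2 A.det = 1 ↔ IsEvenLat A))

/-- A stable (primitive) ternary lattice. -/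
def IsStable (A : TernMat) : Prop := IsPrimitiveLat A ∧ ∀ p : ℕ, p.Prime → StableAt A p

def RepresentedAt (p : ℕ) (hp : p.Prime) (n : ℤ) (A : TernMat) : Prop :=
  letI : Fact p.Prime := ⟨hp⟩
  ∃ x : Fin 3 → ℤ_[p], quadVal (padicMat p A) x = (n : ℤ_[p])

/-- `n` is represented by `L_p` for every prime `p`. -/
def LocallyRepresented (n : ℤ) (A : TernMat) : Prop :=
  ∀ (p : ℕ) (hp : p.Prime), RepresentedAt p hp n A

/-! ## Siegel local densities -/

/-- The Siegel local density `α_p(n, L)` (here `s = 1`, `t = 3`). -/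
def localDensity (p : ℕ) (hp : p.Prime) (n : ℤ) (A : TernMat) : ℝ :=
  limUnder atTop fun r : ℕ =>
    (Nat.card {X : Fin 3 → ZMod (p ^ r) //
        (∑ i, ∑ j, X i * (A i j : ZMod (p ^ r)) * X j) = (n : ZMod (p ^ r))} : ℝ) /
      (p : ℝ) ^ (2 * r)

def localDensityN (p : ℕ) (n : ℤ) (A : TernMat) : ℝ :=
  if h : p.Prime then localDensity p h n A else 0

/-- The value `L(1, χ_a)` of the Dirichlet series attached to the Kronecker symbol `(a/·)`. -/
def LOne (a : ℤ) : ℝ :=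
  limUnder atTop fun N : ℕ =>
    ∑ k ∈ Finset.range N, (kroneckerSym a (k + 1) : ℝ) / (k + 1)

/-! ## Watson transformations (Gram matrix form) -/

/-- The underlying set of `Λ_m(L)` in the coordinates of `L`. -/
def watsonSetG (m : ℕ) (A : TernMat) : Set (Fin 3 → ℤ) :=
  {x | ∀ y : Fin 3 → ℤ, (m : ℤ) ∣ (quadVal A (x + y) - quadVal A y)}

/-- `B` is a Gram matrix for the sublattice `Λ_m(L)` of the lattice `L` with Gram matrix `A`. -/
def IsWatsonGram (m : ℕ) (A B : TernMat) : Prop :=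
  ∃ T : TernMat, Set.range T.mulVec = watsonSetG m A ∧ B = Tᵀ * A * T

/-- `B` is a Gram matrix of the Watson transform `λ_m(L)`: the primitive rescaling of `Λ_m(L)`. -/
def IsLambdaGram (m : ℕ) (A B : TernMat) : Prop :=
  IsPrimitiveLat B ∧
    ∃ (B₀ : TernMat) (c : ℚ), 0 < c ∧ IsWatsonGram m A B₀ ∧
      B.map ((↑) : ℤ → ℚ) = c • B₀.map ((↑) : ℤ → ℚ)

/-- The `3×3` Gram matrix of the orthogonal sum `M ⊥ U`. -/
def blockMat3 {p : ℕ} [Fact p.Prime] (k : ℕ) (hk : k ≤ 3)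
    (M : Matrix (Fin k) (Fin k) ℤ_[p]) (U : Matrix (Fin (3 - k)) (Fin (3 - k)) ℤ_[p]) :
    Matrix (Fin 3) (Fin 3) ℤ_[p] :=
  Matrix.reindex (finSumFinEquiv.trans (finCongr (by omega)))
    (finSumFinEquiv.trans (finCongr (by omega))) (Matrix.fromBlocks M 0 0 U)

end

section Basics

lemma quadVal_three {R : Type*} [CommRing R] (M : Matrix (Fin 3) (Fin 3) R) (x : Fin 3 → R) :
    quadVal M x = x 0 * M 0 0 * x 0 + x 0 * M 0 1 * x 1 + x 0 * M 0 2 * x 2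
      + (x 1 * M 1 0 * x 0 + x 1 * M 1 1 * x 1 + x 1 * M 1 2 * x 2)
      + (x 2 * M 2 0 * x 0 + x 2 * M 2 1 * x 1 + x 2 * M 2 2 * x 2) := by
  simp [quadVal, Fin.sum_univ_three]

lemma quadVal_dot {R : Type*} [CommRing R] (M : Matrix (Fin 3) (Fin 3) R) (x : Fin 3 → R) :
    quadVal M x = x ⬝ᵥ (M *ᵥ x) := by
  simp [quadVal, dotProduct, mulVec, Finset.mul_sum, mul_assoc]

lemma quadVal_conj {R : Type*} [CommRing R] (M U : Matrix (Fin 3) (Fin 3) R) (x : Fin 3 → R) :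
    quadVal (Uᵀ * M * U) x = quadVal M (U *ᵥ x) := by
  rw [quadVal_dot, quadVal_dot, ← Matrix.mulVec_mulVec, ← Matrix.mulVec_mulVec,
    Matrix.mulVec_transpose, dotProduct_comm x, ← Matrix.dotProduct_mulVec, dotProduct_comm]

lemma quadVal_smul {R : Type*} [CommRing R] (M : Matrix (Fin 3) (Fin 3) R) (a : R) (x : Fin 3 → R) :
    quadVal M (a • x) = a ^ 2 * quadVal M x := by
  simp only [quadVal_three, Pi.smul_apply, smul_eq_mul]; ring

lemma quadVal_smul_mat {R : Type*} [CommRing R] (M : Matrix (Fin 3) (Fin 3) R) (a : R)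
    (x : Fin 3 → R) : quadVal (a • M) x = a * quadVal M x := by
  simp only [quadVal_three, Matrix.smul_apply, smul_eq_mul]; ring

lemma quadVal_map {R S : Type*} [CommRing R] [CommRing S] (φ : R →+* S)
    (M : Matrix (Fin 3) (Fin 3) R) (x : Fin 3 → R) :
    quadVal (M.map φ) (φ ∘ x) = φ (quadVal M x) := by
  simp [quadVal_three]

lemma conj_symm {R : Type*} [CommRing R] {M : Matrix (Fin 3) (Fin 3) R} (hM : M.IsSymm)
    (U : Matrix (Fin 3) (Fin 3) R) : (Uᵀ * M * U).IsSymm := by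
  unfold Matrix.IsSymm
  simp [Matrix.transpose_mul, hM.eq, Matrix.mul_assoc]

lemma IsLat.e10 {B : TernMat} (h : IsLat B) : B 1 0 = B 0 1 := h.1.apply 0 1
lemma IsLat.e20 {B : TernMat} (h : IsLat B) : B 2 0 = B 0 2 := h.1.apply 0 2
lemma IsLat.e21 {B : TernMat} (h : IsLat B) : B 2 1 = B 1 2 := h.1.apply 1 2

lemma IsLat.pos00 {B : TernMat} (h : IsLat B) : 0 < B 0 0 := by
  have := h.2 ![1, 0, 0] (by intro h0; simpa using congrFun h0 0)
  simpa [quadVal_three] using this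

lemma IsLat.posMinor {B : TernMat} (h : IsLat B) : 0 < B 0 0 * B 1 1 - B 0 1 ^ 2 := by
  have h0 := h.pos00
  have := h.2 ![- B 0 1, B 0 0, 0] (by intro h1; have := congrFun h1 1; simp at this; omega)
  rw [quadVal_three] at this
  simp [h.e10] at this
  have h2 : 0 < B 0 0 * (B 0 0 * B 1 1 - B 0 1 ^ 2) := by linarith
  exact (mul_pos_iff_of_pos_left h0).1 h2

lemma IsLat.posDet {B : TernMat} (h : IsLat B) : 0 < B.det := by
  have h0 := h.posMinor
  have := h.2 ![B 0 1 * B 1 2 - B 0 2 * B 1 1, B 0 2 * B 0 1 - B 0 0 * B 1 2,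
    B 0 0 * B 1 1 - B 0 1 ^ 2] (by intro h1; have := congrFun h1 2; simp at this; omega)
  rw [quadVal_three] at this
  simp [h.e10, h.e20, h.e21] at this
  have h2 : 0 < (B 0 0 * B 1 1 - B 0 1 ^ 2) * B.det := by
    rw [Matrix.det_fin_three, h.e10, h.e20, h.e21]; linarith
  exact (mul_pos_iff_of_pos_left h0).1 h2

lemma lagrange_id {R : Type*} [CommRing R] {B : Matrix (Fin 3) (Fin 3) R} (h : B.IsSymm)
    (x : Fin 3 → R) :
    B 0 0 * (B 0 0 * B 1 1 - B 0 1 ^ 2) * quadVal B x =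
      (B 0 0 * B 1 1 - B 0 1 ^ 2) * (B 0 0 * x 0 + B 0 1 * x 1 + B 0 2 * x 2) ^ 2 +
      ((B 0 0 * B 1 1 - B 0 1 ^ 2) * x 1 + (B 0 0 * B 1 2 - B 0 1 * B 0 2) * x 2) ^ 2 +
      B 0 0 * B.det * x 2 ^ 2 := by
  have h1 : B 1 0 = B 0 1 := h.apply 0 1
  have h2 : B 2 0 = B 0 2 := h.apply 0 2
  have h3 : B 2 1 = B 1 2 := h.apply 1 2
  rw [quadVal_three, Matrix.det_fin_three, h1, h2, h3]; ring

lemma isLat_of_pos {B : TernMat} (h : B.IsSymm) (h0 : 0 < B 0 0)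
    (h1 : 0 < B 0 0 * B 1 1 - B 0 1 ^ 2) (h2 : 0 < B.det) : IsLat B := by
  refine ⟨h, fun x hx => ?_⟩
  have key := lagrange_id h x
  by_contra hneg
  push Not at hneg
  have hl : B 0 0 * (B 0 0 * B 1 1 - B 0 1 ^ 2) * quadVal B x ≤ 0 :=
    mul_nonpos_of_nonneg_of_nonpos (by positivity) hneg
  set g := B 0 0 * B 1 1 - B 0 1 ^ 2
  have t1 : 0 ≤ g * (B 0 0 * x 0 + B 0 1 * x 1 + B 0 2 * x 2) ^ 2 := by positivity
  have t2 : 0 ≤ (g * x 1 + (B 0 0 * B 1 2 - B 0 1 * B 0 2) * x 2) ^ 2 := by positivity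
  have t3 : 0 ≤ B 0 0 * B.det * x 2 ^ 2 := by positivity
  have e3 : B 0 0 * B.det * x 2 ^ 2 = 0 := by linarith
  have e2 : (g * x 1 + (B 0 0 * B 1 2 - B 0 1 * B 0 2) * x 2) ^ 2 = 0 := by linarith
  have e1 : g * (B 0 0 * x 0 + B 0 1 * x 1 + B 0 2 * x 2) ^ 2 = 0 := by linarith
  have x2 : x 2 = 0 := by
    have : x 2 ^ 2 = 0 := by
      rcases mul_eq_zero.1 e3 with h | h
      · exact absurd h (by positivity)
      · exact h
    exact pow_eq_zero_iff (by norm_num) |>.1 this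
  have x1 : x 1 = 0 := by
    have := pow_eq_zero_iff (by norm_num) |>.1 e2
    rw [x2] at this
    simp at this
    exact this.resolve_left h1.ne'
  have x0 : x 0 = 0 := by
    rcases mul_eq_zero.1 e1 with h | h
    · exact absurd h h1.ne'
    · have := pow_eq_zero_iff (by norm_num) |>.1 h
      rw [x2, x1] at this
      simp at this
      exact this.resolve_left h0.ne'
  apply hx
  ext i; fin_cases i <;> assumption

lemma IsLat.conj {B U : TernMat} (h : IsLat B) (hU : U.det ≠ 0) : IsLat (Uᵀ * B * U) := by
  refine ⟨conj_symm h.1 U, fun x hx => ?_⟩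
  rw [quadVal_conj]
  apply h.2
  intro h0
  exact hx (Matrix.eq_zero_of_mulVec_eq_zero hU h0)

lemma finite_rep {B : TernMat} (h : IsLat B) (n : ℤ) : {x : Fin 3 → ℤ | quadVal B x = n}.Finite := by
  have h0 := h.pos00
  have h1 := h.posMinor
  have h2 := h.posDet
  set g := B 0 0 * B 1 1 - B 0 1 ^ 2 with hg
  set C := B 0 0 * g * n
  let φ : (Fin 3 → ℤ) → ℤ × ℤ × ℤ := fun x => (B 0 0 * x 0 + B 0 1 * x 1 + B 0 2 * x 2,
    g * x 1 + (B 0 0 * B 1 2 - B 0 1 * B 0 2) * x 2, x 2)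
  have hφ : Function.Injective φ := by
    intro x y hxy
    simp only [φ, Prod.mk.injEq] at hxy
    obtain ⟨a, b, c⟩ := hxy
    rw [c] at a b
    have b' : x 1 = y 1 := by
      have : g * x 1 = g * y 1 := by linarith
      exact mul_left_cancel₀ h1.ne' this
    rw [b'] at a
    have a' : x 0 = y 0 := by
      have : B 0 0 * x 0 = B 0 0 * y 0 := by linarith
      exact mul_left_cancel₀ h0.ne' this
    ext i; fin_cases i <;> assumption
  have sub : {x : Fin 3 → ℤ | quadVal B x = n} ⊆
      φ ⁻¹' (Set.Icc (-C) C ×ˢ (Set.Icc (-C) C ×ˢ Set.Icc (-C) C)) := by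
    intro x hx
    simp only [Set.mem_ofPred_eq] at hx
    have key := lagrange_id h.1 x
    rw [hx, ← hg] at key
    have t1 : 0 ≤ g * (B 0 0 * x 0 + B 0 1 * x 1 + B 0 2 * x 2) ^ 2 := by positivity
    have t2 : 0 ≤ (g * x 1 + (B 0 0 * B 1 2 - B 0 1 * B 0 2) * x 2) ^ 2 := by positivity
    have t3 : 0 ≤ B 0 0 * B.det * x 2 ^ 2 := by positivity
    have aux : ∀ k z : ℤ, 0 < k → k * z ^ 2 ≤ C → z ∈ Set.Icc (-C) C := by
      intro k z hk hz
      have : z ^ 2 ≤ C := by nlinarith [sq_nonneg z]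
      constructor <;> nlinarith [sq_nonneg z, sq_nonneg (z - 1), sq_nonneg (z + 1)]
    simp only [Set.mem_preimage, φ, Set.mem_prod]
    refine ⟨aux g _ h1 (by linarith), aux 1 _ one_pos (by linarith),
      aux (B 0 0 * B.det) _ (by positivity) (by linarith)⟩
  refine Set.Finite.subset (Set.Finite.preimage hφ.injOn ?_) sub
  exact (Set.finite_Icc _ _).prod ((Set.finite_Icc _ _).prod (Set.finite_Icc _ _))

lemma conj_apply {R : Type*} [CommRing R] (M U : Matrix (Fin 3) (Fin 3) R) (i : Fin 3) :
    (Uᵀ * M * U) i i = quadVal M (fun k => U k i) := by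
  simp only [quadVal_three, Matrix.mul_apply, Fin.sum_univ_three, Matrix.transpose_apply]
  ring

lemma finite_isos {B : TernMat} (h : IsLat B) (C : TernMat) :
    {U : TernMat | Uᵀ * B * U = C}.Finite := by
  have hf : {g : Fin 3 → Fin 3 → ℤ | ∀ i, g i ∈ {x : Fin 3 → ℤ | quadVal B x = C i i}}.Finite :=
    Set.Finite.pi' fun i => finite_rep h _
  refine Set.Finite.subset (hf.preimage (f := fun U : TernMat => (fun i k => U k i))
    (fun U _ V _ hUV => by ext i j; exact congrFun (congrFun hUV j) i)) ?_
  intro U hU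
  have hU' : Uᵀ * B * U = C := hU
  intro i
  change quadVal B (fun k => U k i) = C i i
  rw [← hU', conj_apply]

lemma LatIsom.refl (B : TernMat) : LatIsom B B := ⟨1, by simp, by simp⟩

lemma LatIsom.symm {B C : TernMat} (h : LatIsom B C) : LatIsom C B := by
  obtain ⟨U, hU, rfl⟩ := h
  refine ⟨U⁻¹, ?_, ?_⟩
  · exact (Matrix.isUnit_nonsing_inv_det_iff).2 hU
  · have h1 : U * U⁻¹ = 1 := Matrix.mul_nonsing_inv U hU
    have h2 : (U⁻¹)ᵀ * Uᵀ = 1 := by rw [← Matrix.transpose_mul, h1, Matrix.transpose_one]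
    calc (U⁻¹)ᵀ * (Uᵀ * B * U) * U⁻¹ = ((U⁻¹)ᵀ * Uᵀ) * B * (U * U⁻¹) := by
          simp only [Matrix.mul_assoc]
      _ = B := by rw [h1, h2]; simp

lemma LatIsom.trans {B C D : TernMat} (h : LatIsom B C) (h' : LatIsom C D) : LatIsom B D := by
  obtain ⟨U, hU, rfl⟩ := h
  obtain ⟨V, hV, rfl⟩ := h'
  refine ⟨U * V, by rw [Matrix.det_mul]; exact hU.mul hV, ?_⟩
  simp only [Matrix.transpose_mul, Matrix.mul_assoc]

lemma numAut_pos {B : TernMat} (h : IsLat B) : 0 < numAut B := by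
  unfold numAut
  have : Finite {U : TernMat // IsUnit U.det ∧ Uᵀ * B * U = B} :=
    ((finite_isos h B).subset (fun U hU => hU.2)).to_subtype
  have : Nonempty {U : TernMat // IsUnit U.det ∧ Uᵀ * B * U = B} := ⟨⟨1, by simp, by simp⟩⟩
  exact Nat.card_pos

/-- isometries between equivalent lattices are counted by `numAut`. -/
lemma card_isos {B C : TernMat} (h : LatIsom B C) :
    Nat.card {U : TernMat // IsUnit U.det ∧ Uᵀ * B * U = C} = numAut C := by
  obtain ⟨U, hU, hUC⟩ := h
  have h1 : U * U⁻¹ = 1 := Matrix.mul_nonsing_inv U hU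
  have h2 : U⁻¹ * U = 1 := Matrix.nonsing_inv_mul U hU
  have h3 : (U⁻¹)ᵀ * C * U⁻¹ = B := by
    have h4 : (U⁻¹)ᵀ * Uᵀ = 1 := by rw [← Matrix.transpose_mul, h1, Matrix.transpose_one]
    calc (U⁻¹)ᵀ * C * U⁻¹ = ((U⁻¹)ᵀ * Uᵀ) * B * (U * U⁻¹) := by
          rw [← hUC]; simp only [Matrix.mul_assoc]
      _ = B := by rw [h1, h4]; simp
  unfold numAut
  refine Nat.card_congr ⟨fun V => ⟨U⁻¹ * V.1, ?_, ?_⟩, fun V => ⟨U * V.1, ?_, ?_⟩, ?_, ?_⟩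
  · rw [Matrix.det_mul]; exact ((Matrix.isUnit_nonsing_inv_det_iff).2 hU).mul V.2.1
  · rw [Matrix.transpose_mul]
    calc V.1ᵀ * (U⁻¹)ᵀ * C * (U⁻¹ * V.1) = V.1ᵀ * ((U⁻¹)ᵀ * C * U⁻¹) * V.1 := by
          simp only [Matrix.mul_assoc]
      _ = C := by rw [h3]; exact V.2.2
  · rw [Matrix.det_mul]; exact hU.mul V.2.1
  · rw [Matrix.transpose_mul]
    calc V.1ᵀ * Uᵀ * B * (U * V.1) = V.1ᵀ * (Uᵀ * B * U) * V.1 := by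
          simp only [Matrix.mul_assoc]
      _ = C := by rw [hUC]; exact V.2.2
  · intro V; ext1; simp [← Matrix.mul_assoc, h1]
  · intro V; ext1; simp [← Matrix.mul_assoc, h2]

lemma numAut_congr {B C : TernMat} (h : LatIsom B C) : numAut B = numAut C := by
  obtain ⟨U, hU, hUC⟩ := h
  rw [← card_isos ⟨U, hU, hUC⟩]
  have h1 : U * U⁻¹ = 1 := Matrix.mul_nonsing_inv U hU
  have h2 : U⁻¹ * U = 1 := Matrix.nonsing_inv_mul U hU
  unfold numAut
  refine Nat.card_congr ⟨fun V => ⟨V.1 * U, ?_, ?_⟩, fun V => ⟨V.1 * U⁻¹, ?_, ?_⟩, ?_, ?_⟩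
  · rw [Matrix.det_mul]; exact V.2.1.mul hU
  · rw [Matrix.transpose_mul]
    calc Uᵀ * V.1ᵀ * B * (V.1 * U) = Uᵀ * (V.1ᵀ * B * V.1) * U := by
          simp only [Matrix.mul_assoc]
      _ = C := by rw [V.2.2]; exact hUC
  · rw [Matrix.det_mul]; exact V.2.1.mul ((Matrix.isUnit_nonsing_inv_det_iff).2 hU)
  · rw [Matrix.transpose_mul]
    have h4 : (U⁻¹)ᵀ * Uᵀ = 1 := by rw [← Matrix.transpose_mul, h1, Matrix.transpose_one]
    calc (U⁻¹)ᵀ * V.1ᵀ * B * (V.1 * U⁻¹) = (U⁻¹)ᵀ * (V.1ᵀ * B * V.1) * U⁻¹ := by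
          simp only [Matrix.mul_assoc]
      _ = ((U⁻¹)ᵀ * Uᵀ) * B * (U * U⁻¹) := by
          rw [V.2.2, ← hUC]; simp only [Matrix.mul_assoc]
      _ = B := by rw [h1, h4]; simp
  · intro V; ext1; simp [Matrix.mul_assoc, h1]
  · intro V; ext1; simp [Matrix.mul_assoc, h2]

lemma rRep_congr {B C : TernMat} (h : LatIsom B C) (n : ℤ) : rRep n B = rRep n C := by
  obtain ⟨U, hU, rfl⟩ := h
  have h1 : U * U⁻¹ = 1 := Matrix.mul_nonsing_inv U hU
  have h2 : U⁻¹ * U = 1 := Matrix.nonsing_inv_mul U hU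
  unfold rRep
  refine Nat.card_congr ⟨fun x => ⟨U⁻¹ *ᵥ x.1, ?_⟩, fun x => ⟨U *ᵥ x.1, ?_⟩, ?_, ?_⟩
  · rw [quadVal_conj, Matrix.mulVec_mulVec, h1, Matrix.one_mulVec]; exact x.2
  · rw [← quadVal_conj]; exact x.2
  · intro x; ext1; simp [Matrix.mulVec_mulVec, h1]
  · intro x; ext1; simp [Matrix.mulVec_mulVec, h2]

end Basics

section Reduction

lemma exists_round (x a : ℤ) (ha : 0 < a) : ∃ k : ℤ, 2 * (x + k * a) ≤ a ∧ -a ≤ 2 * (x + k * a) := by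
  refine ⟨-((2 * x + a) / (2 * a)), ?_⟩
  have h1 := Int.mul_ediv_add_emod (2 * x + a) (2 * a)
  have h2 := Int.emod_nonneg (2 * x + a) (show (2 * a : ℤ) ≠ 0 by omega)
  have h3 := Int.emod_lt_of_pos (2 * x + a) (show (0 : ℤ) < 2 * a by omega)
  set q := (2 * x + a) / (2 * a)
  set r := (2 * x + a) % (2 * a)
  constructor <;> nlinarith

lemma isLat_of_latIsom {B C : TernMat} (hB : IsLat B) (h : LatIsom B C) : IsLat C := by
  obtain ⟨U, hU, rfl⟩ := h
  exact hB.conj hU.ne_zero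

lemma det_of_latIsom {B C : TernMat} (h : LatIsom B C) : C.det = B.det := by
  obtain ⟨U, hU, rfl⟩ := h
  rw [Matrix.det_mul, Matrix.det_mul, Matrix.det_transpose]
  rcases Int.isUnit_iff.1 hU with h | h <;> rw [h] <;> ring

lemma exists_reduced {B : TernMat} (hB : IsLat B) : ∃ C, LatIsom B C ∧
    C 0 0 ≤ C 1 1 ∧ C 0 0 * C 1 1 - C 0 1 ^ 2 ≤ C 0 0 * C 2 2 - C 0 2 ^ 2 ∧
    2 * C 0 1 ≤ C 0 0 ∧ - C 0 0 ≤ 2 * C 0 1 ∧ 2 * C 0 2 ≤ C 0 0 ∧ - C 0 0 ≤ 2 * C 0 2 ∧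
    2 * (C 0 0 * C 1 2 - C 0 1 * C 0 2) ≤ C 0 0 * C 1 1 - C 0 1 ^ 2 ∧
    - (C 0 0 * C 1 1 - C 0 1 ^ 2) ≤ 2 * (C 0 0 * C 1 2 - C 0 1 * C 0 2) := by
  obtain ⟨C₀, hC₀, hmin⟩ := exists_minimalFor_of_wellFoundedLT (fun C => LatIsom B C)
    (fun C => toLex ((C 0 0).toNat, (C 0 0 * C 1 1 - C 0 1 ^ 2).toNat)) ⟨B, LatIsom.refl B⟩
  have L0 := isLat_of_latIsom hB hC₀
  obtain ⟨j, hj1, hj2⟩ := exists_round (C₀ 0 0 * C₀ 1 2 - C₀ 0 1 * C₀ 0 2)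
    (C₀ 0 0 * C₀ 1 1 - C₀ 0 1 ^ 2) L0.posMinor
  obtain ⟨k, hk1, hk2⟩ := exists_round (C₀ 0 1) (C₀ 0 0) L0.pos00
  obtain ⟨l, hl1, hl2⟩ := exists_round (C₀ 0 2 + j * C₀ 0 1) (C₀ 0 0) L0.pos00
  set U : TernMat := !![1, k, l; 0, 1, j; 0, 0, 1] with hU
  have hUd : IsUnit U.det := by
    simp [hU, Matrix.det_fin_three]
  set C := Uᵀ * C₀ * U with hC
  have hCC : LatIsom C₀ C := ⟨U, hUd, rfl⟩
  have e00 : C 0 0 = C₀ 0 0 := by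
    simp [hC, hU, Matrix.mul_apply, Fin.sum_univ_three]
  have e01 : C 0 1 = C₀ 0 1 + k * C₀ 0 0 := by
    simp [hC, hU, Matrix.mul_apply, Fin.sum_univ_three]; ring
  have e02 : C 0 2 = C₀ 0 2 + j * C₀ 0 1 + l * C₀ 0 0 := by
    simp [hC, hU, Matrix.mul_apply, Fin.sum_univ_three]; ring
  have e11 : C 1 1 = C₀ 1 1 + 2 * k * C₀ 0 1 + k ^ 2 * C₀ 0 0 := by
    simp [hC, hU, Matrix.mul_apply, Fin.sum_univ_three, L0.e10]; ring
  have e12 : C 1 2 = C₀ 1 2 + j * C₀ 1 1 + l * C₀ 0 1 + k * (C₀ 0 2 + j * C₀ 0 1 + l * C₀ 0 0) := by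
    simp [hC, hU, Matrix.mul_apply, Fin.sum_univ_three, L0.e10]; ring
  have g11 : C 0 0 * C 1 1 - C 0 1 ^ 2 = C₀ 0 0 * C₀ 1 1 - C₀ 0 1 ^ 2 := by
    rw [e00, e01, e11]; ring
  have g12 : C 0 0 * C 1 2 - C 0 1 * C 0 2 =
      C₀ 0 0 * C₀ 1 2 - C₀ 0 1 * C₀ 0 2 + j * (C₀ 0 0 * C₀ 1 1 - C₀ 0 1 ^ 2) := by
    rw [e00, e01, e02, e12]; ring
  have hBC := hC₀.trans hCC
  have LC := isLat_of_latIsom hB hBC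
  have hmin' : ∀ D, LatIsom C D → C 0 0 < D 0 0 ∨ (C 0 0 = D 0 0 ∧
      C 0 0 * C 1 1 - C 0 1 ^ 2 ≤ D 0 0 * D 1 1 - D 0 1 ^ 2) := by
    intro D hD
    have LD := isLat_of_latIsom LC hD
    have key : toLex ((C 0 0).toNat, (C 0 0 * C 1 1 - C 0 1 ^ 2).toNat) ≤
        toLex ((D 0 0).toNat, (D 0 0 * D 1 1 - D 0 1 ^ 2).toNat) := by
      rw [g11, e00]
      rcases le_total (toLex ((D 0 0).toNat, (D 0 0 * D 1 1 - D 0 1 ^ 2).toNat))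
        (toLex ((C₀ 0 0).toNat, (C₀ 0 0 * C₀ 1 1 - C₀ 0 1 ^ 2).toNat)) with h | h
      · exact hmin (hBC.trans hD) h
      · exact h
    rw [Prod.Lex.toLex_le_toLex] at key
    have := LC.pos00; have := LD.pos00; have := LC.posMinor; have := LD.posMinor
    simp only at key
    generalize C 0 0 * C 1 1 - C 0 1 ^ 2 = u at *
    generalize D 0 0 * D 1 1 - D 0 1 ^ 2 = v at *
    omega
  refine ⟨C, hBC, ?_, ?_, ?_, ?_, ?_, ?_, ?_, ?_⟩
  · obtain ⟨W, hW⟩ : ∃ W : TernMat, W = !![0, 1, 0; 1, 0, 0; 0, 0, 1] := ⟨_, rfl⟩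
    obtain ⟨D, hD⟩ : ∃ D : TernMat, D = Wᵀ * C * W := ⟨_, rfl⟩
    have := hmin' D ⟨W, by simp [hW, Matrix.det_fin_three], hD.symm⟩
    have e : D 0 0 = C 1 1 := by simp [hD, hW, Matrix.mul_apply, Fin.sum_univ_three]
    rw [e] at this; omega
  · obtain ⟨W, hW⟩ : ∃ W : TernMat, W = !![1, 0, 0; 0, 0, 1; 0, 1, 0] := ⟨_, rfl⟩
    obtain ⟨D, hD⟩ : ∃ D : TernMat, D = Wᵀ * C * W := ⟨_, rfl⟩
    have := hmin' D ⟨W, by simp [hW, Matrix.det_fin_three], hD.symm⟩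
    have e : D 0 0 = C 0 0 := by simp [hD, hW, Matrix.mul_apply, Fin.sum_univ_three]
    have e1 : D 1 1 = C 2 2 := by simp [hD, hW, Matrix.mul_apply, Fin.sum_univ_three]
    have e2 : D 0 1 = C 0 2 := by simp [hD, hW, Matrix.mul_apply, Fin.sum_univ_three]
    rw [e, e1, e2] at this
    rcases this with h | h
    · exact absurd h (lt_irrefl _)
    · exact h.2
  · rw [e01, e00]; exact hk1
  · rw [e01, e00]; exact hk2
  · rw [e02, e00]; exact hl1
  · rw [e02, e00]; exact hl2
  · rw [g12, g11]; exact hj1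
  · rw [g12, g11]; exact hj2

lemma sq_le_of_two {x a : ℤ} (h1 : 2 * x ≤ a) (h2 : -a ≤ 2 * x) : 4 * x ^ 2 ≤ a ^ 2 := by
  nlinarith

lemma abs_le_sq_of {x M : ℤ} (hM : 0 ≤ M) (h : x ^ 2 ≤ M) : |x| ≤ M := by
  by_cases hx : x = 0
  · simpa [hx] using hM
  · have : 1 ≤ |x| := Int.one_le_abs hx
    rw [← sq_abs] at h
    nlinarith

lemma reduced_bounds {a b c u v w g h k d : ℤ} (pa : 0 < a) (pg : 0 < g) (pd : 0 < d)
    (hg : g = a * u - b ^ 2) (hh : h = a * v - b * c) (hk : k = a * w - c ^ 2)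
    (h1 : a ≤ u) (h2 : g ≤ k) (q1 : 4 * b ^ 2 ≤ a ^ 2) (q2 : 4 * c ^ 2 ≤ a ^ 2)
    (q3 : 4 * h ^ 2 ≤ g ^ 2) (id1 : g * k - h ^ 2 = a * d) :
    a ≤ 64 * d ∧ g ≤ 4 * (64 * d) * d ∧ k ≤ 64 * d * d + (4 * (64 * d) * d) ^ 2 := by
  have i1 : 3 * g ^ 2 ≤ 4 * (a * d) := by nlinarith
  have i2 : 3 * a ^ 2 ≤ 4 * g := by nlinarith
  have i3 : 9 * a ^ 4 ≤ 16 * g ^ 2 := by nlinarith [sq_nonneg a]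
  have i4 : a * (27 * a ^ 3) ≤ a * (64 * d) := by nlinarith
  have i5 : 27 * a ^ 3 ≤ 64 * d := le_of_mul_le_mul_left i4 pa
  have i6 : a ≤ 64 * d := by nlinarith [sq_nonneg (a - 1), mul_pos pa pa]
  have ad : a * d ≤ 64 * d * d := by nlinarith
  have i7 : g ≤ 4 * (64 * d) * d := by nlinarith
  have gg : g ^ 2 ≤ (4 * (64 * d) * d) ^ 2 := by gcongr
  refine ⟨i6, i7, ?_⟩
  have : k ≤ g * k := by nlinarith
  have : h ^ 2 ≤ g ^ 2 := by nlinarith [sq_nonneg h]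
  linarith

lemma reduced_bounds2 {a b c u v w α γ κ : ℤ} (pa : 0 < a) (hα : 0 < α) (hγ : 0 < γ) (hκ : 0 < κ)
    (iα : a ≤ α) (iγ : a * u - b ^ 2 ≤ γ) (iκ : a * w - c ^ 2 ≤ κ)
    (pγ : 0 < a * u - b ^ 2) (pκ : 0 < a * w - c ^ 2)
    (q1 : 4 * b ^ 2 ≤ a ^ 2) (q2 : 4 * c ^ 2 ≤ a ^ 2)
    (q3 : 4 * (a * v - b * c) ^ 2 ≤ (a * u - b ^ 2) ^ 2) :
    |a| ≤ α ^ 2 + γ ^ 2 + κ ∧ |b| ≤ α ^ 2 + γ ^ 2 + κ ∧ |c| ≤ α ^ 2 + γ ^ 2 + κ ∧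
    |u| ≤ α ^ 2 + γ ^ 2 + κ ∧ |v| ≤ α ^ 2 + γ ^ 2 + κ ∧ |w| ≤ α ^ 2 + γ ^ 2 + κ := by
  have aa : a ^ 2 ≤ α ^ 2 := by gcongr
  have hg2 : (a * u - b ^ 2) ^ 2 ≤ γ ^ 2 := by gcongr
  have γγ : γ ≤ γ ^ 2 := by nlinarith
  have u0 : 0 < u := by
    by_contra hc
    nlinarith [sq_nonneg b]
  have w0 : 0 < w := by
    by_contra hc
    nlinarith [sq_nonneg c]
  have hu : u ≤ a * u := by nlinarith
  have hw : w ≤ a * w := by nlinarith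
  have hv : |a * v - b * c| ≤ γ ^ 2 := by
    apply abs_le_sq_of (by positivity)
    nlinarith [sq_nonneg (a * v - b * c)]
  have hbc : |b * c| ≤ α ^ 2 := by
    rw [abs_le]
    constructor <;> nlinarith [sq_nonneg (b - c), sq_nonneg (b + c)]
  have hv2 : |v| ≤ |a * v| := by
    rw [abs_mul, abs_of_pos pa]; nlinarith [abs_nonneg v]
  have hv3 : |a * v| ≤ γ ^ 2 + α ^ 2 := by
    calc |a * v| = |(a * v - b * c) + b * c| := by ring_nf
      _ ≤ _ := (abs_add_le _ _).trans (add_le_add hv hbc)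
  refine ⟨?_, ?_, ?_, ?_, ?_, ?_⟩
  · exact abs_le_sq_of (by positivity) (by nlinarith)
  · exact abs_le_sq_of (by positivity) (by nlinarith)
  · exact abs_le_sq_of (by positivity) (by nlinarith)
  · rw [abs_of_pos u0]; nlinarith
  · linarith
  · rw [abs_of_pos w0]; nlinarith

lemma finite_reduced (d : ℤ) : ∃ S : Set TernMat, S.Finite ∧
    ∀ B, IsLat B → B.det = d → ∃ C ∈ S, LatIsom B C := by
  obtain ⟨α, hα⟩ : ∃ α, α = 64 * d := ⟨_, rfl⟩
  obtain ⟨γ, hγ⟩ : ∃ γ, γ = 4 * (64 * d) * d := ⟨_, rfl⟩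
  obtain ⟨κ, hκ⟩ : ∃ κ, κ = 64 * d * d + (4 * (64 * d) * d) ^ 2 := ⟨_, rfl⟩
  refine ⟨{C | ∀ i j, C i j ∈ Set.Icc (-(α ^ 2 + γ ^ 2 + κ)) (α ^ 2 + γ ^ 2 + κ)}, ?_, ?_⟩
  · exact Set.Finite.pi' fun i => Set.Finite.pi' fun j => Set.finite_Icc _ _
  · intro B hB hd
    obtain ⟨C, hBC, h1, h2, h3, h4, h5, h6, h7, h8⟩ := exists_reduced hB
    have LC := isLat_of_latIsom hB hBC
    have hdet : C.det = d := by rw [det_of_latIsom hBC, hd]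
    have q1 := sq_le_of_two h3 h4
    have q2 := sq_le_of_two h5 h6
    have q3 := sq_le_of_two h7 h8
    have pa := LC.pos00
    have pg := LC.posMinor
    have pd : 0 < d := hdet ▸ LC.posDet
    have id1 : (C 0 0 * C 1 1 - C 0 1 ^ 2) * (C 0 0 * C 2 2 - C 0 2 ^ 2) -
        (C 0 0 * C 1 2 - C 0 1 * C 0 2) ^ 2 = C 0 0 * d := by
      rw [← hdet, Matrix.det_fin_three, LC.e10, LC.e20, LC.e21]; ring
    refine ⟨C, ?_, hBC⟩
    obtain ⟨b1, b2, b3⟩ := reduced_bounds pa pg pd rfl rfl rfl h1 h2 q1 q2 q3 id1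
    rw [← hα] at b1
    rw [← hγ] at b2
    rw [← hκ] at b3
    obtain ⟨aM, bM, cM, uM, vM, wM⟩ := reduced_bounds2 pa (by rw [hα]; positivity)
      (by rw [hγ]; positivity) (by rw [hκ]; positivity) b1 b2 b3 pg (lt_of_lt_of_le pg h2) q1 q2 q3
    rw [abs_le] at aM bM cM uM vM wM
    intro i j
    fin_cases i <;> fin_cases j
    · exact aM
    · exact bM
    · exact cM
    · simpa [LC.e10] using bM
    · exact uM
    · exact vM
    · simpa [LC.e20] using cM
    · simpa [LC.e21] using vM
    · exact wM

end Reduction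

section LocalBasics

variable {p : ℕ} [Fact p.Prime]

lemma padic_isUnit_iff_not_dvd (x : ℤ_[p]) : IsUnit x ↔ ¬ (p : ℤ_[p]) ∣ x := by
  rw [← Ideal.mem_span_singleton, ← PadicInt.maximalIdeal_eq_span_p,
    IsLocalRing.mem_maximalIdeal, mem_nonunits_iff, not_not]

lemma padic_isUnit_two (hp2 : p ≠ 2) : IsUnit (2 : ℤ_[p]) := by
  have := PadicInt.isUnit_iff (p := p) (z := ((2 : ℤ) : ℤ_[p]))
  rw [show (2 : ℤ_[p]) = ((2 : ℤ) : ℤ_[p]) by norm_num, padic_isUnit_iff_not_dvd,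
    show (p : ℤ_[p]) = ((p : ℤ) : ℤ_[p]) by norm_num]
  intro h
  have h2 : ((p : ℤ) ^ 1) ∣ (2 : ℤ) := by
    rw [← PadicInt.norm_int_le_pow_iff_dvd]
    have := (PadicInt.norm_le_pow_iff_mem_span_pow ((2 : ℤ) : ℤ_[p]) 1).2
      (by rw [Ideal.mem_span_singleton]; simpa using h)
    simpa using this
  have h3 : p ∣ 2 := by
    have : (p : ℤ) ∣ ((2 : ℕ) : ℤ) := by simpa using h2
    exact Int.natCast_dvd_natCast.1 this
  exact hp2 ((Nat.prime_dvd_prime_iff_eq Fact.out Nat.prime_two).1 h3)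

lemma padic_intCast_dvd_iff (k : ℕ) (a : ℤ) : ((p : ℤ_[p]) ^ k ∣ (a : ℤ_[p])) ↔ (p : ℤ) ^ k ∣ a := by
  rw [← PadicInt.norm_int_le_pow_iff_dvd, PadicInt.norm_le_pow_iff_mem_span_pow,
    Ideal.mem_span_singleton]

lemma padic_intCast_dvd_iff' (a : ℤ) : ((p : ℤ_[p]) ∣ (a : ℤ_[p])) ↔ (p : ℤ) ∣ a := by
  have := padic_intCast_dvd_iff (p := p) 1 a
  simpa using this

lemma padic_prime : Prime (p : ℤ_[p]) := PadicInt.prime_p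

lemma hensel_quad (a b c t : ℤ_[p]) (h1 : (p : ℤ_[p]) ∣ a * t ^ 2 + b * t + c)
    (h2 : IsUnit (2 * a * t + b)) :
    ∃ z : ℤ_[p], a * z ^ 2 + b * z + c = 0 ∧ (p : ℤ_[p]) ∣ z - t := by
  open Polynomial in
  set F : ℤ_[p][X] := C a * X ^ 2 + C b * X + C c with hF
  have e1 : F.aeval t = a * t ^ 2 + b * t + c := by simp [hF]
  have e2 : F.derivative.aeval t = 2 * a * t + b := by simp [hF]; ring
  have n2 : ‖F.derivative.aeval t‖ = 1 := by rw [e2]; exact PadicInt.isUnit_iff.1 h2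
  obtain ⟨z, hz1, hz2, -⟩ := hensels_lemma (F := F) (a := t) (by
    rw [n2, e1]
    have := (PadicInt.norm_lt_one_iff_dvd _).2 h1
    simpa using this)
  refine ⟨z, ?_, ?_⟩
  · simpa [hF] using hz1
  · rw [n2] at hz2
    exact (PadicInt.norm_lt_one_iff_dvd _).1 hz2

lemma exists_primitive_vec {x : Fin 3 → ℤ_[p]} (hx : x ≠ 0) :
    ∃ (k : ℕ) (y : Fin 3 → ℤ_[p]), x = (p : ℤ_[p]) ^ k • y ∧ ∃ i, IsUnit (y i) := by
  obtain ⟨i0, hi0⟩ : ∃ i, x i ≠ 0 := by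
    by_contra h; push Not at h; exact hx (funext h)
  obtain ⟨i, hi, hmin⟩ := Finset.exists_min_image
    (Finset.univ.filter fun i => x i ≠ 0) (fun i => (x i).valuation) ⟨i0, by simp [hi0]⟩
  simp only [Finset.mem_filter, Finset.mem_univ, true_and] at hi hmin
  have hd : ∀ j, (p : ℤ_[p]) ^ (x i).valuation ∣ x j := by
    intro j
    by_cases hj : x j = 0
    · rw [hj]; exact dvd_zero _
    · have h1 := hmin j hj
      rw [PadicInt.unitCoeff_spec hj]
      exact Dvd.dvd.mul_left (pow_dvd_pow _ h1) _
  choose y hy using hd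
  refine ⟨(x i).valuation, y, funext fun j => by simp [← hy j], i, ?_⟩
  have h1 := PadicInt.unitCoeff_spec hi
  have h2 := hy i
  have h3 : (p : ℤ_[p]) ^ (x i).valuation ≠ 0 := pow_ne_zero _ padic_prime.ne_zero
  have h4 : y i = (PadicInt.unitCoeff hi : ℤ_[p]) := by
    apply mul_left_cancel₀ h3
    rw [← h2, mul_comm, ← h1]
  rw [h4]
  exact Units.isUnit _

lemma exists_complete {y : Fin 3 → ℤ_[p]} (hy : ∃ i, IsUnit (y i)) :
    ∃ U : Matrix (Fin 3) (Fin 3) ℤ_[p], U.det = 1 ∧ ∀ i, U i 0 = y i := by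
  obtain ⟨i, hi⟩ := hy
  obtain ⟨v, hv⟩ := hi.exists_right_inv
  fin_cases i
  · refine ⟨!![y 0, 0, 0; y 1, v, 0; y 2, 0, 1], ?_, ?_⟩
    · simp only [Matrix.det_fin_three]; simpa using hv
    · intro i; fin_cases i <;> simp
  · refine ⟨!![y 0, -v, 0; y 1, 0, 0; y 2, 0, 1], ?_, ?_⟩
    · simp only [Matrix.det_fin_three]; simp at hv; simp; linear_combination hv
    · intro i; fin_cases i <;> simp
  · refine ⟨!![y 0, 0, v; y 1, -1, 0; y 2, 0, 0], ?_, ?_⟩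
    · simp only [Matrix.det_fin_three]; simp at hv; simp; linear_combination hv
    · intro i; fin_cases i <;> simp

lemma PadicIsomP.refl (M : Matrix (Fin 3) (Fin 3) ℤ_[p]) : PadicIsomP p M M := ⟨1, by simp, by simp⟩

lemma PadicIsomP.symm {M N : Matrix (Fin 3) (Fin 3) ℤ_[p]} (h : PadicIsomP p M N) :
    PadicIsomP p N M := by
  obtain ⟨U, hU, rfl⟩ := h
  refine ⟨U⁻¹, (Matrix.isUnit_nonsing_inv_det_iff).2 hU, ?_⟩
  have h1 : U * U⁻¹ = 1 := Matrix.mul_nonsing_inv U hU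
  calc (U⁻¹)ᵀ * (Uᵀ * M * U) * U⁻¹ = (U * U⁻¹)ᵀ * M * (U * U⁻¹) := by
        simp only [Matrix.transpose_mul, Matrix.mul_assoc]
    _ = M := by rw [h1]; simp

lemma PadicIsomP.trans {M N P : Matrix (Fin 3) (Fin 3) ℤ_[p]} (h : PadicIsomP p M N)
    (h' : PadicIsomP p N P) : PadicIsomP p M P := by
  obtain ⟨U, hU, rfl⟩ := h
  obtain ⟨V, hV, rfl⟩ := h'
  refine ⟨U * V, by rw [Matrix.det_mul]; exact hU.mul hV, ?_⟩
  simp only [Matrix.transpose_mul, Matrix.mul_assoc]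

/-- `M` is isotropic over `ℤ_p`. -/
def IsoM (M : Matrix (Fin 3) (Fin 3) ℤ_[p]) : Prop :=
  ∃ x : Fin 3 → ℤ_[p], x ≠ 0 ∧ quadVal M x = 0

lemma IsoM.conj {M U : Matrix (Fin 3) (Fin 3) ℤ_[p]} (hU : U.det ≠ 0) (h : IsoM (Uᵀ * M * U)) :
    IsoM M := by
  obtain ⟨x, hx, h⟩ := h
  rw [quadVal_conj] at h
  exact ⟨U *ᵥ x, fun h0 => hx (Matrix.eq_zero_of_mulVec_eq_zero hU h0), h⟩

lemma IsoM.congr {M N : Matrix (Fin 3) (Fin 3) ℤ_[p]} (h : PadicIsomP p M N) (hM : IsoM M) :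
    IsoM N := by
  obtain ⟨U, hU, hUN⟩ := h.symm
  rw [← hUN] at hM
  exact hM.conj hU.ne_zero

lemma det_gram_conj {R : Type*} [CommRing R] (M U : Matrix (Fin 3) (Fin 3) R) :
    (Uᵀ * M * U).det = U.det ^ 2 * M.det := by
  rw [Matrix.det_mul, Matrix.det_mul, Matrix.det_transpose]; ring

lemma det_symm {R : Type*} [CommRing R] {M : Matrix (Fin 3) (Fin 3) R} (h : M.IsSymm) :
    M.det = M 0 0 * M 1 1 * M 2 2 + 2 * M 0 1 * M 0 2 * M 1 2 - M 0 0 * M 1 2 ^ 2 -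
      M 1 1 * M 0 2 ^ 2 - M 2 2 * M 0 1 ^ 2 := by
  rw [Matrix.det_fin_three, h.apply 0 1, h.apply 0 2, h.apply 1 2]; ring

lemma hyperbolic_step1 {M : Matrix (Fin 3) (Fin 3) ℤ_[p]} (hs : M.IsSymm)
    (hd : ¬ (p : ℤ_[p]) ^ 2 ∣ M.det) (hi : IsoM M) :
    ∃ U : Matrix (Fin 3) (Fin 3) ℤ_[p], U.det = 1 ∧ (Uᵀ * M * U) 0 0 = 0 ∧
      IsUnit ((Uᵀ * M * U) 0 1) := by
  obtain ⟨x, hx, h0⟩ := hi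
  obtain ⟨k, y, rfl, hy⟩ := exists_primitive_vec hx
  rw [quadVal_smul] at h0
  have h0' : quadVal M y = 0 := by
    rcases mul_eq_zero.1 h0 with h | h
    · exact absurd h (pow_ne_zero _ (pow_ne_zero _ padic_prime.ne_zero))
    · exact h
  obtain ⟨U, hU, hUy⟩ := exists_complete hy
  have s1 := conj_symm hs U
  have e00 : (Uᵀ * M * U) 0 0 = 0 := by
    rw [conj_apply, ← h0']; congr 1; exact funext hUy
  have hdet : (Uᵀ * M * U).det = M.det := by rw [det_gram_conj, hU]; ring
  by_cases h1 : IsUnit ((Uᵀ * M * U) 0 1)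
  · exact ⟨U, hU, e00, h1⟩
  · by_cases h2 : IsUnit ((Uᵀ * M * U) 0 2)
    · obtain ⟨W, hW⟩ : ∃ W : Matrix (Fin 3) (Fin 3) ℤ_[p], W = !![1, 0, 0; 0, 0, -1; 0, 1, 0] :=
        ⟨_, rfl⟩
      have eq : (U * W)ᵀ * M * (U * W) = Wᵀ * (Uᵀ * M * U) * W := by
        simp only [Matrix.transpose_mul, Matrix.mul_assoc]
      refine ⟨U * W, ?_, ?_, ?_⟩
      · rw [Matrix.det_mul, hU, hW]; simp [Matrix.det_fin_three]
      · rw [eq]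
        generalize Uᵀ * M * U = N at *
        rw [← e00]
        simp [hW, Matrix.mul_apply, Fin.sum_univ_three]
      · rw [eq]
        generalize Uᵀ * M * U = N at *
        convert h2 using 1
        simp [hW, Matrix.mul_apply, Fin.sum_univ_three]
    · exfalso
      rw [padic_isUnit_iff_not_dvd, not_not] at h1 h2
      apply hd
      rw [← hdet, det_symm s1, e00]
      obtain ⟨a, ha⟩ := h1
      obtain ⟨b, hb⟩ := h2
      rw [ha, hb]
      exact ⟨2 * a * b * (Uᵀ * M * U) 1 2 - (Uᵀ * M * U) 1 1 * b ^ 2 -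
        (Uᵀ * M * U) 2 2 * a ^ 2, by ring⟩

/-- The standard hyperbolic Gram matrix. -/
noncomputable def hypMat (d : ℤ_[p]) : Matrix (Fin 3) (Fin 3) ℤ_[p] := !![0, 1, 0; 1, 0, 0; 0, 0, -d]

lemma hyperbolic_form (hp2 : p ≠ 2) {M : Matrix (Fin 3) (Fin 3) ℤ_[p]} (hs : M.IsSymm)
    (hd : ¬ (p : ℤ_[p]) ^ 2 ∣ M.det) (hi : IsoM M) :
    ∃ U : Matrix (Fin 3) (Fin 3) ℤ_[p], U.det = 1 ∧ Uᵀ * M * U = hypMat M.det := by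
  obtain ⟨U, hU, h00, hu⟩ := hyperbolic_step1 hs hd hi
  have s1 := conj_symm hs U
  have hdet : (Uᵀ * M * U).det = M.det := by rw [det_gram_conj, hU]; ring
  rw [← hdet]
  obtain ⟨N, hN⟩ : ∃ N, N = Uᵀ * M * U := ⟨_, rfl⟩
  rw [← hN] at h00 hu s1 ⊢
  obtain ⟨ai, hai⟩ := hu.exists_right_inv
  obtain ⟨h, hh⟩ := (padic_isUnit_two (p := p) hp2).exists_right_inv
  obtain ⟨V, hV⟩ : ∃ V : Matrix (Fin 3) (Fin 3) ℤ_[p], V = !![1, -(h * ai ^ 2 * N 1 1),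
      -(N 1 2 - N 0 2 * ai * N 1 1); 0, ai, -N 0 2; 0, 0, N 0 1] := ⟨_, rfl⟩
  have e1 := s1.apply 0 1
  have e2 := s1.apply 0 2
  have e3 := s1.apply 1 2
  refine ⟨U * V, ?_, ?_⟩
  · rw [Matrix.det_mul, hU, hV]; simp [Matrix.det_fin_three]; linear_combination hai
  · have eq : (U * V)ᵀ * M * (U * V) = Vᵀ * N * V := by
      rw [hN]; simp only [Matrix.transpose_mul, Matrix.mul_assoc]
    rw [eq, det_symm s1, hypMat, hV]
    ext i j
    fin_cases i <;> fin_cases j <;>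
      simp [Matrix.mul_apply, Fin.sum_univ_three, h00, e1, e2, e3]
    · linear_combination hai
    · ring
    · linear_combination hai
    · linear_combination (-h * ai ^ 2 * N 1 1 * 2) * hai - ai ^ 2 * N 1 1 * hh
    · linear_combination (N 0 2 * N 1 1 * ai) * hai
    · ring
    · linear_combination (N 0 2 * N 1 1 * ai) * hai
    · ring

lemma isom_of_isotropic (hp2 : p ≠ 2) {M N : Matrix (Fin 3) (Fin 3) ℤ_[p]} (hM : M.IsSymm)
    (hN : N.IsSymm) (hdet : M.det = N.det) (hd : ¬ (p : ℤ_[p]) ^ 2 ∣ M.det)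
    (iM : IsoM M) (iN : IsoM N) : PadicIsomP p M N := by
  obtain ⟨U, hU, h1⟩ := hyperbolic_form hp2 hM hd iM
  obtain ⟨V, hV, h2⟩ := hyperbolic_form hp2 hN (hdet ▸ hd) iN
  have a : PadicIsomP p M (hypMat M.det) := ⟨U, by simp [hU], h1⟩
  have b : PadicIsomP p N (hypMat M.det) := ⟨V, by simp [hV], by rw [h2, hdet]⟩
  exact a.trans b.symm

end LocalBasics

section Closeness

variable {p : ℕ} [Fact p.Prime]

open scoped Matrix.Norms.Operator in
lemma mat_norm_le (X : Matrix (Fin 3) (Fin 3) ℤ_[p]) : ‖X‖ ≤ 3 := by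
  rw [Matrix.linfty_opNorm_def]
  have : (Finset.univ.sup fun i => ∑ j, ‖X i j‖₊) ≤ 3 := by
    apply Finset.sup_le
    intro i _
    have h : ∀ j, ‖X i j‖₊ ≤ 1 := fun j => by
      have := PadicInt.norm_le_one (X i j)
      exact_mod_cast this
    rw [Fin.sum_univ_three]
    calc ‖X i 0‖₊ + ‖X i 1‖₊ + ‖X i 2‖₊ ≤ 1 + 1 + 1 := by gcongr <;> apply h
      _ = 3 := by norm_num
  exact_mod_cast this

open scoped Matrix.Norms.Operator in
lemma exists_unique_fix (G J : Matrix (Fin 3) (Fin 3) ℤ_[p]) :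
    ∃! Y : Matrix (Fin 3) (Fin 3) ℤ_[p], Y = G - (p : ℤ_[p]) ^ 5 • (Y * J * Y) := by
  set f : Matrix (Fin 3) (Fin 3) ℤ_[p] → Matrix (Fin 3) (Fin 3) ℤ_[p] :=
    fun Y => G - (p : ℤ_[p]) ^ 5 • (Y * J * Y) with hf
  have hpn : ‖(p : ℤ_[p]) ^ 5‖ ≤ 1 / 32 := by
    rw [norm_pow, PadicInt.norm_p]
    have : (2 : ℝ) ≤ p := by exact_mod_cast (Fact.out : p.Prime).two_le
    have h2 : ((p : ℝ)⁻¹) ≤ 2⁻¹ := by gcongr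
    calc ((p : ℝ)⁻¹) ^ 5 ≤ (2⁻¹) ^ 5 := by gcongr
      _ = 1 / 32 := by norm_num
  have hlip : ∀ X Y, dist (f X) (f Y) ≤ (18 / 32 : ℝ) * dist X Y := by
    intro X Y
    rw [dist_eq_norm, dist_eq_norm]
    have e : f X - f Y = (p : ℤ_[p]) ^ 5 • (-((X - Y) * (J * X) + (Y * J) * (X - Y))) := by
      simp only [hf, smul_neg, smul_add]
      rw [← smul_add]
      have : X * J * X - Y * J * Y = (X - Y) * (J * X) + (Y * J) * (X - Y) := by
        noncomm_ring
      rw [← this, smul_sub]; abel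
    rw [e]
    calc _ ≤ ‖(p : ℤ_[p]) ^ 5‖ * ‖-((X - Y) * (J * X) + (Y * J) * (X - Y))‖ := norm_smul_le _ _
      _ ≤ 1 / 32 * (‖X - Y‖ * 3 * 1 + 3 * ‖X - Y‖ * 1) := by
          gcongr
          rw [norm_neg]
          refine (norm_add_le _ _).trans ?_
          rw [mul_one, mul_one]
          gcongr
          · refine (norm_mul_le _ _).trans ?_
            gcongr
            exact mat_norm_le _
          · refine (norm_mul_le _ _).trans ?_
            gcongr
            exact mat_norm_le _
      _ ≤ 18 / 32 * ‖X - Y‖ := by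
          have := norm_nonneg (X - Y)
          linarith
  have hc : ContractingWith (18 / 32 : NNReal) f := by
    refine ⟨by norm_num [← NNReal.coe_lt_coe], LipschitzWith.of_dist_le_mul ?_⟩
    intro X Y
    simpa using hlip X Y
  have hcs : @CompleteSpace (Matrix (Fin 3) (Fin 3) ℤ_[p])
      (Matrix.linftyOpNormedRing).toMetricSpace.toPseudoMetricSpace.toUniformSpace := by
    have : CompleteSpace (Fin 3 → Fin 3 → ℤ_[p]) := inferInstance
    exact this
  refine ⟨hc.fixedPoint f, ?_, ?_⟩
  · exact (hc.fixedPoint_isFixedPt (f := f)).symm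
  · intro Z hZ
    exact hc.fixedPoint_unique (x := Z) hZ.symm

lemma isom_of_close {A B G : Matrix (Fin 3) (Fin 3) ℤ_[p]} (hA : A.IsSymm)
    (hG : G.IsSymm) (hB : B = A + (4 * (p : ℤ_[p]) ^ 5 * A.det) • G) : PadicIsomP p A B := by
  obtain ⟨Y, hY, huniq⟩ := exists_unique_fix G A.adjugate
  have hadj : A.adjugateᵀ = A.adjugate := by rw [Matrix.adjugate_transpose, hA.eq]
  have hYs : Yᵀ = Y := by
    apply huniq
    conv_lhs => rw [hY]
    rw [Matrix.transpose_sub, Matrix.transpose_smul, Matrix.transpose_mul, Matrix.transpose_mul,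
      hadj, hG.eq, Matrix.mul_assoc]
  set π : ℤ_[p] := (p : ℤ_[p]) ^ 5 with hπ
  refine ⟨1 + (2 * π) • (A.adjugate * Y), ?_, ?_⟩
  · apply isUnit_of_map_unit (IsLocalRing.residue ℤ_[p])
    rw [RingHom.map_det]
    have h0 : IsLocalRing.residue ℤ_[p] (p : ℤ_[p]) = 0 := by
      rw [IsLocalRing.residue_eq_zero_iff, PadicInt.maximalIdeal_eq_span_p]
      exact Ideal.mem_span_singleton_self _
    have h1 : (IsLocalRing.residue ℤ_[p]).mapMatrix (1 + (2 * π) • (A.adjugate * Y)) = 1 := by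
      rw [map_add, map_one]
      ext i j
      simp only [Matrix.add_apply, RingHom.mapMatrix_apply, Matrix.map_apply, Matrix.smul_apply,
        smul_eq_mul, map_mul, hπ, map_pow, h0]
      simp
    rw [h1, Matrix.det_one]
    exact isUnit_one
  · have h1 : A.adjugate * A = A.det • 1 := Matrix.adjugate_mul A
    have h2 : A * A.adjugate = A.det • 1 := Matrix.mul_adjugate A
    rw [Matrix.transpose_add, Matrix.transpose_smul, Matrix.transpose_mul, hYs, hadj,
      Matrix.transpose_one, hB]
    have h3 : (1 + (2 * π) • (Y * A.adjugate)) * A * (1 + (2 * π) • (A.adjugate * Y)) =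
        A + (2 * π) • (Y * (A.adjugate * A)) + (2 * π) • ((A * A.adjugate) * Y) +
        (2 * π) • (2 * π) • (Y * A.adjugate * (A * A.adjugate) * Y) := by
      simp only [add_mul, mul_add, one_mul, mul_one, Matrix.smul_mul, Matrix.mul_smul,
        Matrix.mul_assoc]
      abel
    rw [h3, h1, h2]
    have h4 : G = Y + π • (Y * A.adjugate * Y) := by
      nth_rewrite 1 [hY]; abel
    rw [h4]
    simp only [Matrix.smul_mul, Matrix.mul_smul, one_mul, mul_one, smul_add, smul_smul]
    module

end Closeness

section LocalIso

variable {p : ℕ} [Fact p.Prime]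

lemma quadVal_add_single {R : Type*} [CommRing R] {M : Matrix (Fin 3) (Fin 3) R} (hM : M.IsSymm)
    (x : Fin 3 → R) (i : Fin 3) (t : R) :
    quadVal M (x + Pi.single i t) = M i i * t ^ 2 + 2 * (M *ᵥ x) i * t + quadVal M x := by
  have e1 := hM.apply 0 1
  have e2 := hM.apply 0 2
  have e3 := hM.apply 1 2
  fin_cases i <;>
    simp [quadVal_three, Matrix.mulVec, dotProduct, Fin.sum_univ_three, Pi.single_apply, e1, e2, e3] <;>
    ring

lemma isoM_of_hensel (hp2 : p ≠ 2) {M : Matrix (Fin 3) (Fin 3) ℤ_[p]} (hM : M.IsSymm)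
    {x : Fin 3 → ℤ_[p]} (h0 : (p : ℤ_[p]) ∣ quadVal M x) {i : Fin 3} (hi : IsUnit ((M *ᵥ x) i)) :
    IsoM M := by
  obtain ⟨t, ht, htp⟩ := hensel_quad (M i i) (2 * (M *ᵥ x) i) (quadVal M x) 0 (by simpa using h0)
    (by simpa using (padic_isUnit_two hp2).mul hi)
  refine ⟨x + Pi.single i t, ?_, ?_⟩
  · intro h
    have h1 : x = - Pi.single i t := by rw [eq_neg_iff_add_eq_zero, h]
    rw [padic_isUnit_iff_not_dvd] at hi
    apply hi
    rw [h1, Matrix.mulVec_neg]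
    simp only [Pi.neg_apply, Matrix.mulVec_single, sub_zero] at htp ⊢
    rw [dvd_neg]
    simpa using Dvd.dvd.mul_left htp _
  · rw [quadVal_add_single hM, ht]

lemma exists_zero_zmod (M : Matrix (Fin 3) (Fin 3) (ZMod p)) :
    ∃ x : Fin 3 → ZMod p, x ≠ 0 ∧ quadVal M x = 0 := by
  let f : MvPolynomial (Fin 3) (ZMod p) :=
    ∑ i, ∑ j, MvPolynomial.X i * MvPolynomial.C (M i j) * MvPolynomial.X j
  have hev : ∀ x, MvPolynomial.eval x f = quadVal M x := by
    intro x; simp [f, quadVal]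
  have hdeg : f.totalDegree < Fintype.card (Fin 3) := by
    refine lt_of_le_of_lt (MvPolynomial.totalDegree_finsetSum_le (d := 2) ?_) (by simp)
    intro i _
    refine MvPolynomial.totalDegree_finsetSum_le ?_
    intro j _
    refine (MvPolynomial.totalDegree_mul _ _).trans ?_
    have h1 := MvPolynomial.totalDegree_mul (MvPolynomial.X i : MvPolynomial (Fin 3) (ZMod p))
      (MvPolynomial.C (M i j))
    simp at h1
    have h2 : (MvPolynomial.X j : MvPolynomial (Fin 3) (ZMod p)).totalDegree = 1 := by simp
    omega
  have hcard := char_dvd_card_solutions p hdeg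
  by_contra hcon
  push Not at hcon
  have : Fintype.card {x : Fin 3 → ZMod p // MvPolynomial.eval x f = 0} = 1 := by
    rw [Fintype.card_eq_one_iff]
    refine ⟨⟨0, by rw [hev]; simp [quadVal]⟩, ?_⟩
    rintro ⟨y, hy⟩
    rw [hev] at hy
    by_contra hne
    exact hcon y (fun h => hne (by simp [h])) hy
  rw [this] at hcard
  exact (Fact.out : p.Prime).one_lt.ne' (Nat.dvd_one.1 hcard)

lemma toZMod_eq_zero_iff (x : ℤ_[p]) : PadicInt.toZMod x = 0 ↔ (p : ℤ_[p]) ∣ x := by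
  rw [← RingHom.mem_ker, PadicInt.ker_toZMod, PadicInt.maximalIdeal_eq_span_p,
    Ideal.mem_span_singleton]

lemma isoM_of_unimodular (hp2 : p ≠ 2) {M : Matrix (Fin 3) (Fin 3) ℤ_[p]} (hM : M.IsSymm)
    (hd : IsUnit M.det) : IsoM M := by
  obtain ⟨x, hx, h0⟩ := exists_zero_zmod (M.map (PadicInt.toZMod (p := p)))
  have hsurj : Function.Surjective (PadicInt.toZMod (p := p)) := ZMod.ringHom_surjective _
  choose y hy using fun i => hsurj (x i)
  have hxy : x = PadicInt.toZMod ∘ y := funext fun i => (hy i).symm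
  rw [hxy, quadVal_map, toZMod_eq_zero_iff] at h0
  have : ∃ i, IsUnit ((M *ᵥ y) i) := by
    by_contra hcon
    push Not at hcon
    apply hx
    have hd' : (M.map (PadicInt.toZMod (p := p))).det ≠ 0 := by
      have := hd.map (PadicInt.toZMod (p := p))
      rw [RingHom.map_det] at this
      exact this.ne_zero
    apply Matrix.eq_zero_of_mulVec_eq_zero hd'
    ext i
    have h1 := hcon i
    rw [padic_isUnit_iff_not_dvd, not_not, ← toZMod_eq_zero_iff] at h1
    rw [hxy, Pi.zero_apply, ← h1, RingHom.map_mulVec]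
  obtain ⟨i, hi⟩ := this
  exact isoM_of_hensel hp2 hM h0 hi

lemma padicMat_symm {A : TernMat} (h : A.IsSymm) : (padicMat p A).IsSymm := by
  unfold padicMat Matrix.IsSymm
  rw [← Matrix.transpose_map, h.eq]

lemma padicMat_det (A : TernMat) : (padicMat p A).det = (A.det : ℤ_[p]) := by
  have := RingHom.map_det (Int.castRingHom ℤ_[p]) A
  simpa [padicMat] using this.symm

lemma padicMat_mul (A B : TernMat) : padicMat p (A * B) = padicMat p A * padicMat p B := by
  have := Matrix.map_mul (L := A) (M := B) (f := Int.castRingHom ℤ_[p])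
  simpa [padicMat] using this

lemma padicMat_transpose (A : TernMat) : padicMat p Aᵀ = (padicMat p A)ᵀ := by
  simp [padicMat, Matrix.transpose_map]

lemma padicMat_smul (c : ℤ) (A : TernMat) : padicMat p (c • A) = (c : ℤ_[p]) • padicMat p A := by
  ext i j; simp only [padicMat, Matrix.map_apply, Matrix.smul_apply, smul_eq_mul, Int.cast_mul]

lemma quadVal_padicMat (A : TernMat) (x : Fin 3 → ℤ) :
    quadVal (padicMat p A) (fun i => (x i : ℤ_[p])) = ((quadVal A x : ℤ) : ℤ_[p]) := by
  have := quadVal_map (Int.castRingHom ℤ_[p]) A x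
  simpa [padicMat, Function.comp_def] using this

end LocalIso

lemma genus_det {A B : TernMat} (hA : IsLat A) (h : InGenus A B) : B.det = A.det := by
  have hB := h.1
  have pa := hA.posDet
  have pb := hB.posDet
  have key : ∀ (p : ℕ) (hp : p.Prime) (k : ℕ), (p : ℤ) ^ k ∣ A.det ↔ (p : ℤ) ^ k ∣ B.det := by
    intro p hp k
    have : Fact p.Prime := ⟨hp⟩
    obtain ⟨U, hU, hUB⟩ := h.2 p hp
    rw [← padic_intCast_dvd_iff, ← padic_intCast_dvd_iff, ← padicMat_det, ← padicMat_det, ← hUB,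
      det_gram_conj]
    exact ((hU.pow 2).dvd_mul_left).symm
  have h1 : A.det.natAbs = B.det.natAbs := by
    apply Nat.eq_of_factorization_eq (by omega) (by omega)
    intro p
    by_cases hp : p.Prime
    · apply le_antisymm
      · rw [← hp.pow_dvd_iff_le_factorization (by omega)]
        have := (key p hp (A.det.natAbs.factorization p)).1 (by
          have := Nat.ordProj_dvd A.det.natAbs p
          rw [← Int.dvd_natAbs]; exact_mod_cast this)
        rw [← Int.dvd_natAbs] at this; exact_mod_cast this
      · rw [← hp.pow_dvd_iff_le_factorization (by omega)]
        have := (key p hp (B.det.natAbs.factorization p)).2 (by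
          have := Nat.ordProj_dvd B.det.natAbs p
          rw [← Int.dvd_natAbs]; exact_mod_cast this)
        rw [← Int.dvd_natAbs] at this; exact_mod_cast this
    · rw [Nat.factorization_eq_zero_of_not_prime _ hp, Nat.factorization_eq_zero_of_not_prime _ hp]
  omega

lemma InGenus.refl {A : TernMat} (hA : IsLat A) : InGenus A A :=
  ⟨hA, fun p hp => by have : Fact p.Prime := ⟨hp⟩; exact PadicIsomP.refl _⟩

lemma InGenus.of_latIsom {A B C : TernMat} (h : InGenus A B) (h' : LatIsom B C) : InGenus A C := by
  refine ⟨isLat_of_latIsom h.1 h', fun p hp => ?_⟩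
  have : Fact p.Prime := ⟨hp⟩
  refine PadicIsomP.trans (h.2 p hp) ?_
  obtain ⟨U, hU, rfl⟩ := h'
  refine ⟨padicMat p U, ?_, ?_⟩
  · rw [padicMat_det]; exact hU.map (Int.castRingHom ℤ_[p])
  · rw [padicMat_mul, padicMat_mul, padicMat_transpose]

/-- Same determinant and unimodular at an odd prime: locally isometric. -/
lemma padicLatIsom_of_unimodular {A B : TernMat} (hA : A.IsSymm) (hB : B.IsSymm)
    (hd : A.det = B.det) (p : ℕ) (hp : p.Prime) (hp2 : p ≠ 2) (hpd : ¬ (p : ℤ) ∣ A.det) :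
    PadicLatIsom p hp A B := by
  have : Fact p.Prime := ⟨hp⟩
  have hu : IsUnit (padicMat p A).det := by
    rw [padicMat_det, padic_isUnit_iff_not_dvd, padic_intCast_dvd_iff']; exact hpd
  have hdd : (padicMat p A).det = (padicMat p B).det := by rw [padicMat_det, padicMat_det, hd]
  refine isom_of_isotropic hp2 (padicMat_symm hA) (padicMat_symm hB) hdd ?_
    (isoM_of_unimodular hp2 (padicMat_symm hA) hu)
    (isoM_of_unimodular hp2 (padicMat_symm hB) (hdd ▸ hu))
  intro h
  exact (padic_isUnit_iff_not_dvd _).1 hu ((dvd_pow_self _ two_ne_zero).trans h)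

section HilbertSymbol

/-- The prime-to-`p` part of an integer. -/
def uPart (p : ℕ) (a : ℤ) : ℤ := a / (p : ℤ) ^ padicValInt p a

lemma uPart_spec (p : ℕ) (a : ℤ) : a = (p : ℤ) ^ padicValInt p a * uPart p a := by
  unfold uPart
  rw [Int.mul_ediv_cancel']
  exact padicValInt_dvd a

lemma uPart_not_dvd {p : ℕ} (hp : p.Prime) {a : ℤ} (ha : a ≠ 0) : ¬ (p : ℤ) ∣ uPart p a := by
  have : Fact p.Prime := ⟨hp⟩
  intro h
  have h1 : (p : ℤ) ^ (padicValInt p a + 1) ∣ a := by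
    conv_rhs => rw [uPart_spec p a]
    rw [pow_succ]
    exact mul_dvd_mul_left _ h
  rw [padicValInt_dvd_iff] at h1
  rcases h1 with h1 | h1
  · exact ha h1
  · omega

lemma uPart_ne_zero {p : ℕ} (hp : p.Prime) {a : ℤ} (ha : a ≠ 0) : uPart p a ≠ 0 :=
  fun h => uPart_not_dvd hp ha (by rw [h]; exact dvd_zero _)

lemma uPart_mul {p : ℕ} (hp : p.Prime) {a b : ℤ} (ha : a ≠ 0) (hb : b ≠ 0) :
    uPart p (a * b) = uPart p a * uPart p b := by
  have : Fact p.Prime := ⟨hp⟩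
  have h1 := uPart_spec p (a * b)
  rw [padicValInt.mul ha hb] at h1
  have h2 := uPart_spec p a
  have h3 := uPart_spec p b
  have h4 : ((p : ℤ) ^ (padicValInt p a + padicValInt p b)) ≠ 0 :=
    pow_ne_zero _ (by exact_mod_cast hp.ne_zero)
  apply mul_left_cancel₀ h4
  rw [← h1]
  nth_rewrite 1 [h2, h3]
  ring

lemma uPart_of_not_dvd {p : ℕ} {a : ℤ} (h : ¬ (p : ℤ) ∣ a) : padicValInt p a = 0 ∧ uPart p a = a := by
  have : padicValInt p a = 0 := padicValInt.eq_zero_of_not_dvd h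
  exact ⟨this, by simp [uPart, this]⟩

lemma uPart_self {p : ℕ} (hp : p.Prime) : padicValInt p (p : ℤ) = 1 ∧ uPart p (p : ℤ) = 1 := by
  have h1 : padicValInt p (p : ℤ) = 1 := by
    have : Fact p.Prime := ⟨hp⟩
    exact padicValInt_self
  refine ⟨h1, ?_⟩
  unfold uPart
  rw [h1, pow_one, Int.ediv_self]
  exact_mod_cast hp.ne_zero

/-- The sign `(-1)^{(u-1)/2 (v-1)/2}`. -/
def c4 (u v : ℤ) : ℤ := if u % 4 = 3 ∧ v % 4 = 3 then -1 else 1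
/-- The sign `(-1)^{(u^2-1)/8}`. -/
def c8 (u : ℤ) : ℤ := if u % 8 = 1 ∨ u % 8 = 7 then 1 else -1

lemma c4_mul {u v w : ℤ} (hu : u % 2 = 1) (hv : v % 2 = 1) : c4 (u * v) w = c4 u w * c4 v w := by
  have h1 : u % 4 = 1 ∨ u % 4 = 3 := by omega
  have h2 : v % 4 = 1 ∨ v % 4 = 3 := by omega
  unfold c4
  by_cases hw : w % 4 = 3 <;>
  rcases h1 with h1 | h1 <;> rcases h2 with h2 | h2 <;> simp [Int.mul_emod, h1, h2, hw]

lemma c4_symm (u v : ℤ) : c4 u v = c4 v u := by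
  unfold c4; simp only [and_comm]

lemma c8_mul {u v : ℤ} (hu : u % 2 = 1) (hv : v % 2 = 1) : c8 (u * v) = c8 u * c8 v := by
  have h1 : u % 8 = 1 ∨ u % 8 = 3 ∨ u % 8 = 5 ∨ u % 8 = 7 := by omega
  have h2 : v % 8 = 1 ∨ v % 8 = 3 ∨ v % 8 = 5 ∨ v % 8 = 7 := by omega
  unfold c8
  rcases h1 with h1 | h1 | h1 | h1 <;> rcases h2 with h2 | h2 | h2 | h2 <;>
    simp [Int.mul_emod, h1, h2]

/-- Hilbert symbol at `p` for integers. -/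
noncomputable def hil (p : ℕ) (a b : ℤ) : ℤ :=
  if p = 2 then c4 (uPart 2 a) (uPart 2 b) * c8 (uPart 2 a) ^ padicValInt 2 b *
      c8 (uPart 2 b) ^ padicValInt 2 a
  else if p.Prime then jacobiSym (-1) p ^ (padicValInt p a * padicValInt p b) *
      jacobiSym (uPart p a) p ^ padicValInt p b * jacobiSym (uPart p b) p ^ padicValInt p a
  else 1

lemma hil_symm (p : ℕ) (a b : ℤ) : hil p a b = hil p b a := by
  unfold hil
  split_ifs
  · rw [c4_symm]; ring
  · rw [mul_comm (padicValInt p a)]; ring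
  · rfl

lemma odd_of_uPart {a : ℤ} (ha : a ≠ 0) : uPart 2 a % 2 = 1 := by
  have := uPart_not_dvd Nat.prime_two ha
  have h2 : ¬ (2 : ℤ) ∣ uPart 2 a := by simpa using this
  omega

lemma hil_mul (p : ℕ) {a b c : ℤ} (ha : a ≠ 0) (hb : b ≠ 0) (_hc : c ≠ 0) :
    hil p (a * b) c = hil p a c * hil p b c := by
  unfold hil
  split_ifs with h1 h2
  · have : Fact (Nat.Prime 2) := ⟨Nat.prime_two⟩
    rw [uPart_mul Nat.prime_two ha hb, padicValInt.mul ha hb,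
      c4_mul (odd_of_uPart ha) (odd_of_uPart hb), c8_mul (odd_of_uPart ha) (odd_of_uPart hb)]
    ring
  · have : Fact p.Prime := ⟨h2⟩
    rw [uPart_mul h2 ha hb, padicValInt.mul ha hb, jacobiSym.mul_left]
    ring
  · ring

lemma hil_unit {p : ℕ} (hp2 : p ≠ 2) {a b : ℤ} (ha : ¬ (p : ℤ) ∣ a) (hb : ¬ (p : ℤ) ∣ b) :
    hil p a b = 1 := by
  unfold hil
  rw [if_neg hp2]
  split_ifs
  · simp [uPart_of_not_dvd ha, uPart_of_not_dvd hb]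
  · rfl

lemma hil_support {a b : ℤ} (ha : a ≠ 0) (hb : b ≠ 0) :
    (Function.mulSupport fun p => hil p a b).Finite := by
  apply Set.Finite.subset (Set.finite_Iic (2 + a.natAbs + b.natAbs))
  intro p hp
  by_contra hcon
  simp only [Set.mem_Iic, not_le] at hcon
  apply hp
  apply hil_unit (by omega)
  · intro h
    have := Int.le_of_dvd (by omega) ((Int.dvd_natAbs).2 h)
    omega
  · intro h
    have := Int.le_of_dvd (by omega) ((Int.dvd_natAbs).2 h)
    omega

/-- The symbol at infinity. -/
def hilInf (a b : ℤ) : ℤ := if a < 0 ∧ b < 0 then -1 else 1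

/-- Product of all symbols. -/
noncomputable def hilProd (a b : ℤ) : ℤ := hilInf a b * ∏ᶠ p, hil p a b

lemma hilProd_symm (a b : ℤ) : hilProd a b = hilProd b a := by
  unfold hilProd hilInf
  simp only [and_comm, hil_symm _ a b]

lemma hilProd_mul {a b c : ℤ} (ha : a ≠ 0) (hb : b ≠ 0) (hc : c ≠ 0) :
    hilProd (a * b) c = hilProd a c * hilProd b c := by
  unfold hilProd
  have h1 : ∏ᶠ p, hil p (a * b) c = (∏ᶠ p, hil p a c) * ∏ᶠ p, hil p b c := by
    rw [← finprod_mul_distrib (hil_support ha hc) (hil_support hb hc)]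
    exact finprod_congr fun p => hil_mul p ha hb hc
  have h2 : hilInf (a * b) c = hilInf a c * hilInf b c := by
    unfold hilInf
    rcases lt_or_gt_of_ne ha with h | h <;> rcases lt_or_gt_of_ne hb with h' | h' <;>
    by_cases hc' : c < 0
    · simp [h, h', hc', (mul_pos_of_neg_of_neg h h').le]
    · simp [hc']
    · simp [h, h'.le, hc', mul_neg_of_neg_of_pos h h']
    · simp [hc']
    · simp [h.le, h', hc', mul_neg_of_pos_of_neg h h']
    · simp [hc']
    · rw [if_neg (by rintro ⟨h0, -⟩; nlinarith [mul_pos h h']), if_neg (by omega), if_neg (by omega)]; rfl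
    · simp [hc']
  rw [h1, h2]; ring

lemma int_mul_induction {P : ℤ → Prop} (hneg : P (-1)) (hpr : ∀ p : ℕ, p.Prime → P p)
    (hmul : ∀ a b : ℤ, a ≠ 0 → b ≠ 0 → P a → P b → P (a * b)) : ∀ a : ℤ, a ≠ 0 → P a := by
  have h1 : P 1 := by
    have := hmul (-1) (-1) (by norm_num) (by norm_num) hneg hneg
    simpa using this
  have hnat : ∀ n : ℕ, n ≠ 0 → P n := by
    intro n
    induction n using induction_on_primes with
    | zero => intro h; exact absurd rfl h
    | one => intro _; simpa using h1
    | prime_mul p a hp ih =>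
      intro h
      have ha : a ≠ 0 := fun h0 => h (by simp [h0])
      rw [Nat.cast_mul]
      exact hmul _ _ (by exact_mod_cast hp.ne_zero) (by exact_mod_cast ha) (hpr p hp) (ih ha)
  intro a ha
  rcases Int.natAbs_eq a with h | h
  · rw [h]; exact hnat _ (by omega)
  · rw [h, neg_eq_neg_one_mul]
    exact hmul _ _ (by norm_num) (by omega) hneg (hnat _ (by omega))

lemma not_dvd_of_primes {p q : ℕ} (hp : p.Prime) (hq : q.Prime) (h : p ≠ q) : ¬ (p : ℤ) ∣ (q : ℤ) := by
  intro hd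
  exact h ((Nat.prime_dvd_prime_iff_eq hp hq).1 (Int.natCast_dvd_natCast.1 hd))

lemma not_dvd_neg_one {p : ℕ} (hp : p.Prime) : ¬ (p : ℤ) ∣ -1 := by
  intro hd
  rw [Int.dvd_neg] at hd
  exact hp.one_lt.ne' (by exact_mod_cast Int.eq_one_of_dvd_one (by positivity) hd)

lemma hil_not_prime {p : ℕ} (hp : ¬ p.Prime) (a b : ℤ) : hil p a b = 1 := by
  unfold hil
  rw [if_neg (by rintro rfl; exact hp Nat.prime_two), if_neg hp]

lemma jacobi_neg_one {l : ℕ} (hl : l.Prime) (hl2 : l ≠ 2) : jacobiSym (-1) l = c4 (-1) l := by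
  have ho := hl.odd_of_ne_two hl2
  rw [jacobiSym.at_neg_one ho, ZMod.χ₄_nat_eq_if_mod_four]
  have : l % 2 = 1 := Nat.odd_iff.1 ho
  unfold c4
  rcases (show l % 4 = 1 ∨ l % 4 = 3 by omega) with h | h
  · rw [if_neg (by omega), if_pos h, if_neg (by omega)]
  · rw [if_neg (by omega), if_neg (by omega), if_pos (by omega)]

lemma jacobi_two {l : ℕ} (hl : l.Prime) (hl2 : l ≠ 2) : jacobiSym 2 l = c8 l := by
  have ho := hl.odd_of_ne_two hl2
  rw [jacobiSym.at_two ho, ZMod.χ₈_nat_eq_if_mod_eight]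
  have : l % 2 = 1 := Nat.odd_iff.1 ho
  unfold c8
  by_cases h : l % 8 = 1 ∨ l % 8 = 7
  · rw [if_neg (by omega), if_pos h, if_pos (by omega)]
  · rw [if_neg (by omega), if_neg h, if_neg (by omega)]

lemma two_cast_not_dvd {l : ℕ} (hl : l.Prime) (hl2 : l ≠ 2) : ¬ ((2 : ℕ) : ℤ) ∣ (l : ℤ) :=
  not_dvd_of_primes Nat.prime_two hl (Ne.symm hl2)

lemma finprod_hil_eq {a b : ℤ} (s : Finset ℕ) (h2 : 2 ∈ s)
    (h : ∀ p : ℕ, p.Prime → p ∉ s → ¬ (p : ℤ) ∣ a ∧ ¬ (p : ℤ) ∣ b) :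
    ∏ᶠ p, hil p a b = ∏ p ∈ s, hil p a b := by
  apply finprod_eq_prod_of_mulSupport_subset
  intro p hp
  by_contra hcon
  apply hp
  by_cases hpp : p.Prime
  · have hps : p ∉ s := by simpa using hcon
    exact hil_unit (fun h0 : p = 2 => hps (by rw [h0]; exact h2)) (h p hpp hps).1 (h p hpp hps).2
  · exact hil_not_prime hpp _ _

lemma c4_sq (u v : ℤ) : c4 u v * c4 u v = 1 := by unfold c4; split_ifs <;> rfl
lemma c8_sq (u : ℤ) : c8 u * c8 u = 1 := by unfold c8; split_ifs <;> rfl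

lemma hilProd_primes {l m : ℕ} (hl : l.Prime) (hm : m.Prime) (hl2 : l ≠ 2) (hm2 : m ≠ 2)
    (hlm : l ≠ m) : hilProd l m = 1 := by
  have n1 := not_dvd_of_primes hl hm hlm
  have n2 := not_dvd_of_primes hm hl hlm.symm
  have t1 := two_cast_not_dvd hl hl2
  have t2 := two_cast_not_dvd hm hm2
  unfold hilProd
  rw [finprod_hil_eq {2, l, m} (by simp) (by
    intro p hp hps
    simp only [Finset.mem_insert, Finset.mem_singleton, not_or] at hps
    exact ⟨not_dvd_of_primes hp hl hps.2.1, not_dvd_of_primes hp hm hps.2.2⟩)]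
  rw [Finset.prod_insert (by simp [hl2.symm, hm2.symm]), Finset.prod_insert (by simp [hlm]),
    Finset.prod_singleton]
  have e2 : hil 2 l m = c4 l m := by
    unfold hil
    rw [if_pos rfl, (uPart_of_not_dvd t1).1, (uPart_of_not_dvd t2).1, (uPart_of_not_dvd t1).2,
      (uPart_of_not_dvd t2).2]
    simp
  have el : hil l l m = jacobiSym m l := by
    unfold hil
    rw [if_neg hl2, if_pos hl, (uPart_of_not_dvd n1).1, (uPart_of_not_dvd n1).2,
      (uPart_self hl).1]
    simp
  have em : hil m l m = jacobiSym l m := by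
    unfold hil
    rw [if_neg hm2, if_pos hm, (uPart_of_not_dvd n2).1, (uPart_of_not_dvd n2).2,
      (uPart_self hm).1]
    simp
  have hinf : hilInf l m = 1 := by unfold hilInf; rw [if_neg (by omega)]
  rw [e2, el, em, hinf]
  have ol := Nat.odd_iff.1 (hl.odd_of_ne_two hl2)
  have om := Nat.odd_iff.1 (hm.odd_of_ne_two hm2)
  have sq : jacobiSym (m : ℤ) l * jacobiSym (m : ℤ) l = 1 := by
    have : (m : ℤ).gcd l = 1 := by
      rw [Int.gcd_natCast_natCast]; exact (Nat.coprime_primes hm hl).2 hlm.symm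
    have := jacobiSym.sq_one this
    rwa [sq] at this
  unfold c4
  by_cases h : l % 4 = 3 ∧ m % 4 = 3
  · rw [if_pos (by omega), jacobiSym.quadratic_reciprocity_three_mod_four h.1 h.2]
    linarith
  · rw [if_neg (by omega)]
    have : l % 4 = 1 ∨ m % 4 = 1 := by omega
    rcases this with h | h
    · rw [jacobiSym.quadratic_reciprocity_one_mod_four h (hm.odd_of_ne_two hm2)]
      linarith
    · rw [← jacobiSym.quadratic_reciprocity_one_mod_four h (hl.odd_of_ne_two hl2)]
      linarith

lemma hilProd_self {l : ℕ} (hl : l.Prime) (hl2 : l ≠ 2) : hilProd l l = 1 := by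
  have t1 := two_cast_not_dvd hl hl2
  unfold hilProd
  rw [finprod_hil_eq {2, l} (by simp) (by
    intro p hp hps
    simp only [Finset.mem_insert, Finset.mem_singleton, not_or] at hps
    exact ⟨not_dvd_of_primes hp hl hps.2, not_dvd_of_primes hp hl hps.2⟩)]
  rw [Finset.prod_insert (by simp [hl2.symm]), Finset.prod_singleton]
  have e2 : hil 2 l l = c4 l l := by
    unfold hil
    rw [if_pos rfl, (uPart_of_not_dvd t1).1, (uPart_of_not_dvd t1).2]
    simp
  have el : hil l l l = c4 (-1) l := by
    unfold hil
    rw [if_neg hl2, if_pos hl, (uPart_self hl).1, (uPart_self hl).2, jacobi_neg_one hl hl2]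
    simp
  have hinf : hilInf l l = 1 := by unfold hilInf; rw [if_neg (by omega)]
  rw [e2, el, hinf]
  unfold c4
  by_cases h : (l : ℤ) % 4 = 3
  · rw [if_pos ⟨h, h⟩, if_pos ⟨by norm_num, h⟩]; rfl
  · rw [if_neg (by tauto), if_neg (by tauto)]; rfl

lemma hilProd_two {l : ℕ} (hl : l.Prime) (hl2 : l ≠ 2) : hilProd (2 : ℕ) l = 1 := by
  have t1 := two_cast_not_dvd hl hl2
  have t2 := not_dvd_of_primes hl Nat.prime_two hl2
  unfold hilProd
  rw [finprod_hil_eq {2, l} (by simp) (by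
    intro p hp hps
    simp only [Finset.mem_insert, Finset.mem_singleton, not_or] at hps
    exact ⟨not_dvd_of_primes hp Nat.prime_two hps.1, not_dvd_of_primes hp hl hps.2⟩)]
  rw [Finset.prod_insert (by simp [hl2.symm]), Finset.prod_singleton]
  have e2 : hil 2 (2 : ℕ) l = c8 l := by
    unfold hil
    rw [if_pos rfl, (uPart_of_not_dvd t1).1, (uPart_of_not_dvd t1).2, (uPart_self Nat.prime_two).1,
      (uPart_self Nat.prime_two).2]
    simp [c4]
  have el : hil l (2 : ℕ) l = c8 l := by
    unfold hil
    rw [if_neg hl2, if_pos hl, (uPart_self hl).1, (uPart_self hl).2, (uPart_of_not_dvd t2).1,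
      (uPart_of_not_dvd t2).2, ← jacobi_two hl hl2]
    simp
  have hinf : hilInf (2 : ℕ) l = 1 := by unfold hilInf; rw [if_neg (by omega)]
  rw [e2, el, hinf]
  linarith [c8_sq l]

lemma hilProd_two_two : hilProd (2 : ℕ) (2 : ℕ) = 1 := by
  unfold hilProd
  rw [finprod_hil_eq {2} (by simp) (by
    intro p hp hps
    simp only [Finset.mem_singleton] at hps
    exact ⟨not_dvd_of_primes hp Nat.prime_two hps, not_dvd_of_primes hp Nat.prime_two hps⟩)]
  rw [Finset.prod_singleton]
  unfold hil
  rw [if_pos rfl, (uPart_self Nat.prime_two).1, (uPart_self Nat.prime_two).2]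
  simp [c4, c8, hilInf]

lemma hilProd_neg_one_two : hilProd (-1) (2 : ℕ) = 1 := by
  unfold hilProd
  rw [finprod_hil_eq {2} (by simp) (by
    intro p hp hps
    simp only [Finset.mem_singleton] at hps
    exact ⟨not_dvd_neg_one hp, not_dvd_of_primes hp Nat.prime_two hps⟩)]
  rw [Finset.prod_singleton]
  unfold hil
  rw [if_pos rfl, (uPart_self Nat.prime_two).1, (uPart_self Nat.prime_two).2,
    (uPart_of_not_dvd (not_dvd_neg_one Nat.prime_two)).1,
    (uPart_of_not_dvd (not_dvd_neg_one Nat.prime_two)).2]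
  simp [c4, c8, hilInf]

lemma hilProd_neg_one_neg_one : hilProd (-1) (-1) = 1 := by
  unfold hilProd
  rw [finprod_hil_eq {2} (by simp) (by
    intro p hp hps
    exact ⟨not_dvd_neg_one hp, not_dvd_neg_one hp⟩)]
  rw [Finset.prod_singleton]
  unfold hil
  rw [if_pos rfl, 
    (uPart_of_not_dvd (not_dvd_neg_one Nat.prime_two)).1,
    (uPart_of_not_dvd (not_dvd_neg_one Nat.prime_two)).2]
  simp [c4, hilInf]

lemma hilProd_neg_one {l : ℕ} (hl : l.Prime) (hl2 : l ≠ 2) : hilProd (-1) l = 1 := by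
  have t1 := two_cast_not_dvd hl hl2
  have t2 := not_dvd_neg_one hl
  have t3 := not_dvd_neg_one Nat.prime_two
  unfold hilProd
  rw [finprod_hil_eq {2, l} (by simp) (by
    intro p hp hps
    simp only [Finset.mem_insert, Finset.mem_singleton, not_or] at hps
    exact ⟨not_dvd_neg_one hp, not_dvd_of_primes hp hl hps.2⟩)]
  rw [Finset.prod_insert (by simp [hl2.symm]), Finset.prod_singleton]
  have e2 : hil 2 (-1) l = c4 (-1) l := by
    unfold hil
    rw [if_pos rfl, (uPart_of_not_dvd t1).1, (uPart_of_not_dvd t1).2, (uPart_of_not_dvd t3).1,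
      (uPart_of_not_dvd t3).2]
    simp
  have el : hil l (-1) l = c4 (-1) l := by
    unfold hil
    rw [if_neg hl2, if_pos hl, (uPart_self hl).1, (uPart_self hl).2, (uPart_of_not_dvd t2).1,
      (uPart_of_not_dvd t2).2, ← jacobi_neg_one hl hl2]
    simp
  have hinf : hilInf (-1) l = 1 := by unfold hilInf; rw [if_neg (by omega)]
  rw [e2, el, hinf]
  linarith [c4_sq (-1) l]

theorem hilbert_product {a b : ℤ} (ha : a ≠ 0) (hb : b ≠ 0) : hilProd a b = 1 := by
  have key : ∀ c : ℤ, c ≠ 0 → hilProd (-1) c = 1 → (∀ p : ℕ, p.Prime → hilProd p c = 1) →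
      ∀ a : ℤ, a ≠ 0 → hilProd a c = 1 := by
    intro c hc h1 h2
    exact int_mul_induction h1 h2 fun a b ha hb h h' => by rw [hilProd_mul ha hb hc, h, h', one_mul]
  have n1 : ∀ c : ℤ, c ≠ 0 → hilProd c (-1) = 1 := by
    refine key (-1) (by norm_num) hilProd_neg_one_neg_one fun p hp => ?_
    rw [hilProd_symm]
    by_cases h : p = 2
    · subst h; exact hilProd_neg_one_two
    · exact hilProd_neg_one hp h
  refine key b hb (by rw [hilProd_symm]; exact n1 b hb) (fun p hp => ?_) a ha
  rw [hilProd_symm]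
  refine key p (by exact_mod_cast hp.ne_zero) (by rw [hilProd_symm]; exact n1 _ (by exact_mod_cast hp.ne_zero))
    (fun q hq => ?_) b hb
  by_cases hq2 : q = 2
  · subst hq2
    by_cases hp2 : p = 2
    · subst hp2; exact hilProd_two_two
    · exact hilProd_two hp hp2
  · by_cases hp2 : p = 2
    · subst hp2; rw [hilProd_symm]; exact hilProd_two hq hq2
    · by_cases hpq : q = p
      · subst hpq; exact hilProd_self hq hq2
      · exact hilProd_primes hq hp hq2 hp2 hpq

end HilbertSymbol

section HilbertLocal

variable {p : ℕ} [Fact p.Prime]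

/-- Solvability of `z² = a x² + b y²` over `ℤ_p`. -/
def HS (a b : ℤ_[p]) : Prop :=
  ∃ x y z : ℤ_[p], ¬ (x = 0 ∧ y = 0 ∧ z = 0) ∧ z ^ 2 = a * x ^ 2 + b * y ^ 2

lemma HS.symm {a b : ℤ_[p]} (h : HS a b) : HS b a := by
  obtain ⟨x, y, z, h0, h⟩ := h
  exact ⟨y, x, z, by tauto, by rw [h]; ring⟩

lemma HS_comm {a b : ℤ_[p]} : HS a b ↔ HS b a := ⟨HS.symm, HS.symm⟩

lemma HS.prim {a b : ℤ_[p]} (h : HS a b) : ∃ x y z : ℤ_[p],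
    ¬ ((p : ℤ_[p]) ∣ x ∧ (p : ℤ_[p]) ∣ y ∧ (p : ℤ_[p]) ∣ z) ∧ z ^ 2 = a * x ^ 2 + b * y ^ 2 := by
  obtain ⟨x, y, z, h0, h⟩ := h
  obtain ⟨k, w, hw, i, hi⟩ := exists_primitive_vec (x := ![x, y, z]) (by
    intro h1
    exact h0 ⟨by simpa using congrFun h1 0, by simpa using congrFun h1 1,
      by simpa using congrFun h1 2⟩)
  refine ⟨w 0, w 1, w 2, ?_, ?_⟩
  · rw [padic_isUnit_iff_not_dvd] at hi
    rintro ⟨h1, h2, h3⟩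
    apply hi
    fin_cases i <;> assumption
  · have e0 : x = (p : ℤ_[p]) ^ k * w 0 := by simpa using congrFun hw 0
    have e1 : y = (p : ℤ_[p]) ^ k * w 1 := by simpa using congrFun hw 1
    have e2 : z = (p : ℤ_[p]) ^ k * w 2 := by simpa using congrFun hw 2
    have hne : ((p : ℤ_[p]) ^ k) ^ 2 ≠ 0 := pow_ne_zero _ (pow_ne_zero _ padic_prime.ne_zero)
    apply mul_left_cancel₀ hne
    rw [e0, e1, e2] at h
    linear_combination h

lemma HS_mul_sq {a b s : ℤ_[p]} (hs : s ≠ 0) : HS (s ^ 2 * a) b ↔ HS a b := by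
  constructor
  · rintro ⟨x, y, z, h0, h⟩
    refine ⟨s * x, y, z, ?_, by rw [h]; ring⟩
    rintro ⟨h1, h2, h3⟩
    exact h0 ⟨(mul_eq_zero.1 h1).resolve_left hs, h2, h3⟩
  · rintro ⟨x, y, z, h0, h⟩
    refine ⟨x, s * y, s * z, ?_, by rw [mul_pow, h]; ring⟩
    rintro ⟨h1, h2, h3⟩
    exact h0 ⟨h1, (mul_eq_zero.1 h2).resolve_left hs, (mul_eq_zero.1 h3).resolve_left hs⟩

lemma HS_mul_sq_right {a b s : ℤ_[p]} (hs : s ≠ 0) : HS a (s ^ 2 * b) ↔ HS a b := by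
  rw [HS_comm, HS_mul_sq hs, HS_comm]

lemma HS.neg_mul {a b : ℤ_[p]} (ha : a ≠ 0) (hb : b ≠ 0) (h : HS a b) : HS a (-(a * b)) := by
  obtain ⟨x, y, z, h0, h⟩ := h
  refine ⟨z, y, a * x, ?_, by linear_combination (-a) * h⟩
  rintro ⟨h1, h2, h3⟩
  exact h0 ⟨(mul_eq_zero.1 h3).resolve_left ha, h2, h1⟩

lemma HS_neg_mul {a b : ℤ_[p]} (ha : a ≠ 0) (hb : b ≠ 0) : HS a (-(a * b)) ↔ HS a b := by
  refine ⟨fun h => ?_, fun h => h.neg_mul ha hb⟩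
  have := h.neg_mul ha (neg_ne_zero.2 (mul_ne_zero ha hb))
  rw [show -(a * -(a * b)) = a ^ 2 * b by ring, HS_mul_sq_right ha] at this
  exact this

lemma HS_of_sq (a s : ℤ_[p]) : HS a (s ^ 2) := ⟨0, 1, s, by simp, by ring⟩

lemma HS_unit_unit (hp2 : p ≠ 2) {u v : ℤ_[p]} (hu : IsUnit u) (hv : IsUnit v) : HS u v := by
  obtain ⟨x, hx, h⟩ := isoM_of_unimodular hp2 (M := !![1, 0, 0; 0, -u, 0; 0, 0, -v]) (by
    ext i j; fin_cases i <;> fin_cases j <;> simp) (by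
    simp [Matrix.det_fin_three]; exact ⟨hu, hv⟩)
  rw [quadVal_three] at h
  simp at h
  refine ⟨x 1, x 2, x 0, ?_, by linear_combination h⟩
  rintro ⟨h1, h2, h3⟩
  apply hx
  ext i
  fin_cases i <;> simp [h1, h2, h3]

lemma HS_p_unit {u v : ℤ_[p]} (hu : IsUnit u) (hv : IsUnit v)
    (h : HS ((p : ℤ_[p]) * u) v) :
    ∃ y z : ℤ_[p], IsUnit y ∧ ∃ x, z ^ 2 = (p : ℤ_[p]) * u * x ^ 2 + v * y ^ 2 := by
  obtain ⟨x, y, z, h0, h⟩ := h.prim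
  refine ⟨y, z, ?_, x, h⟩
  rw [padic_isUnit_iff_not_dvd]
  intro hy
  have hz : (p : ℤ_[p]) ∣ z := by
    apply padic_prime.dvd_of_dvd_pow (n := 2)
    rw [h]
    exact dvd_add (Dvd.intro _ (by ring : (p : ℤ_[p]) * (u * x ^ 2) = _))
      (Dvd.dvd.mul_left (dvd_pow hy two_ne_zero) _)
  obtain ⟨y', rfl⟩ := hy
  obtain ⟨z', rfl⟩ := hz
  have h1 : (p : ℤ_[p]) * (z' ^ 2 - v * y' ^ 2) = u * x ^ 2 := by
    apply mul_left_cancel₀ padic_prime.ne_zero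
    linear_combination h
  have h2 : (p : ℤ_[p]) ∣ x := by
    apply padic_prime.dvd_of_dvd_pow (n := 2)
    rw [← hu.dvd_mul_left, ← h1]
    exact dvd_mul_right _ _
  exact h0 ⟨h2, dvd_mul_right _ _, dvd_mul_right _ _⟩

lemma sq_of_sq_mod (hp2 : p ≠ 2) {v s : ℤ_[p]} (hv : IsUnit v) (h : (p : ℤ_[p]) ∣ s ^ 2 - v) :
    ∃ t, t ^ 2 = v := by
  have hs : IsUnit s := by
    rw [padic_isUnit_iff_not_dvd] at hv ⊢
    intro h1
    apply hv
    have := dvd_sub (dvd_pow h1 two_ne_zero) h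
    simpa using this
  obtain ⟨z, hz, -⟩ := hensel_quad 1 0 (-v) s (by ring_nf; ring_nf at h; exact h)
    (by simpa using (padic_isUnit_two hp2).mul hs)
  exact ⟨z, by linear_combination hz⟩

lemma jacobi_eq_one_iff (hp2 : p ≠ 2) {v : ℤ} (hv : ¬ (p : ℤ) ∣ v) :
    jacobiSym v p = 1 ↔ ∃ t : ℤ_[p], t ^ 2 = (v : ℤ_[p]) := by
  have hv0 : (v : ZMod p) ≠ 0 := by rwa [Ne, ZMod.intCast_zmod_eq_zero_iff_dvd]
  rw [← jacobiSym.legendreSym.to_jacobiSym, legendreSym.eq_one_iff p hv0]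
  constructor
  · rintro ⟨s, hs⟩
    obtain ⟨t, rfl⟩ := ZMod.ringHom_surjective (PadicInt.toZMod (p := p)) s
    apply sq_of_sq_mod hp2 (s := t)
    · rw [padic_isUnit_iff_not_dvd, padic_intCast_dvd_iff']; exact hv
    · rw [← toZMod_eq_zero_iff, map_sub, map_pow, map_intCast, hs]; ring
  · rintro ⟨t, ht⟩
    refine ⟨PadicInt.toZMod t, ?_⟩
    rw [← map_mul, ← sq, ht, map_intCast]

lemma jacobi_pm {v : ℤ} (hv : ¬ (p : ℤ) ∣ v) : jacobiSym v p = 1 ∨ jacobiSym v p = -1 := by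
  apply jacobiSym.eq_one_or_neg_one
  rw [Int.gcd_comm, Int.gcd_eq_natAbs, Int.natAbs_natCast]
  exact (Nat.Prime.coprime_iff_not_dvd (Fact.out : p.Prime)).2 (fun h => hv (Int.natCast_dvd.2 h))

lemma int_unit {v : ℤ} (hv : ¬ (p : ℤ) ∣ v) : IsUnit (v : ℤ_[p]) := by
  rw [padic_isUnit_iff_not_dvd, padic_intCast_dvd_iff']; exact hv

lemma HS_p_unit_iff (hp2 : p ≠ 2) {u v : ℤ} (hu : ¬ (p : ℤ) ∣ u) (hv : ¬ (p : ℤ) ∣ v) :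
    HS ((p : ℤ_[p]) * (u : ℤ_[p])) (v : ℤ_[p]) ↔ jacobiSym v p = 1 := by
  rw [jacobi_eq_one_iff hp2 hv]
  constructor
  · intro h
    obtain ⟨y, z, hy, x, h⟩ := HS_p_unit (int_unit hu) (int_unit hv) h
    obtain ⟨w, hw⟩ := hy.exists_right_inv
    apply sq_of_sq_mod hp2 (s := z * w) (int_unit hv)
    refine ⟨u * x ^ 2 * w ^ 2, ?_⟩
    have : (y * w) ^ 2 = 1 := by rw [hw]; ring
    linear_combination w ^ 2 * h + v * this
  · rintro ⟨t, ht⟩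
    rw [← ht]; exact HS_of_sq _ _

lemma exists_parity (x : ℤ_[p]) (n : ℕ) : ∃ s : ℤ_[p], s ≠ 0 ∧
    (p : ℤ_[p]) ^ n * x = s ^ 2 * ((p : ℤ_[p]) ^ (n % 2) * x) := by
  refine ⟨(p : ℤ_[p]) ^ (n / 2), pow_ne_zero _ padic_prime.ne_zero, ?_⟩
  rw [← pow_mul, ← mul_assoc, ← pow_add]
  congr 2
  omega

lemma pow_pm_parity {e : ℤ} (he : e = 1 ∨ e = -1) (n : ℕ) : e ^ n = e ^ (n % 2) := by
  rcases he with rfl | rfl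
  · simp
  · rw [← Nat.mod_add_div n 2]
    simp [pow_add, pow_mul]

/-- reduce `HS` for integers to valuations modulo two -/
lemma HS_int_reduce {a b : ℤ} :
    HS (a : ℤ_[p]) (b : ℤ_[p]) ↔
      HS ((p : ℤ_[p]) ^ (padicValInt p a % 2) * (uPart p a : ℤ_[p]))
        ((p : ℤ_[p]) ^ (padicValInt p b % 2) * (uPart p b : ℤ_[p])) := by
  have ea : (a : ℤ_[p]) = (p : ℤ_[p]) ^ padicValInt p a * (uPart p a : ℤ_[p]) := by
    exact_mod_cast congrArg (Int.cast : ℤ → ℤ_[p]) (uPart_spec p a)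
  have eb : (b : ℤ_[p]) = (p : ℤ_[p]) ^ padicValInt p b * (uPart p b : ℤ_[p]) := by
    exact_mod_cast congrArg (Int.cast : ℤ → ℤ_[p]) (uPart_spec p b)
  obtain ⟨s, hs, h1⟩ := exists_parity (p := p) (uPart p a : ℤ_[p]) (padicValInt p a)
  obtain ⟨t, ht, h2⟩ := exists_parity (p := p) (uPart p b : ℤ_[p]) (padicValInt p b)
  rw [ea, eb, h1, h2, HS_mul_sq hs, HS_mul_sq_right ht]

lemma HS_pp {u v : ℤ} (hu : ¬ (p : ℤ) ∣ u) (hv : ¬ (p : ℤ) ∣ v) :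
    HS ((p : ℤ_[p]) * (u : ℤ_[p])) ((p : ℤ_[p]) * (v : ℤ_[p])) ↔
      HS ((p : ℤ_[p]) * (u : ℤ_[p])) ((-(u * v) : ℤ) : ℤ_[p]) := by
  have h1 := (int_unit hu).ne_zero
  have h2 := (int_unit hv).ne_zero
  have h3 := (padic_prime (p := p)).ne_zero
  rw [← HS_neg_mul (mul_ne_zero h3 h1) (mul_ne_zero h3 h2),
    show -((p : ℤ_[p]) * (u : ℤ_[p]) * ((p : ℤ_[p]) * (v : ℤ_[p]))) = (p : ℤ_[p]) ^ 2 * ((-(u * v) : ℤ) : ℤ_[p]) by push_cast; ring,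
    HS_mul_sq_right h3]

lemma hil_eq_one_iff_odd (hp2 : p ≠ 2) {a b : ℤ} (ha : a ≠ 0) (hb : b ≠ 0) :
    hil p a b = 1 ↔ HS (a : ℤ_[p]) (b : ℤ_[p]) := by
  have hp : p.Prime := Fact.out
  have hu := uPart_not_dvd hp ha
  have hv := uPart_not_dvd hp hb
  rw [HS_int_reduce]
  unfold hil
  rw [if_neg hp2, if_pos hp]
  have j1 := jacobi_pm (p := p) (v := -1) (not_dvd_neg_one hp)
  have j2 := jacobi_pm hu
  have j3 := jacobi_pm hv
  rw [pow_pm_parity j1, pow_pm_parity j2, pow_pm_parity j3, Nat.mul_mod]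
  rcases Nat.mod_two_eq_zero_or_one (padicValInt p a) with h1 | h1 <;>
  rcases Nat.mod_two_eq_zero_or_one (padicValInt p b) with h2 | h2 <;> rw [h1, h2]
  · simp [HS_unit_unit hp2 (int_unit hu) (int_unit hv)]
  · rw [HS_comm]
    simp only [pow_one, pow_zero, one_mul]
    rw [HS_p_unit_iff hp2 hv hu]
    simp
  · simp only [pow_one, pow_zero, one_mul]
    rw [HS_p_unit_iff hp2 hu hv]
    simp
  · simp only [pow_one]
    rw [HS_pp hu hv, HS_p_unit_iff hp2 hu, show -(uPart p a * uPart p b) =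
      (-1) * (uPart p a * uPart p b) by ring, jacobiSym.mul_left (-1) (uPart p a * uPart p b),
      jacobiSym.mul_left (uPart p a) (uPart p b), ← mul_assoc]
    · simp
    · intro h
      rw [dvd_neg] at h
      rcases (Nat.prime_iff_prime_int.1 hp).dvd_or_dvd h with h | h
      · exact hu h
      · exact hv h

end HilbertLocal

section HilbertTwo

lemma unit_two_iff {v : ℤ} : ¬ ((2 : ℕ) : ℤ) ∣ v ↔ v % 2 = 1 := by
  push_cast; omega

/-- reduction mod 8 -/
noncomputable def red8 : ℤ_[2] →+* ZMod 8 := PadicInt.toZModPow 3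
/-- reduction mod 4 -/
noncomputable def red4 : ℤ_[2] →+* ZMod 4 := PadicInt.toZModPow 2

lemma sq_two_of_mod (v : ℤ) (hv : v % 8 = 1) : ∃ t : ℤ_[2], t ^ 2 = (v : ℤ_[2]) := by
  obtain ⟨c, rfl⟩ : ∃ c : ℤ, v = 8 * c + 1 := ⟨v / 8, by omega⟩
  obtain ⟨z, hz, -⟩ := hensel_quad (p := 2) 2 1 (-(c : ℤ_[2])) (c : ℤ_[2])
    ⟨(c : ℤ_[2]) ^ 2, by push_cast; ring⟩ (by
      rw [padic_isUnit_iff_not_dvd]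
      have : (2 * 2 * (c : ℤ_[2]) + 1) = ((4 * c + 1 : ℤ) : ℤ_[2]) := by push_cast; ring
      rw [this, padic_intCast_dvd_iff']
      push_cast; omega)
  refine ⟨4 * z + 1, ?_⟩
  push_cast
  linear_combination 8 * hz

lemma HS_two_uu {u v : ℤ} (hu : u % 2 = 1) (hv : v % 2 = 1) :
    HS (u : ℤ_[2]) (v : ℤ_[2]) ↔ c4 u v = 1 := by
  have key : ∀ {u v : ℤ}, u % 4 = 1 → v % 2 = 1 → HS (u : ℤ_[2]) (v : ℤ_[2]) := by
    intro u v hu hv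
    by_cases h8 : u % 8 = 1
    · obtain ⟨t, ht⟩ := sq_two_of_mod u h8
      rw [← ht]; exact (HS_of_sq _ _).symm
    · obtain ⟨t, ht⟩ := sq_two_of_mod (u + 4 * v) (by omega)
      refine ⟨1, 2, t, by simp, ?_⟩
      rw [ht]; push_cast; ring
  constructor
  · intro h
    obtain ⟨x, y, z, h0, h⟩ := h.prim
    unfold c4
    rw [if_neg]
    rintro ⟨h1, h2⟩
    apply h0
    have hu4 : (u : ZMod 4) = 3 := by
      have := (ZMod.intCast_eq_intCast_iff u 3 4).2 (by unfold Int.ModEq; push_cast; omega)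
      simpa using this
    have hv4 : (v : ZMod 4) = 3 := by
      have := (ZMod.intCast_eq_intCast_iff v 3 4).2 (by unfold Int.ModEq; push_cast; omega)
      simpa using this
    have e := congrArg red4 h
    simp only [map_add, map_mul, map_pow, map_intCast, hu4, hv4] at e
    have dec : ∀ x y z : ZMod 4, z ^ 2 = 3 * x ^ 2 + 3 * y ^ 2 → 2 * x = 0 ∧ 2 * y = 0 ∧ 2 * z = 0 := by
      decide
    have := dec _ _ _ e
    have conv : ∀ w : ℤ_[2], 2 * red4 w = 0 → ((2 : ℕ) : ℤ_[2]) ∣ w := by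
      intro w hw
      rw [show (2 : ZMod 4) = red4 2 from (map_ofNat _ _).symm, ← map_mul] at hw
      have h3 : (2 * w : ℤ_[2]) ∈ RingHom.ker (PadicInt.toZModPow (p := 2) 2) := hw
      rw [PadicInt.ker_toZModPow, Ideal.mem_span_singleton] at h3
      obtain ⟨k, hk⟩ := h3
      refine ⟨k, ?_⟩
      apply mul_left_cancel₀ (padic_prime (p := 2)).ne_zero
      push_cast at hk ⊢
      linear_combination hk
    exact ⟨conv _ this.1, conv _ this.2.1, conv _ this.2.2⟩
  · intro h
    unfold c4 at h
    split_ifs at h with h1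
    by_cases h2 : u % 4 = 1
    · exact key h2 hv
    · exact (key (by omega) hu).symm

lemma HS_two_pu {u v : ℤ} (hu : u % 2 = 1) (hv : v % 2 = 1) :
    HS (((2 : ℕ) : ℤ_[2]) * (u : ℤ_[2])) (v : ℤ_[2]) ↔ v % 8 = 1 ∨ (v + 2 * u) % 8 = 1 := by
  constructor
  · intro h
    obtain ⟨y, z, hy, x, h⟩ := HS_p_unit (p := 2) (int_unit (unit_two_iff.2 hu))
      (int_unit (unit_two_iff.2 hv)) h
    have e := congrArg red8 h
    simp only [map_add, map_mul, map_pow, map_intCast, map_natCast] at e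
    have hy8 : IsUnit (red8 y) := hy.map _
    have hv8 : IsUnit (v : ZMod 8) := by
      have := (int_unit (p := 2) (unit_two_iff.2 hv)).map red8
      simpa using this
    have d1 : ∀ w : ZMod 8, (∃ w', w * w' = 1) → w ^ 2 = 1 := by decide
    have d2 : ∀ a b : ZMod 8, 2 * a * b ^ 2 = 0 ∨ 2 * a * b ^ 2 = 2 * a := by decide
    have d3 : ∀ z a v: ZMod 8, (∃ w', v * w' = 1) → z ^ 2 = 2 * a + v → 2 * a + v = 1 := by decide
    rw [d1 _ hy8.exists_right_inv] at e
    have e' := d3 (red8 z) ((u : ZMod 8) * red8 x ^ 2) v hv8.exists_right_inv (by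
      rw [e]; push_cast; ring)
    rw [← mul_assoc] at e'
    rcases d2 u (red8 x) with h3 | h3
    · left
      rw [h3, zero_add] at e'
      have := (ZMod.intCast_eq_intCast_iff v 1 8).1 (by push_cast; exact e')
      unfold Int.ModEq at this; push_cast at this; omega
    · right
      rw [h3] at e'
      have := (ZMod.intCast_eq_intCast_iff (v + 2 * u) 1 8).1 (by
        push_cast; rw [add_comm]; exact e')
      unfold Int.ModEq at this; push_cast at this; omega
  · rintro (h | h)
    · obtain ⟨t, ht⟩ := sq_two_of_mod v h
      rw [← ht]; exact HS_of_sq _ _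
    · obtain ⟨t, ht⟩ := sq_two_of_mod _ h
      refine ⟨1, 1, t, by simp, ?_⟩
      rw [ht]; push_cast; ring

lemma two_pu_sign {u v : ℤ} (hu : u % 2 = 1) (hv : v % 2 = 1) :
    (v % 8 = 1 ∨ (v + 2 * u) % 8 = 1) ↔ c4 u v * c8 v = 1 := by
  unfold c4 c8
  have h1 : u % 4 = 1 ∨ u % 4 = 3 := by omega
  have h2 : v % 8 = 1 ∨ v % 8 = 3 ∨ v % 8 = 5 ∨ v % 8 = 7 := by omega
  split_ifs <;> simp <;> omega

lemma c8_pm (u : ℤ) : c8 u = 1 ∨ c8 u = -1 := by unfold c8; split_ifs <;> simp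

lemma hil_eq_one_iff_two {a b : ℤ} (ha : a ≠ 0) (hb : b ≠ 0) :
    hil 2 a b = 1 ↔ HS (a : ℤ_[2]) (b : ℤ_[2]) := by
  have hu := odd_of_uPart ha
  have hv := odd_of_uPart hb
  rw [HS_int_reduce]
  unfold hil
  rw [if_pos rfl]
  rw [pow_pm_parity (c8_pm _), pow_pm_parity (c8_pm _) (padicValInt 2 a)]
  generalize uPart 2 a = u at *
  generalize uPart 2 b = v at *
  rcases Nat.mod_two_eq_zero_or_one (padicValInt 2 a) with h1 | h1 <;>
  rcases Nat.mod_two_eq_zero_or_one (padicValInt 2 b) with h2 | h2 <;> rw [h1, h2] <;>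
    simp only [pow_one, pow_zero, one_mul, mul_one]
  · rw [HS_two_uu hu hv]
  · rw [HS_comm, HS_two_pu hv hu, two_pu_sign hv hu, c4_symm]
  · rw [HS_two_pu hu hv, two_pu_sign hu hv]
  · have huv : (-(u * v)) % 2 = 1 := by
      have : (u * v) % 2 = 1 := by rw [Int.mul_emod, hu, hv]; rfl
      omega
    rw [HS_pp (unit_two_iff.2 hu) (unit_two_iff.2 hv), HS_two_pu hu huv, two_pu_sign hu huv]
    have e1 : -(u * v) = (-u) * v := by ring
    have hnu : (-u) % 2 = 1 := by omega
    rw [e1, c4_symm u (-u * v), c4_mul hnu hv, c8_mul hnu hv]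
    have e2 : c4 (-u) u = 1 := by
      unfold c4; rw [if_neg]; omega
    have e3 : c8 (-u) = c8 u := by
      unfold c8
      have : (-u % 8 = 1 ∨ -u % 8 = 7) ↔ (u % 8 = 1 ∨ u % 8 = 7) := by omega
      simp only [this]
    rw [e2, e3, c4_symm v u, one_mul, mul_assoc]

end HilbertTwo

lemma hil_eq_one_iff {p : ℕ} [Fact p.Prime] {a b : ℤ} (ha : a ≠ 0) (hb : b ≠ 0) :
    hil p a b = 1 ↔ HS (a : ℤ_[p]) (b : ℤ_[p]) := by
  by_cases hp2 : p = 2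
  · subst hp2
    convert hil_eq_one_iff_two ha hb
  · exact hil_eq_one_iff_odd hp2 ha hb

instance primesFact (p : Nat.Primes) : Fact (p : ℕ).Prime := ⟨p.2⟩

lemma exists_approx (S : Finset Nat.Primes) (K : ℕ) (a : ∀ p : Nat.Primes, ℤ_[(p : ℕ)]) :
    ∃ k : ℤ, ∀ p ∈ S, (((p : ℕ) : ℤ_[(p : ℕ)]) ^ K) ∣ (k : ℤ_[(p : ℕ)]) - a p := by
  obtain ⟨k, hk⟩ := Nat.chineseRemainderOfFinset (fun p : Nat.Primes => (a p).appr K)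
    (fun p : Nat.Primes => (p : ℕ) ^ K) S (fun p _ => pow_ne_zero _ p.2.ne_zero) (by
      intro p _ q _ hpq
      exact Nat.Coprime.pow _ _ ((Nat.coprime_primes p.2 q.2).2 (fun h => hpq (Subtype.ext h))))
  refine ⟨k, fun p hp => ?_⟩
  have h1 := PadicInt.appr_spec K (a p)
  rw [Ideal.mem_span_singleton] at h1
  have h2 := (Nat.modEq_iff_dvd.1 (hk p hp))
  push_cast at h2
  have h3 := (padic_intCast_dvd_iff (p := (p : ℕ)) K _).2 h2
  push_cast at h3 ⊢
  have := dvd_neg.2 (dvd_add h1 h3)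
  convert this using 1
  ring

lemma int_dvd_of_padic {x y : ℤ}
    (h : ∀ p : Nat.Primes, (x : ℤ_[(p : ℕ)]) ∣ (y : ℤ_[(p : ℕ)])) : x ∣ y := by
  rw [← Int.natAbs_dvd_natAbs, Nat.dvd_iff_prime_pow_dvd_dvd]
  intro p k hp hpk
  rw [← Int.natCast_dvd] at hpk ⊢
  push_cast at hpk ⊢
  have : Fact p.Prime := ⟨hp⟩
  rw [← padic_intCast_dvd_iff (p := p)] at hpk ⊢
  exact hpk.trans (h ⟨p, hp⟩)

lemma hil_pm (p : ℕ) {a b : ℤ} (ha : a ≠ 0) (hb : b ≠ 0) : hil p a b = 1 ∨ hil p a b = -1 := by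
  have key : ∀ {e f g : ℤ} (i j k : ℕ), (e = 1 ∨ e = -1) → (f = 1 ∨ f = -1) → (g = 1 ∨ g = -1) →
      (e ^ i * f ^ j * g ^ k = 1 ∨ e ^ i * f ^ j * g ^ k = -1) := by
    intro e f g i j k he hf hg
    have hpow : ∀ {e : ℤ} (i : ℕ), (e = 1 ∨ e = -1) → (e ^ i = 1 ∨ e ^ i = -1) := by
      intro e i he
      rcases he with rfl | rfl
      · simp
      · exact neg_one_pow_eq_or ℤ i
    rcases hpow i he with h1 | h1 <;> rcases hpow j hf with h2 | h2 <;>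
      rcases hpow k hg with h3 | h3 <;> simp [h1, h2, h3]
  by_cases hp2 : p = 2
  · unfold hil
    rw [if_pos hp2]
    have : c4 (uPart 2 a) (uPart 2 b) = 1 ∨ c4 (uPart 2 a) (uPart 2 b) = -1 := by
      unfold c4; split_ifs <;> simp
    have := key 1 (padicValInt 2 b) (padicValInt 2 a) this (c8_pm (uPart 2 a)) (c8_pm (uPart 2 b))
    rwa [pow_one] at this
  · by_cases hp : p.Prime
    · have : Fact p.Prime := ⟨hp⟩
      unfold hil
      rw [if_neg hp2, if_pos hp]
      exact key _ _ _ (jacobi_pm (not_dvd_neg_one hp)) (jacobi_pm (uPart_not_dvd hp ha))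
        (jacobi_pm (uPart_not_dvd hp hb))
    · left; exact hil_not_prime hp a b

section
variable {p : ℕ} [Fact p.Prime]

/-- isotropy in terms of the Hilbert symbol -/
lemma isoM_iff_HS {M : Matrix (Fin 3) (Fin 3) ℤ_[p]} (hM : M.IsSymm) (ha : M 0 0 ≠ 0)
    (hg : M 0 0 * M 1 1 - M 0 1 ^ 2 ≠ 0) (hd : M.det ≠ 0) :
    IsoM M ↔ HS (-(M 0 0 * M 1 1 - M 0 1 ^ 2)) (-(M 0 0 * M.det)) := by
  constructor
  · rintro ⟨x, hx, h⟩
    have key := lagrange_id hM x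
    rw [h, mul_zero] at key
    refine ⟨M 0 0 * x 0 + M 0 1 * x 1 + M 0 2 * x 2, x 2,
      (M 0 0 * M 1 1 - M 0 1 ^ 2) * x 1 + (M 0 0 * M 1 2 - M 0 1 * M 0 2) * x 2, ?_, ?_⟩
    · rintro ⟨h1, h2, h3⟩
      rw [h2, mul_zero, add_zero] at h1 h3
      have h4 := (mul_eq_zero.1 h3).resolve_left hg
      rw [h4, mul_zero, add_zero] at h1
      have h5 := (mul_eq_zero.1 h1).resolve_left ha
      apply hx
      ext i
      fin_cases i <;> simp [h2, h4, h5]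
    · linear_combination -key
  · rintro ⟨X, z, Y, h0, h⟩
    let g := M 0 0 * M 1 1 - M 0 1 ^ 2
    let g12 := M 0 0 * M 1 2 - M 0 1 * M 0 2
    let x : Fin 3 → ℤ_[p] := ![g * X - M 0 1 * (Y - g12 * z) - M 0 2 * g * z,
      M 0 0 * (Y - g12 * z), M 0 0 * g * z]
    refine ⟨x, ?_, ?_⟩
    · intro hx
      have h2 : M 0 0 * g * z = 0 := congrFun hx 2
      have h1 : M 0 0 * (Y - g12 * z) = 0 := congrFun hx 1
      have h3 : g * X - M 0 1 * (Y - g12 * z) - M 0 2 * g * z = 0 := congrFun hx 0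
      have hz : z = 0 := (mul_eq_zero.1 h2).resolve_left (mul_ne_zero ha hg)
      have hY := (mul_eq_zero.1 h1).resolve_left ha
      rw [hY, hz, mul_zero, mul_zero, sub_zero, sub_zero] at h3
      have hX := (mul_eq_zero.1 h3).resolve_left hg
      rw [hz, mul_zero, sub_zero] at hY
      exact h0 ⟨hX, hz, hY⟩
    · have key := lagrange_id hM x
      have e2 : x 2 = M 0 0 * g * z := rfl
      have e1 : x 1 = M 0 0 * (Y - g12 * z) := rfl
      have e0 : x 0 = g * X - M 0 1 * (Y - g12 * z) - M 0 2 * g * z := rfl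
      have f0 : M 0 0 * x 0 + M 0 1 * x 1 + M 0 2 * x 2 = M 0 0 * g * X := by
        rw [e0, e1, e2]; ring
      have f1 : g * x 1 + g12 * x 2 = M 0 0 * g * Y := by
        rw [e1, e2]; ring
      apply mul_left_cancel₀ (mul_ne_zero ha hg)
      rw [key, mul_zero]
      change g * _ ^ 2 + (g * x 1 + g12 * x 2) ^ 2 + _ = 0
      rw [f0, f1, e2]
      change Y ^ 2 = -g * X ^ 2 + _ at h
      linear_combination (M 0 0 * g) ^ 2 * h

/-- numbers close to 1 are squares -/
lemma sq_near_one (r : ℤ_[p]) : ∃ t : ℤ_[p], t ^ 2 = 1 + 4 * p * r ∧ IsUnit t := by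
  obtain ⟨z, hz, hz'⟩ := hensel_quad (p : ℤ_[p]) 1 (-r) r ⟨r ^ 2, by ring⟩ (by
      rw [padic_isUnit_iff_not_dvd]
      intro h
      have : (p : ℤ_[p]) ∣ 1 := by
        have := dvd_sub h (⟨2 * r, by ring⟩ : (p : ℤ_[p]) ∣ 2 * p * r)
        simpa using this
      exact padic_prime.not_unit (isUnit_of_dvd_one this))
  refine ⟨1 + 2 * p * z, by linear_combination 4 * (p : ℤ_[p]) * hz, ?_⟩
  rw [padic_isUnit_iff_not_dvd]
  intro h
  have : (p : ℤ_[p]) ∣ 1 := by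
    have := dvd_sub h (⟨2 * z, by ring⟩ : (p : ℤ_[p]) ∣ 2 * p * z)
    simpa using this
  exact padic_prime.not_unit (isUnit_of_dvd_one this)

lemma dvd_pow_of_ne_zero {x : ℤ_[p]} (hx : x ≠ 0) : ∃ K : ℕ, ∀ k ≥ K, x ∣ (p : ℤ_[p]) ^ k := by
  refine ⟨x.valuation, fun k hk => ?_⟩
  have := PadicInt.unitCoeff_spec hx
  have h2 : x ∣ (p : ℤ_[p]) ^ x.valuation :=
    ⟨((PadicInt.unitCoeff hx)⁻¹ : ℤ_[p]ˣ), by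
      nth_rewrite 2 [this]
      rw [mul_comm, ← mul_assoc, Units.inv_mul, one_mul]⟩
  exact h2.trans (pow_dvd_pow _ hk)

lemma exists_local_mat {A : TernMat} (hA : IsLat A) {m : ℤ} (hm : m ≠ 0) {y : Fin 3 → ℤ_[p]}
    (hy : ∃ i, IsUnit (y i)) (hQ : quadVal (padicMat p A) y = m) :
    ∃ M : Matrix (Fin 3) (Fin 3) ℤ_[p], M.IsSymm ∧ PadicIsomP p (padicMat p A) M ∧
      M.det = A.det ∧ M 0 0 = m ∧ M 0 0 * M 1 1 - M 0 1 ^ 2 ≠ 0 := by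
  obtain ⟨U, hU, hUy⟩ := exists_complete hy
  obtain ⟨N, hN⟩ : ∃ N, N = Uᵀ * padicMat p A * U := ⟨_, rfl⟩
  have hNs : N.IsSymm := by rw [hN]; exact conj_symm (padicMat_symm hA.1) _
  have hNd : N.det = A.det := by rw [hN, det_gram_conj, hU, padicMat_det]; ring
  have hN0 : N 0 0 = m := by
    rw [hN, conj_apply, ← hQ]; congr 1; ext i; exact hUy i
  have hd : (A.det : ℤ_[p]) ≠ 0 := by exact_mod_cast hA.posDet.ne'
  have hm' : (m : ℤ_[p]) ≠ 0 := by exact_mod_cast hm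
  have gen : ∀ t : ℤ_[p], ∃ W : Matrix (Fin 3) (Fin 3) ℤ_[p], W.det = 1 ∧
      (Wᵀ * N * W) 0 0 = m ∧ (Wᵀ * N * W) 0 0 * (Wᵀ * N * W) 1 1 - (Wᵀ * N * W) 0 1 ^ 2 =
        (N 0 0 * N 1 1 - N 0 1 ^ 2) + 2 * t * (N 0 0 * N 1 2 - N 0 1 * N 0 2) +
          t ^ 2 * (N 0 0 * N 2 2 - N 0 2 ^ 2) := by
    intro t
    obtain ⟨W, hW⟩ : ∃ W : Matrix (Fin 3) (Fin 3) ℤ_[p], W = !![1, 0, 0; 0, 1, 0; 0, t, 1] := ⟨_, rfl⟩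
    have e00 : (Wᵀ * N * W) 0 0 = N 0 0 := by
      rw [conj_apply, quadVal_three, hW]; simp
    have e11 : (Wᵀ * N * W) 1 1 = N 1 1 + 2 * t * N 1 2 + t ^ 2 * N 2 2 := by
      rw [conj_apply, quadVal_three, hW]; simp; rw [hNs.apply 1 2]; ring
    have e01 : (Wᵀ * N * W) 0 1 = N 0 1 + t * N 0 2 := by
      rw [hW]
      simp [Matrix.mul_apply, Fin.sum_univ_three]; ring
    refine ⟨W, by rw [hW]; simp [Matrix.det_fin_three], by rw [e00, hN0], ?_⟩
    rw [e00, e11, e01]; ring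
  obtain ⟨t, ht⟩ : ∃ t : ℤ_[p], (N 0 0 * N 1 1 - N 0 1 ^ 2) +
      2 * t * (N 0 0 * N 1 2 - N 0 1 * N 0 2) + t ^ 2 * (N 0 0 * N 2 2 - N 0 2 ^ 2) ≠ 0 := by
    by_contra hcon
    push Not at hcon
    have c0 := hcon 0
    have c1 := hcon 1
    have c2 := hcon (-1)
    have h12 : (N 0 0 * N 1 2 - N 0 1 * N 0 2) = 0 := by
      have : (4 : ℤ_[p]) * (N 0 0 * N 1 2 - N 0 1 * N 0 2) = 0 := by linear_combination c1 - c2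
      exact (mul_eq_zero.1 this).resolve_left (by norm_num)
    have h11 : (N 0 0 * N 1 1 - N 0 1 ^ 2) = 0 := by linear_combination c0
    have : N 0 0 * N.det = 0 := by
      rw [det_symm hNs]
      linear_combination (N 0 0 * N 2 2 - N 0 2 ^ 2) * h11 - (N 0 0 * N 1 2 - N 0 1 * N 0 2) * h12
    rw [hN0, hNd] at this
    exact mul_ne_zero hm' hd this
  obtain ⟨W, hW, h0, h1⟩ := gen t
  refine ⟨Wᵀ * N * W, conj_symm hNs _, ?_, ?_, h0, by rw [h1]; exact ht⟩
  · exact PadicIsomP.trans ⟨U, by rw [hU]; exact isUnit_one, hN.symm⟩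
      ⟨W, by rw [hW]; exact isUnit_one, rfl⟩
  · rw [det_gram_conj, hW, hNd]; ring

end

lemma exists_min_rep {A : TernMat} {n : ℕ} (hn : 0 < n) (hloc : LocallyRepresented n A) :
    ∃ m c : ℕ, 0 < m ∧ n = m * c ^ 2 ∧ ∀ p : Nat.Primes, ∃ y : Fin 3 → ℤ_[(p : ℕ)],
      quadVal (padicMat p A) y = ((m : ℤ) : ℤ_[(p : ℕ)]) ∧ ∃ i, IsUnit (y i) := by
  induction n using Nat.strong_induction_on with
  | _ n ih =>
  by_cases hprim : ∀ p : Nat.Primes, ∃ y : Fin 3 → ℤ_[(p : ℕ)],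
      quadVal (padicMat p A) y = ((n : ℤ) : ℤ_[(p : ℕ)]) ∧ ∃ i, IsUnit (y i)
  · exact ⟨n, 1, hn, by simp, hprim⟩
  push Not at hprim
  obtain ⟨p, hpn⟩ := hprim
  obtain ⟨x, hx⟩ := hloc p p.2
  have hdiv : ∀ i, ((p : ℕ) : ℤ_[(p : ℕ)]) ∣ x i := by
    intro i
    by_contra hi
    exact hpn x hx i ((padic_isUnit_iff_not_dvd _).2 hi)
  choose y hy using hdiv
  have hxy : x = ((p : ℕ) : ℤ_[(p : ℕ)]) • y := by ext1 i; rw [hy i]; rfl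
  have hx' : quadVal (padicMat p A) x = ((n : ℤ) : ℤ_[(p : ℕ)]) := hx
  rw [hxy, quadVal_smul] at hx'
  have hd : ((p : ℕ) : ℤ) ^ 2 ∣ (n : ℤ) := by
    rw [← padic_intCast_dvd_iff (p := (p : ℕ)), ← hx']
    exact dvd_mul_right _ _
  have hd' : (p : ℕ) ^ 2 ∣ n := by exact_mod_cast hd
  obtain ⟨k, rfl⟩ := hd'
  have hp2 : 2 ≤ (p : ℕ) := p.2.two_le
  have hk : 0 < k := by
    rcases Nat.eq_zero_or_pos k with h | h
    · subst h; simp at hn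
    · exact h
  have hlt : k < (p : ℕ) ^ 2 * k := by
    have h4 : 2 ^ 2 ≤ (p : ℕ) ^ 2 := Nat.pow_le_pow_left hp2 2
    have := Nat.mul_le_mul_right k h4
    omega
  obtain ⟨m, c, hm, hmc, H⟩ := ih k hlt hk (by
    intro q hq
    have : Fact q.Prime := ⟨hq⟩
    by_cases hqp : q = p
    · subst hqp
      refine ⟨y, ?_⟩
      have hne : (((p : ℕ) : ℤ_[(p : ℕ)])) ^ 2 ≠ 0 := pow_ne_zero _ padic_prime.ne_zero
      apply mul_left_cancel₀ hne
      rw [hx']; push_cast; ring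
    · obtain ⟨z, hz⟩ := hloc q hq
      have hz' : quadVal (padicMat q A) z = ((((p : ℕ) ^ 2 * k : ℕ) : ℤ) : ℤ_[q]) := hz
      have hu : IsUnit (((p : ℕ) : ℤ) : ℤ_[q]) := int_unit (not_dvd_of_primes hq p.2 hqp)
      obtain ⟨w, hw⟩ := hu.exists_left_inv
      refine ⟨w • z, ?_⟩
      rw [quadVal_smul, hz']
      push_cast at hw ⊢
      linear_combination (k : ℤ_[q]) * (w * ((p : ℕ) : ℤ_[q]) + 1) * hw)
  exact ⟨m, c * p, hm, by rw [hmc]; ring, H⟩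

lemma isoM_iff_hil {p : ℕ} [Fact p.Prime] {A : TernMat} (hA : IsLat A) :
    IsoM (padicMat p A) ↔ hil p (-(A 0 0 * A 1 1 - A 0 1 ^ 2)) (-(A 0 0 * A.det)) = 1 := by
  have h0 := hA.pos00
  have h1 := hA.posMinor
  have h2 := hA.posDet
  have hmin : A 0 0 * A 1 1 - A 0 1 ^ 2 ≠ 0 := by nlinarith
  rw [hil_eq_one_iff (neg_ne_zero.2 hmin) (neg_ne_zero.2 (mul_ne_zero h0.ne' h2.ne')),
    isoM_iff_HS (padicMat_symm hA.1)]
  · rw [padicMat_det]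
    simp [padicMat]
  · simp only [padicMat, Matrix.map_apply]; exact_mod_cast h0.ne'
  · simp only [padicMat, Matrix.map_apply]; exact_mod_cast hmin
  · rw [padicMat_det]; exact_mod_cast h2.ne'

lemma hil_transfer {A : TernMat} (hA : IsLat A) {g m : ℤ} (hg : 0 < g) (hm : 0 < m) {q : ℕ}
    (hqS : ¬ (q : ℤ) ∣ 2 * m * A.det) (hq : q.Prime)
    (h1 : ∀ p : Nat.Primes, ((p : ℕ) : ℤ) ∣ 2 * m * A.det →
      (hil p (-g) (-(m * A.det)) = 1 ↔ IsoM (padicMat p A)))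
    (h2 : ∀ p : ℕ, p.Prime → p ≠ q → ¬ (p : ℤ) ∣ 2 * m * A.det → ¬ (p : ℤ) ∣ g) :
    hil q (-g) (-(m * A.det)) = 1 := by
  have hA0 := hA.pos00
  have hA1 := hA.posMinor
  have hA2 := hA.posDet
  obtain ⟨g', hg'⟩ : ∃ g', g' = A 0 0 * A 1 1 - A 0 1 ^ 2 := ⟨_, rfl⟩
  have hgA : 0 < g' := by rw [hg']; nlinarith
  have P1 := hilbert_product (a := -g) (b := -(m * A.det)) (neg_ne_zero.2 hg.ne')
    (neg_ne_zero.2 (mul_pos hm hA2).ne')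
  have P2 := hilbert_product (a := -g') (b := -(A 0 0 * A.det)) (neg_ne_zero.2 hgA.ne')
    (neg_ne_zero.2 (mul_pos hA0 hA2).ne')
  have S1 := hil_support (a := -g) (b := -(m * A.det)) (neg_ne_zero.2 hg.ne')
    (neg_ne_zero.2 (mul_pos hm hA2).ne')
  have S2 := hil_support (a := -g') (b := -(A 0 0 * A.det)) (neg_ne_zero.2 hgA.ne')
    (neg_ne_zero.2 (mul_pos hA0 hA2).ne')
  have hgood : ∀ p : ℕ, p.Prime → ¬ (p : ℤ) ∣ 2 * m * A.det →
      hil p (-g') (-(A 0 0 * A.det)) = 1 := by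
    intro p hp hpd
    have : Fact p.Prime := ⟨hp⟩
    rw [hg', ← isoM_iff_hil hA]
    apply isoM_of_unimodular
    · rintro rfl; exact hpd ⟨m * A.det, by push_cast; ring⟩
    · exact padicMat_symm hA.1
    · rw [padicMat_det]; exact int_unit (fun h => hpd (Dvd.dvd.mul_left h _))
  have heq : (fun p => hil p (-g) (-(m * A.det))) =
      fun p => hil p (-g') (-(A 0 0 * A.det)) *
        Pi.mulSingle (M := fun _ => ℤ) q (hil q (-g) (-(m * A.det))) p := by
    funext p
    by_cases hpq : p = q
    · subst hpq
      rw [hgood p hq hqS, Pi.mulSingle_eq_same, one_mul]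
    · rw [Pi.mulSingle_eq_of_ne hpq, mul_one]
      by_cases hp : p.Prime
      · by_cases hpd : (p : ℤ) ∣ 2 * m * A.det
        · have : Fact p.Prime := ⟨hp⟩
          have k1 := h1 ⟨p, hp⟩ hpd
          have k2 := isoM_iff_hil (p := p) hA
          rw [← hg'] at k2
          have k3 : hil p (-g) (-(m * A.det)) = 1 ↔ hil p (-g') (-(A 0 0 * A.det)) = 1 := k1.trans k2
          rcases hil_pm p (a := -g) (b := -(m * A.det)) (neg_ne_zero.2 hg.ne')
            (neg_ne_zero.2 (mul_pos hm hA2).ne') with e1 | e1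
          · rw [e1, k3.1 e1]
          · rcases hil_pm p (a := -g') (b := -(A 0 0 * A.det)) (neg_ne_zero.2 hgA.ne')
              (neg_ne_zero.2 (mul_pos hA0 hA2).ne') with e2 | e2
            · rw [k3.2 e2, e2]
            · rw [e1, e2]
        · rw [hgood p hp hpd]
          apply hil_unit
          · rintro rfl; exact hpd ⟨m * A.det, by push_cast; ring⟩
          · rw [dvd_neg]; exact h2 p hp hpq hpd
          · rw [dvd_neg, ← Int.dvd_natAbs]
            intro h
            rw [Int.dvd_natAbs] at h
            apply hpd
            rw [mul_assoc]; exact Dvd.dvd.mul_left h _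
      · rw [hil_not_prime hp, hil_not_prime hp]
  unfold hilProd hilInf at P1 P2
  rw [if_pos ⟨by linarith, by nlinarith [mul_pos hm hA2]⟩] at P1
  rw [if_pos ⟨by linarith, by nlinarith [mul_pos hA0 hA2]⟩] at P2
  rw [heq, finprod_mul_distrib S2 (by
    refine (Set.finite_singleton q).subset ?_
    intro x hx
    by_contra hne
    exact hx (Pi.mulSingle_eq_of_ne hne _))] at P1
  rw [show (∏ᶠ i, Pi.mulSingle (M := fun _ => ℤ) q (hil q (-g) (-(m * A.det))) i) =
    hil q (-g) (-(m * A.det)) from finprod_eq_single _ q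
      (fun x hx => Pi.mulSingle_eq_of_ne hx _) |>.trans (Pi.mulSingle_eq_same _ _)] at P1
  rw [← mul_assoc, P2, one_mul] at P1
  exact P1

section
variable {p : ℕ} [Fact p.Prime]

lemma local_close {M : Matrix (Fin 3) (Fin 3) ℤ_[p]} (hM : M.IsSymm)
    {m d g b1 b2 c11 c12 : ℤ_[p]} (hm : M 0 0 = m) (hd : M.det = d)
    (hg : M 0 0 * M 1 1 - M 0 1 ^ 2 = g)
    {δ : ℤ_[p]} (hδ : δ = 32 * (p : ℤ_[p]) ^ 6 * d * m * g ^ 2)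
    (h1 : δ ∣ b1 - M 0 1) (h2 : δ ∣ b2 - M 0 2) (h11 : δ ∣ c11 - M 1 1) (h12 : δ ∣ c12 - M 1 2) :
    (∃ t : ℤ_[p], IsUnit t ∧ m * c11 - b1 ^ 2 = t ^ 2 * g) ∧
    ∃ G C r : ℤ_[p], (m * c11 - b1 ^ 2) * G = m * d + (m * c12 - b1 * b2) ^ 2 ∧
      G + b2 ^ 2 = m * C ∧ C = M 2 2 + (4 * (p : ℤ_[p]) ^ 5 * d) * r := by
  obtain ⟨β1, e1⟩ := h1
  obtain ⟨β2, e2⟩ := h2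
  obtain ⟨γ11, e11⟩ := h11
  obtain ⟨γ12, e12⟩ := h12
  obtain rfl : b1 = M 0 1 + δ * β1 := by linear_combination e1
  obtain rfl : b2 = M 0 2 + δ * β2 := by linear_combination e2
  obtain rfl : c11 = M 1 1 + δ * γ11 := by linear_combination e11
  obtain rfl : c12 = M 1 2 + δ * γ12 := by linear_combination e12
  obtain ⟨r1, hr1⟩ : ∃ r1, r1 = m * γ11 - 2 * M 0 1 * β1 - δ * β1 ^ 2 := ⟨_, rfl⟩
  obtain ⟨k, hk⟩ : ∃ k, k = m * M 2 2 - M 0 2 ^ 2 := ⟨_, rfl⟩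
  obtain ⟨h, hh⟩ : ∃ h, h = m * M 1 2 - M 0 1 * M 0 2 := ⟨_, rfl⟩
  obtain ⟨r2, hr2⟩ : ∃ r2, r2 = m * γ12 - M 0 1 * β2 - M 0 2 * β1 - δ * β1 * β2 := ⟨_, rfl⟩
  have hgk : m * d + h ^ 2 = g * k := by
    rw [← hd, det_symm hM, hh, hk, ← hg, ← hm]; ring
  have E1 : m * (M 1 1 + δ * γ11) - (M 0 1 + δ * β1) ^ 2 = g + δ * r1 := by
    rw [← hg, hr1, hm]; ring
  have E2 : m * (M 1 2 + δ * γ12) - (M 0 1 + δ * β1) * (M 0 2 + δ * β2) = h + δ * r2 := by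
    rw [hh, hr2]; ring
  obtain ⟨t, ht, htu⟩ := sq_near_one (8 * (p : ℤ_[p]) ^ 5 * d * m * g * r1)
  have E1' : g + δ * r1 = t ^ 2 * g := by rw [ht, hδ]; ring
  obtain ⟨u, hu⟩ := htu.exists_right_inv
  obtain ⟨r3, hr3⟩ : ∃ r3, r3 = 2 * h * r2 + δ * r2 ^ 2 := ⟨_, rfl⟩
  have hu2 : t ^ 2 * u ^ 2 = 1 := by rw [← mul_pow, hu, one_pow]
  rw [E1, E2]
  refine ⟨⟨t, htu, E1'⟩, u ^ 2 * (k + 32 * (p : ℤ_[p]) ^ 6 * d * m * g * r3),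
    M 2 2 + 32 * (p : ℤ_[p]) ^ 6 * d * (g * (u ^ 2 * r3 - u ^ 2 * r1 * k) + g ^ 2 * (2 * M 0 2 * β2 + δ * β2 ^ 2)),
    8 * p * (g * (u ^ 2 * r3 - u ^ 2 * r1 * k) + g ^ 2 * (2 * M 0 2 * β2 + δ * β2 ^ 2)), ?_, ?_, by ring⟩
  · rw [E1']
    have : m * d + (h + δ * r2) ^ 2 = g * k + δ * r3 := by rw [← hgk, hr3]; ring
    rw [this, hδ]
    linear_combination (g * k + 32 * (p : ℤ_[p]) ^ 6 * d * m * g ^ 2 * r3) * hu2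
  · have hu3 : u ^ 2 = 1 - u ^ 2 * (32 * (p : ℤ_[p]) ^ 6 * d * m * g * r1) := by
      have : u ^ 2 * t ^ 2 = 1 := by rw [mul_comm]; exact hu2
      rw [ht] at this
      linear_combination this
    have hδ' := hδ
    have : u ^ 2 * k = k - u ^ 2 * (32 * (p : ℤ_[p]) ^ 6 * d * m * g * r1) * k := by
      linear_combination k * hu3
    calc _ = u ^ 2 * k + u ^ 2 * (32 * (p : ℤ_[p]) ^ 6 * d * m * g * r3) + (M 0 2 + δ * β2) ^ 2 := by ring
      _ = k + M 0 2 ^ 2 + 32 * (p : ℤ_[p]) ^ 6 * d * m * (g * (u ^ 2 * r3 - u ^ 2 * r1 * k)) +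
          δ * (2 * M 0 2 * β2 + δ * β2 ^ 2) := by rw [this]; ring
      _ = _ := by
        nth_rewrite 1 [hδ]
        rw [hk]; ring

end

lemma finite_primes_dvd {N : ℤ} (hN : N ≠ 0) : {p : Nat.Primes | ((p : ℕ) : ℤ) ∣ N}.Finite := by
  have : Set.Finite ((fun p : Nat.Primes => (p : ℕ)) '' {p : Nat.Primes | ((p : ℕ) : ℤ) ∣ N}) := by
    refine (N.natAbs.primeFactors.finite_toSet).subset ?_
    rintro x ⟨p, hp, rfl⟩
    simp only [Finset.mem_coe, Nat.mem_primeFactors]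
    exact ⟨p.2, Int.natCast_dvd.1 hp, by simpa using hN⟩
  exact this.of_finite_image (fun a _ b _ h => Subtype.ext h)

theorem exists_genus_rep {A : TernMat} (hA : IsLat A) {n : ℕ} (hn : 0 < n)
    (hloc : LocallyRepresented n A) :
    ∃ B, InGenus A B ∧ ∃ x : Fin 3 → ℤ, quadVal B x = n := by
  obtain ⟨m, c, hm, hmc, Hy⟩ := exists_min_rep hn hloc
  have hdpos := hA.posDet
  have hmZ : (0 : ℤ) < m := by exact_mod_cast hm
  have hex : ∀ p : Nat.Primes, ∃ M : Matrix (Fin 3) (Fin 3) ℤ_[(p : ℕ)], M.IsSymm ∧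
      PadicIsomP p (padicMat p A) M ∧ M.det = A.det ∧ M 0 0 = ((m : ℤ) : ℤ_[(p : ℕ)]) ∧
      M 0 0 * M 1 1 - M 0 1 ^ 2 ≠ 0 := by
    intro p
    obtain ⟨y, hy, hu⟩ := Hy p
    exact exists_local_mat hA hmZ.ne' hu hy
  choose M hMs hMi hMd hM0 hMg using hex
  obtain ⟨g, hg⟩ : ∃ g : ∀ p : Nat.Primes, ℤ_[(p : ℕ)],
    ∀ p, M p 0 0 * M p 1 1 - M p 0 1 ^ 2 = g p := ⟨_, fun p => rfl⟩
  obtain ⟨δ, hδ⟩ : ∃ δ : ∀ p : Nat.Primes, ℤ_[(p : ℕ)],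
    ∀ p, δ p = 32 * ((p : ℕ) : ℤ_[(p : ℕ)]) ^ 6 * A.det * ((m : ℤ) : ℤ_[(p : ℕ)]) * (g p) ^ 2 :=
      ⟨_, fun p => rfl⟩
  have hδ0 : ∀ p, δ p ≠ 0 := by
    intro p
    rw [hδ]
    have e1 : (A.det : ℤ_[(p : ℕ)]) ≠ 0 := by exact_mod_cast hdpos.ne'
    have e2 : ((m : ℤ) : ℤ_[(p : ℕ)]) ≠ 0 := by exact_mod_cast hmZ.ne'
    have e3 : g p ≠ 0 := by rw [← hg]; exact hMg p
    have e4 : ((p : ℕ) : ℤ_[(p : ℕ)]) ≠ 0 := padic_prime.ne_zero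
    have e5 : (32 : ℤ_[(p : ℕ)]) ≠ 0 := by norm_num
    exact mul_ne_zero (mul_ne_zero (mul_ne_zero (mul_ne_zero e5 (pow_ne_zero _ e4)) e1) e2)
      (pow_ne_zero _ e3)
  choose Kp hKp using fun p => dvd_pow_of_ne_zero (hδ0 p)
  have hN : 2 * (m : ℤ) * A.det ≠ 0 := by positivity
  obtain ⟨S, hS⟩ : ∃ S : Finset Nat.Primes, ∀ p, p ∈ S ↔ ((p : ℕ) : ℤ) ∣ 2 * (m : ℤ) * A.det :=
    ⟨(finite_primes_dvd hN).toFinset, fun p => by rw [Set.Finite.mem_toFinset]; rfl⟩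
  obtain ⟨K, hK⟩ : ∃ K : ℕ, ∀ p ∈ S, δ p ∣ ((p : ℕ) : ℤ_[(p : ℕ)]) ^ K :=
    ⟨S.sup Kp, fun p hp => hKp p _ (Finset.le_sup (f := Kp) hp)⟩
  obtain ⟨b1, hb1⟩ := exists_approx S K (fun p => M p 0 1)
  obtain ⟨b2, hb2⟩ := exists_approx S K (fun p => M p 0 2)
  obtain ⟨c110, hc110⟩ := exists_approx S K (fun p => M p 1 1)
  obtain ⟨c120, hc120⟩ := exists_approx S K (fun p => M p 1 2)
  obtain ⟨P, hP⟩ : ∃ P : ℕ, P = ∏ p ∈ S, (p : ℕ) ^ K := ⟨_, rfl⟩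
  have hPpos : 0 < P := by
    rw [hP]; exact Finset.prod_pos (fun p _ => pow_pos p.2.pos _)
  have hPdvd : ∀ p ∈ S, δ p ∣ (P : ℤ_[(p : ℕ)]) := by
    intro p hp
    refine (hK p hp).trans ?_
    have : (p : ℕ) ^ K ∣ P := by rw [hP]; exact Finset.dvd_prod_of_mem (fun p : Nat.Primes => (p : ℕ) ^ K) hp
    have := Nat.cast_dvd_cast (α := ℤ_[(p : ℕ)]) this
    simpa using this
  have hPprime : ∀ r : ℕ, r.Prime → r ∣ P → (r : ℤ) ∣ 2 * (m : ℤ) * A.det := by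
    intro r hr hrP
    rw [hP] at hrP
    obtain ⟨p, hp, hrp⟩ := (Nat.Prime.prime hr).exists_mem_finset_dvd hrP
    have := (Nat.prime_dvd_prime_iff_eq hr p.2).1 (hr.dvd_of_dvd_pow hrp)
    rw [this]
    exact (hS p).1 hp
  -- the auxiliary prime
  obtain ⟨g0, hg0⟩ : ∃ g0 : ℤ, g0 = m * c110 - b1 ^ 2 := ⟨_, rfl⟩
  obtain ⟨e, he⟩ : ∃ e : ℕ, e = Int.gcd g0 ((m * P : ℕ) : ℤ) := ⟨_, rfl⟩
  have hmP : 0 < m * P := Nat.mul_pos hm hPpos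
  have hepos : 0 < e := by
    rw [he]; exact Int.gcd_pos_of_ne_zero_right _ (by exact_mod_cast hmP.ne')
  have he1 : (e : ℤ) ∣ g0 := by rw [he]; exact Int.gcd_dvd_left _ _
  have he2' : (e : ℤ) ∣ ((m * P : ℕ) : ℤ) := by rw [he]; exact Int.gcd_dvd_right _ _
  have he2 : e ∣ m * P := by exact_mod_cast he2'
  obtain ⟨a, ha⟩ := he1
  obtain ⟨N, hNN⟩ := he2
  have hNpos : N ≠ 0 := by rintro rfl; omega
  have hcop : IsCoprime a (N : ℤ) := by
    rw [Int.isCoprime_iff_gcd_eq_one]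
    have h1 : Int.gcd ((e : ℤ) * a) ((e : ℤ) * (N : ℤ)) = e := by
      rw [← ha, ← Nat.cast_mul, ← hNN]; exact he.symm
    rw [Int.gcd_mul_left, Int.natAbs_natCast] at h1
    exact Nat.eq_of_mul_eq_mul_left hepos (by rw [h1, mul_one])
  obtain ⟨q, hqgt, hqp, hqa⟩ := Nat.forall_exists_prime_gt_and_zmodEq
    (m * P + 2 * m * A.det.natAbs) hNpos hcop
  have : Fact q.Prime := ⟨hqp⟩
  obtain ⟨t, ht⟩ := hqa.symm.dvd
  obtain ⟨c11, hc11⟩ : ∃ c11 : ℤ, c11 = c110 + P * t := ⟨_, rfl⟩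
  have hNN' : (m : ℤ) * P = e * N := by exact_mod_cast hNN
  have hg11 : (m : ℤ) * c11 - b1 ^ 2 = e * q := by
    rw [hc11]
    linear_combination (-1 : ℤ) * hg0 + ha + t * hNN' - (e : ℤ) * ht
  have hqS : ¬ (q : ℤ) ∣ 2 * (m : ℤ) * A.det := by
    intro h
    have h1 : q ∣ (2 * (m : ℤ) * A.det).natAbs := Int.natCast_dvd.1 h
    have h2 := Nat.le_of_dvd (Int.natAbs_pos.2 hN) h1
    rw [Int.natAbs_mul, Int.natAbs_mul, Int.natAbs_natCast] at h2
    simp at h2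
    omega
  have hqe : ¬ q ∣ e := by
    intro h
    have h1 := Nat.le_of_dvd hepos h
    have h2 := Nat.le_of_dvd hmP (Dvd.intro _ hNN.symm)
    omega
  have hqmP : ¬ q ∣ m * P := fun h => by
    have := Nat.le_of_dvd hmP h; omega
  have hePrime : ∀ r : ℕ, r.Prime → r ∣ e → (r : ℤ) ∣ 2 * (m : ℤ) * A.det := by
    intro r hr hre
    have : r ∣ m * P := hre.trans (Dvd.intro _ hNN.symm)
    rcases (Nat.Prime.dvd_mul hr).1 this with h | h
    · have : (r : ℤ) ∣ (m : ℤ) := by exact_mod_cast h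
      exact Dvd.dvd.mul_right (Dvd.dvd.mul_left this _) _
    · exact hPprime r hr h
  have hdb1 : ∀ p ∈ S, δ p ∣ (b1 : ℤ_[(p : ℕ)]) - M p 0 1 := fun p hp => (hK p hp).trans (hb1 p hp)
  have hdb2 : ∀ p ∈ S, δ p ∣ (b2 : ℤ_[(p : ℕ)]) - M p 0 2 := fun p hp => (hK p hp).trans (hb2 p hp)
  have shift : ∀ (c0 t : ℤ) (p : Nat.Primes) (hp : p ∈ S) (x : ℤ_[(p : ℕ)]),
      ((p : ℕ) : ℤ_[(p : ℕ)]) ^ K ∣ (c0 : ℤ_[(p : ℕ)]) - x → δ p ∣ ((c0 + P * t : ℤ) : ℤ_[(p : ℕ)]) - x := by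
    intro c0 t p hp x hx
    have h1 := (hK p hp).trans hx
    have h2 := (hPdvd p hp).mul_right (t : ℤ_[(p : ℕ)])
    have := dvd_add h1 h2
    convert this using 1
    push_cast; ring
  have hdc11 : ∀ p ∈ S, δ p ∣ (c11 : ℤ_[(p : ℕ)]) - M p 1 1 := by
    intro p hp; rw [hc11]; exact shift _ _ p hp _ (hc110 p hp)
  have hqpos : 0 < q := hqp.pos
  have hepos' : (0 : ℤ) < e := by exact_mod_cast hepos
  have hqpos' : (0 : ℤ) < q := by exact_mod_cast hqpos
  have hgpos : (0 : ℤ) < e * q := mul_pos hepos' hqpos'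
  have hmd : 0 < (m : ℤ) * A.det := mul_pos hmZ hdpos
  -- Hilbert symbol at q
  have hhil : hil q (-((e : ℤ) * q)) (-((m : ℤ) * A.det)) = 1 := by
    apply hil_transfer hA hgpos hmZ hqS hqp
    · intro p hp
      have hpS := (hS p).2 hp
      obtain ⟨⟨s, hsu, hs⟩, -⟩ := local_close (hMs p) (hM0 p) (hMd p) (hg p) (hδ p) (hdb1 p hpS)
        (hdb2 p hpS) (hdc11 p hpS) ((hK p hpS).trans (hc120 p hpS))
      rw [hil_eq_one_iff (neg_ne_zero.2 hgpos.ne') (neg_ne_zero.2 hmd.ne'), ← hg11]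
      have e1 : ((-((m : ℤ) * c11 - b1 ^ 2) : ℤ) : ℤ_[(p : ℕ)]) = s ^ 2 * (-(g p)) := by
        push_cast
        push_cast at hs
        linear_combination -hs
      rw [e1, HS_mul_sq hsu.ne_zero]
      have e2 : IsoM (padicMat p A) ↔ IsoM (M p) :=
        ⟨fun h => h.congr (hMi p), fun h => h.congr (hMi p).symm⟩
      rw [e2, isoM_iff_HS (hMs p) (by rw [hM0]; exact_mod_cast hmZ.ne') (hMg p)
        (by rw [hMd]; exact_mod_cast hdpos.ne'), hg, hM0, hMd]
      push_cast
      rfl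
    · intro r hr hrq hrS hre
      rcases (Nat.prime_iff_prime_int.1 hr).dvd_or_dvd hre with h | h
      · exact hrS (hePrime r hr (by exact_mod_cast h))
      · exact hrq ((Nat.prime_dvd_prime_iff_eq hr hqp).1 (by exact_mod_cast h))
  have hqmd : ¬ (q : ℤ) ∣ -((m : ℤ) * A.det) := by
    rw [dvd_neg]; intro h
    apply hqS; rw [mul_assoc]; exact Dvd.dvd.mul_left h _
  obtain ⟨s, hs⟩ : ∃ s : ℤ, (q : ℤ) ∣ m * A.det + s ^ 2 := by
    rw [hil_eq_one_iff (neg_ne_zero.2 hgpos.ne') (neg_ne_zero.2 hmd.ne')] at hhil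
    have e1 : ((-((e : ℤ) * q) : ℤ) : ℤ_[q]) = (q : ℤ_[q]) * ((-(e : ℤ) : ℤ) : ℤ_[q]) := by
      push_cast; ring
    rw [e1] at hhil
    obtain ⟨y, z, hy, x, h⟩ := HS_p_unit (int_unit (by rw [dvd_neg]; exact_mod_cast hqe))
      (int_unit hqmd) hhil
    obtain ⟨w, hw⟩ := hy.exists_right_inv
    generalize A.det = D at h ⊢
    refine ⟨(z * w).appr 1, ?_⟩
    have h1 := PadicInt.appr_spec 1 (z * w)
    rw [Ideal.mem_span_singleton, pow_one] at h1
    rw [← padic_intCast_dvd_iff' (p := q)]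
    obtain ⟨r, hr⟩ := h1
    have h2 : (((z * w).appr 1 : ℕ) : ℤ_[q]) = z * w - q * r := by linear_combination -hr
    push_cast
    rw [h2]
    refine ⟨-(e : ℤ_[q]) * x ^ 2 * w ^ 2 - 2 * z * w * r + q * r ^ 2, ?_⟩
    push_cast at h
    linear_combination w ^ 2 * h - (m : ℤ_[q]) * D * (y * w + 1) * hw
  -- choose c12
  obtain ⟨t', ht'⟩ : ∃ t' : ℤ, (q : ℤ) ∣ m * (c120 + P * t') - b1 * b2 - s := by
    have hc : IsCoprime ((m * P : ℕ) : ℤ) (q : ℤ) := by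
      rw [Nat.isCoprime_iff_coprime]
      exact Nat.Coprime.symm ((Nat.Prime.coprime_iff_not_dvd hqp).2 hqmP)
    obtain ⟨u, v, huv⟩ := hc
    push_cast at huv
    refine ⟨u * (s - m * c120 + b1 * b2), -v * (s - m * c120 + b1 * b2), ?_⟩
    linear_combination (s - m * c120 + b1 * b2) * huv
  obtain ⟨c12, hc12⟩ : ∃ c12 : ℤ, c12 = c120 + P * t' := ⟨_, rfl⟩
  rw [← hc12] at ht'
  have hdc12 : ∀ p ∈ S, δ p ∣ (c12 : ℤ_[(p : ℕ)]) - M p 1 2 := by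
    intro p hp; rw [hc12]; exact shift _ _ p hp _ (hc120 p hp)
  have LC := fun p (hp : p ∈ S) => (local_close (hMs p) (hM0 p) (hMd p) (hg p) (hδ p) (hdb1 p hp)
        (hdb2 p hp) (hdc11 p hp) (hdc12 p hp)).2
  choose! G C r hG hC hr using LC
  have hqmd2 : (q : ℤ) ∣ m * A.det + (m * c12 - b1 * b2) ^ 2 := by
    have e1 : (m : ℤ) * A.det + (m * c12 - b1 * b2) ^ 2 = (m * A.det + s ^ 2) +
      (m * c12 - b1 * b2 - s) * (m * c12 - b1 * b2 + s) := by ring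
    rw [e1]
    exact dvd_add hs (Dvd.dvd.mul_right ht' _)
  have hdv1 : (m * c11 - b1 ^ 2 : ℤ) ∣ m * A.det + (m * c12 - b1 * b2) ^ 2 := by
    apply int_dvd_of_padic
    intro p
    by_cases hp : p ∈ S
    · refine ⟨G p, ?_⟩
      push_cast
      have := hG p hp
      push_cast at this
      exact this.symm
    · have hpe : IsUnit (e : ℤ_[(p : ℕ)]) := by
        have := int_unit (p := (p : ℕ)) (v := (e : ℤ)) (by
          intro h
          exact hp ((hS p).2 (hePrime p p.2 (by exact_mod_cast h))))
        simpa using this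
      rw [hg11]
      by_cases hpq : (p : ℕ) = q
      · subst hpq
        push_cast
        rw [hpe.mul_left_dvd]
        have := (padic_intCast_dvd_iff' (p := (p : ℕ)) _).2 hqmd2
        push_cast at this
        exact this
      · have := int_unit (p := (p : ℕ)) (v := (q : ℤ)) (not_dvd_of_primes p.2 hqp hpq)
        push_cast
        rw [hpe.mul_left_dvd]
        push_cast at this
        exact this.dvd
  obtain ⟨G22, hG22⟩ := hdv1
  have hGG : ∀ p ∈ S, (G22 : ℤ_[(p : ℕ)]) = G p := by
    intro p hp
    have h1 := hG p hp
    have h2 := congrArg (Int.cast : ℤ → ℤ_[(p : ℕ)]) hG22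
    have hne : ((m * c11 - b1 ^ 2 : ℤ) : ℤ_[(p : ℕ)]) ≠ 0 := by
      rw [hg11]; exact_mod_cast hgpos.ne'
    apply mul_left_cancel₀ hne
    push_cast at h1 h2 ⊢
    rw [h1, h2]
  have hdv2 : (m : ℤ) ∣ G22 + b2 ^ 2 := by
    apply int_dvd_of_padic
    intro p
    by_cases hp : p ∈ S
    · refine ⟨C p, ?_⟩
      rw [← hC p hp, ← hGG p hp]
      push_cast; ring
    · exact (int_unit (p := (p : ℕ)) (v := (m : ℤ)) (fun h => hp ((hS p).2
        (Dvd.dvd.mul_right (Dvd.dvd.mul_left h _) _)))).dvd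
  obtain ⟨c22, hc22⟩ := hdv2
  have hCC : ∀ p ∈ S, (c22 : ℤ_[(p : ℕ)]) = C p := by
    intro p hp
    have h2 := congrArg (Int.cast : ℤ → ℤ_[(p : ℕ)]) hc22
    have hne : ((m : ℤ) : ℤ_[(p : ℕ)]) ≠ 0 := by exact_mod_cast hmZ.ne'
    apply mul_left_cancel₀ hne
    rw [← hC p hp, ← hGG p hp]
    push_cast at h2 ⊢
    rw [h2]
  obtain ⟨B, hB⟩ : ∃ B : TernMat, B = !![(m : ℤ), b1, b2; b1, c11, c12; b2, c12, c22] := ⟨_, rfl⟩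
  have hBs : B.IsSymm := by
    rw [hB]; ext i j; fin_cases i <;> fin_cases j <;> rfl
  have hB00 : B 0 0 = m := by rw [hB]; rfl
  have hB01 : B 0 1 = b1 := by rw [hB]; rfl
  have hB02 : B 0 2 = b2 := by rw [hB]; rfl
  have hB11 : B 1 1 = c11 := by rw [hB]; rfl
  have hB12 : B 1 2 = c12 := by rw [hB]; rfl
  have hB22 : B 2 2 = c22 := by rw [hB]; rfl
  have hBd : B.det = A.det := by
    apply mul_left_cancel₀ hmZ.ne'
    rw [det_symm hBs, hB00, hB01, hB02, hB11, hB12, hB22]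
    linear_combination -hG22 - (m * c11 - b1 ^ 2) * hc22
  have hBL : IsLat B := by
    apply isLat_of_pos hBs
    · rw [hB00]; exact hmZ
    · rw [hB00, hB11, hB01, hg11]; exact hgpos
    · rw [hBd]; exact hdpos
  refine ⟨B, ⟨hBL, fun p hp => ?_⟩, fun i => if i = 0 then (c : ℤ) else 0, ?_⟩
  · obtain ⟨pp, hpp⟩ : ∃ pp : Nat.Primes, (pp : ℕ) = p := ⟨⟨p, hp⟩, rfl⟩
    subst hpp
    by_cases hpS : pp ∈ S
    · show PadicIsomP _ (padicMat (pp : ℕ) A) (padicMat (pp : ℕ) B)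
      refine (hMi pp).trans ?_
      -- closeness
      obtain ⟨η, hη⟩ : ∃ η : ℤ_[(pp : ℕ)], δ pp = (4 * ((pp : ℕ) : ℤ_[(pp : ℕ)]) ^ 5 * (M pp).det) * η :=
        ⟨8 * ((pp : ℕ) : ℤ_[(pp : ℕ)]) * ((m : ℤ) : ℤ_[(pp : ℕ)]) * g pp ^ 2, by
          rw [hδ, hMd]; ring⟩
      obtain ⟨x01, h01⟩ := hdb1 pp hpS
      obtain ⟨x02, h02⟩ := hdb2 pp hpS
      obtain ⟨x11, h11⟩ := hdc11 pp hpS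
      obtain ⟨x12, h12⟩ := hdc12 pp hpS
      have h22 := hr pp hpS
      rw [← hCC pp hpS, ← hMd] at h22
      rw [hη] at h01 h02 h11 h12
      apply isom_of_close (hMs pp)
        (G := !![0, η * x01, η * x02; η * x01, η * x11, η * x12; η * x02, η * x12, r pp])
      · ext i j; fin_cases i <;> fin_cases j <;> rfl
      · have s10 := (hMs pp).apply 0 1
        have s20 := (hMs pp).apply 0 2
        have s21 := (hMs pp).apply 1 2
        have s0 := hM0 pp
        generalize 4 * ((pp : ℕ) : ℤ_[(pp : ℕ)]) ^ 5 * (M pp).det = X at *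
        rw [hB]
        ext i j
        fin_cases i <;> fin_cases j <;>
          simp only [padicMat, Matrix.map_apply, Matrix.add_apply, Matrix.smul_apply, smul_eq_mul,
            Matrix.of_apply, Matrix.cons_val, Fin.zero_eta, Fin.mk_one, Fin.reduceFinMk] <;>
          first
          | linear_combination -s0
          | linear_combination h01
          | linear_combination h02
          | linear_combination h11
          | linear_combination h12
          | linear_combination h22
          | linear_combination h01 - s10
          | linear_combination h02 - s20
          | linear_combination h12 - s21
    · have hnd : ¬ ((pp : ℕ) : ℤ) ∣ 2 * (m : ℤ) * A.det := fun h => hpS ((hS pp).2 h)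
      apply padicLatIsom_of_unimodular hA.1 hBs hBd.symm
      · intro h2; rw [h2] at hnd; exact hnd ⟨m * A.det, by push_cast; ring⟩
      · intro h; exact hnd (Dvd.dvd.mul_left h _)
  · rw [quadVal_three]
    simp [hB00, hmc]
    ring

/-- Counting a free right `G`-set through a transversal. -/
lemma transversal_count {k G Ω ι R : Type} [Field k] [CharZero k] [Group G] [Fintype R] [Fintype ι]
    (act : Ω → G → Ω) (act_mul : ∀ x g h, act x (g * h) = act (act x g) h)
    (act_one : ∀ x, act x 1 = x) (ω : ι → Ω) (φ : R → Ω)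
    (hfin : ∀ i, Finite {g : G // act (ω i) g = ω i})
    (hex : ∀ r, ∃ i, ∃ g, act (φ r) g = ω i)
    (huniq : ∀ i j, (∃ g, act (ω i) g = ω j) → i = j) :
    ∑ i, (Nat.card {x : R × G // act (φ x.1) x.2 = ω i} : k) /
      (Nat.card {g : G // act (ω i) g = ω i} : k) = (Fintype.card R : k) := by
  choose idx gg hgg using hex
  have hinv : ∀ x y g, act x g = y → act y g⁻¹ = x := by
    intro x y g h; rw [← h, ← act_mul, mul_inv_cancel, act_one]
  have fib : ∀ r, Nonempty ({g : G // act (φ r) g = ω (idx r)} ≃ {g : G // act (ω (idx r)) g = ω (idx r)}) := by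
    intro r
    refine ⟨⟨fun g => ⟨(gg r)⁻¹ * g.1, ?_⟩, fun g => ⟨gg r * g.1, ?_⟩, ?_, ?_⟩⟩
    · rw [act_mul, hinv _ _ _ (hgg r), g.2]
    · rw [act_mul, hgg, g.2]
    · intro g; ext; simp
    · intro g; ext; simp
  have emp : ∀ r i, i ≠ idx r → IsEmpty {g : G // act (φ r) g = ω i} := by
    intro r i hi
    refine ⟨fun g => hi ?_⟩
    apply (huniq (idx r) i ⟨(gg r)⁻¹ * g.1, ?_⟩).symm
    rw [act_mul, hinv _ _ _ (hgg r), g.2]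
  have ffin : ∀ r i, Finite {g : G // act (φ r) g = ω i} := by
    intro r i
    by_cases hi : i = idx r
    · subst hi
      have := hfin (idx r)
      exact Finite.of_equiv _ (fib r).some.symm
    · have := emp r i hi
      infer_instance
  have cnt : ∀ i, Nat.card {x : R × G // act (φ x.1) x.2 = ω i} =
      ∑ r, if i = idx r then Nat.card {g : G // act (ω i) g = ω i} else 0 := by
    intro i
    have e : {x : R × G // act (φ x.1) x.2 = ω i} ≃ Σ r : R, {g : G // act (φ r) g = ω i} :=
      ⟨fun x => ⟨x.1.1, x.1.2, x.2⟩, fun y => ⟨(y.1, y.2.1), y.2.2⟩, fun _ => rfl, fun _ => rfl⟩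
    rw [Nat.card_congr e, Nat.card_sigma]
    refine Finset.sum_congr rfl fun r _ => ?_
    split_ifs with h
    · subst h; exact Nat.card_congr (fib r).some
    · have := emp r i h
      exact Nat.card_of_isEmpty
  have hpos : ∀ i, (Nat.card {g : G // act (ω i) g = ω i} : k) ≠ 0 := by
    intro i
    have := hfin i
    have : Nonempty {g : G // act (ω i) g = ω i} := ⟨1, act_one _⟩
    exact Nat.cast_ne_zero.2 Nat.card_pos.ne'
  have step : ∀ i, (Nat.card {x : R × G // act (φ x.1) x.2 = ω i} : k) /
      (Nat.card {g : G // act (ω i) g = ω i} : k) = ∑ r, if i = idx r then (1 : k) else 0 := by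
    intro i
    rw [cnt i, div_eq_iff (hpos i), Finset.sum_mul]
    push_cast
    refine Finset.sum_congr rfl fun r _ => ?_
    split_ifs <;> simp
  simp_rw [step]
  rw [Finset.sum_comm]
  simp

abbrev M2 := Matrix (Fin 2) (Fin 2) ℤ
abbrev SL2 := Matrix.SpecialLinearGroup (Fin 2) ℤ

/-- substitution of a `2×2` matrix in a binary form -/
def bact (f : ℤ × ℤ × ℤ) (M : M2) : ℤ × ℤ × ℤ :=
  (f.1 * M 0 0 ^ 2 + f.2.1 * M 0 0 * M 1 0 + f.2.2 * M 1 0 ^ 2,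
   2 * f.1 * M 0 0 * M 0 1 + f.2.1 * (M 0 0 * M 1 1 + M 0 1 * M 1 0) +
        2 * f.2.2 * M 1 0 * M 1 1,
   f.1 * M 0 1 ^ 2 + f.2.1 * M 0 1 * M 1 1 + f.2.2 * M 1 1 ^ 2)

def bdisc (f : ℤ × ℤ × ℤ) : ℤ := f.2.1 ^ 2 - 4 * f.1 * f.2.2

lemma bqfEquiv_iff (f g : ℤ × ℤ × ℤ) : BQFEquiv f g ↔ ∃ M : SL2, bact f M.1 = g := by
  unfold BQFEquiv bact
  constructor
  · rintro ⟨M, h1, h2, h3⟩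
    exact ⟨M, Prod.ext h1.symm (Prod.ext h2.symm h3.symm)⟩
  · rintro ⟨M, rfl⟩
    exact ⟨M, rfl, rfl, rfl⟩

lemma bact_mul (f : ℤ × ℤ × ℤ) (M N : M2) : bact (bact f M) N = bact f (M * N) := by
  unfold bact
  refine Prod.ext ?_ (Prod.ext ?_ ?_) <;> simp [Matrix.mul_apply, Fin.sum_univ_two] <;> ring

lemma bact_one (f : ℤ × ℤ × ℤ) : bact f 1 = f := by
  unfold bact
  refine Prod.ext ?_ (Prod.ext ?_ ?_) <;> simp

lemma bdisc_bact (f : ℤ × ℤ × ℤ) (M : M2) : bdisc (bact f M) = M.det ^ 2 * bdisc f := by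
  unfold bact bdisc
  rw [Matrix.det_fin_two]; simp only; ring

def bsmul (m : ℤ) (f : ℤ × ℤ × ℤ) : ℤ × ℤ × ℤ := (m * f.1, m * f.2.1, m * f.2.2)

lemma bact_bsmul (m : ℤ) (f : ℤ × ℤ × ℤ) (M : M2) : bact (bsmul m f) M = bsmul m (bact f M) := by
  unfold bact bsmul
  refine Prod.ext ?_ (Prod.ext ?_ ?_) <;> simp only <;> ring

lemma bact_scalar (m : ℤ) (f : ℤ × ℤ × ℤ) : bact f (m • (1 : M2)) = bsmul (m ^ 2) f := by
  unfold bact bsmul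
  refine Prod.ext ?_ (Prod.ext ?_ ?_) <;> simp <;> ring

lemma bsmul_inj {m : ℤ} (hm : m ≠ 0) {f g : ℤ × ℤ × ℤ} (h : bsmul m f = bsmul m g) : f = g := by
  unfold bsmul at h
  simp only [Prod.mk.injEq] at h
  exact Prod.ext (mul_left_cancel₀ hm h.1)
    (Prod.ext (mul_left_cancel₀ hm h.2.1) (mul_left_cancel₀ hm h.2.2))

def bprim (f : ℤ × ℤ × ℤ) : Prop := ∀ l : ℕ, l.Prime → ¬ ((l : ℤ) ∣ f.1 ∧ (l : ℤ) ∣ f.2.1 ∧ (l : ℤ) ∣ f.2.2)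

lemma bprim_iff (f : ℤ × ℤ × ℤ) : Int.gcd f.1 (Int.gcd f.2.1 f.2.2) = 1 ↔ bprim f := by
  constructor
  · intro h l hl hd
    have : (l : ℤ) ∣ (Int.gcd f.1 (Int.gcd f.2.1 f.2.2) : ℤ) :=
      Int.dvd_coe_gcd hd.1 (Int.dvd_coe_gcd hd.2.1 hd.2.2)
    rw [h] at this
    exact hl.one_lt.ne' (by exact_mod_cast Int.eq_one_of_dvd_one (by positivity) this)
  · intro h
    by_contra hne
    obtain ⟨l, hl, hd⟩ := Nat.exists_prime_and_dvd hne
    have hd' : (l : ℤ) ∣ (Int.gcd f.1 (Int.gcd f.2.1 f.2.2) : ℤ) := by exact_mod_cast hd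
    refine h l hl ⟨hd'.trans (Int.gcd_dvd_left _ _), ?_, ?_⟩
    · exact (hd'.trans (Int.gcd_dvd_right _ _)).trans (Int.gcd_dvd_left _ _)
    · exact (hd'.trans (Int.gcd_dvd_right _ _)).trans (Int.gcd_dvd_right _ _)

lemma dvd_bact {l : ℤ} {f : ℤ × ℤ × ℤ} (M : M2) (h : l ∣ f.1 ∧ l ∣ f.2.1 ∧ l ∣ f.2.2) :
    l ∣ (bact f M).1 ∧ l ∣ (bact f M).2.1 ∧ l ∣ (bact f M).2.2 := by
  obtain ⟨⟨a, ha⟩, ⟨b, hb⟩, ⟨c, hc⟩⟩ := h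
  unfold bact
  simp only [ha, hb, hc]
  refine ⟨⟨a * M 0 0 ^ 2 + b * M 0 0 * M 1 0 + c * M 1 0 ^ 2, by ring⟩,
    ⟨2 * a * M 0 0 * M 0 1 + b * (M 0 0 * M 1 1 + M 0 1 * M 1 0) +
        2 * c * M 1 0 * M 1 1, by ring⟩,
    ⟨a * M 0 1 ^ 2 + b * M 0 1 * M 1 1 + c * M 1 1 ^ 2, by ring⟩⟩

lemma bact_inv (f : ℤ × ℤ × ℤ) (M : SL2) : bact (bact f M.1) (M⁻¹).1 = f := by
  rw [bact_mul, ← Matrix.SpecialLinearGroup.coe_mul, mul_inv_cancel, Matrix.SpecialLinearGroup.coe_one, bact_one]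

lemma bprim_bact {f : ℤ × ℤ × ℤ} (M : M2) (h : bprim (bact f M)) : bprim f :=
  fun l hl hd => h l hl (dvd_bact M hd)

lemma pos_bact {f : ℤ × ℤ × ℤ} (hf : 0 < f.1) (hD : bdisc f < 0) (M : M2) (hM : M.det ≠ 0) :
    0 < (bact f M).1 := by
  have key : 4 * f.1 * (bact f M).1 = (2 * f.1 * M 0 0 + f.2.1 * M 1 0) ^ 2 - bdisc f * M 1 0 ^ 2 := by
    unfold bact bdisc; simp only; ring
  have : 0 < 4 * f.1 * (bact f M).1 := by
    rw [key]
    by_cases h : M 1 0 = 0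
    · have : M 0 0 ≠ 0 := by
        intro h0; apply hM; rw [Matrix.det_fin_two, h, h0]; ring
      rw [h]
      have : 0 < (2 * f.1 * M 0 0) ^ 2 := by positivity
      simpa using this
    · have h2 : 0 < M 1 0 ^ 2 := by positivity
      nlinarith [sq_nonneg (2 * f.1 * M 0 0 + f.2.1 * M 1 0)]
  exact pos_of_mul_pos_right this (by positivity)

lemma isPPD_iff (d : ℤ) (f : ℤ × ℤ × ℤ) : IsPrimPosDefBQF d f ↔ bdisc f = d ∧ bprim f ∧ 0 < f.1 := by
  unfold IsPrimPosDefBQF; rw [bprim_iff]; rfl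

lemma isPPD_bact {d : ℤ} (hd : d < 0) {f : ℤ × ℤ × ℤ} (hf : IsPrimPosDefBQF d f) (M : SL2) :
    IsPrimPosDefBQF d (bact f M.1) := by
  rw [isPPD_iff] at hf ⊢
  refine ⟨?_, ?_, ?_⟩
  · rw [bdisc_bact, hf.1]; simp
  · apply bprim_bact (M⁻¹).1; rw [bact_inv]; exact hf.2.1
  · exact pos_bact hf.2.2 (by rw [hf.1]; exact hd) _ (by simp)

/-- coset representatives of matrices of determinant `p` -/
def Srep (p : ℕ) : Option (Fin p) → M2
  | none => !![(p : ℤ), 0; 0, 1]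
  | some j => !![1, 0; ((j : ℕ) : ℤ), (p : ℤ)]

lemma Srep_det (p : ℕ) (r) : (Srep p r).det = p := by
  cases r <;> simp [Srep, Matrix.det_fin_two]

lemma Srep_exists {p : ℕ} (hp : p.Prime) (S : M2) (hS : S.det = p) :
    ∃ r, ∃ g : SL2, S = Srep p r * g.1 := by
  have hpos : (0 : ℤ) < p := by exact_mod_cast hp.pos
  have hpp : Prime (p : ℤ) := Nat.prime_iff_prime_int.mp hp
  rw [Matrix.det_fin_two] at hS
  by_cases h : (p : ℤ) ∣ S 0 0 ∧ (p : ℤ) ∣ S 0 1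
  · obtain ⟨⟨a, ha⟩, ⟨b, hb⟩⟩ := h
    refine ⟨none, ⟨!![a, b; S 1 0, S 1 1], ?_⟩, ?_⟩
    · rw [Matrix.det_fin_two]; simp
      rw [ha, hb] at hS
      apply mul_left_cancel₀ hpos.ne'; linear_combination hS
    · ext i j; fin_cases i <;> fin_cases j <;> simp [Srep, Matrix.mul_apply, Fin.sum_univ_two, ha, hb]
  · -- find j
    have : ∃ j : ℤ, (p : ℤ) ∣ S 1 0 - j * S 0 0 ∧ (p : ℤ) ∣ S 1 1 - j * S 0 1 := by
      by_cases h0 : (p : ℤ) ∣ S 0 0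
      · have h1 : ¬ (p : ℤ) ∣ S 0 1 := fun h1 => h ⟨h0, h1⟩
        have hc : IsCoprime (S 0 1) (p : ℤ) := ((Prime.coprime_iff_not_dvd hpp).mpr h1).symm
        obtain ⟨u, v, huv⟩ := hc
        refine ⟨S 1 1 * u, ?_, ?_⟩
        · have : S 0 1 * (S 1 0 - S 1 1 * u * S 0 0) = p * (-1 + v * (S 0 0) * S 1 1) := by
            linear_combination -hS - S 1 1 * S 0 0 * huv
          exact (hpp.dvd_or_dvd ⟨_, this⟩).resolve_left h1
        · exact ⟨v * S 1 1, by linear_combination -S 1 1 * huv⟩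
      · have hc : IsCoprime (S 0 0) (p : ℤ) := ((Prime.coprime_iff_not_dvd hpp).mpr h0).symm
        obtain ⟨u, v, huv⟩ := hc
        refine ⟨S 1 0 * u, ?_, ?_⟩
        · exact ⟨v * S 1 0, by linear_combination -S 1 0 * huv⟩
        · have : S 0 0 * (S 1 1 - S 1 0 * u * S 0 1) = p * (1 + v * (S 0 1) * S 1 0) := by
            linear_combination hS - S 1 0 * S 0 1 * huv
          exact (hpp.dvd_or_dvd ⟨_, this⟩).resolve_left h0
    obtain ⟨j, ⟨c, hc⟩, ⟨d, hd⟩⟩ := this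
    have hj0 := Int.emod_nonneg j hpos.ne'
    have hjp := Int.emod_lt_of_pos j hpos
    refine ⟨some ⟨(j % p).toNat, by omega⟩, ⟨!![S 0 0, S 0 1; c + j / p * S 0 0, d + j / p * S 0 1], ?_⟩, ?_⟩
    · rw [Matrix.det_fin_two]; simp
      apply mul_left_cancel₀ hpos.ne'; linear_combination hS - S 0 0 * hd + S 0 1 * hc
    · have e : (((j % p).toNat : ℕ) : ℤ) = j % p := Int.toNat_of_nonneg hj0
      have e2 := Int.emod_add_mul_ediv j p
      ext i k; fin_cases i <;> fin_cases k <;> simp [Srep, Matrix.mul_apply, Fin.sum_univ_two, e]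
      · linear_combination hc - S 0 0 * e2
      · linear_combination hd - S 0 1 * e2

lemma Srep_unique {p : ℕ} (hp : p.Prime) {r r' : Option (Fin p)} {g g' : SL2}
    (h : Srep p r * g.1 = Srep p r' * g'.1) : r = r' ∧ g = g' := by
  have hpos : (0 : ℤ) < p := by exact_mod_cast hp.pos
  have hpp : Prime (p : ℤ) := Nat.prime_iff_prime_int.mp hp
  have dg := g.2
  have dg' := g'.2
  rw [Matrix.det_fin_two] at dg dg'
  have hr : r = r' := by
    have h00 := congrFun (congrFun h 0) 0
    have h01 := congrFun (congrFun h 0) 1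
    have h10 := congrFun (congrFun h 1) 0
    have h11 := congrFun (congrFun h 1) 1
    rcases r with _ | j <;> rcases r' with _ | j' <;>
      simp [Srep, Matrix.mul_apply, Fin.sum_univ_two] at h00 h01 h10 h11 ⊢
    · apply hpp.not_dvd_one
      have h00 : (p : ℤ) * g.1 0 0 = g'.1 0 0 := h00
      have h01 : (p : ℤ) * g.1 0 1 = g'.1 0 1 := h01
      rw [← h00, ← h01] at dg'
      exact ⟨g.1 0 0 * g'.1 1 1 - g.1 0 1 * g'.1 1 0, by linear_combination -dg'⟩
    · apply hpp.not_dvd_one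
      have h00 : g.1 0 0 = (p : ℤ) * g'.1 0 0 := h00
      have h01 : g.1 0 1 = (p : ℤ) * g'.1 0 1 := h01
      rw [h00, h01] at dg
      exact ⟨g'.1 0 0 * g.1 1 1 - g'.1 0 1 * g.1 1 0, by linear_combination -dg⟩
    · have h00 : g.1 0 0 = g'.1 0 0 := h00
      have h01 : g.1 0 1 = g'.1 0 1 := h01
      have h10 : (j : ℤ) * g.1 0 0 + p * g.1 1 0 = (j' : ℤ) * g'.1 0 0 + p * g'.1 1 0 := h10
      have h11 : (j : ℤ) * g.1 0 1 + p * g.1 1 1 = (j' : ℤ) * g'.1 0 1 + p * g'.1 1 1 := h11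
      have hd : (p : ℤ) ∣ (j : ℤ) - j' := by
        rw [← h00] at h10
        rw [← h01] at h11
        exact ⟨g.1 1 1 * (g'.1 1 0 - g.1 1 0) - g.1 1 0 * (g'.1 1 1 - g.1 1 1),
          by linear_combination g.1 1 1 * h10 - g.1 1 0 * h11 - ((j:ℤ) - j') * dg⟩
      have := Int.eq_zero_of_abs_lt_dvd hd (by rw [abs_lt]; constructor <;> omega)
      apply Fin.ext; omega
  refine ⟨hr, ?_⟩
  subst hr
  apply Subtype.ext
  have : (Srep p r).adjugate * (Srep p r * g.1) = (Srep p r).adjugate * (Srep p r * g'.1) := by rw [h]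
  rw [← Matrix.mul_assoc, ← Matrix.mul_assoc, Matrix.adjugate_mul, Srep_det] at this
  simp only [Matrix.smul_mul, Matrix.one_mul] at this
  ext i k
  have := congrFun (congrFun this i) k
  simp only [Matrix.smul_apply, smul_eq_mul] at this
  exact mul_left_cancel₀ hpos.ne' this

/-- matrices of determinant `p` counted through coset representatives -/
lemma card_detp {p : ℕ} (hp : p.Prime) (f : ℤ × ℤ × ℤ) (m : ℤ) (hm : m ≠ 0) (g : ℤ × ℤ × ℤ)
    (P : Option (Fin p) → Prop) (φ : {r // P r} → ℤ × ℤ × ℤ)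
    (hφ : ∀ r, bsmul m (φ r) = bact f (Srep p r.1))
    (hP : ∀ r (u : SL2), bact f (Srep p r * u.1) = bsmul m g → P r) :
    Nat.card {S : M2 // S.det = p ∧ bact f S = bsmul m g} =
      Nat.card {x : {r // P r} × SL2 // bact (φ x.1) x.2.1 = g} := by
  symm
  apply Nat.card_congr
  refine Equiv.ofBijective (fun x => ⟨Srep p x.1.1.1 * x.1.2.1, ?_, ?_⟩) ⟨?_, ?_⟩
  · rw [Matrix.det_mul, Srep_det, x.1.2.2, mul_one]
  · rw [← bact_mul, ← hφ, bact_bsmul, x.2]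
  · rintro ⟨⟨r, u⟩, hx⟩ ⟨⟨r', u'⟩, hx'⟩ h
    simp only [Subtype.mk.injEq] at h
    obtain ⟨h1, h2⟩ := Srep_unique hp h
    subst h2
    have := Subtype.ext h1
    subst this
    rfl
  · rintro ⟨S, hS, hS2⟩
    obtain ⟨r, u, rfl⟩ := Srep_exists hp S hS
    refine ⟨⟨⟨⟨r, hP r u hS2⟩, u⟩, ?_⟩, rfl⟩
    apply bsmul_inj hm
    rw [← bact_bsmul, hφ, bact_mul, hS2]

lemma bqf_reduce (d : ℤ) (hd : d < 0) : ∀ (n : ℕ) (f : ℤ × ℤ × ℤ), f.1.toNat = n → 0 < f.1 → bdisc f = d →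
    ∃ M : SL2, |(bact f M.1).2.1| ≤ (bact f M.1).1 ∧ (bact f M.1).1 ≤ (bact f M.1).2.2 := by
  intro n
  induction n using Nat.strong_induction_on with
  | _ n ih =>
    intro f hn hf hfd
    obtain ⟨a, b, c⟩ := f
    simp only at hn hf
    obtain ⟨k, hk⟩ : ∃ k : ℤ, |b + 2 * a * k| ≤ a := by
      refine ⟨-((b + a) / (2 * a)), ?_⟩
      have h1 := Int.emod_add_mul_ediv (b + a) (2 * a)
      have h2 := Int.emod_nonneg (b + a) (by omega : 2 * a ≠ 0)
      have h3 := Int.emod_lt_of_pos (b + a) (by omega : 0 < 2 * a)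
      rw [abs_le]
      constructor <;> nlinarith
    let M : SL2 := ⟨!![1, k; 0, 1], by simp [Matrix.det_fin_two]⟩
    have hM : bact (a, b, c) M.1 = (a, b + 2 * a * k, a * k ^ 2 + b * k + c) := by
      simp only [bact, M]
      refine Prod.ext ?_ (Prod.ext ?_ ?_) <;> simp <;> ring
    by_cases hc : a ≤ a * k ^ 2 + b * k + c
    · exact ⟨M, by rw [hM]; exact ⟨hk, hc⟩⟩
    · push Not at hc
      set b' := b + 2 * a * k with hb'
      set c' := a * k ^ 2 + b * k + c with hc'
      let W : SL2 := ⟨!![0, -1; 1, 0], by simp [Matrix.det_fin_two]⟩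
      have hW : bact (a, b', c') W.1 = (c', -b', a) := by
        simp only [bact, W]
        refine Prod.ext ?_ (Prod.ext ?_ ?_) <;> simp
      have hdisc : b' ^ 2 - 4 * a * c' = d := by
        rw [← hfd]; simp only [bdisc, hb', hc']; ring
      have hc0 : 0 < c' := by
        have : 0 < 4 * a * c' := by nlinarith [sq_nonneg b']
        exact pos_of_mul_pos_right this (by positivity)
      obtain ⟨N, hN⟩ := ih c'.toNat (by omega) (c', -b', a) rfl hc0 (by simp only [bdisc]; linear_combination hdisc)
      refine ⟨M * W * N, ?_⟩
      have : bact (a, b, c) (M * W * N).1 = bact (c', -b', a) N.1 := by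
        rw [← hW, ← hM, bact_mul, bact_mul, ← Matrix.mul_assoc]; rfl
      rw [this]; exact hN

abbrev BCls (d : ℤ) := Quot fun f g : {f : ℤ × ℤ × ℤ // IsPrimPosDefBQF d f} => BQFEquiv f.1 g.1

lemma bcls_finite (d : ℤ) (hd : d < 0) : Finite (BCls d) := by
  have hfin : ((Finset.Icc (0:ℤ) (-d) ×ˢ (Finset.Icc d (-d) ×ˢ Finset.Icc (0:ℤ) (-d)) : Finset (ℤ × ℤ × ℤ)) : Set (ℤ × ℤ × ℤ)).Finite :=
    Finset.finite_toSet _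
  set T : Set {f : ℤ × ℤ × ℤ // IsPrimPosDefBQF d f} := {f | f.1 ∈ (Finset.Icc (0:ℤ) (-d) ×ˢ (Finset.Icc d (-d) ×ˢ Finset.Icc (0:ℤ) (-d)) : Finset (ℤ × ℤ × ℤ))} with hT
  have hTf : T.Finite := Set.Finite.preimage (Subtype.val_injective.injOn) hfin
  have : Finite T := hTf
  apply Finite.of_surjective (fun t : T => (Quot.mk _ t.1 : BCls d))
  intro q
  induction q using Quot.ind with
  | _ f =>
    obtain ⟨f, hf⟩ := f
    have hf' := (isPPD_iff _ _).mp hf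
    obtain ⟨M, h1, h2⟩ := bqf_reduce d hd _ f rfl hf'.2.2 hf'.1
    have hg := isPPD_bact hd hf M
    have hg' := (isPPD_iff _ _).mp hg
    refine ⟨⟨⟨bact f M.1, hg⟩, ?_⟩, ?_⟩
    · obtain ⟨g, hgg⟩ : ∃ g, g = bact f M.1 := ⟨_, rfl⟩
      simp only [hT, Set.mem_ofPred_eq]
      rw [← hgg] at h1 h2 hg' ⊢
      obtain ⟨a, b, c⟩ := g
      simp only [bdisc] at hg' h1 h2
      obtain ⟨e, -, pos⟩ := hg'
      rw [abs_le] at h1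
      have hb2 : b ^ 2 ≤ a ^ 2 := by nlinarith
      simp only [Finset.mem_product, Finset.mem_Icc]
      have hc : c ≤ -d := by nlinarith
      refine ⟨⟨by omega, by omega⟩, ⟨by omega, by omega⟩, by omega, by omega⟩
    · apply Quot.sound
      rw [bqfEquiv_iff]
      exact ⟨M⁻¹, bact_inv f M⟩

lemma bcls_uniq {d : ℤ} (i j : BCls d) (h : ∃ M : SL2, bact (Quot.out i).1 M.1 = (Quot.out j).1) : i = j := by
  rw [← Quot.out_eq i, ← Quot.out_eq j]
  apply Quot.sound
  rwa [bqfEquiv_iff]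

lemma bcls_ex {d : ℤ} (f : ℤ × ℤ × ℤ) (hf : IsPrimPosDefBQF d f) :
    ∃ i : BCls d, ∃ M : SL2, bact f M.1 = (Quot.out i).1 := by
  let i : BCls d := Quot.mk _ ⟨f, hf⟩
  refine ⟨i, ?_⟩
  have h : (Quot.mk _ ⟨f, hf⟩ : BCls d) = Quot.mk _ (Quot.out i) := (Quot.out_eq i).symm
  have h2 := Quot.eqvGen_exact h
  clear_value i
  have key : ∀ x y : {f : ℤ × ℤ × ℤ // IsPrimPosDefBQF d f},
     Relation.EqvGen (fun f g : {f : ℤ × ℤ × ℤ // IsPrimPosDefBQF d f} => BQFEquiv f.1 g.1) x y →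
      ∃ M : SL2, bact x.1 M.1 = y.1 := by
    intro x y hxy
    induction hxy with
    | rel x y h => exact (bqfEquiv_iff _ _).mp h
    | refl x => exact ⟨1, bact_one _⟩
    | symm x y _ ih =>
      obtain ⟨M, hM⟩ := ih
      exact ⟨M⁻¹, by rw [← hM, bact_inv]⟩
    | trans x y z _ _ ih1 ih2 =>
      obtain ⟨M, hM⟩ := ih1
      obtain ⟨N, hN⟩ := ih2
      exact ⟨M * N, by rw [← hN, ← hM, bact_mul]; rfl⟩
  exact key _ _ h2

lemma stab_eqs {a b c α β γ δ : ℤ} (h1 : a * α ^ 2 + b * α * γ + c * γ ^ 2 = a)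
    (h2 : 2 * a * α * β + b * (α * δ + β * γ) + 2 * c * γ * δ = b)
    (h3 : a * β ^ 2 + b * β * δ + c * δ ^ 2 = c) (hdet : α * δ - β * γ = 1) :
    a * (δ - α) = b * γ ∧ a * β = - (c * γ) := by
  constructor
  · apply mul_left_cancel₀ (two_ne_zero : (2:ℤ) ≠ 0)
    linear_combination (-2 * δ) * h1 + γ * h2 + (2 * a * α + b * γ) * hdet
  · apply mul_left_cancel₀ (two_ne_zero : (2:ℤ) ≠ 0)
    linear_combination δ * h2 - 2 * γ * h3 - (2 * a * β + b * δ) * hdet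

lemma stab_card {d : ℤ} {f : ℤ × ℤ × ℤ} (hf : IsPrimPosDefBQF d f) :
    Nonempty ({M : SL2 // bact f M.1 = f} ≃ {x : ℤ × ℤ // x.1 ^ 2 - d * x.2 ^ 2 = 4}) := by
  obtain ⟨a, b, c⟩ := f
  obtain ⟨hD, hg, hpos⟩ := hf
  simp only at hD hg hpos
  have main : ∀ M : SL2, bact (a, b, c) M.1 = (a, b, c) → ∃ k : ℤ, M.1 1 0 = a * k ∧ M.1 0 1 = - c * k ∧
      M.1 1 1 - M.1 0 0 = b * k := by
    intro M hM
    have hdet := M.2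
    rw [Matrix.det_fin_two] at hdet
    simp only [bact, Prod.mk.injEq] at hM
    obtain ⟨e1, e2⟩ := stab_eqs hM.1 hM.2.1 hM.2.2 hdet
    have hdvd : a ∣ M.1 1 0 := by
      have hc : IsCoprime a (Int.gcd b c : ℤ) := by
        rw [Int.isCoprime_iff_gcd_eq_one]; exact hg
      apply hc.dvd_of_dvd_mul_left
      rw [Int.gcd_eq_gcd_ab]
      rw [add_mul]
      refine dvd_add ⟨(M.1 1 1 - M.1 0 0) * Int.gcdA b c, by linear_combination -Int.gcdA b c * e1⟩
       ⟨-(M.1 0 1 * Int.gcdB b c), by linear_combination Int.gcdB b c * e2⟩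
    obtain ⟨k, hk⟩ := hdvd
    rw [hk] at e1 e2
    refine ⟨k, hk, mul_left_cancel₀ hpos.ne' (by linear_combination e2), mul_left_cancel₀ hpos.ne' (by linear_combination e1)⟩
  choose! kk h1 h2 h3 using main
  refine ⟨Equiv.ofBijective (fun M => ⟨(M.1.1 0 0 + M.1.1 1 1, kk M.1), ?_⟩) ⟨?_, ?_⟩⟩
  · have e1 := h1 M.1 M.2
    have e2 := h2 M.1 M.2
    have e3 := h3 M.1 M.2
    have hdet := M.1.2
    rw [Matrix.det_fin_two, e1, e2] at hdet
    simp only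
    rw [← hD]
    have e3' : M.1.1 1 1 = M.1.1 0 0 + b * kk M.1 := by linear_combination e3
    rw [e3'] at hdet ⊢
    linear_combination 4 * hdet
  · rintro ⟨M, hM⟩ ⟨N, hN⟩ h
    simp only [Subtype.mk.injEq, Prod.mk.injEq] at h ⊢
    have a1 := h1 M hM
    have a2 := h2 M hM
    have a3 := h3 M hM
    have b1 := h1 N hN
    have b2 := h2 N hN
    have b3 := h3 N hN
    rw [h.2] at a1 a2 a3
    apply Subtype.ext
    ext i j
    fin_cases i <;> fin_cases j <;> simp only [Fin.zero_eta, Fin.mk_one, Fin.isValue]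
    · have := h.1; omega
    · rw [a2, b2]
    · rw [a1, b1]
    · have := h.1; omega
  · rintro ⟨⟨t, k⟩, h⟩
    simp only at h
    have hpar : (2 : ℤ) ∣ t - b * k := by
      have e : (t - b * k) * (t + b * k) = 2 * (2 - 2 * a * c * k ^ 2) := by rw [← hD] at h; linear_combination h
      rcases Int.prime_two.dvd_or_dvd ⟨_, e⟩ with h | h
      · exact h
      · have : t - b * k = t + b * k - 2 * (b * k) := by ring
        rw [this]; exact dvd_sub h ⟨_, rfl⟩
    obtain ⟨s, hs⟩ := hpar
    have ht : t = 2 * s + b * k := by linear_combination hs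
    subst ht
    have hd : s * (s + b * k) + c * a * k ^ 2 = 1 := by
      rw [← hD] at h
      apply mul_left_cancel₀ (by norm_num : (4:ℤ) ≠ 0)
      linear_combination h
    let M : SL2 := ⟨!![s, -c * k; a * k, s + b * k], by rw [Matrix.det_fin_two]; simp; linear_combination hd⟩
    have hM : bact (a, b, c) M.1 = (a, b, c) := by
      simp only [bact, M]
      refine Prod.ext ?_ (Prod.ext ?_ ?_) <;> simp
      · linear_combination a * hd
      · linear_combination b * hd
      · linear_combination c * hd
    refine ⟨⟨M, hM⟩, ?_⟩
    apply Subtype.ext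
    refine Prod.ext ?_ ?_
    · simp [M]; ring
    · have := h1 M hM
      have e : M.1 1 0 = a * k := by simp [M]
      rw [e] at this
      exact (mul_left_cancel₀ hpos.ne' this).symm

lemma wAut_card {d : ℤ} (hd : d < 0) {f : ℤ × ℤ × ℤ} (hf : IsPrimPosDefBQF d f) :
    Nat.card {M : SL2 // bact f M.1 = f} = wAut d := by
  rw [Nat.card_congr (stab_card hf).some]
  have hmod : d % 4 = 0 ∨ d % 4 = 1 := by
    obtain ⟨hD, -⟩ := hf
    rw [← hD]
    have : f.2.1 ^ 2 % 4 = 0 ∨ f.2.1 ^ 2 % 4 = 1 := by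
      rcases Int.even_or_odd' f.2.1 with ⟨m, hm | hm⟩ <;> rw [hm] <;> ring_nf <;> omega
    have e : 4 * f.1 * f.2.2 = 4 * (f.1 * f.2.2) := by ring
    omega
  have key : ∀ S : Finset (ℤ × ℤ), (∀ x : ℤ × ℤ, x.1 ^ 2 - d * x.2 ^ 2 = 4 ↔ x ∈ S) →
      Nat.card {x : ℤ × ℤ // x.1 ^ 2 - d * x.2 ^ 2 = 4} = S.card := by
    intro S hS
    rw [Nat.card_congr (Equiv.subtypeEquivRight hS)]
    simp
  have bd : ∀ t k : ℤ, t ^ 2 - d * k ^ 2 = 4 → (-2 ≤ t ∧ t ≤ 2) ∧ (-1 ≤ k ∧ k ≤ 1) := by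
    intro t k h
    have hd3 : d ≤ -3 := by omega
    have h1 : t ^ 2 ≤ 4 := by nlinarith [sq_nonneg k]
    have h2 : 3 * k ^ 2 ≤ 4 := by nlinarith [sq_nonneg t, sq_nonneg k]
    refine ⟨⟨by nlinarith, by nlinarith⟩, ⟨by nlinarith, by nlinarith⟩⟩
  unfold wAut
  split_ifs with h3 h4
  · rw [key {(2,0),(-2,0),(1,1),(1,-1),(-1,1),(-1,-1)}]
    · decide
    · rintro ⟨t, k⟩
      constructor
      · intro h
        obtain ⟨⟨a1, a2⟩, b1, b2⟩ := bd t k h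
        subst h3
        interval_cases t <;> interval_cases k <;> first | (exfalso; revert h; decide) | decide
      · intro h; simp at h; subst h3; rcases h with h | h | h | h | h | h <;> rw [h.1, h.2] <;> norm_num
  · rw [key {(2,0),(-2,0),(0,1),(0,-1)}]
    · decide
    · rintro ⟨t, k⟩
      constructor
      · intro h
        obtain ⟨⟨a1, a2⟩, b1, b2⟩ := bd t k h
        subst h4
        interval_cases t <;> interval_cases k <;> first | (exfalso; revert h; decide) | decide
      · intro h; simp at h; subst h4; rcases h with h | h | h | h <;> rw [h.1, h.2] <;> norm_num
  · rw [key {(2,0),(-2,0)}]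
    · decide
    · rintro ⟨t, k⟩
      constructor
      · intro h
        obtain ⟨⟨a1, a2⟩, b1, b2⟩ := bd t k h
        have hd5 : d ≤ -5 := by omega
        simp only at h
        have hk : k = 0 := by
          by_contra hk
          have : 1 ≤ k ^ 2 := by have : 0 < k ^ 2 := by positivity
                                 omega
          nlinarith [sq_nonneg t]
        subst hk
        interval_cases t <;> simp at h ⊢
      · intro h; simp at h; rcases h with h | h <;> rw [h.1, h.2] <;> norm_num

lemma bact_adj {p : ℕ} (f : ℤ × ℤ × ℤ) (S : M2) (hS : S.det = p) :
    bact (bact f S) S.adjugate = bsmul ((p : ℤ) ^ 2) f := by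
  rw [bact_mul, Matrix.mul_adjugate, hS, bact_scalar]

lemma adj_det2 (S : M2) : S.adjugate.det = S.det := by
  rw [Matrix.adjugate_fin_two, Matrix.det_fin_two, Matrix.det_fin_two]; simp; ring

lemma bact_S_some {p : ℕ} (f : ℤ × ℤ × ℤ) (j : Fin p) :
    bact f (Srep p (some j)) = (f.1 + f.2.1 * (j : ℕ) + f.2.2 * (j : ℕ) ^ 2,
      p * (f.2.1 + 2 * f.2.2 * (j : ℕ)), f.2.2 * p ^ 2) := by
  simp only [bact, Srep]
  refine Prod.ext ?_ (Prod.ext ?_ ?_) <;> simp <;> ring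

lemma bact_S_none {p : ℕ} (f : ℤ × ℤ × ℤ) :
    bact f (Srep p none) = (f.1 * p ^ 2, f.2.1 * p, f.2.2) := by
  simp only [bact, Srep]
  refine Prod.ext ?_ (Prod.ext ?_ ?_) <;> simp

lemma bprim_bact_iff {p : ℕ} (hp : p.Prime) {f : ℤ × ℤ × ℤ} (hf : bprim f) (S : M2) (hS : S.det = p) :
    bprim (bact f S) ↔ ¬ ((p : ℤ) ∣ (bact f S).1 ∧ (p : ℤ) ∣ (bact f S).2.1 ∧ (p : ℤ) ∣ (bact f S).2.2) := by
  constructor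
  · intro h; exact h p hp
  · intro h l hl hd
    by_cases hlp : l = p
    · subst hlp; exact h hd
    · have h2 := dvd_bact S.adjugate hd
      rw [bact_adj f S hS] at h2
      have hc : IsCoprime (l : ℤ) ((p : ℤ) ^ 2) := by
        apply IsCoprime.pow_right
        exact Nat.Coprime.isCoprime ((Nat.coprime_primes hl hp).mpr hlp)
      exact hf l hl ⟨hc.dvd_of_dvd_mul_left h2.1, hc.dvd_of_dvd_mul_left h2.2.1, hc.dvd_of_dvd_mul_left h2.2.2⟩

lemma root_count {p : ℕ} [Fact p.Prime] (hp2 : p ≠ 2) (a b c : ZMod p) (h : ¬ (a = 0 ∧ b = 0 ∧ c = 0))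
    (D : ℤ) (hD : (D : ZMod p) = b ^ 2 - 4 * a * c) :
    ((Finset.univ.filter fun x : ZMod p => a + b * x + c * x ^ 2 = 0).card : ℤ) + (if c = 0 then 1 else 0) =
      1 + legendreSym p D := by
  have h2 : (2 : ZMod p) ≠ 0 := by
    intro h
    have h' : ((2 : ℕ) : ZMod p) = 0 := by exact_mod_cast h
    rw [ZMod.natCast_eq_zero_iff] at h'
    exact hp2 ((Nat.prime_dvd_prime_iff_eq Fact.out Nat.prime_two).mp h')
  have h4 : (4 : ZMod p) ≠ 0 := by
    have : (4 : ZMod p) = 2 * 2 := by norm_num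
    rw [this]; exact mul_ne_zero h2 h2
  by_cases hc : c = 0
  · subst hc
    simp only [if_true]
    by_cases hb : b = 0
    · subst hb
      have ha : a ≠ 0 := by tauto
      have : legendreSym p D = 0 := by rw [legendreSym.eq_zero_iff, hD]; ring
      rw [this]; simp [ha]
    · have h1 : legendreSym p D = 1 := by
        rw [legendreSym.eq_one_iff p]
        · rw [hD]; exact ⟨b, by ring⟩
        · rw [hD]; simpa using hb
      rw [h1]
      have : (Finset.univ.filter fun x : ZMod p => a + b * x + 0 * x ^ 2 = 0) = {-a / b} := by
        ext x; simp only [Finset.mem_filter, Finset.mem_univ, true_and, Finset.mem_singleton]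
        constructor
        · intro h; field_simp; linear_combination h
        · rintro rfl; field_simp; ring
      rw [this]; simp
  · simp only [hc, if_false, add_zero]
    have hcs := legendreSym.card_sqrts p hp2 D
    rw [add_comm, ← hcs]
    congr 1
    apply Finset.card_bij (fun x _ => 2 * c * x + b)
    · intro x hx
      simp only [Finset.mem_filter, Finset.mem_univ, true_and] at hx
      simp [Set.mem_ofPred_eq]
      rw [hD]; linear_combination 4 * c * hx
    · intro x _ y _ h
      have : 2 * c * x = 2 * c * y := by linear_combination h
      exact mul_left_cancel₀ (mul_ne_zero h2 hc) this
    · intro y hy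
      simp [Set.mem_ofPred_eq] at hy
      refine ⟨(y - b) / (2 * c), ?_, by field_simp; ring⟩
      simp only [Finset.mem_filter, Finset.mem_univ, true_and]
      have : 4 * c * (a + b * ((y - b) / (2 * c)) + c * ((y - b) / (2 * c)) ^ 2) = 0 := by
        field_simp
        linear_combination 4 * hy + 4 * hD
      exact (mul_eq_zero.mp this).resolve_left (mul_ne_zero h4 hc)

lemma card_R {p : ℕ} [hp : Fact p.Prime] (hp2 : p ≠ 2) {f : ℤ × ℤ × ℤ} (hf : bprim f) :
    (Fintype.card {r : Option (Fin p) // bprim (bact f (Srep p r))} : ℤ) = p - legendreSym p (bdisc f) := by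
  have hpp := hp.out
  have hz : ∀ x : ℤ, (p : ℤ) ∣ x ↔ (x : ZMod p) = 0 := fun x => (ZMod.intCast_zmod_eq_zero_iff_dvd x p).symm
  have hc : (Fintype.card {r : Option (Fin p) // bprim (bact f (Srep p r))} : ℤ) +
      Fintype.card {r : Option (Fin p) // ¬ bprim (bact f (Srep p r))} = p + 1 := by
    have := Fintype.card_subtype_compl (fun r : Option (Fin p) => bprim (bact f (Srep p r)))
    have h2 := Fintype.card_subtype_le (fun r : Option (Fin p) => bprim (bact f (Srep p r)))
    have h3 : Fintype.card (Option (Fin p)) = p + 1 := by simp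
    rw [h3] at this h2
    have e : (Fintype.card {r : Option (Fin p) // ¬ bprim (bact f (Srep p r))}) = p + 1 -
       (Fintype.card {r : Option (Fin p) // bprim (bact f (Srep p r))}) := by
       rw [← this]
    omega
  have hroot := root_count hp2 (f.1 : ZMod p) (f.2.1 : ZMod p) (f.2.2 : ZMod p)
    (by rw [← hz, ← hz, ← hz]; exact hf p hpp) (bdisc f) (by unfold bdisc; push_cast; ring)
  have hcompl : (Fintype.card {r : Option (Fin p) // ¬ bprim (bact f (Srep p r))} : ℤ) =
      ((Finset.univ.filter fun x : ZMod p => (f.1 : ZMod p) + (f.2.1 : ZMod p) * x + (f.2.2 : ZMod p) * x ^ 2 = 0).card : ℤ) + (if (f.2.2 : ZMod p) = 0 then 1 else 0) := by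
    rw [Fintype.card_subtype, Finset.card_filter, Fintype.sum_option, add_comm]
    push_cast
    congr 1
    · rw [Finset.card_filter]
      push_cast
      have hinj : Function.Injective (fun j : Fin p => ((j : ℕ) : ZMod p)) := by
        intro i j h
        have := (ZMod.natCast_eq_natCast_iff' _ _ _).mp h
        rw [Nat.mod_eq_of_lt i.2, Nat.mod_eq_of_lt j.2] at this
        exact Fin.ext this
      have hbij : Function.Bijective (fun j : Fin p => ((j : ℕ) : ZMod p)) := by
        rw [Fintype.bijective_iff_injective_and_card]
        exact ⟨hinj, by simp [ZMod.card]⟩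
      apply Fintype.sum_bijective _ hbij
      intro j
      congr 1
      rw [bprim_bact_iff hpp hf _ (Srep_det p _), not_not, bact_S_some]
      simp only [eq_iff_iff]
      have : (p : ℤ) ∣ f.1 + f.2.1 * (j : ℕ) + f.2.2 * (j : ℕ) ^ 2 ↔
        (f.1 : ZMod p) + (f.2.1 : ZMod p) * ((j : ℕ) : ZMod p) + (f.2.2 : ZMod p) * ((j : ℕ) : ZMod p) ^ 2 = 0 := by
        rw [hz]; push_cast; rfl
      rw [← this]
      exact ⟨fun h => h.1, fun h => ⟨h, Dvd.intro _ rfl, Dvd.intro_left _ (by rw [pow_two, ← mul_assoc])⟩⟩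
    · congr 1
      rw [bprim_bact_iff hpp hf _ (Srep_det p _), not_not, bact_S_none]
      simp only [eq_iff_iff]
      rw [← hz]
      exact ⟨fun h => h.2.2, fun h => ⟨Dvd.intro_left _ (by rw [pow_two, ← mul_assoc]), Dvd.intro_left _ rfl, h⟩⟩
  rw [hcompl, hroot] at hc
  linarith

lemma exists_unique_R' {p : ℕ} (hp : p.Prime) (hp2 : p ≠ 2) {f : ℤ × ℤ × ℤ} (hf : bprim f) {D : ℤ}
    (hD : bdisc f = D * p ^ 2) : ∃! r : Option (Fin p), ∃ g, bsmul ((p : ℤ) ^ 2) g = bact f (Srep p r) := by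
  have hpos : (0 : ℤ) < p := by exact_mod_cast hp.pos
  have hpp : Prime (p : ℤ) := Nat.prime_iff_prime_int.mp hp
  have h2 : ¬ (p : ℤ) ∣ 2 := by
    intro h
    have : p ∣ 2 := by exact_mod_cast h
    exact hp2 ((Nat.prime_dvd_prime_iff_eq hp Nat.prime_two).mp this)
  have h4 : ¬ (p : ℤ) ∣ 4 := by
    intro h
    have : (4 : ℤ) = 2 * 2 := by norm_num
    rw [this] at h
    rcases hpp.dvd_or_dvd h with h | h <;> exact h2 h
  have hiff : ∀ x : ℤ × ℤ × ℤ, (∃ g, bsmul ((p : ℤ) ^ 2) g = x) ↔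
      ((p : ℤ) ^ 2 ∣ x.1 ∧ (p : ℤ) ^ 2 ∣ x.2.1 ∧ (p : ℤ) ^ 2 ∣ x.2.2) := by
    intro x
    constructor
    · rintro ⟨g, rfl⟩; exact ⟨⟨_, rfl⟩, ⟨_, rfl⟩, ⟨_, rfl⟩⟩
    · rintro ⟨⟨a, ha⟩, ⟨b, hb⟩, ⟨c, hc⟩⟩
      exact ⟨(a, b, c), Prod.ext ha.symm (Prod.ext hb.symm hc.symm)⟩
  simp only [hiff]
  obtain ⟨a, b, c⟩ := f
  simp only [bdisc] at hD
  by_cases hc : (p : ℤ) ∣ c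
  · have hb : (p : ℤ) ∣ b := by
      apply hpp.dvd_of_dvd_pow (n := 2)
      have : b ^ 2 = 4 * a * c + p * (D * p) := by linear_combination hD
      rw [this]; exact dvd_add (hc.mul_left _) (Dvd.intro _ rfl)
    have ha : ¬ (p : ℤ) ∣ a := fun ha => hf p hp ⟨ha, hb, hc⟩
    have hc2 : (p : ℤ) ^ 2 ∣ c := by
      have : (p : ℤ) ^ 2 ∣ 4 * a * c := by
        have e : 4 * a * c = b ^ 2 - p ^ 2 * D := by linear_combination -hD
        rw [e]; exact dvd_sub (pow_dvd_pow_of_dvd hb 2) (Dvd.intro _ rfl)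
      apply (IsCoprime.dvd_of_dvd_mul_left _ this)
      apply IsCoprime.pow_left
      rw [Prime.coprime_iff_not_dvd hpp]
      intro h; rcases hpp.dvd_or_dvd h with h | h
      · exact h4 h
      · exact ha h
    refine ⟨none, ?_, ?_⟩
    · simp only [bact_S_none]
      refine ⟨Dvd.intro_left _ rfl, ?_, hc2⟩
      rw [pow_two]; exact mul_dvd_mul hb (dvd_refl _)
    · rintro (_ | j) h
      · rfl
      · exfalso
        simp only [bact_S_some] at h
        apply ha
        have h1 : (p : ℤ) ∣ a + b * (j : ℕ) + c * (j : ℕ) ^ 2 := (dvd_pow_self _ two_ne_zero).trans h.1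
        have : a = (a + b * (j : ℕ) + c * (j : ℕ) ^ 2) - b * (j : ℕ) - c * (j : ℕ) ^ 2 := by ring
        rw [this]
        exact dvd_sub (dvd_sub h1 (hb.mul_right _)) (hc.mul_right _)
  · have h2c : ¬ (p : ℤ) ∣ 2 * c := fun h => (hpp.dvd_or_dvd h).elim h2 hc
    obtain ⟨u, v, huv⟩ : IsCoprime (2 * c) (p : ℤ) := ((Prime.coprime_iff_not_dvd hpp).mpr h2c).symm
    have hj0 := Int.emod_nonneg (-(u * b)) hpos.ne'
    have hjp := Int.emod_lt_of_pos (-(u * b)) hpos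
    have hj : (p : ℤ) ∣ b + 2 * c * ((-(u * b)) % p) := by
      have e2 := Int.emod_add_mul_ediv (-(u * b)) p
      refine ⟨v * b - 2 * c * (-(u * b) / p), by linear_combination 2 * c * e2 - b * huv⟩
    have e : ((((-(u * b)) % p).toNat : ℕ) : ℤ) = (-(u * b)) % p := Int.toNat_of_nonneg hj0
    refine ⟨some ⟨((-(u * b)) % p).toNat, by omega⟩, ?_, ?_⟩
    · simp only [bact_S_some, e]
      set j := (-(u * b)) % p
      refine ⟨?_, ?_, Dvd.intro_left _ rfl⟩
      · have hd : (p : ℤ) ^ 2 ∣ 4 * c * (a + b * j + c * j ^ 2) := by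
          have e : 4 * c * (a + b * j + c * j ^ 2) = (b + 2 * c * j) ^ 2 - p ^ 2 * D := by linear_combination -hD
          rw [e]; exact dvd_sub (pow_dvd_pow_of_dvd hj 2) (Dvd.intro _ rfl)
        apply (IsCoprime.dvd_of_dvd_mul_left _ hd)
        apply IsCoprime.pow_left
        rw [Prime.coprime_iff_not_dvd hpp]
        intro h; rcases hpp.dvd_or_dvd h with h | h
        · exact h4 h
        · exact hc h
      · rw [pow_two]; exact mul_dvd_mul (dvd_refl _) hj
    · rintro (_ | j) h
      · exfalso
        simp only [bact_S_none] at h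
        exact hc ((dvd_pow_self _ two_ne_zero).trans h.2.2)
      · simp only [bact_S_some] at h
        have h1 : (p : ℤ) ∣ b + 2 * c * (j : ℕ) := by
          have := h.2.1
          rw [pow_two] at this
          exact (mul_dvd_mul_iff_left hpos.ne').mp this
        have h3 : (p : ℤ) ∣ (2 * c) * ((j : ℕ) - (-(u * b)) % p) := by
          have : (2 * c) * ((j : ℕ) - (-(u * b)) % p) = (b + 2 * c * (j : ℕ)) - (b + 2 * c * ((-(u * b)) % p)) := by ring
          rw [this]; exact dvd_sub h1 hj
        have h5 := (hpp.dvd_or_dvd h3).resolve_left h2c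
        have := Int.eq_zero_of_abs_lt_dvd h5 (by rw [abs_lt]; constructor <;> omega)
        congr 1
        apply Fin.ext
        simp only
        omega

/-- weighted primitive class number -/
noncomputable def Wcl (d : ℤ) : ℚ := (classNum d : ℚ) / ((wAut d : ℚ) / 2)

lemma wAut_pos (d : ℤ) : (0 : ℚ) < wAut d := by
  unfold wAut; split_ifs <;> norm_num

lemma Wcl_mul {p : ℕ} [hp : Fact p.Prime] (hp2 : p ≠ 2) {D : ℤ} (hD : D < 0) :
    Wcl (D * p ^ 2) = (p - legendreSym p D) * Wcl D := by
  have hpp := hp.out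
  have hpos : (0 : ℤ) < p := by exact_mod_cast hpp.pos
  have hp20 : ((p : ℤ) ^ 2) ≠ 0 := by positivity
  have hD' : D * p ^ 2 < 0 := mul_neg_of_neg_of_pos hD (by positivity)
  have := bcls_finite D hD
  have := bcls_finite _ hD'
  have : Fintype (BCls D) := Fintype.ofFinite _
  have : Fintype (BCls (D * p ^ 2)) := Fintype.ofFinite _
  let F : BCls D → ℤ × ℤ × ℤ := fun i => (Quot.out i).1
  let F' : BCls (D * p ^ 2) → ℤ × ℤ × ℤ := fun i => (Quot.out i).1
  have hF : ∀ i, IsPrimPosDefBQF D (F i) := fun i => (Quot.out i).2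
  have hF' : ∀ i, IsPrimPosDefBQF (D * p ^ 2) (F' i) := fun i => (Quot.out i).2
  let X : BCls D → BCls (D * p ^ 2) → ℚ := fun i j => (Nat.card {S : M2 // S.det = p ∧ bact (F i) S = bsmul 1 (F' j)} : ℚ)
  have stabpos : ∀ {d : ℤ}, d < 0 → ∀ {f}, IsPrimPosDefBQF d f → Finite {g : SL2 // bact f g.1 = f} := by
    intro d hd f hf
    apply Nat.finite_of_card_ne_zero
    rw [wAut_card hd hf]
    have := wAut_pos d
    exact_mod_cast this.ne'
  have bs1 : ∀ f, bsmul 1 f = f := fun f => by simp [bsmul]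
  have side1 : ∀ i, ∑ j, X i j / (wAut (D * p ^ 2) : ℚ) = p - legendreSym p D := by
    intro i
    have h := (isPPD_iff _ _).mp (hF i)
    have hc := card_R hp2 h.2.1
    rw [h.1] at hc
    have ht := transversal_count (k := ℚ) (fun f (g : SL2) => bact f g.1)
      (fun f g h => by simp only [bact_mul]; rfl) (fun f => bact_one f) F'
      (fun r : {r : Option (Fin p) // bprim (bact (F i) (Srep p r))} => bact (F i) (Srep p r.1))
      (fun j => stabpos hD' (hF' j))
      (fun r => by
        apply bcls_ex
        rw [isPPD_iff]
        refine ⟨?_, r.2, pos_bact h.2.2 (by rw [h.1]; exact hD) _ (by rw [Srep_det]; exact hpos.ne')⟩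
        rw [bdisc_bact, Srep_det, h.1]; ring)
      (fun i j => bcls_uniq i j)
    have hc' : ((Fintype.card {r : Option (Fin p) // bprim (bact (F i) (Srep p r))} : ℕ) : ℚ) = p - legendreSym p D := by
      exact_mod_cast congrArg (Int.cast : ℤ → ℚ) hc
    rw [hc'] at ht
    rw [← ht]
    apply Finset.sum_congr rfl
    intro j _
    rw [wAut_card hD' (hF' j)]
    congr 1
    simp only [X]
    rw [card_detp hpp (F i) 1 one_ne_zero (F' j) (fun r => bprim (bact (F i) (Srep p r))) (fun r => bact (F i) (Srep p r.1))
      (fun r => bs1 _) ?_]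
    intro r u hu
    rw [bs1, ← bact_mul] at hu
    apply bprim_bact u.1
    rw [hu]
    exact ((isPPD_iff _ _).mp (hF' j)).2.1
  have side2 : ∀ j, ∑ i, X i j / (wAut D : ℚ) = 1 := by
    intro j
    have h := (isPPD_iff _ _).mp (hF' j)
    obtain ⟨r0, hr0, hr0u⟩ := exists_unique_R' hpp hp2 h.2.1 h.1
    have hcard : Fintype.card {r : Option (Fin p) // ∃ g, bsmul ((p : ℤ) ^ 2) g = bact (F' j) (Srep p r)} = 1 := by
      rw [Fintype.card_eq_one_iff]
      exact ⟨⟨r0, hr0⟩, fun y => Subtype.ext (hr0u y.1 y.2)⟩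
    have ht := transversal_count (k := ℚ) (fun f (g : SL2) => bact f g.1)
      (fun f g h => by simp only [bact_mul]; rfl) (fun f => bact_one f) F
      (fun r : {r : Option (Fin p) // ∃ g, bsmul ((p : ℤ) ^ 2) g = bact (F' j) (Srep p r)} => r.2.choose)
      (fun j => stabpos hD (hF j))
      (fun r => by
        have hs := r.2.choose_spec
        set g := r.2.choose
        apply bcls_ex
        rw [isPPD_iff]
        have hadj : bact g (Srep p r.1).adjugate = F' j := by
          apply bsmul_inj hp20
          rw [← bact_bsmul, hs, bact_adj _ _ (Srep_det p r.1)]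
        have hpg := pos_bact h.2.2 (by rw [h.1]; exact hD') (Srep p r.1) (by rw [Srep_det]; exact hpos.ne')
        refine ⟨?_, bprim_bact (Srep p r.1).adjugate (by rw [hadj]; exact h.2.1), ?_⟩
        · have := bdisc_bact g (Srep p r.1).adjugate
          rw [hadj, h.1, adj_det2, Srep_det] at this
          exact mul_left_cancel₀ hp20 (by linear_combination -this)
        · rw [← hs] at hpg
          exact pos_of_mul_pos_right hpg (by positivity))
      (fun i j => bcls_uniq i j)
    rw [hcard] at ht
    rw [← Nat.cast_one, ← ht]
    apply Finset.sum_congr rfl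
    intro i _
    rw [wAut_card hD (hF i)]
    congr 1
    rw [← card_detp hpp (F' j) ((p : ℤ) ^ 2) hp20 (F i) (fun r => ∃ g, bsmul ((p : ℤ) ^ 2) g = bact (F' j) (Srep p r))
      (fun r => r.2.choose) (fun r => r.2.choose_spec) ?_]
    · simp only [X]
      congr 1
      apply Nat.card_congr
      refine ⟨fun S => ⟨S.1.adjugate, ?_, ?_⟩, fun S => ⟨S.1.adjugate, ?_, ?_⟩, ?_, ?_⟩
      · rw [adj_det2, S.2.1]
      · obtain ⟨S, hS1, hS2⟩ := S
        rw [bs1] at hS2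
        simp only
        rw [← hS2, bact_adj _ _ hS1]
      · rw [adj_det2, S.2.1]
      · rw [bs1]
        apply bsmul_inj hp20
        obtain ⟨S, hS1, hS2⟩ := S
        simp only
        rw [← bact_bsmul, ← hS2, bact_adj _ _ hS1]
      · intro S; apply Subtype.ext; simp [Matrix.adjugate_fin_two]
        ext a b; fin_cases a <;> fin_cases b <;> rfl
      · intro S; apply Subtype.ext; simp [Matrix.adjugate_fin_two]
        ext a b; fin_cases a <;> fin_cases b <;> rfl
    · intro r u hu
      refine ⟨bact (F i) (u⁻¹).1, ?_⟩
      rw [← bact_bsmul, ← hu, ← bact_mul, bact_inv]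
  have total1 : ∑ i, ∑ j, X i j = (Fintype.card (BCls D)) * ((p - legendreSym p D) * (wAut (D * p ^ 2) : ℚ)) := by
    rw [← nsmul_eq_mul, ← Finset.card_univ, ← Finset.sum_const]
    apply Finset.sum_congr rfl
    intro i _
    rw [← side1 i, ← Finset.sum_div, div_mul_cancel₀ _ (wAut_pos _).ne']
  have total2 : ∑ i, ∑ j, X i j = (Fintype.card (BCls (D * p ^ 2))) * ((wAut D : ℚ)) := by
    rw [Finset.sum_comm, ← nsmul_eq_mul, ← Finset.card_univ, ← Finset.sum_const]
    apply Finset.sum_congr rfl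
    intro j _
    have := side2 j
    rw [← Finset.sum_div, div_eq_one_iff_eq (wAut_pos _).ne'] at this
    exact this
  have c1 : classNum D = Fintype.card (BCls D) := Nat.card_eq_fintype_card
  have c2 : classNum (D * p ^ 2) = Fintype.card (BCls (D * p ^ 2)) := Nat.card_eq_fintype_card
  unfold Wcl
  rw [c1, c2]
  have w1 := wAut_pos D
  have w2 := wAut_pos (D * p ^ 2)
  rw [total1] at total2
  have n1 := w1.ne'
  have n2 := w2.ne'
  field_simp
  linear_combination -total2

noncomputable def GH (N : ℕ) : ℚ :=
  ∑ f ∈ N.divisors.filter (fun f => f ^ 2 ∣ N), Wcl (-((N / f ^ 2 : ℕ) : ℤ))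

noncomputable def GH0 (p N : ℕ) : ℚ :=
  ∑ f ∈ N.divisors.filter (fun f => f ^ 2 ∣ N ∧ ¬ p ∣ f), Wcl (-((N / f ^ 2 : ℕ) : ℤ))

lemma hurwitzNat_eq (N : ℕ) : hurwitzNat N = if 0 < N ∧ (N % 4 = 0 ∨ N % 4 = 3) then GH N else 0 := rfl

lemma GH_split {p N : ℕ} (hp : p.Prime) (hN : 0 < N) :
    GH N = GH0 p N + if p ^ 2 ∣ N then GH (N / p ^ 2) else 0 := by
  have h1 : GH N = GH0 p N + ∑ f ∈ N.divisors.filter (fun f => f ^ 2 ∣ N ∧ p ∣ f), Wcl (-((N / f ^ 2 : ℕ) : ℤ)) := by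
    unfold GH GH0
    rw [← Finset.sum_filter_add_sum_filter_not _ (fun f => ¬ p ∣ f)]
    rw [Finset.filter_filter, Finset.filter_filter]
    simp only [not_not]
  rw [h1]
  congr 1
  have hp0 := hp.pos
  split_ifs with hd
  · symm
    obtain ⟨m, rfl⟩ := hd
    have hm : 0 < m := Nat.pos_of_ne_zero (by rintro rfl; simp at hN)
    rw [Nat.mul_div_cancel_left _ (by positivity)]
    unfold GH
    apply Finset.sum_bij (fun f _ => p * f)
    · intro f hf
      simp only [Finset.mem_filter, Nat.mem_divisors] at hf ⊢
      have : (p * f) ^ 2 ∣ p ^ 2 * m := by rw [mul_pow]; exact mul_dvd_mul (dvd_refl _) hf.2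
      exact ⟨⟨(dvd_pow_self _ two_ne_zero).trans this, hN.ne'⟩, this, Dvd.intro _ rfl⟩
    · intro a _ b _ h
      exact Nat.eq_of_mul_eq_mul_left hp0 h
    · intro f hf
      simp only [Finset.mem_filter, Nat.mem_divisors] at hf
      obtain ⟨-, h2, g, rfl⟩ := hf
      rw [mul_pow] at h2
      have h3 := Nat.dvd_of_mul_dvd_mul_left (by positivity) h2
      exact ⟨g, by simp only [Finset.mem_filter, Nat.mem_divisors]; exact ⟨⟨(dvd_pow_self _ two_ne_zero).trans h3, hm.ne'⟩, h3⟩, rfl⟩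
    · intro f hf
      rw [mul_pow, Nat.mul_div_mul_left _ _ (by positivity)]
  · apply Finset.sum_eq_zero
    intro f hf
    simp only [Finset.mem_filter] at hf
    exact absurd ((pow_dvd_pow_of_dvd hf.2.2 2).trans hf.2.1) hd

lemma GH0_mul {p N : ℕ} [hp : Fact p.Prime] (hp2 : p ≠ 2) (hN : 0 < N) :
    GH0 p (p ^ 2 * N) = ∑ f ∈ N.divisors.filter (fun f => f ^ 2 ∣ N ∧ ¬ p ∣ f),
      (p - legendreSym p (-((N / f ^ 2 : ℕ) : ℤ))) * Wcl (-((N / f ^ 2 : ℕ) : ℤ)) := by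
  have hp0 := hp.out.pos
  unfold GH0
  apply Finset.sum_congr
  · ext f
    simp only [Finset.mem_filter, Nat.mem_divisors]
    constructor
    · rintro ⟨-, h2, h3⟩
      have hc : Nat.Coprime (f ^ 2) (p ^ 2) := Nat.Coprime.pow _ _ ((Nat.Prime.coprime_iff_not_dvd hp.out).mpr h3).symm
      have h4 := hc.dvd_of_dvd_mul_left h2
      exact ⟨⟨(dvd_pow_self _ two_ne_zero).trans h4, hN.ne'⟩, h4, h3⟩
    · rintro ⟨⟨h1, -⟩, h2, h3⟩
      exact ⟨⟨h1.mul_left _, by positivity⟩, h2.mul_left _, h3⟩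
  · intro f hf
    simp only [Finset.mem_filter, Nat.mem_divisors] at hf
    rw [Nat.mul_div_assoc _ hf.2.1]
    have hpos : 0 < N / f ^ 2 := Nat.div_pos (Nat.le_of_dvd hN hf.2.1) (by
      have : f ≠ 0 := by rintro rfl; simp at hf
      positivity)
    rw [← Wcl_mul hp2 (by omega)]
    congr 1
    push_cast; ring

lemma GH_rec1 {p N : ℕ} [hp : Fact p.Prime] (hp2 : p ≠ 2) (hN : 0 < N) (hd : p ∣ N) :
    GH (p ^ 2 * N) - GH N = p * (GH N - if p ^ 2 ∣ N then GH (N / p ^ 2) else 0) := by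
  have hp0 := hp.out.pos
  rw [GH_split hp.out (N := p ^ 2 * N) (by positivity), if_pos (Dvd.intro _ rfl), Nat.mul_div_cancel_left _ (by positivity)]
  have h2 := GH_split hp.out hN
  have : GH0 p (p ^ 2 * N) = p * GH0 p N := by
    rw [GH0_mul hp2 hN, GH0, Finset.mul_sum]
    apply Finset.sum_congr rfl
    intro f hf
    simp only [Finset.mem_filter, Nat.mem_divisors] at hf
    have : legendreSym p (-((N / f ^ 2 : ℕ) : ℤ)) = 0 := by
      rw [legendreSym.eq_zero_iff, ZMod.intCast_zmod_eq_zero_iff_dvd, dvd_neg]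
      have hc : Nat.Coprime p (f ^ 2) := Nat.Coprime.pow_right _ ((Nat.Prime.coprime_iff_not_dvd hp.out).mpr hf.2.2)
      have h3 : p ∣ f ^ 2 * (N / f ^ 2) := by rw [Nat.mul_div_cancel' hf.2.1]; exact hd
      exact_mod_cast hc.dvd_of_dvd_mul_left h3
    rw [this]; simp
  rw [this]
  linear_combination -p * h2

lemma GH_rec2 {p N : ℕ} [hp : Fact p.Prime] (hp2 : p ≠ 2) (hN : 0 < N) (hd : ¬ p ∣ N) :
    GH (p ^ 2 * N) = (p + 1 - legendreSym p (-(N : ℤ))) * GH N := by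
  have hp0 := hp.out.pos
  rw [GH_split hp.out (N := p ^ 2 * N) (by positivity), if_pos (Dvd.intro _ rfl), Nat.mul_div_cancel_left _ (by positivity)]
  have h2 := GH_split hp.out hN
  rw [if_neg (fun h => hd ((dvd_pow_self _ two_ne_zero).trans h)), add_zero] at h2
  have : GH0 p (p ^ 2 * N) = (p - legendreSym p (-(N : ℤ))) * GH0 p N := by
    rw [GH0_mul hp2 hN, GH0, Finset.mul_sum]
    apply Finset.sum_congr rfl
    intro f hf
    simp only [Finset.mem_filter, Nat.mem_divisors] at hf
    have : legendreSym p (-((N / f ^ 2 : ℕ) : ℤ)) = legendreSym p (-(N : ℤ)) := by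
      have e : (-(N : ℤ)) = (f : ℤ) ^ 2 * (-((N / f ^ 2 : ℕ) : ℤ)) := by
        have := Nat.mul_div_cancel' hf.2.1
        have h' : ((f ^ 2 * (N / f ^ 2) : ℕ) : ℤ) = N := by rw [this]
        rw [← h']; push_cast; ring
      rw [e, legendreSym.mul, legendreSym.sq_one', one_mul]
      intro h
      rw [Int.cast_natCast, ZMod.natCast_eq_zero_iff] at h
      exact hf.2.2 h
    rw [this]
  rw [this]
  linear_combination -(p - legendreSym p (-(N : ℤ)) : ℚ) * h2

lemma odd_sq_mod4 {p : ℕ} (hp : p.Prime) (hp2 : p ≠ 2) (N : ℕ) : (p ^ 2 * N) % 4 = N % 4 := by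
  have h := hp.eq_two_or_odd'.resolve_left hp2
  obtain ⟨k, rfl⟩ := h
  have : (2 * k + 1) ^ 2 * N = N + 4 * ((k ^ 2 + k) * N) := by ring
  omega

lemma hur_rec1 {p N : ℕ} (hp : p.Prime) (hp2 : p ≠ 2) (hd : p ∣ N) :
    hurwitzNat (p ^ 2 * N) - hurwitzNat N = p * (hurwitzNat N - if p ^ 2 ∣ N then hurwitzNat (N / p ^ 2) else 0) := by
  have hpf : Fact p.Prime := ⟨hp⟩
  have hp0 := hp.pos
  by_cases hN : 0 < N
  · have e1 : (0 < p ^ 2 * N) := by positivity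
    simp only [hurwitzNat_eq, odd_sq_mod4 hp hp2, hN, e1, true_and]
    by_cases h4 : N % 4 = 0 ∨ N % 4 = 3
    · simp only [h4, if_true]
      rw [GH_rec1 hp2 hN hd]
      congr 2
      split_ifs with h1 h2
      · rfl
      · exfalso; apply h2
        obtain ⟨m, rfl⟩ := h1
        rw [Nat.mul_div_cancel_left _ (by positivity)]
        rw [odd_sq_mod4 hp hp2] at h4
        exact ⟨Nat.pos_of_ne_zero (by rintro rfl; simp at hN), h4⟩
      · rfl
    · simp only [h4, if_false]
      split_ifs with h1 h2
      · exfalso; apply h4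
        obtain ⟨m, rfl⟩ := h1
        rw [Nat.mul_div_cancel_left _ (by positivity)] at h2
        rw [odd_sq_mod4 hp hp2]
        exact h2.2
      · simp
      · simp
  · have : N = 0 := by omega
    subst this
    simp [hurwitzNat]

lemma hur_rec2 {p N : ℕ} [hp : Fact p.Prime] (hp2 : p ≠ 2) (hd : ¬ p ∣ N) :
    hurwitzNat (p ^ 2 * N) = (p + 1 - legendreSym p (-(N : ℤ))) * hurwitzNat N := by
  have hp0 := hp.out.pos
  have hN : 0 < N := Nat.pos_of_ne_zero (by rintro rfl; simp at hd)
  have e1 : (0 < p ^ 2 * N) := by positivity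
  simp only [hurwitzNat_eq, odd_sq_mod4 hp.out hp2, hN, e1, true_and]
  split_ifs
  · exact GH_rec2 hp2 hN hd
  · simp

lemma Wcl_nonneg (d : ℤ) : 0 ≤ Wcl d := by
  unfold Wcl; have := wAut_pos d; positivity

lemma hurwitzNat_nonneg (N : ℕ) : 0 ≤ hurwitzNat N := by
  rw [hurwitzNat_eq]; split_ifs
  · exact Finset.sum_nonneg fun _ _ => Wcl_nonneg _
  · exact le_refl _

/-- local normal form at `p` (modulo `p^2`) -/
structure NF (p : ℕ) (B : TernMat) : Prop where
  h00 : (p : ℤ) ^ 2 ∣ B 0 0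
  h11 : (p : ℤ) ^ 2 ∣ B 1 1
  h02 : (p : ℤ) ^ 2 ∣ B 0 2
  h12 : (p : ℤ) ^ 2 ∣ B 1 2
  h01 : ¬ (p : ℤ) ∣ B 0 1

lemma complete_int {x : Fin 3 → ℤ} (hx : ∃ u v w : ℤ, u * x 0 + v * x 1 + w * x 2 = 1) :
    ∃ U : TernMat, U.det = 1 ∧ ∀ i, U i 0 = x i := by
  obtain ⟨u, v, w, h⟩ := hx
  obtain ⟨g, a, b, hg⟩ : ∃ g a b : ℤ, x 0 = g * a ∧ x 1 = g * b ∧ IsCoprime a b := by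
    by_cases h0 : Int.gcd (x 0) (x 1) = 0
    · rw [Int.gcd_eq_zero_iff] at h0
      exact ⟨0, 1, 0, by simp [h0.1], by simp [h0.2], isCoprime_one_left⟩
    · obtain ⟨a, b, hab, e1, e2⟩ := Int.exists_gcd_one (Nat.pos_of_ne_zero h0)
      exact ⟨Int.gcd (x 0) (x 1), a, b, by rw [mul_comm]; exact e1, by rw [mul_comm]; exact e2, by
        rw [Int.isCoprime_iff_gcd_eq_one]; exact hab⟩
  obtain ⟨e1, e2, r, s, hrs⟩ := hg
  refine ⟨!![x 0, -s, -a * w; x 1, r, -b * w; x 2, 0, u * a + v * b], ?_, ?_⟩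
  · rw [Matrix.det_fin_three]; simp
    rw [e1, e2] at h ⊢
    linear_combination h + ((u * a + v * b) * g + x 2 * w) * hrs
  · intro i; fin_cases i <;> simp

/-- a vector with content prime to `p` is a multiple of a primitive vector -/
lemma exists_prim_int {x : Fin 3 → ℤ} (hx : x ≠ 0) :
    ∃ (c : ℤ) (y : Fin 3 → ℤ), x = c • y ∧ ∃ u v w : ℤ, u * y 0 + v * y 1 + w * y 2 = 1 := by
  set g := Int.gcd (x 0) (Int.gcd (x 1) (x 2)) with hg
  have hg0 : g ≠ 0 := by
    intro h
    rw [hg, Int.gcd_eq_zero_iff] at h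
    have h2 : Int.gcd (x 1) (x 2) = 0 := by exact_mod_cast h.2
    rw [Int.gcd_eq_zero_iff] at h2
    apply hx; funext i; fin_cases i
    · exact h.1
    · exact h2.1
    · exact h2.2
  have d0 : (g : ℤ) ∣ x 0 := Int.gcd_dvd_left _ _
  have d12 : (g : ℤ) ∣ (Int.gcd (x 1) (x 2) : ℤ) := Int.gcd_dvd_right _ _
  obtain ⟨y0, h0⟩ := d0
  obtain ⟨y1, h1⟩ := d12.trans (Int.gcd_dvd_left _ _)
  obtain ⟨y2, h2⟩ := d12.trans (Int.gcd_dvd_right _ _)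
  refine ⟨g, ![y0, y1, y2], ?_, ?_⟩
  · funext i; fin_cases i
    · simpa using h0
    · simpa using h1
    · simpa using h2
  · have e1 := Int.gcd_eq_gcd_ab (x 0) (Int.gcd (x 1) (x 2))
    have e2 := Int.gcd_eq_gcd_ab (x 1) (x 2)
    rw [← hg] at e1
    set A := Int.gcdA (x 0) (Int.gcd (x 1) (x 2))
    set A' := Int.gcdB (x 0) (Int.gcd (x 1) (x 2))
    refine ⟨A, A' * Int.gcdA (x 1) (x 2), A' * Int.gcdB (x 1) (x 2), ?_⟩
    simp only [Matrix.cons_val_zero, Matrix.cons_val_one, Matrix.cons_val]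
    apply mul_left_cancel₀ (show (g : ℤ) ≠ 0 by exact_mod_cast hg0)
    linear_combination -e1 - A' * e2 - A * h0 - A' * Int.gcdA (x 1) (x 2) * h1 - A' * Int.gcdB (x 1) (x 2) * h2

lemma solve_lin {p : ℕ} (hp : p.Prime) {b : ℤ} (hb : ¬ (p : ℤ) ∣ b) (k : ℕ) (c : ℤ) :
    ∃ x : ℤ, (p : ℤ) ^ k ∣ c + x * b := by
  have hpp : Prime (p : ℤ) := Nat.prime_iff_prime_int.mp hp
  obtain ⟨u, v, huv⟩ : IsCoprime ((p : ℤ) ^ k) b := ((Prime.coprime_iff_not_dvd hpp).mpr hb).pow_left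
  exact ⟨-c * v, ⟨c * u, by linear_combination -c * huv⟩⟩

lemma two_not_dvd {p : ℕ} (hp : p.Prime) (hp2 : p ≠ 2) : ¬ (p : ℤ) ∣ 2 := by
  intro h
  have : p ∣ 2 := by exact_mod_cast h
  exact hp2 ((Nat.prime_dvd_prime_iff_eq hp Nat.prime_two).mp this)

lemma quadVal_sub_dvd {R : Type*} [CommRing R] (M : Matrix (Fin 3) (Fin 3) R) {d : R} {z y : Fin 3 → R}
    (h : ∀ j, d ∣ z j - y j) : d ∣ quadVal M z - quadVal M y := by
  unfold quadVal
  rw [← Finset.sum_sub_distrib]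
  apply Finset.dvd_sum
  intro i _
  rw [← Finset.sum_sub_distrib]
  apply Finset.dvd_sum
  intro j _
  have : z i * M i j * z j - y i * M i j * y j = (z i - y i) * (M i j * z j) + (y i * M i j) * (z j - y j) := by ring
  rw [this]
  exact dvd_add ((h i).mul_right _) ((h j).mul_left _)

lemma exists_NF {p : ℕ} [hp : Fact p.Prime] (hp2 : p ≠ 2) {B : TernMat} (hB : IsLat B)
    (hd : ¬ (p : ℤ) ^ 2 ∣ B.det) (hi : IsotropicP p B) : ∃ C, LatIsom B C ∧ NF p C := by
  have hpp : Prime (p : ℤ) := Nat.prime_iff_prime_int.mp hp.out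
  -- step 1
  obtain ⟨e, he0, hev⟩ : ∃ e : Fin 3 → ℤ, (∃ u v w : ℤ, u * e 0 + v * e 1 + w * e 2 = 1) ∧ (p : ℤ) ^ 2 ∣ quadVal B e := by
    obtain ⟨x, hx, hx0⟩ := hi
    obtain ⟨k, y, rfl, i, hy⟩ := exists_primitive_vec hx
    rw [quadVal_smul] at hx0
    have h0' : quadVal (padicMat p B) y = 0 :=
      (mul_eq_zero.mp hx0).resolve_left (pow_ne_zero _ (pow_ne_zero _ padic_prime.ne_zero))
    have happ : ∀ j, ∃ k : ℤ, (p : ℤ_[p]) ^ 2 ∣ (k : ℤ_[p]) - y j := by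
      intro j
      have h := PadicInt.appr_spec 2 (y j)
      rw [Ideal.mem_span_singleton] at h
      refine ⟨((y j).appr 2 : ℤ), ?_⟩
      rw [← neg_sub, dvd_neg]
      exact_mod_cast h
    choose z hz using happ
    have hzi : ¬ (p : ℤ) ∣ z i := by
      rw [← padic_intCast_dvd_iff']
      intro h
      rw [padic_isUnit_iff_not_dvd] at hy
      apply hy
      have : y i = z i - (z i - y i) := by ring
      rw [this]; exact dvd_sub h ((dvd_pow_self _ two_ne_zero).trans (hz i))
    have hQ : (p : ℤ) ^ 2 ∣ quadVal B z := by
      rw [← padic_intCast_dvd_iff, ← quadVal_padicMat]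
      have h := quadVal_sub_dvd (padicMat p B) (d := (p : ℤ_[p]) ^ 2) (z := fun j => (z j : ℤ_[p])) hz
      rwa [h0', sub_zero] at h
    have hz0 : z ≠ 0 := by rintro rfl; simp at hzi
    obtain ⟨c, e, rfl, he⟩ := exists_prim_int hz0
    refine ⟨e, he, ?_⟩
    rw [quadVal_smul] at hQ
    have hc : ¬ (p : ℤ) ∣ c := fun h => hzi (by simpa using h.mul_right _)
    have hcc : IsCoprime ((p : ℤ) ^ 2) (c ^ 2) := ((Prime.coprime_iff_not_dvd hpp).mpr hc).pow
    exact hcc.dvd_of_dvd_mul_left hQ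
  obtain ⟨U, hU, hUe⟩ := complete_int he0
  obtain ⟨C1, hC1⟩ : ∃ C1, C1 = Uᵀ * B * U := ⟨_, rfl⟩
  have l1 : LatIsom B C1 := ⟨U, by simp [hU], hC1.symm⟩
  have c00 : (p : ℤ) ^ 2 ∣ C1 0 0 := by
    rw [hC1, conj_apply]
    have : (fun k => U k 0) = e := funext hUe
    rw [this]; exact hev
  have hL1 := isLat_of_latIsom hB l1
  have hd1 : C1.det = B.det := det_of_latIsom l1
  -- step 2
  obtain ⟨C2, l2, d00, d01⟩ : ∃ C2, LatIsom B C2 ∧ (p : ℤ) ^ 2 ∣ C2 0 0 ∧ ¬ (p : ℤ) ∣ C2 0 1 := by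
    by_cases h : (p : ℤ) ∣ C1 0 1
    · obtain ⟨W, hW⟩ : ∃ W : TernMat, W = !![1, 0, 0; 0, 0, 1; 0, 1, 0] := ⟨_, rfl⟩
      refine ⟨Wᵀ * C1 * W, l1.trans ⟨W, ?_, rfl⟩, ?_, ?_⟩
      · rw [hW, Matrix.det_fin_three]; simp
      · rw [hW]; simpa [Matrix.mul_apply, Fin.sum_univ_three] using c00
      · rw [hW]; simp [Matrix.mul_apply, Fin.sum_univ_three]
        intro h2
        apply hd
        rw [← hd1, Matrix.det_fin_three, hL1.e10, hL1.e20, hL1.e21]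
        obtain ⟨a, ha⟩ := c00
        obtain ⟨b, hb⟩ := h
        obtain ⟨c, hc⟩ := h2
        rw [ha, hb, hc]
        exact ⟨a * C1 1 1 * C1 2 2 - a * C1 1 2 * C1 1 2 - b * b * C1 2 2 + b * C1 1 2 * c + c * b * C1 1 2 - c * C1 1 1 * c, by ring⟩
    · exact ⟨C1, l1, c00, h⟩
  have hL2 := isLat_of_latIsom hB l2
  have h2b : ¬ (p : ℤ) ∣ 2 * C2 0 1 := fun h => (hpp.dvd_or_dvd h).elim (two_not_dvd hp.out hp2) d01
  obtain ⟨k, hk⟩ := solve_lin hp.out h2b 2 (C2 1 1)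
  obtain ⟨t, ht⟩ := solve_lin hp.out d01 2 (C2 0 2)
  obtain ⟨s, hs⟩ := solve_lin hp.out d01 2 (C2 1 2 + t * C2 1 1)
  obtain ⟨W, hW⟩ : ∃ W : TernMat, W = !![1, k, s; 0, 1, t; 0, 0, 1] := ⟨_, rfl⟩
  refine ⟨Wᵀ * C2 * W, l2.trans ⟨W, by rw [hW, Matrix.det_fin_three]; simp, rfl⟩, ?_⟩
  obtain ⟨a, ha⟩ := d00
  obtain ⟨k', hk'⟩ := hk
  obtain ⟨t', ht'⟩ := ht
  obtain ⟨s', hs'⟩ := hs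
  constructor
  · rw [hW]; simp [Matrix.mul_apply, Fin.sum_univ_three]; exact ⟨a, ha⟩
  · rw [hW]; simp [Matrix.mul_apply, Fin.sum_univ_three]
    rw [hL2.e10]
    exact ⟨k' + k ^ 2 * a, by linear_combination hk' + k ^ 2 * ha⟩
  · rw [hW]; simp [Matrix.mul_apply, Fin.sum_univ_three]
    exact ⟨t' + s * a, by linear_combination ht' + s * ha⟩
  · rw [hW]; simp [Matrix.mul_apply, Fin.sum_univ_three]
    rw [hL2.e10]
    exact ⟨s' + k * t' + k * s * a, by linear_combination hs' + k * ht' + k * s * ha⟩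
  · rw [hW]; simp [Matrix.mul_apply, Fin.sum_univ_three]
    rw [ha]
    intro h
    apply d01
    have : C2 0 1 = ((p : ℤ) ^ 2 * a * k + C2 0 1) - p * (p * a * k) := by ring
    rw [this]; exact dvd_sub h (Dvd.intro _ rfl)

lemma NF.det22 {p : ℕ} [hp : Fact p.Prime] {B : TernMat} (hB : IsLat B) (h : NF p B) (hd1 : (p : ℤ) ∣ B.det)
    (hd2 : ¬ (p : ℤ) ^ 2 ∣ B.det) : (p : ℤ) ∣ B 2 2 ∧ ¬ (p : ℤ) ^ 2 ∣ B 2 2 := by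
  have hpp : Prime (p : ℤ) := Nat.prime_iff_prime_int.mp hp.out
  obtain ⟨a, ha⟩ := h.h00
  obtain ⟨b, hb⟩ := h.h11
  obtain ⟨c, hc⟩ := h.h02
  obtain ⟨d, hdd⟩ := h.h12
  have key : ∃ z, B.det = - (B 0 1 ^ 2 * B 2 2) + (p : ℤ) ^ 2 * z := by
    rw [Matrix.det_fin_three, hB.e10, hB.e20, hB.e21, ha, hb, hc, hdd]
    exact ⟨a * p ^ 2 * b * B 2 2 - a * (p ^ 2 * d) * (p ^ 2 * d) + B 0 1 * (p ^ 2 * d) * c + c * B 0 1 * (p ^ 2 * d) - c * (p ^ 2 * b) * (p ^ 2 * c), by ring⟩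
  obtain ⟨z, hz⟩ := key
  constructor
  · have : (p : ℤ) ∣ B 0 1 ^ 2 * B 2 2 := by
      have e : B 0 1 ^ 2 * B 2 2 = p * (p * z) - B.det := by linear_combination hz
      rw [e]; exact dvd_sub (Dvd.intro _ rfl) hd1
    exact (hpp.dvd_or_dvd this).resolve_left (fun h' => h.h01 (hpp.dvd_of_dvd_pow h'))
  · intro h2
    apply hd2
    rw [hz]
    exact dvd_add (dvd_neg.mpr (h2.mul_left _)) (Dvd.intro _ rfl)

abbrev GCls (A : TernMat) := Quot fun B C : {B : TernMat // InGenus A B} => LatIsom B.1 C.1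

lemma gcls_eq {A : TernMat} {B C : {B : TernMat // InGenus A B}}
    (h : (Quot.mk _ B : GCls A) = Quot.mk _ C) : LatIsom B.1 C.1 := by
  have h2 := Quot.eqvGen_exact h
  clear h
  induction h2 with
  | rel x y h => exact h
  | refl x => exact LatIsom.refl _
  | symm x y _ ih => exact ih.symm
  | trans x y z _ _ ih1 ih2 => exact ih1.trans ih2

lemma gcls_finite {A : TernMat} (hA : IsLat A) : Finite (GCls A) := by
  obtain ⟨S, hS, h⟩ := finite_reduced A.det
  have : Finite S := hS
  have hex : ∀ c : GCls A, ∃ s : S, LatIsom (Quot.out c).1 s.1 := by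
    intro c
    obtain ⟨C, hC, hl⟩ := h _ (Quot.out c).2.1 (genus_det hA (Quot.out c).2)
    exact ⟨⟨C, hC⟩, hl⟩
  choose F hF using hex
  apply Finite.of_injective F
  intro c c' hcc
  rw [← Quot.out_eq c, ← Quot.out_eq c']
  apply Quot.sound
  have h1 := hF c
  rw [hcc] at h1
  exact h1.trans (hF c').symm

lemma genus_setup {A : TernMat} (hA : IsLat A) (P : TernMat → Prop)
    (hP : ∀ B, InGenus A B → ∃ C, LatIsom B C ∧ P C) :
    ∃ (m : ℕ) (ω : Fin m → TernMat), (∀ i, InGenus A (ω i) ∧ P (ω i)) ∧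
      (∀ B, InGenus A B → ∃ i, LatIsom B (ω i)) ∧ (∀ i j, LatIsom (ω i) (ω j) → i = j) ∧
      ∃ w : ℝ, w ≠ 0 ∧ ∀ n, rGenus n A = w * ∑ i, (rRep n (ω i) : ℝ) / (numAut (ω i) : ℝ) := by
  have := gcls_finite hA
  have : Fintype (GCls A) := Fintype.ofFinite _
  have e := (Fintype.equivFin (GCls A)).symm
  choose! N hN1 hN2 using hP
  refine ⟨_, fun i => N (Quot.out (e i)).1, ?_, ?_, ?_, (massOf A)⁻¹, ?_, ?_⟩
  · intro i
    exact ⟨InGenus.of_latIsom (Quot.out (e i)).2 (hN1 _ (Quot.out (e i)).2), hN2 _ (Quot.out (e i)).2⟩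
  · intro B hB
    refine ⟨e.symm (Quot.mk _ ⟨B, hB⟩), ?_⟩
    simp only [Equiv.apply_symm_apply]
    refine LatIsom.trans ?_ (hN1 _ (Quot.out (Quot.mk _ ⟨B, hB⟩ : GCls A)).2)
    exact gcls_eq (B := ⟨B, hB⟩) (Quot.out_eq _).symm
  · intro i j h
    apply e.injective
    rw [← Quot.out_eq (e i), ← Quot.out_eq (e j)]
    apply Quot.sound
    exact ((hN1 _ (Quot.out (e i)).2).trans h).trans (hN1 _ (Quot.out (e j)).2).symm
  · apply inv_ne_zero
    apply ne_of_gt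
    unfold massOf
    rw [finsum_eq_sum_of_fintype]
    apply Finset.sum_pos
    · intro c _
      have := numAut_pos (Quot.out c).2.1
      positivity
    · exact ⟨Quot.mk _ ⟨A, InGenus.refl hA⟩, Finset.mem_univ _⟩
  · intro n
    unfold rGenus
    congr 1
    rw [finsum_eq_sum_of_fintype, ← e.sum_comp]
    apply Finset.sum_congr rfl
    intro i _
    have hl := hN1 _ (Quot.out (e i)).2
    rw [rRep_congr hl, numAut_congr hl]

def T0 (p k t : ℤ) : TernMat := !![1, 0, 0; k, p ^ 2, 0; t, 0, p]
def T0i (p k t : ℤ) : TernMat := !![p ^ 2, 0, 0; -k, 1, 0; -t * p, 0, p]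
def sw : TernMat := !![0, 1, 0; 1, 0, 0; 0, 0, 1]

lemma sw_sq : sw * sw = 1 := by
  ext i j; fin_cases i <;> fin_cases j <;> simp [sw, Matrix.mul_apply, Fin.sum_univ_three]

lemma T0_mul (p k t : ℤ) : T0 p k t * T0i p k t = p ^ 2 • (1 : TernMat) := by
  ext i j; fin_cases i <;> fin_cases j <;> simp [T0, T0i, Matrix.mul_apply, Fin.sum_univ_three] <;> ring

/-- the parameter `k` of the neighbour with parameter `t` -/
noncomputable def kf (p : ℕ) (B : TernMat) (t : ℤ) : ℤ :=
  if h : ∃ k : ℤ, (p : ℤ) ^ 2 ∣ t ^ 2 * B 2 2 + k * (2 * B 0 1) then h.choose else 0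

noncomputable def Trep (p : ℕ) (B : TernMat) (r : Bool × Fin p) : TernMat :=
  if r.1 then sw * T0 p (kf p B ((r.2 : ℕ) : ℤ)) ((r.2 : ℕ) : ℤ)
  else T0 p (kf p B ((r.2 : ℕ) : ℤ)) ((r.2 : ℕ) : ℤ)

noncomputable def Trepi (p : ℕ) (B : TernMat) (r : Bool × Fin p) : TernMat :=
  if r.1 then T0i p (kf p B ((r.2 : ℕ) : ℤ)) ((r.2 : ℕ) : ℤ) * sw
  else T0i p (kf p B ((r.2 : ℕ) : ℤ)) ((r.2 : ℕ) : ℤ)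

lemma Trep_mul (p : ℕ) (B : TernMat) (r : Bool × Fin p) :
    Trep p B r * Trepi p B r = (p : ℤ) ^ 2 • (1 : TernMat) := by
  unfold Trep Trepi
  split_ifs
  · rw [Matrix.mul_assoc, ← Matrix.mul_assoc (T0 _ _ _), T0_mul, Matrix.smul_mul, Matrix.one_mul,
      Matrix.mul_smul, sw_sq]
  · exact T0_mul _ _ _

lemma sw_det : sw.det = -1 := by simp [sw, Matrix.det_fin_three]

lemma T0_det (p k t : ℤ) : (T0 p k t).det = p ^ 3 := by simp [T0, Matrix.det_fin_three]; ring

lemma Trep_det (p : ℕ) (B : TernMat) (r : Bool × Fin p) : (Trep p B r).det ^ 2 = (p : ℤ) ^ 6 := by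
  unfold Trep
  split_ifs
  · rw [Matrix.det_mul, sw_det, T0_det]; ring
  · rw [T0_det]; ring

section
variable {p : ℕ} [hp : Fact p.Prime]

lemma kf_spec (hp2 : p ≠ 2) {B : TernMat} (h : NF p B) (t : ℤ) :
    (p : ℤ) ^ 2 ∣ t ^ 2 * B 2 2 + kf p B t * (2 * B 0 1) := by
  have hpp : Prime (p : ℤ) := Nat.prime_iff_prime_int.mp hp.out
  have h2b : ¬ (p : ℤ) ∣ 2 * B 0 1 := fun h' => (hpp.dvd_or_dvd h').elim (two_not_dvd hp.out hp2) h.h01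
  have he := solve_lin hp.out h2b 2 (t ^ 2 * B 2 2)
  unfold kf
  rw [dif_pos he]
  exact he.choose_spec

lemma kf_dvd (hp2 : p ≠ 2) {B : TernMat} (h : NF p B) (hc : (p : ℤ) ∣ B 2 2) (t : ℤ) :
    (p : ℤ) ∣ kf p B t := by
  have hpp : Prime (p : ℤ) := Nat.prime_iff_prime_int.mp hp.out
  have h2b : ¬ (p : ℤ) ∣ 2 * B 0 1 := fun h' => (hpp.dvd_or_dvd h').elim (two_not_dvd hp.out hp2) h.h01
  have h1 := (dvd_pow_self (p : ℤ) two_ne_zero).trans (kf_spec hp2 h t)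
  have h3 : (p : ℤ) ∣ kf p B t * (2 * B 0 1) := (dvd_add_right (hc.mul_left _)).mp h1
  exact (hpp.dvd_or_dvd h3).resolve_right h2b

/-- quadratic form modulo `p^2` in normal form -/
lemma NF.quad {B : TernMat} (hB : B.IsSymm) (h : NF p B) (x : Fin 3 → ℤ) :
    ∃ z, quadVal B x = 2 * B 0 1 * x 0 * x 1 + B 2 2 * x 2 ^ 2 + (p : ℤ) ^ 2 * z := by
  obtain ⟨a, ha⟩ := h.h00
  obtain ⟨b, hb⟩ := h.h11
  obtain ⟨c, hc⟩ := h.h02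
  obtain ⟨d, hdd⟩ := h.h12
  rw [quadVal_three, hB.apply 0 1, hB.apply 0 2, hB.apply 1 2, ha, hb, hc, hdd]
  exact ⟨x 0 * a * x 0 + 2 * x 0 * c * x 2 + x 1 * b * x 1 + 2 * x 1 * d * x 2, by ring⟩

lemma NF.mulVec {B : TernMat} (hB : B.IsSymm) (h : NF p B) (x : Fin 3 → ℤ) :
    (∃ z, (B *ᵥ x) 0 = B 0 1 * x 1 + (p : ℤ) ^ 2 * z) ∧ (∃ z, (B *ᵥ x) 1 = B 0 1 * x 0 + (p : ℤ) ^ 2 * z) ∧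
      (∃ z, (B *ᵥ x) 2 = B 2 2 * x 2 + (p : ℤ) ^ 2 * z) := by
  obtain ⟨a, ha⟩ := h.h00
  obtain ⟨b, hb⟩ := h.h11
  obtain ⟨c, hc⟩ := h.h02
  obtain ⟨d, hdd⟩ := h.h12
  simp only [Matrix.mulVec, dotProduct, Fin.sum_univ_three]
  rw [hB.apply 0 1, hB.apply 0 2, hB.apply 1 2, ha, hb, hc, hdd]
  exact ⟨⟨a * x 0 + c * x 2, by ring⟩, ⟨b * x 1 + d * x 2, by ring⟩, ⟨c * x 0 + d * x 1, by ring⟩⟩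

lemma NF.swap {B : TernMat} (hB : B.IsSymm) (h : NF p B) : NF p (swᵀ * B * sw) := by
  constructor <;> simp [sw, Matrix.mul_apply, Fin.sum_univ_three]
  · exact h.h11
  · exact h.h00
  · exact h.h12
  · exact h.h02
  · rw [hB.apply 0 1]; exact h.h01

lemma T0_image (k t : ℤ) (x : Fin 3 → ℤ) : (∃ y, x = T0 p k t *ᵥ y) ↔
    (p : ℤ) ^ 2 ∣ x 1 - k * x 0 ∧ (p : ℤ) ∣ x 2 - t * x 0 := by
  constructor
  · rintro ⟨y, rfl⟩
    simp [T0, Matrix.mulVec, dotProduct, Fin.sum_univ_three]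
  · rintro ⟨⟨a, ha⟩, ⟨b, hb⟩⟩
    refine ⟨![x 0, a, b], ?_⟩
    funext i; fin_cases i <;> simp [T0, Matrix.mulVec, dotProduct, Fin.sum_univ_three]
    · linear_combination ha
    · linear_combination hb

lemma sw_mulVec (x : Fin 3 → ℤ) : sw *ᵥ x = ![x 1, x 0, x 2] := by
  funext i; fin_cases i <;> simp [sw, Matrix.mulVec, dotProduct, Fin.sum_univ_three]

lemma Trep_image (B : TernMat) (r : Bool × Fin p) (x : Fin 3 → ℤ) : (∃ y, x = Trep p B r *ᵥ y) ↔
    if r.1 then ((p : ℤ) ^ 2 ∣ x 0 - kf p B ((r.2 : ℕ) : ℤ) * x 1 ∧ (p : ℤ) ∣ x 2 - ((r.2 : ℕ) : ℤ) * x 1)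
    else ((p : ℤ) ^ 2 ∣ x 1 - kf p B ((r.2 : ℕ) : ℤ) * x 0 ∧ (p : ℤ) ∣ x 2 - ((r.2 : ℕ) : ℤ) * x 0) := by
  unfold Trep
  split_ifs
  · have h := T0_image (p := p) (kf p B ((r.2 : ℕ) : ℤ)) ((r.2 : ℕ) : ℤ) (sw *ᵥ x)
    rw [sw_mulVec] at h
    simp only [Matrix.cons_val_zero, Matrix.cons_val_one, Matrix.cons_val] at h
    rw [← h]
    constructor
    · rintro ⟨y, hy⟩
      refine ⟨y, ?_⟩
      rw [← sw_mulVec, hy, ← Matrix.mulVec_mulVec, Matrix.mulVec_mulVec _ sw sw, sw_sq, Matrix.one_mulVec]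
    · rintro ⟨y, hy⟩
      refine ⟨y, ?_⟩
      rw [← Matrix.mulVec_mulVec, ← hy, ← sw_mulVec, Matrix.mulVec_mulVec, sw_sq, Matrix.one_mulVec]
  · exact T0_image _ _ x

/-- Core: columns of an isometry with first coordinate of some column prime to `p`. -/
lemma image_of_cols (hp2 : p ≠ 2) {B : TernMat} (hB : B.IsSymm) (h : NF p B) (hc1 : (p : ℤ) ∣ B 2 2)
    (hc2 : ¬ (p : ℤ) ^ 2 ∣ B 2 2) {x : Fin 3 → ℤ} (hx : (p : ℤ) ^ 2 ∣ quadVal B x) (hx0 : ¬ (p : ℤ) ∣ x 0) :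
    ∃ t : Fin p, ∀ y : Fin 3 → ℤ, (p : ℤ) ^ 2 ∣ quadVal B y → (p : ℤ) ^ 2 ∣ y ⬝ᵥ (B *ᵥ x) →
      (p : ℤ) ^ 2 ∣ y 1 - kf p B ((t : ℕ) : ℤ) * y 0 ∧ (p : ℤ) ∣ y 2 - ((t : ℕ) : ℤ) * y 0 := by
  have hpp : Prime (p : ℤ) := Nat.prime_iff_prime_int.mp hp.out
  have hpos : (0 : ℤ) < p := by exact_mod_cast hp.out.pos
  have h2 := two_not_dvd hp.out hp2
  obtain ⟨t0, ht0⟩ := solve_lin hp.out hx0 1 (-x 2)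
  rw [pow_one] at ht0
  have hj0 := Int.emod_nonneg t0 hpos.ne'
  have hjp := Int.emod_lt_of_pos t0 hpos
  have e : (((t0 % p).toNat : ℕ) : ℤ) = t0 % p := Int.toNat_of_nonneg hj0
  refine ⟨⟨(t0 % p).toNat, by omega⟩, ?_⟩
  simp only [e]
  obtain ⟨t, htt⟩ : ∃ t, t = t0 % p := ⟨_, rfl⟩
  rw [← htt]
  have ht : (p : ℤ) ∣ x 2 - t * x 0 := by
    have e2 := Int.emod_add_mul_ediv t0 p
    rw [← htt] at e2
    obtain ⟨m, hm⟩ := ht0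
    exact ⟨-m + (t0 / p) * x 0, by linear_combination -hm - x 0 * e2⟩
  have hk := kf_spec hp2 h t
  have hkd := kf_dvd hp2 h hc1 t
  obtain ⟨k, hkk⟩ : ∃ k, k = kf p B t := ⟨_, rfl⟩
  rw [← hkk] at hk hkd ⊢
  obtain ⟨c, hc⟩ := hc1
  obtain ⟨u, hu⟩ := ht
  have hu' : x 2 = t * x 0 + p * u := by linear_combination hu
  obtain ⟨z, hz⟩ := h.quad hB x
  obtain ⟨kk, hk⟩ := hk
  obtain ⟨xx, hxx⟩ := hx
  have hb0 : ¬ (p : ℤ) ∣ 2 * B 0 1 * x 0 := by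
    intro h'; rcases hpp.dvd_or_dvd h' with h' | h'
    · exact (hpp.dvd_or_dvd h').elim h2 h.h01
    · exact hx0 h'
  have hx1 : (p : ℤ) ^ 2 ∣ x 1 - k * x 0 := by
    have hd : (p : ℤ) ^ 2 ∣ (2 * B 0 1 * x 0) * (x 1 - k * x 0) := by
      rw [hu', hc] at hz
      rw [hc] at hk
      refine ⟨xx - z - c * p * u ^ 2 - 2 * c * t * x 0 * u - kk * x 0 ^ 2, ?_⟩
      linear_combination -hz + hxx - x 0 ^ 2 * hk
    exact IsCoprime.dvd_of_dvd_mul_left (((Prime.coprime_iff_not_dvd hpp).mpr hb0).pow_left) hd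
  obtain ⟨w, hw⟩ := hx1
  have hw' : x 1 = k * x 0 + p ^ 2 * w := by linear_combination hw
  intro y hy hyx
  obtain ⟨zy, hzy⟩ := h.quad hB y
  obtain ⟨⟨m0, hm0⟩, ⟨m1, hm1⟩, ⟨m2, hm2⟩⟩ := h.mulVec hB x
  have hdot : y ⬝ᵥ (B *ᵥ x) = y 0 * (B *ᵥ x) 0 + y 1 * (B *ᵥ x) 1 + y 2 * (B *ᵥ x) 2 := by
    simp [dotProduct, Fin.sum_univ_three]
  rw [hdot, hm0, hm1, hm2] at hyx
  obtain ⟨s, hs⟩ := hyx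
  obtain ⟨v, hv⟩ := hy
  -- polar relation: `p^2 ∣ B01 x0 (y1 - k y0) + B22 t x0 (y2 - t y0)`
  have r1 : (p : ℤ) ^ 2 ∣ x 0 * (2 * B 0 1 * (y 1 - k * y 0) + 2 * B 2 2 * t * (y 2 - t * y 0)) := by
    rw [hw', hu', hc] at hs
    rw [hc] at hk ⊢
    refine ⟨2 * s - 2 * y 0 * m0 - 2 * y 1 * m1 - 2 * y 2 * m2 - 2 * y 0 * B 0 1 * w - 2 * y 2 * c * u - 2 * x 0 * y 0 * kk, ?_⟩
    linear_combination 2 * hs - 2 * x 0 * y 0 * hk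
  have r2 : (p : ℤ) ^ 2 ∣ (2 * B 0 1 * (y 1 - k * y 0) + 2 * B 2 2 * t * (y 2 - t * y 0)) :=
    IsCoprime.dvd_of_dvd_mul_left (((Prime.coprime_iff_not_dvd hpp).mpr hx0).pow_left) r1
  -- value: `Q(y) = y0 * (...) + B22 (y2 - t y0)^2`
  have r3 : (p : ℤ) ^ 2 ∣ B 2 2 * (y 2 - t * y 0) ^ 2 := by
    obtain ⟨q, hq⟩ := r2
    refine ⟨v - zy - kk * y 0 ^ 2 - y 0 * q - 0, ?_⟩
    linear_combination hv - hzy - y 0 * hq - y 0 ^ 2 * hk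
  have r4 : (p : ℤ) ∣ y 2 - t * y 0 := by
    by_contra hn
    apply hc2
    have hn2 : ¬ (p : ℤ) ∣ (y 2 - t * y 0) ^ 2 := fun h' => hn (hpp.dvd_of_dvd_pow h')
    exact IsCoprime.dvd_of_dvd_mul_right (((Prime.coprime_iff_not_dvd hpp).mpr hn2).pow_left) r3
  refine ⟨?_, r4⟩
  have hb1 : ¬ (p : ℤ) ∣ 2 * B 0 1 := fun h' => (hpp.dvd_or_dvd h').elim h2 h.h01
  have r5 : (p : ℤ) ^ 2 ∣ (2 * B 0 1) * (y 1 - k * y 0) := by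
    obtain ⟨q, hq⟩ := r2
    obtain ⟨l, hl⟩ := r4
    rw [hl, hc] at hq
    exact ⟨q - 2 * c * t * l, by linear_combination hq⟩
  exact IsCoprime.dvd_of_dvd_mul_left (((Prime.coprime_iff_not_dvd hpp).mpr hb1).pow_left) r5

end

/-- `T` is a primitive similitude of norm `p^2` from `B'` into `B`. -/
def PIso (p : ℕ) (B B' T : TernMat) : Prop :=
  Tᵀ * B * T = (p : ℤ) ^ 2 • B' ∧ ∃ i j, ¬ (p : ℤ) ∣ T i j

structure GoodL (p : ℕ) (B : TernMat) : Prop where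
  lat : IsLat B
  nf : NF p B
  c1 : (p : ℤ) ∣ B 2 2
  c2 : ¬ (p : ℤ) ^ 2 ∣ B 2 2

section
variable {p : ℕ} [hp : Fact p.Prime]

lemma kf_swap {B : TernMat} (hB : B.IsSymm) (t : ℤ) : kf p (swᵀ * B * sw) t = kf p B t := by
  have e1 : (swᵀ * B * sw) 2 2 = B 2 2 := by simp [sw, Matrix.mul_apply, Fin.sum_univ_three]
  have e2 : (swᵀ * B * sw) 0 1 = B 0 1 := by
    simp [sw, Matrix.mul_apply, Fin.sum_univ_three]; exact hB.apply 0 1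
  unfold kf
  rw [e1, e2]

lemma swB22 (B : TernMat) : (swᵀ * B * sw) 2 2 = B 2 2 := by
  simp [sw, Matrix.mul_apply, Fin.sum_univ_three]

lemma iso_col_quad {B B' T : TernMat} (h : Tᵀ * B * T = (p : ℤ) ^ 2 • B') (j : Fin 3) :
    (p : ℤ) ^ 2 ∣ quadVal B (fun i => T i j) := by
  rw [← conj_apply, h]; exact ⟨B' j j, by simp⟩

lemma iso_col_dot {B B' T : TernMat} (h : Tᵀ * B * T = (p : ℤ) ^ 2 • B') (i j : Fin 3) :
    (p : ℤ) ^ 2 ∣ (fun k => T k i) ⬝ᵥ (B *ᵥ (fun k => T k j)) := by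
  have e : (fun k => T k i) ⬝ᵥ (B *ᵥ (fun k => T k j)) = (Tᵀ * B * T) i j := by
    rw [Matrix.mul_assoc]
    simp [dotProduct, Matrix.mul_apply, Matrix.mulVec]
  rw [e, h]; exact ⟨B' i j, by simp⟩

lemma iso_cols {B B' T : TernMat} (hp2 : p ≠ 2) (g : GoodL p B) (h : PIso p B B' T) :
    ∃ r : Bool × Fin p, ∀ j, ∃ y, (fun i => T i j) = Trep p B r *ᵥ y := by
  have hpp : Prime (p : ℤ) := Nat.prime_iff_prime_int.mp hp.out
  obtain ⟨h1, i, j, hij⟩ := h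
  have key : ¬ (p : ℤ) ∣ T 0 j ∨ ¬ (p : ℤ) ∣ T 1 j := by
    by_contra hcon
    push Not at hcon
    obtain ⟨⟨a, ha⟩, ⟨b, hb⟩⟩ := hcon
    obtain ⟨z, hz⟩ := g.nf.quad g.lat.1 (fun i => T i j)
    obtain ⟨w, hw⟩ := iso_col_quad h1 j
    have hd : (p : ℤ) ^ 2 ∣ B 2 2 * T 2 j ^ 2 := by
      rw [hw] at hz
      rw [ha, hb] at hz
      exact ⟨w - 2 * B 0 1 * a * b - z, by linear_combination -hz⟩
    have h2 : (p : ℤ) ∣ T 2 j := by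
      by_contra hn
      apply g.c2
      have hn2 : ¬ (p : ℤ) ∣ (T 2 j) ^ 2 := fun h' => hn (hpp.dvd_of_dvd_pow h')
      exact IsCoprime.dvd_of_dvd_mul_right (((Prime.coprime_iff_not_dvd hpp).mpr hn2).pow_left) hd
    apply hij
    fin_cases i
    · exact ⟨a, ha⟩
    · exact ⟨b, hb⟩
    · exact h2
  rcases key with h0 | h0
  · obtain ⟨t, ht⟩ := image_of_cols hp2 g.lat.1 g.nf g.c1 g.c2 (iso_col_quad h1 j) h0
    refine ⟨(false, t), fun l => (Trep_image B _ _).2 ?_⟩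
    simpa using ht _ (iso_col_quad h1 l) (iso_col_dot h1 l j)
  · have hs : (sw * T)ᵀ * (swᵀ * B * sw) * (sw * T) = (p : ℤ) ^ 2 • B' := by
      have e : swᵀ = sw := by ext i j; fin_cases i <;> fin_cases j <;> simp [sw]
      rw [← h1, Matrix.transpose_mul, e]
      calc Tᵀ * sw * (sw * B * sw) * (sw * T) = Tᵀ * (sw * sw) * B * (sw * sw) * T := by
            simp only [Matrix.mul_assoc]
        _ = _ := by rw [sw_sq]; simp [Matrix.mul_assoc]
    have ecol : ∀ l, (fun i => (sw * T) i l) = ![T 1 l, T 0 l, T 2 l] := by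
      intro l; funext i; fin_cases i <;> simp [sw, Matrix.mul_apply, Fin.sum_univ_three]
    obtain ⟨t, ht⟩ := image_of_cols (B := swᵀ * B * sw) hp2 (conj_symm g.lat.1 _) (g.nf.swap g.lat.1)
      (by rw [swB22]; exact g.c1) (by rw [swB22]; exact g.c2) (iso_col_quad hs j)
      (by rw [congrFun (ecol j) 0]; exact h0)
    refine ⟨(true, t), fun l => (Trep_image B _ _).2 ?_⟩
    have := ht _ (iso_col_quad hs l) (iso_col_dot hs l j)
    rw [kf_swap g.lat.1] at this
    have e0 : (sw * T) 0 l = T 1 l := congrFun (ecol l) 0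
    have e1 : (sw * T) 1 l = T 0 l := congrFun (ecol l) 1
    have e2 : (sw * T) 2 l = T 2 l := congrFun (ecol l) 2
    simpa [e0, e1, e2] using this

lemma det_eq_of_cols {T S V : TernMat} {d : ℤ} (hd : d ≠ 0) (h : T = S * V) (h1 : T.det ^ 2 = d) (h2 : S.det ^ 2 = d) :
    IsUnit V.det := by
  rw [h, Matrix.det_mul, mul_pow, h2] at h1
  have : V.det ^ 2 = 1 := by
    have h3 : d * (V.det ^ 2 - 1) = 0 := by linear_combination h1
    rcases mul_eq_zero.mp h3 with h4 | h4
    · exact absurd h4 hd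
    · linarith
  exact IsUnit.of_mul_eq_one (V.det) (by rw [← sq]; exact this)

lemma iso_det {B B' T : TernMat} (hB : IsLat B) (hd : B'.det = B.det) (h : Tᵀ * B * T = (p : ℤ) ^ 2 • B') :
    T.det ^ 2 = (p : ℤ) ^ 6 := by
  have h1 := congrArg Matrix.det h
  rw [det_gram_conj, Matrix.det_smul, hd] at h1
  have h2 := hB.posDet
  simp only [Fintype.card_fin] at h1
  have h3 : (T.det ^ 2 - (p : ℤ) ^ 6) * B.det = 0 := by linear_combination h1
  rcases mul_eq_zero.mp h3 with h4 | h4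
  · linarith
  · omega

lemma iso_classify {B B' T : TernMat} (hp2 : p ≠ 2) (g : GoodL p B) (hd : B'.det = B.det) (h : PIso p B B' T) :
    ∃ (r : Bool × Fin p) (V : TernMatˣ), T = Trep p B r * V.1 := by
  obtain ⟨r, hr⟩ := iso_cols hp2 g h
  choose y hy using hr
  have e : T = Trep p B r * (Matrix.of y)ᵀ := by
    ext i j
    have := congrFun (hy j) i
    rw [this]; simp [Matrix.mul_apply, Matrix.mulVec, dotProduct]
  have hu := det_eq_of_cols (by have := hp.out.pos; positivity) e (iso_det g.lat hd h.1) (Trep_det p B r)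
  obtain ⟨V, hV⟩ := (Matrix.isUnit_iff_isUnit_det _).2 hu
  exact ⟨r, V, by rw [hV]; exact e⟩

lemma Trep_mem_inj {B : TernMat} (hp2 : p ≠ 2) (g : GoodL p B) {r r' : Bool × Fin p}
    (h : ∃ y, (fun i => Trep p B r i 0) = Trep p B r' *ᵥ y) : r = r' := by
  have hp1 : ¬ (p : ℤ) ∣ 1 := (Nat.prime_iff_prime_int.mp hp.out).not_dvd_one
  have hk := fun t => kf_dvd hp2 g.nf g.c1 t
  have hfin : ∀ t t' : Fin p, (p : ℤ) ∣ ((t : ℕ) : ℤ) - ((t' : ℕ) : ℤ) → t = t' := by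
    intro t t' ht
    have h1 := t.2
    have h2 := t'.2
    have : ((t : ℕ) : ℤ) - ((t' : ℕ) : ℤ) = 0 := by
      apply Int.eq_zero_of_abs_lt_dvd ht
      rw [abs_lt]; constructor <;> omega
    exact Fin.ext (by omega)
  have hno : ∀ t t' : ℤ, ¬ (p : ℤ) ^ 2 ∣ 1 - kf p B t' * kf p B t := by
    intro t t' h'
    apply hp1
    have h2 := (dvd_pow_self (p : ℤ) two_ne_zero).trans h'
    exact (dvd_sub_left ((hk t').mul_right _)).mp h2
  rw [Trep_image] at h
  obtain ⟨b, t⟩ := r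
  obtain ⟨b', t'⟩ := r'
  cases b <;> cases b' <;> simp [Trep, T0, sw, Matrix.mul_apply, Fin.sum_univ_three] at h
  · rw [hfin _ _ h.2]
  · exact absurd h.1 (hno _ _)
  · exact absurd h.1 (hno _ _)
  · rw [hfin _ _ h.2]

lemma Trep_inj {B : TernMat} (hp2 : p ≠ 2) (g : GoodL p B) {r r' : Bool × Fin p} {V V' : TernMatˣ}
    (h : Trep p B r * V.1 = Trep p B r' * V'.1) : r = r' ∧ V = V' := by
  have h1 : Trep p B r = Trep p B r' * (V' * V⁻¹ : TernMatˣ).1 := by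
    rw [Units.val_mul, ← Matrix.mul_assoc, ← h, Matrix.mul_assoc, ← Units.val_mul, mul_inv_cancel]
    simp
  have h2 : r = r' := by
    apply Trep_mem_inj hp2 g
    refine ⟨fun i => (V' * V⁻¹ : TernMatˣ).1 i 0, ?_⟩
    funext i
    conv_lhs => rw [h1]
    simp [Matrix.mul_apply, Matrix.mulVec, dotProduct]
  subst h2
  refine ⟨rfl, ?_⟩
  have hd : (Trep p B r).det ≠ 0 := by
    intro h0
    have := Trep_det p B r
    rw [h0] at this
    have h3 := hp.out.pos
    have : (0 : ℤ) < (p : ℤ) ^ 6 := by positivity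
    omega
  ext1
  have h4 := congrArg (fun M => (Trep p B r).adjugate * M) h
  simp only [← Matrix.mul_assoc, Matrix.adjugate_mul, Matrix.smul_mul, Matrix.one_mul] at h4
  exact smul_right_injective _ hd h4

lemma T0_gram {B : TernMat} (hB : B.IsSymm) (h : NF p B) (hc : (p : ℤ) ∣ B 2 2) {k t : ℤ}
    (hk : (p : ℤ) ^ 2 ∣ t ^ 2 * B 2 2 + k * (2 * B 0 1)) (i j : Fin 3) :
    (p : ℤ) ^ 2 ∣ ((T0 p k t)ᵀ * B * T0 p k t) i j := by
  obtain ⟨a, ha⟩ := h.h00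
  obtain ⟨b, hb⟩ := h.h11
  obtain ⟨c, hc'⟩ := h.h02
  obtain ⟨d, hdd⟩ := h.h12
  obtain ⟨e, he⟩ := hc
  obtain ⟨q, hq⟩ := hk
  have e10 := hB.apply 0 1
  have e20 := hB.apply 0 2
  have e21 := hB.apply 1 2
  fin_cases i <;> fin_cases j <;>
    simp only [T0, Matrix.mul_apply, Fin.sum_univ_three, Matrix.transpose_apply, Fin.zero_eta, Fin.mk_one,
      Fin.reduceFinMk, Matrix.of_apply, Matrix.cons_val_zero, Matrix.cons_val_one, Matrix.cons_val, e10, e20, e21,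
      ha, hb, hc', hdd, mul_zero, zero_mul, add_zero, zero_add, one_mul, mul_one]
  · exact ⟨q + a + k * b * k + 2 * t * c + 2 * k * t * d, by linear_combination hq⟩
  · exact ⟨B 0 1 + k * b * p ^ 2 + t * p ^ 2 * d, by ring⟩
  · exact ⟨c * p + k * d * p + t * e, by rw [he]; ring⟩
  · exact ⟨B 0 1 + k * b * p ^ 2 + t * p ^ 2 * d, by ring⟩
  · exact ⟨p ^ 4 * b, by ring⟩
  · exact ⟨p ^ 3 * d, by ring⟩
  · exact ⟨c * p + k * d * p + t * e, by rw [he]; ring⟩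
  · exact ⟨p ^ 3 * d, by ring⟩
  · exact ⟨B 2 2, by ring⟩

/-- Gram matrix of the neighbour. -/
noncomputable def Bn (p : ℕ) (B : TernMat) (r : Bool × Fin p) : TernMat :=
  fun i j => ((Trep p B r)ᵀ * B * Trep p B r) i j / (p : ℤ) ^ 2

lemma Bn_spec {B : TernMat} (hp2 : p ≠ 2) (g : GoodL p B) (r : Bool × Fin p) :
    (Trep p B r)ᵀ * B * Trep p B r = (p : ℤ) ^ 2 • Bn p B r := by
  have key : ∀ i j, (p : ℤ) ^ 2 ∣ ((Trep p B r)ᵀ * B * Trep p B r) i j := by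
    intro i j
    unfold Trep
    split_ifs
    · have := T0_gram (conj_symm g.lat.1 sw) (g.nf.swap g.lat.1) (by rw [swB22]; exact g.c1)
        (kf_spec hp2 (g.nf.swap g.lat.1) ((r.2 : ℕ) : ℤ)) i j
      rw [kf_swap g.lat.1] at this
      rw [Matrix.transpose_mul]
      simpa only [Matrix.mul_assoc] using this
    · exact T0_gram g.lat.1 g.nf g.c1 (kf_spec hp2 g.nf _) i j
  ext i j
  rw [Matrix.smul_apply, smul_eq_mul]
  exact (Int.mul_ediv_cancel' (key i j)).symm

lemma Bn_det {B : TernMat} (hp2 : p ≠ 2) (g : GoodL p B) (r : Bool × Fin p) : (Bn p B r).det = B.det := by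
  have h1 := congrArg Matrix.det (Bn_spec hp2 g r)
  rw [det_gram_conj, Matrix.det_smul, Trep_det] at h1
  simp only [Fintype.card_fin] at h1
  have h3 := hp.out.pos
  have h0 : ((p : ℤ) ^ 6) ≠ 0 := by positivity
  apply mul_left_cancel₀ h0
  linear_combination -h1

lemma smul_p2_inj {M N : TernMat} (h : (p : ℤ) ^ 2 • M = (p : ℤ) ^ 2 • N) : M = N := by
  have h3 := hp.out.pos
  exact smul_right_injective _ (by positivity : ((p : ℤ) ^ 2) ≠ 0) h

lemma Bn_lat {B : TernMat} (hp2 : p ≠ 2) (g : GoodL p B) (r : Bool × Fin p) : IsLat (Bn p B r) := by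
  have h3 := hp.out.pos
  have hd : (Trep p B r).det ≠ 0 := by
    intro h0
    have := Trep_det p B r
    rw [h0] at this
    have : (0 : ℤ) < (p : ℤ) ^ 6 := by positivity
    omega
  have hl := g.lat.conj hd
  rw [Bn_spec hp2 g] at hl
  constructor
  · have := hl.1
    unfold Matrix.IsSymm at this ⊢
    rw [Matrix.transpose_smul] at this
    exact smul_p2_inj this
  · intro x hx
    have := hl.2 x hx
    rw [quadVal_smul_mat] at this
    exact pos_of_mul_pos_right this (by positivity)

end

section
variable {p : ℕ} [hp : Fact p.Prime]

lemma dual_gram {B B' T T' : TernMat} (h : Tᵀ * B * T = (p : ℤ) ^ 2 • B')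
    (hT : T * T' = (p : ℤ) ^ 2 • (1 : TernMat)) : T'ᵀ * B' * T' = (p : ℤ) ^ 2 • B := by
  apply smul_p2_inj (p := p)
  calc (p : ℤ) ^ 2 • (T'ᵀ * B' * T') = T'ᵀ * ((p : ℤ) ^ 2 • B') * T' := by
        rw [Matrix.mul_smul, Matrix.smul_mul]
    _ = (T * T')ᵀ * B * (T * T') := by rw [← h, Matrix.transpose_mul]; simp only [Matrix.mul_assoc]
    _ = _ := by rw [hT, Matrix.transpose_smul, Matrix.transpose_one, Matrix.smul_mul, Matrix.one_mul, Matrix.mul_smul, Matrix.mul_one]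

lemma GoodL.isoM {B : TernMat} (hp2 : p ≠ 2) (g : GoodL p B) : IsoM (padicMat p B) := by
  have h1 : ((Matrix.mulVec (padicMat p B) (Pi.single 0 1)) 1) = ((B 0 1 : ℤ) : ℤ_[p]) := by
    rw [Matrix.mulVec_single_one]
    simp [padicMat, g.lat.e10]
  have h2 : quadVal (padicMat p B) (Pi.single 0 1) = ((B 0 0 : ℤ) : ℤ_[p]) := by
    simp [quadVal_three, padicMat]
  apply isoM_of_hensel hp2 (padicMat_symm g.lat.1) (x := Pi.single 0 1) (i := 1)
  · rw [h2, padic_intCast_dvd_iff']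
    exact (dvd_pow_self (p : ℤ) two_ne_zero).trans g.nf.h00
  · rw [h1, padic_isUnit_iff_not_dvd, padic_intCast_dvd_iff']
    exact g.nf.h01

lemma Bn_isoM {B : TernMat} (hp2 : p ≠ 2) (g : GoodL p B) (r : Bool × Fin p) :
    IsoM (padicMat p (Bn p B r)) := by
  have h3 := hp.out.pos
  have h1 := dual_gram (Bn_spec hp2 g r) (Trep_mul p B r)
  have hd : (Trepi p B r).det ≠ 0 := by
    intro h0
    have := congrArg Matrix.det (Trep_mul p B r)
    rw [Matrix.det_mul, h0, Matrix.det_smul, Matrix.det_one, mul_zero, mul_one] at this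
    have h4 : ((p : ℤ) ^ 2) ^ Fintype.card (Fin 3) ≠ 0 := by positivity
    exact h4 this.symm
  apply IsoM.conj (U := padicMat p (Trepi p B r))
  · rw [padicMat_det]; exact_mod_cast hd
  · rw [← padicMat_transpose, ← padicMat_mul, ← padicMat_mul, h1, padicMat_smul]
    obtain ⟨x, hx, h0⟩ := g.isoM hp2
    exact ⟨x, hx, by rw [quadVal_smul_mat, h0, mul_zero]⟩

lemma Bn_padic {B : TernMat} (hp2 : p ≠ 2) (g : GoodL p B) (hd : ¬ (p : ℤ) ^ 2 ∣ B.det) (r : Bool × Fin p)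
    (q : ℕ) (hq : q.Prime) : PadicLatIsom q hq B (Bn p B r) := by
  by_cases hqp : q = p
  · subst hqp
    apply isom_of_isotropic hp2 (padicMat_symm g.lat.1) (padicMat_symm (Bn_lat hp2 g r).1)
    · rw [padicMat_det, padicMat_det, Bn_det hp2 g]
    · rw [padicMat_det, padic_intCast_dvd_iff]; exact hd
    · exact g.isoM hp2
    · exact Bn_isoM hp2 g r
  · have : Fact q.Prime := ⟨hq⟩
    have hu : IsUnit (((p : ℤ) : ℤ_[q])) := by
      rw [padic_isUnit_iff_not_dvd, padic_intCast_dvd_iff', Int.natCast_dvd_natCast,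
        Nat.prime_dvd_prime_iff_eq hq hp.out]
      exact hqp
    obtain ⟨v, hv⟩ := hu.exists_right_inv
    have hvu : IsUnit v := IsUnit.of_mul_eq_one _ (by rw [mul_comm]; exact hv)
    refine ⟨v • padicMat q (Trep p B r), ?_, ?_⟩
    · rw [Matrix.det_smul, padicMat_det]
      apply (hvu.pow _).mul
      have h6 : IsUnit ((((Trep p B r).det : ℤ) : ℤ_[q]) ^ 2) := by
        rw [← Int.cast_pow, Trep_det, Int.cast_pow]
        exact hu.pow _
      exact (isUnit_pow_iff two_ne_zero).1 h6
    · rw [Matrix.transpose_smul, Matrix.smul_mul, Matrix.smul_mul, Matrix.mul_smul, smul_smul,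
        ← padicMat_transpose, ← padicMat_mul, ← padicMat_mul, Bn_spec hp2 g, padicMat_smul, smul_smul]
      have : v * v * (((p : ℤ) ^ 2 : ℤ) : ℤ_[q]) = 1 := by
        rw [Int.cast_pow]
        linear_combination (((p : ℤ) : ℤ_[q]) * v + 1) * hv
      rw [this, one_smul]

lemma Bn_genus {A B : TernMat} (hp2 : p ≠ 2) (g : GoodL p B) (hd : ¬ (p : ℤ) ^ 2 ∣ B.det) (h : InGenus A B)
    (r : Bool × Fin p) : InGenus A (Bn p B r) := by
  refine ⟨Bn_lat hp2 g r, fun q hq => ?_⟩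
  have : Fact q.Prime := ⟨hq⟩
  exact PadicIsomP.trans (h.2 q hq) (Bn_padic hp2 g hd r q hq)

lemma Trepi_prim (B : TernMat) (r : Bool × Fin p) : ∃ i j, ¬ (p : ℤ) ∣ Trepi p B r i j := by
  have hp1 : ¬ (p : ℤ) ∣ 1 := (Nat.prime_iff_prime_int.mp hp.out).not_dvd_one
  obtain ⟨b, t⟩ := r
  cases b
  · exact ⟨1, 1, by simpa [Trepi, T0i] using hp1⟩
  · exact ⟨1, 0, by simpa [Trepi, T0i, sw, Matrix.mul_apply, Fin.sum_univ_three] using hp1⟩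

lemma Trepi_mul (B : TernMat) (r : Bool × Fin p) :
    Trepi p B r * Trep p B r = (p : ℤ) ^ 2 • (1 : TernMat) := by
  have h3 := hp.out.pos
  have h := Trep_mul p B r
  have hd : (Trep p B r).det ≠ 0 := by
    intro h0
    have := Trep_det p B r
    rw [h0] at this
    have : (0 : ℤ) < (p : ℤ) ^ 6 := by positivity
    omega
  have h4 : (Trep p B r).adjugate * (Trep p B r * (Trepi p B r * Trep p B r)) =
      (Trep p B r).adjugate * (Trep p B r * ((p : ℤ) ^ 2 • (1 : TernMat))) := by
    congr 1
    rw [← Matrix.mul_assoc, h, Matrix.smul_mul, Matrix.one_mul, Matrix.mul_smul, Matrix.mul_one]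
  simp only [← Matrix.mul_assoc, Matrix.adjugate_mul, Matrix.smul_mul, Matrix.one_mul] at h4
  exact smul_right_injective _ hd h4

lemma prim_of_mul {V M : TernMat} (h : ∃ i j, ¬ (p : ℤ) ∣ (V * M) i j) : ∃ i j, ¬ (p : ℤ) ∣ M i j := by
  by_contra hcon
  push Not at hcon
  obtain ⟨i, j, hij⟩ := h
  exact hij (by rw [Matrix.mul_apply]; exact Finset.dvd_sum fun k _ => (hcon k j).mul_left _)

lemma iso_dual {B B' T : TernMat} (hp2 : p ≠ 2) (g : GoodL p B) (hd : B'.det = B.det) (h : PIso p B B' T) :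
    ∃ T', T * T' = (p : ℤ) ^ 2 • (1 : TernMat) ∧ T' * T = (p : ℤ) ^ 2 • (1 : TernMat) ∧ PIso p B' B T' := by
  obtain ⟨r, V, hV⟩ := iso_classify hp2 g hd h
  have e1 : T * ((V⁻¹ : TernMatˣ).1 * Trepi p B r) = (p : ℤ) ^ 2 • (1 : TernMat) := by
    rw [hV, Matrix.mul_assoc, ← Matrix.mul_assoc V.1, ← Units.val_mul, mul_inv_cancel]
    simp [Trep_mul]
  refine ⟨(V⁻¹ : TernMatˣ).1 * Trepi p B r, e1, ?_, dual_gram h.1 e1, ?_⟩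
  · rw [hV, Matrix.mul_assoc, ← Matrix.mul_assoc (Trepi p B r), Trepi_mul, Matrix.smul_mul, Matrix.one_mul,
      Matrix.mul_smul, ← Units.val_mul, inv_mul_cancel]
    simp
  · apply prim_of_mul (V := V.1)
    rw [← Matrix.mul_assoc, ← Units.val_mul, mul_inv_cancel]
    simpa using Trepi_prim B r

lemma cancel_left {T X Y T' : TernMat} (hT : T' * T = (p : ℤ) ^ 2 • (1 : TernMat)) (h : T * X = T * Y) : X = Y := by
  have h2 := congrArg (fun M => T' * M) h
  simp only [← Matrix.mul_assoc, hT, Matrix.smul_mul, Matrix.one_mul] at h2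
  exact smul_p2_inj h2

lemma iso_card_symm {B B' : TernMat} (hp2 : p ≠ 2) (g : GoodL p B) (g' : GoodL p B') (hd : B'.det = B.det) :
    Nat.card {T // PIso p B B' T} = Nat.card {T // PIso p B' B T} := by
  choose f hf1 hf2 hf3 using fun T : {T // PIso p B B' T} => iso_dual hp2 g hd T.2
  choose f' hf1' hf2' hf3' using fun T : {T // PIso p B' B T} => iso_dual hp2 g' hd.symm T.2
  refine Nat.card_congr ⟨fun T => ⟨f T, hf3 T⟩, fun T => ⟨f' T, hf3' T⟩, ?_, ?_⟩
  · intro T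
    apply Subtype.ext
    apply cancel_left (hf1 T)
    rw [hf2 T]; exact hf1' ⟨f T, hf3 T⟩
  · intro T
    apply Subtype.ext
    apply cancel_left (hf1' T)
    rw [hf2' T]; exact hf1 ⟨f' T, hf3' T⟩

end

structure HeckeSys (p m : ℕ) (ω : Fin m → TernMat) : Prop where
  good : ∀ i, GoodL p (ω i)
  det : ∀ i j, (ω i).det = (ω j).det
  cov : ∀ i r, ∃ j, LatIsom (Bn p (ω i) r) (ω j)
  uniq : ∀ i j, LatIsom (ω i) (ω j) → i = j

noncomputable def unitsEquivAut (B : TernMat) :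
    {g : TernMatˣ // g.1ᵀ * B * g.1 = B} ≃ {U : TernMat // IsUnit U.det ∧ Uᵀ * B * U = B} where
  toFun g := ⟨g.1.1, (Matrix.isUnit_iff_isUnit_det _).1 g.1.isUnit, g.2⟩
  invFun U := ⟨((Matrix.isUnit_iff_isUnit_det _).2 U.2.1).unit, U.2.2⟩
  left_inv g := by ext1; ext1; rfl
  right_inv U := by ext1; rfl

section
variable {p : ℕ} [hp : Fact p.Prime]

lemma hecke_single (hp2 : p ≠ 2) {m : ℕ} {ω : Fin m → TernMat} (S : HeckeSys p m ω) (i : Fin m)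
    (P : TernMat → Prop) (inv : ∀ T (V : TernMatˣ), P (T * V.1) ↔ P T) :
    ∑ j, (Nat.card {T // PIso p (ω i) (ω j) T ∧ P T} : ℝ) / (numAut (ω j) : ℝ) =
      (Fintype.card {r : Bool × Fin p // P (Trep p (ω i) r)} : ℝ) := by
  have g := S.good i
  have main := transversal_count (k := ℝ) (G := TernMatˣ) (Ω := TernMat) (ι := Fin m)
    (R := {r : Bool × Fin p // P (Trep p (ω i) r)})
    (fun B V => V.1ᵀ * B * V.1)
    (by intro x g h; simp only [Units.val_mul, Matrix.transpose_mul, Matrix.mul_assoc])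
    (by intro x; simp) ω (fun r => Bn p (ω i) r.1)
    (by
      intro j
      have h2 : Finite {U : TernMat // IsUnit U.det ∧ Uᵀ * ω j * U = ω j} :=
        Set.Finite.subset (finite_isos (S.good j).lat (ω j)) (fun U hU => hU.2)
      exact Finite.of_equiv _ (unitsEquivAut (ω j)).symm)
    (by
      intro r
      obtain ⟨j, U, hU, h⟩ := S.cov i r.1
      exact ⟨j, ((Matrix.isUnit_iff_isUnit_det _).2 hU).unit, h⟩)
    (by
      rintro j k ⟨g, hg⟩
      exact S.uniq _ _ ⟨g.1, (Matrix.isUnit_iff_isUnit_det _).1 g.isUnit, hg⟩)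
  rw [← main]
  refine Finset.sum_congr rfl fun j _ => ?_
  have e1 : numAut (ω j) = Nat.card {g : TernMatˣ // g.1ᵀ * ω j * g.1 = ω j} :=
    (Nat.card_congr (unitsEquivAut (ω j))).symm
  rw [e1]
  congr 2
  symm
  refine Nat.card_congr (Equiv.ofBijective (fun x => ⟨Trep p (ω i) x.1.1.1 * x.1.2.1, ⟨?_, ?_⟩, ?_⟩) ⟨?_, ?_⟩)
  · have h := x.2
    calc (Trep p (ω i) x.1.1.1 * x.1.2.1)ᵀ * ω i * (Trep p (ω i) x.1.1.1 * x.1.2.1)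
        = x.1.2.1ᵀ * ((Trep p (ω i) x.1.1.1)ᵀ * ω i * Trep p (ω i) x.1.1.1) * x.1.2.1 := by
          rw [Matrix.transpose_mul]; simp only [Matrix.mul_assoc]
      _ = _ := by rw [Bn_spec hp2 g, Matrix.mul_smul, Matrix.smul_mul, h]
  · have hpr : ∃ a b, ¬ (p : ℤ) ∣ Trep p (ω i) x.1.1.1 a b := by
      have hp1 : ¬ (p : ℤ) ∣ 1 := (Nat.prime_iff_prime_int.mp hp.out).not_dvd_one
      obtain ⟨b, t⟩ := x.1.1.1
      cases b
      · exact ⟨0, 0, by simpa [Trep, T0] using hp1⟩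
      · exact ⟨1, 0, by simpa [Trep, T0, sw, Matrix.mul_apply, Fin.sum_univ_three] using hp1⟩
    by_contra hcon
    push Not at hcon
    obtain ⟨a, b, hab⟩ := hpr
    apply hab
    have e : Trep p (ω i) x.1.1.1 = (Trep p (ω i) x.1.1.1 * x.1.2.1) * (x.1.2⁻¹ : TernMatˣ).1 := by
      rw [Matrix.mul_assoc, ← Units.val_mul, mul_inv_cancel]; simp
    rw [e, Matrix.mul_apply]
    exact Finset.dvd_sum fun k _ => (hcon a k).mul_right _
  · exact (inv _ _).2 x.1.1.2
  · rintro ⟨⟨⟨r, hr⟩, V⟩, h⟩ ⟨⟨⟨r', hr'⟩, V'⟩, h'⟩ heq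
    have := Trep_inj hp2 g (congrArg Subtype.val heq)
    obtain ⟨rfl, rfl⟩ := this
    rfl
  · rintro ⟨T, hT, hPT⟩
    obtain ⟨r, V, hV⟩ := iso_classify hp2 g (S.det j i) hT
    have hr : P (Trep p (ω i) r) := by rw [hV] at hPT; exact (inv _ _).1 hPT
    have hb : V.1ᵀ * Bn p (ω i) r * V.1 = ω j := by
      apply smul_p2_inj (p := p)
      rw [← hT.1, hV, ← Matrix.smul_mul, ← Matrix.mul_smul, ← Bn_spec hp2 g, Matrix.transpose_mul]
      simp only [Matrix.mul_assoc]
    exact ⟨⟨⟨⟨r, hr⟩, V⟩, hb⟩, Subtype.ext hV.symm⟩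

lemma hecke_double (hp2 : p ≠ 2) {m : ℕ} {ω : Fin m → TernMat} (S : HeckeSys p m ω)
    (X : Fin m → Finset (Fin 3 → ℤ)) (P : Fin m → TernMat → (Fin 3 → ℤ) → Prop)
    (inv : ∀ i x T (V : TernMatˣ), P i (T * V.1) x ↔ P i T x) (M : Fin m → ℕ)
    (hM : ∀ i j T, PIso p (ω i) (ω j) T → ((X i).filter (P i T)).card = M j) :
    ∑ i, (∑ x ∈ X i, (Fintype.card {r : Bool × Fin p // P i (Trep p (ω i) r) x} : ℝ)) / (numAut (ω i) : ℝ) =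
      2 * p * ∑ j, (M j : ℝ) / (numAut (ω j) : ℝ) := by
  have hfinI : ∀ i j, {T | PIso p (ω i) (ω j) T}.Finite := fun i j =>
    Set.Finite.subset (finite_isos (S.good i).lat ((p : ℤ) ^ 2 • ω j)) (fun U hU => hU.1)
  have hI : ∀ i j (Q : TernMat → Prop), Nat.card {T // PIso p (ω i) (ω j) T ∧ Q T} =
      ((hfinI i j).toFinset.filter Q).card := by
    intro i j Q
    rw [← Nat.card_eq_finsetCard]
    exact Nat.card_congr (Equiv.subtypeEquivRight fun T => by
      rw [Finset.mem_filter, Set.Finite.mem_toFinset]; rfl)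
  have step1 : ∀ i, ∑ x ∈ X i, (Fintype.card {r : Bool × Fin p // P i (Trep p (ω i) r) x} : ℝ) =
      ∑ j, (Nat.card {T // PIso p (ω i) (ω j) T} : ℝ) * (M j : ℝ) / (numAut (ω j) : ℝ) := by
    intro i
    have e1 : ∀ x, (Fintype.card {r : Bool × Fin p // P i (Trep p (ω i) r) x} : ℝ) =
        ∑ j, (((hfinI i j).toFinset.filter fun T => P i T x).card : ℝ) / (numAut (ω j) : ℝ) := by
      intro x
      rw [← hecke_single hp2 S i (fun T => P i T x) (inv i x)]
      simp_rw [hI]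
    rw [Finset.sum_congr rfl fun x _ => e1 x, Finset.sum_comm]
    refine Finset.sum_congr rfl fun j _ => ?_
    rw [← Finset.sum_div]
    congr 1
    have h2 : ∑ x ∈ X i, ((hfinI i j).toFinset.filter fun T => P i T x).card =
        ∑ T ∈ (hfinI i j).toFinset, ((X i).filter (P i T)).card :=
      (Finset.sum_card_bipartiteAbove_eq_sum_card_bipartiteBelow (fun T x => P i T x)).symm
    have h3 : ∑ T ∈ (hfinI i j).toFinset, ((X i).filter (P i T)).card = (hfinI i j).toFinset.card * M j := by
      rw [Finset.sum_congr rfl (fun T hT => hM i j T ((hfinI i j).mem_toFinset.1 hT)), Finset.sum_const,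
        smul_eq_mul]
    have h4 : Nat.card {T // PIso p (ω i) (ω j) T} = (hfinI i j).toFinset.card := by
      have := hI i j (fun _ => True)
      simpa using this
    rw [h4]
    exact_mod_cast h2.trans h3
  have step2 : ∀ j, ∑ i, (Nat.card {T // PIso p (ω i) (ω j) T} : ℝ) / (numAut (ω i) : ℝ) = 2 * p := by
    intro j
    have h := hecke_single hp2 S j (fun _ => True) (fun _ _ => Iff.rfl)
    simp only [and_true] at h
    rw [Finset.sum_congr rfl fun i _ => by rw [iso_card_symm hp2 (S.good i) (S.good j) (S.det j i)], h]
    rw [Fintype.card_subtype_true]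
    simp
  calc _ = ∑ i, ∑ j, ((Nat.card {T // PIso p (ω i) (ω j) T} : ℝ) / (numAut (ω i) : ℝ)) *
        ((M j : ℝ) / (numAut (ω j) : ℝ)) := by
        refine Finset.sum_congr rfl fun i _ => ?_
        rw [step1, Finset.sum_div]
        refine Finset.sum_congr rfl fun j _ => ?_
        ring
    _ = _ := by
        rw [Finset.sum_comm, Finset.mul_sum]
        refine Finset.sum_congr rfl fun j _ => ?_
        rw [← Finset.sum_mul, step2]

end

noncomputable def repF (B : TernMat) (n : ℤ) : Finset (Fin 3 → ℤ) :=
  if h : {x : Fin 3 → ℤ | quadVal B x = n}.Finite then h.toFinset else ∅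

lemma mem_repF {B : TernMat} (h : IsLat B) {n : ℤ} {x : Fin 3 → ℤ} : x ∈ repF B n ↔ quadVal B x = n := by
  unfold repF
  rw [dif_pos (finite_rep h n), Set.Finite.mem_toFinset, Set.mem_ofPred_eq]

lemma rRep_eq {B : TernMat} (h : IsLat B) (n : ℤ) : rRep n B = (repF B n).card := by
  rw [← Nat.card_eq_finsetCard]
  exact Nat.card_congr (Equiv.subtypeEquivRight fun T => (mem_repF h).symm)

/-- number of representations in the special sublattice -/
noncomputable def rSh (p : ℕ) (n : ℤ) (B : TernMat) : ℕ :=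
  ((repF B n).filter fun y => (p : ℤ) ∣ y 0 ∧ (p : ℤ) ∣ y 1).card

section
variable {p : ℕ} [hp : Fact p.Prime]

lemma GoodL.not_both {B : TernMat} (g : GoodL p B) {x : Fin 3 → ℤ} (hx : (p : ℤ) ^ 2 ∣ quadVal B x)
    (hn : ¬ ∀ i, (p : ℤ) ∣ x i) : ¬ (p : ℤ) ∣ x 0 ∨ ¬ (p : ℤ) ∣ x 1 := by
  have hpp : Prime (p : ℤ) := Nat.prime_iff_prime_int.mp hp.out
  by_contra hcon
  push Not at hcon
  obtain ⟨⟨a, ha⟩, ⟨b, hb⟩⟩ := hcon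
  obtain ⟨z, hz⟩ := g.nf.quad g.lat.1 x
  obtain ⟨w, hw⟩ := hx
  have hd : (p : ℤ) ^ 2 ∣ B 2 2 * x 2 ^ 2 := by
    rw [hw, ha, hb] at hz
    exact ⟨w - 2 * B 0 1 * a * b - z, by linear_combination -hz⟩
  have h2 : (p : ℤ) ∣ x 2 := by
    by_contra hn
    apply g.c2
    have hn2 : ¬ (p : ℤ) ∣ (x 2) ^ 2 := fun h' => hn (hpp.dvd_of_dvd_pow h')
    exact IsCoprime.dvd_of_dvd_mul_right (((Prime.coprime_iff_not_dvd hpp).mpr hn2).pow_left) hd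
  apply hn
  intro i
  fin_cases i
  · exact ⟨a, ha⟩
  · exact ⟨b, hb⟩
  · exact h2

lemma fin_p_eq {t t' : Fin p} (ht : (p : ℤ) ∣ ((t : ℕ) : ℤ) - ((t' : ℕ) : ℤ)) : t = t' := by
  have h1 := t.2
  have h2 := t'.2
  have : ((t : ℕ) : ℤ) - ((t' : ℕ) : ℤ) = 0 := by
    apply Int.eq_zero_of_abs_lt_dvd ht
    rw [abs_lt]; constructor <;> omega
  exact Fin.ext (by omega)

lemma count_prim {B : TernMat} (hp2 : p ≠ 2) (g : GoodL p B) {x : Fin 3 → ℤ} (hx : (p : ℤ) ^ 2 ∣ quadVal B x)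
    (hn : ¬ ∀ i, (p : ℤ) ∣ x i) :
    Fintype.card {r : Bool × Fin p // ∃ y, x = Trep p B r *ᵥ y} = 1 := by
  have hpp : Prime (p : ℤ) := Nat.prime_iff_prime_int.mp hp.out
  have hk := fun t => kf_dvd hp2 g.nf g.c1 t
  have hpd := dvd_pow_self (p : ℤ) two_ne_zero
  have hxx : (p : ℤ) ^ 2 ∣ x ⬝ᵥ (B *ᵥ x) := by rw [← quadVal_dot]; exact hx
  have n0 : ∀ k t : ℤ, (p : ℤ) ∣ k → ∀ u v, (p : ℤ) ^ 2 ∣ v - k * u → (p : ℤ) ∣ v := by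
    intro k t hk u v h
    exact (dvd_sub_left (hk.mul_right _)).mp (hpd.trans h)
  rw [Fintype.card_eq_one_iff]
  have ex : ∃ r : Bool × Fin p, ∃ y, x = Trep p B r *ᵥ y := by
    rcases g.not_both hx hn with h0 | h0
    · obtain ⟨t, ht⟩ := image_of_cols hp2 g.lat.1 g.nf g.c1 g.c2 hx h0
      refine ⟨(false, t), (Trep_image B _ _).2 ?_⟩
      simpa using ht _ hx hxx
    · have hs : (p : ℤ) ^ 2 ∣ quadVal (swᵀ * B * sw) ![x 1, x 0, x 2] := by
        rw [quadVal_conj, sw_mulVec]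
        have : ![(![x 1, x 0, x 2] : Fin 3 → ℤ) 1, (![x 1, x 0, x 2] : Fin 3 → ℤ) 0, (![x 1, x 0, x 2] : Fin 3 → ℤ) 2] = x := by
          funext i; fin_cases i <;> rfl
        rw [this]; exact hx
      obtain ⟨t, ht⟩ := image_of_cols (B := swᵀ * B * sw) hp2 (conj_symm g.lat.1 _) (g.nf.swap g.lat.1)
        (by rw [swB22]; exact g.c1) (by rw [swB22]; exact g.c2) hs h0
      refine ⟨(true, t), (Trep_image B _ _).2 ?_⟩
      have := ht _ hs (by rw [← quadVal_dot]; exact hs)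
      rw [kf_swap g.lat.1] at this
      simpa using this
  obtain ⟨r, hr⟩ := ex
  refine ⟨⟨r, hr⟩, ?_⟩
  rintro ⟨r', hr'⟩
  apply Subtype.ext
  simp only
  rw [Trep_image] at hr hr'
  obtain ⟨b, t⟩ := r
  obtain ⟨b', t'⟩ := r'
  have hall : (p : ℤ) ∣ x 0 → (p : ℤ) ∣ x 1 → False := fun h0 h1 => by
    rcases g.not_both hx hn with h | h
    · exact h h0
    · exact h h1
  cases b <;> cases b' <;> simp only [if_true, if_false, Bool.false_eq_true] at hr hr'
  · have h1 : (p : ℤ) ∣ (((t' : ℕ) : ℤ) - ((t : ℕ) : ℤ)) * x 0 := by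
      obtain ⟨a, ha⟩ := hr.2
      obtain ⟨b, hb⟩ := hr'.2
      exact ⟨a - b, by linear_combination ha - hb⟩
    rcases hpp.dvd_or_dvd h1 with h2 | h2
    · rw [fin_p_eq h2]
    · exact (hall h2 ((n0 _ 0 (hk _) _ _ hr.1))).elim
  · exact (hall (n0 _ 0 (hk _) _ _ hr'.1) (n0 _ 0 (hk _) _ _ hr.1)).elim
  · exact (hall (n0 _ 0 (hk _) _ _ hr.1) (n0 _ 0 (hk _) _ _ hr'.1)).elim
  · have h1 : (p : ℤ) ∣ (((t' : ℕ) : ℤ) - ((t : ℕ) : ℤ)) * x 1 := by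
      obtain ⟨a, ha⟩ := hr.2
      obtain ⟨b, hb⟩ := hr'.2
      exact ⟨a - b, by linear_combination ha - hb⟩
    rcases hpp.dvd_or_dvd h1 with h2 | h2
    · rw [fin_p_eq h2]
    · exact (hall ((n0 _ 0 (hk _) _ _ hr.1)) h2).elim

lemma card_bool_fin (Q : Bool × Fin p → Prop) : Fintype.card {r // Q r} =
    (Finset.univ.filter fun t : Fin p => Q (true, t)).card + (Finset.univ.filter fun t : Fin p => Q (false, t)).card := by
  rw [Fintype.card_subtype, Finset.card_filter, Fintype.sum_prod_type, Fintype.sum_bool, Finset.card_filter,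
    Finset.card_filter]

lemma count_mult {B : TernMat} (hp2 : p ≠ 2) (g : GoodL p B) (y : Fin 3 → ℤ) :
    Fintype.card {r : Bool × Fin p // ∃ z, (p : ℤ) • y = Trep p B r *ᵥ z} =
      p * ((if (p : ℤ) ∣ y 0 then 1 else 0) + (if (p : ℤ) ∣ y 1 then 1 else 0)) := by
  have hk := fun t => kf_dvd hp2 g.nf g.c1 t
  have h0 : (p : ℤ) ≠ 0 := by exact_mod_cast hp.out.ne_zero
  have key : ∀ k u v : ℤ, (p : ℤ) ∣ k → ((p : ℤ) ^ 2 ∣ p * v - k * (p * u) ↔ (p : ℤ) ∣ v) := by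
    intro k u v hk
    rw [show (p : ℤ) * v - k * (p * u) = p * (v - k * u) by ring, pow_two, mul_dvd_mul_iff_left h0,
      dvd_sub_left (hk.mul_right _)]
  have key2 : ∀ t u v : ℤ, (p : ℤ) ∣ p * v - t * (p * u) := fun t u v => ⟨v - t * u, by ring⟩
  rw [card_bool_fin]
  simp only [Trep_image, if_true, if_false, Bool.false_eq_true, Pi.smul_apply, smul_eq_mul, key _ _ _ (hk _),
    key2, and_true]
  by_cases h1 : (p : ℤ) ∣ y 0 <;> by_cases h2 : (p : ℤ) ∣ y 1 <;> simp [h1, h2, mul_two]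

lemma quad_mod_p {B : TernMat} (hp2 : p ≠ 2) (g : GoodL p B) (y : Fin 3 → ℤ) :
    (p : ℤ) ∣ quadVal B y ↔ (p : ℤ) ∣ y 0 ∨ (p : ℤ) ∣ y 1 := by
  have hpp : Prime (p : ℤ) := Nat.prime_iff_prime_int.mp hp.out
  obtain ⟨z, hz⟩ := g.nf.quad g.lat.1 y
  obtain ⟨c, hc⟩ := g.c1
  have e : quadVal B y = 2 * B 0 1 * (y 0 * y 1) + p * (c * y 2 ^ 2 + p * z) := by
    rw [hz, hc]; ring
  have h2b : ¬ (p : ℤ) ∣ 2 * B 0 1 := fun h' => (hpp.dvd_or_dvd h').elim (two_not_dvd hp.out hp2) g.nf.h01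
  rw [e, dvd_add_left (dvd_mul_right _ _), hpp.dvd_mul, or_iff_right h2b, hpp.dvd_mul]

lemma quadVal_p_smul (B : TernMat) (y : Fin 3 → ℤ) : quadVal B ((p : ℤ) • y) = quadVal B y * (p : ℤ) ^ 2 := by
  rw [quadVal_smul, mul_comm]

lemma repF_mult {B : TernMat} (h : IsLat B) (n : ℤ) :
    (repF B (n * (p : ℤ) ^ 2)).filter (fun x => ∀ i, (p : ℤ) ∣ x i) = (repF B n).image (fun y => (p : ℤ) • y) := by
  have h0 : (p : ℤ) ≠ 0 := by exact_mod_cast hp.out.ne_zero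
  ext x
  simp only [Finset.mem_filter, Finset.mem_image, mem_repF h]
  constructor
  · rintro ⟨h1, h2⟩
    choose y hy using h2
    have e : x = (p : ℤ) • y := by funext i; simp [hy i]
    refine ⟨y, ?_, e.symm⟩
    rw [e, quadVal_p_smul] at h1
    exact mul_right_cancel₀ (pow_ne_zero 2 h0) h1
  · rintro ⟨y, hy, rfl⟩
    exact ⟨by rw [quadVal_p_smul, hy], fun i => ⟨y i, by simp⟩⟩

lemma p_smul_inj : Function.Injective (fun y : Fin 3 → ℤ => (p : ℤ) • y) := by
  have h0 : (p : ℤ) ≠ 0 := by exact_mod_cast hp.out.ne_zero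
  exact smul_right_injective _ h0

lemma local_count1 {B : TernMat} (hp2 : p ≠ 2) (g : GoodL p B) (n : ℤ) :
    ∑ x ∈ repF B (n * (p : ℤ) ^ 2), (Fintype.card {r : Bool × Fin p // ∃ z, x = Trep p B r *ᵥ z} : ℝ) =
      rRep (n * (p : ℤ) ^ 2) B - rRep n B + (if (p : ℤ) ∣ n then (p : ℝ) * (rRep n B + rSh p n B) else 0) := by
  rw [← Finset.sum_filter_add_sum_filter_not (repF B (n * (p : ℤ) ^ 2)) (fun x => ∀ i, (p : ℤ) ∣ x i)]
  have hcard := Finset.card_filter_add_card_filter_not (s := repF B (n * (p : ℤ) ^ 2)) (fun x => ∀ i, (p : ℤ) ∣ x i)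
  have e2 : ∑ x ∈ (repF B (n * (p : ℤ) ^ 2)).filter (fun x => ¬ ∀ i, (p : ℤ) ∣ x i),
      (Fintype.card {r : Bool × Fin p // ∃ z, x = Trep p B r *ᵥ z} : ℝ) =
      rRep (n * (p : ℤ) ^ 2) B - rRep n B := by
    rw [Finset.sum_congr rfl (g := fun _ => (1 : ℝ))]
    · rw [repF_mult g.lat, Finset.card_image_of_injective _ p_smul_inj] at hcard
      rw [rRep_eq g.lat, rRep_eq g.lat, ← hcard]
      simp
    · intro x hx
      rw [Finset.mem_filter, mem_repF g.lat] at hx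
      rw [count_prim hp2 g ⟨n, by rw [hx.1]; ring⟩ hx.2]
      simp
  rw [e2, repF_mult g.lat, Finset.sum_image (fun x _ y _ h => p_smul_inj h), add_comm]
  congr 1
  simp only [count_mult hp2 g]
  split_ifs with hn
  · rw [rRep_eq g.lat, rSh, Finset.card_filter]
    push_cast
    rw [Finset.card_eq_sum_ones]
    push_cast
    rw [← Finset.sum_add_distrib, Finset.mul_sum]
    refine Finset.sum_congr rfl fun y hy => ?_
    rw [mem_repF g.lat] at hy
    rw [← hy, quad_mod_p hp2 g] at hn
    by_cases h0 : (p : ℤ) ∣ y 0 <;> by_cases h1 : (p : ℤ) ∣ y 1 <;> simp [h0, h1] at hn ⊢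
  · apply Finset.sum_eq_zero
    intro y hy
    rw [mem_repF g.lat] at hy
    rw [← hy, quad_mod_p hp2 g] at hn
    push Not at hn
    simp [hn.1, hn.2]

lemma im_count {B B' T : TernMat} (hp2 : p ≠ 2) (g : GoodL p B) (g' : GoodL p B') (hd : B'.det = B.det)
    (h : PIso p B B' T) (n : ℤ) :
    ((repF B (n * (p : ℤ) ^ 2)).filter fun x => ∃ y, x = T *ᵥ y).card = rRep n B' := by
  have h0 : (p : ℤ) ≠ 0 := by exact_mod_cast hp.out.ne_zero
  obtain ⟨T', h1, h2, -⟩ := iso_dual hp2 g hd h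
  have hq : ∀ y, quadVal B (T *ᵥ y) = quadVal B' y * (p : ℤ) ^ 2 := by
    intro y; rw [← quadVal_conj, h.1, quadVal_smul_mat, mul_comm]
  have inj : Function.Injective (fun y => T *ᵥ y) := by
    intro y z hyz
    have h3 := congrArg (fun v => T' *ᵥ v) hyz
    simp only [Matrix.mulVec_mulVec, h2, Matrix.smul_mulVec, Matrix.one_mulVec] at h3
    exact smul_right_injective _ (pow_ne_zero 2 h0) h3
  rw [rRep_eq g'.lat, ← Finset.card_image_of_injective (repF B' n) inj]
  congr 1
  ext x
  simp only [Finset.mem_filter, Finset.mem_image, mem_repF g.lat, mem_repF g'.lat]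
  constructor
  · rintro ⟨hx, y, rfl⟩
    refine ⟨y, ?_, rfl⟩
    rw [hq] at hx
    exact mul_right_cancel₀ (pow_ne_zero 2 h0) hx
  · rintro ⟨y, hy, rfl⟩
    exact ⟨by rw [hq, hy], y, rfl⟩

noncomputable def Rsum {m : ℕ} (ω : Fin m → TernMat) (n : ℤ) : ℝ :=
  ∑ i, (rRep n (ω i) : ℝ) / (numAut (ω i) : ℝ)

noncomputable def Rsh (p : ℕ) {m : ℕ} (ω : Fin m → TernMat) (n : ℤ) : ℝ :=
  ∑ i, (rSh p n (ω i) : ℝ) / (numAut (ω i) : ℝ)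

lemma unit_image {T : TernMat} (V : TernMatˣ) (x : Fin 3 → ℤ) :
    (∃ y, x = (T * V.1) *ᵥ y) ↔ ∃ y, x = T *ᵥ y := by
  constructor
  · rintro ⟨y, rfl⟩
    exact ⟨V.1 *ᵥ y, by rw [Matrix.mulVec_mulVec]⟩
  · rintro ⟨y, rfl⟩
    refine ⟨(V⁻¹ : TernMatˣ).1 *ᵥ y, ?_⟩
    rw [Matrix.mulVec_mulVec, Matrix.mul_assoc, ← Units.val_mul, mul_inv_cancel]; simp

lemma count1 (hp2 : p ≠ 2) {m : ℕ} {ω : Fin m → TernMat} (S : HeckeSys p m ω) (n : ℤ) :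
    2 * p * Rsum ω n = Rsum ω (n * (p : ℤ) ^ 2) - Rsum ω n +
      (if (p : ℤ) ∣ n then (p : ℝ) * (Rsum ω n + Rsh p ω n) else 0) := by
  have h := hecke_double hp2 S (fun i => repF (ω i) (n * (p : ℤ) ^ 2)) (fun _ T x => ∃ y, x = T *ᵥ y)
    (fun i x T V => unit_image V x) (fun j => rRep n (ω j))
    (fun i j T hT => im_count hp2 (S.good i) (S.good j) (S.det j i) hT n)
  unfold Rsum Rsh
  rw [← h]
  rw [Finset.sum_congr rfl fun i _ => by rw [local_count1 hp2 (S.good i)]]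
  split_ifs
  · rw [← Finset.sum_sub_distrib, ← Finset.sum_add_distrib, Finset.mul_sum, ← Finset.sum_add_distrib]
    refine Finset.sum_congr rfl fun i _ => ?_
    ring
  · rw [← Finset.sum_sub_distrib, add_zero]
    refine Finset.sum_congr rfl fun i _ => ?_
    ring

end

section
variable {p : ℕ} [hp : Fact p.Prime]

lemma rSh_sq {B : TernMat} (g : GoodL p B) (n : ℤ) : rSh p (n * (p : ℤ) ^ 2) B = rRep n B := by
  unfold rSh
  rw [rRep_eq g.lat, ← Finset.card_image_of_injective (repF B n) (p_smul_inj (p := p)), ← repF_mult g.lat]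
  congr 1
  ext y
  simp only [Finset.mem_filter, mem_repF g.lat]
  constructor
  · rintro ⟨h1, h2, h3⟩
    refine ⟨h1, ?_⟩
    by_contra hn
    rcases g.not_both ⟨n, by rw [h1]; ring⟩ hn with h | h
    · exact h h2
    · exact h h3
  · rintro ⟨h1, h2⟩
    exact ⟨h1, h2 0, h2 1⟩

lemma rSh_zero {B : TernMat} (g : GoodL p B) {n' e : ℤ} (he : B 2 2 = p * e) (hchi : legendreSym p (e * n') = -1) :
    rSh p (p * n') B = 0 := by
  have h0 : (p : ℤ) ≠ 0 := by exact_mod_cast hp.out.ne_zero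
  unfold rSh
  rw [Finset.card_eq_zero, Finset.filter_eq_empty_iff]
  rintro y hy ⟨⟨a, ha⟩, ⟨b, hb⟩⟩
  rw [mem_repF g.lat] at hy
  obtain ⟨z, hz⟩ := g.nf.quad g.lat.1 y
  rw [hy, ha, hb, he] at hz
  have h1 : n' = e * y 2 ^ 2 + p * (2 * B 0 1 * a * b + z) := by
    apply mul_left_cancel₀ h0
    linear_combination hz
  rw [legendreSym.eq_neg_one_iff] at hchi
  apply hchi
  refine ⟨(e : ZMod p) * (y 2 : ZMod p), ?_⟩
  rw [h1]; push_cast; simp; ring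

/-- the counting of solutions of the neighbour condition -/
lemma E_count (hp2 : p ≠ 2) {b e x0 x1 x2 n' : ℤ} {k : ℤ → ℤ} (hb : ¬ (p : ℤ) ∣ b)
    (hk : ∀ t, (p : ℤ) ^ 2 ∣ t ^ 2 * (p * e) + k t * (2 * b))
    (hn : (p : ℤ) ^ 2 ∣ p * n' - (2 * b * x0 * x1 + p * e * x2 ^ 2)) (hchi : legendreSym p (e * n') = 1) :
    (Finset.univ.filter fun t : Fin p =>
      (p : ℤ) ^ 2 ∣ b * x1 + k ((t : ℕ) : ℤ) * (b * x0) + ((t : ℕ) : ℤ) * (p * e * x2)).card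
      + (if (p : ℤ) ∣ x0 ∧ (p : ℤ) ∣ x1 then 1 else 0) = if (p : ℤ) ∣ x1 then 2 else 0 := by
  have hpp : Prime (p : ℤ) := Nat.prime_iff_prime_int.mp hp.out
  have h0 : (p : ℤ) ≠ 0 := by exact_mod_cast hp.out.ne_zero
  have h2 := two_not_dvd hp.out hp2
  have hcop2 : IsCoprime ((p : ℤ) ^ 2) 2 := ((Prime.coprime_iff_not_dvd hpp).mpr h2).pow_left
  -- rewrite the condition
  have hcond : ∀ t : ℤ, ((p : ℤ) ^ 2 ∣ b * x1 + k t * (b * x0) + t * (p * e * x2)) ↔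
      (p : ℤ) ^ 2 ∣ 2 * b * x1 + p * (2 * t * e * x2 - t ^ 2 * e * x0) := by
    intro t
    obtain ⟨q, hq⟩ := hk t
    have e1 : 2 * b * x1 + p * (2 * t * e * x2 - t ^ 2 * e * x0) =
        2 * (b * x1 + k t * (b * x0) + t * (p * e * x2)) - p ^ 2 * (q * x0) := by
      linear_combination -x0 * hq
    rw [e1, dvd_sub_left (dvd_mul_right _ _)]
    exact ⟨fun h => h.mul_left _, fun h => hcop2.dvd_of_dvd_mul_left h⟩
  simp only [hcond]
  by_cases h1 : (p : ℤ) ∣ x1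
  · obtain ⟨y, hy⟩ := h1
    have hcond2 : ∀ t : ℤ, ((p : ℤ) ^ 2 ∣ 2 * b * x1 + p * (2 * t * e * x2 - t ^ 2 * e * x0)) ↔
        (((2 * b * y : ℤ) : ZMod p) + ((2 * e * x2 : ℤ) : ZMod p) * (t : ZMod p) +
          ((- e * x0 : ℤ) : ZMod p) * (t : ZMod p) ^ 2 = 0) := by
      intro t
      rw [hy, show 2 * b * (p * y) + p * (2 * t * e * x2 - t ^ 2 * e * x0) =
        p * (2 * b * y + (2 * e * x2) * t + (-e * x0) * t ^ 2) by ring, pow_two, mul_dvd_mul_iff_left h0,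
        ← ZMod.intCast_zmod_eq_zero_iff_dvd]
      push_cast
      rfl
    have hn2 : (p : ℤ) ∣ n' - (2 * b * x0 * y + e * x2 ^ 2) := by
      rw [hy, show (p : ℤ) * n' - (2 * b * x0 * (p * y) + p * e * x2 ^ 2) =
        p * (n' - (2 * b * x0 * y + e * x2 ^ 2)) by ring, pow_two, mul_dvd_mul_iff_left h0] at hn
      exact hn
    have hn3 : (n' : ZMod p) = 2 * b * x0 * y + e * x2 ^ 2 := by
      have := (ZMod.intCast_zmod_eq_zero_iff_dvd _ _).2 hn2
      push_cast at this
      exact sub_eq_zero.1 this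
    have hD : ((4 * (e * n') : ℤ) : ZMod p) = ((2 * e * x2 : ℤ) : ZMod p) ^ 2 -
        4 * ((2 * b * y : ℤ) : ZMod p) * ((- e * x0 : ℤ) : ZMod p) := by
      push_cast; rw [hn3]; ring
    have hleg : legendreSym p (4 * (e * n')) = 1 := by
      rw [legendreSym.mul, hchi, mul_one, show (4 : ℤ) = 2 ^ 2 by norm_num]
      apply legendreSym.sq_one'
      intro h
      apply h2
      exact (ZMod.intCast_zmod_eq_zero_iff_dvd _ _).1 h
    have hez : ((e * n' : ℤ) : ZMod p) ≠ 0 := by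
      intro h
      rw [(legendreSym.eq_zero_iff p _).2 h] at hchi
      exact zero_ne_one hchi
    have hrc := root_count hp2 ((2 * b * y : ℤ) : ZMod p) ((2 * e * x2 : ℤ) : ZMod p) ((- e * x0 : ℤ) : ZMod p)
      (by
        rintro ⟨ha, hbb, hc⟩
        rw [ha, hbb, hc] at hD
        have hD2 : ((4 * (e * n') : ℤ) : ZMod p) = 0 := by rw [hD]; ring
        rw [← legendreSym.eq_zero_iff, hleg] at hD2
        exact one_ne_zero hD2) _ hD
    rw [hleg] at hrc
    have hc0 : ((- e * x0 : ℤ) : ZMod p) = 0 ↔ (p : ℤ) ∣ x0 := by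
      rw [ZMod.intCast_zmod_eq_zero_iff_dvd, hpp.dvd_mul, or_iff_right]
      rw [dvd_neg, ← ZMod.intCast_zmod_eq_zero_iff_dvd]
      intro h; apply hez; push_cast; rw [h, zero_mul]
    have hcard : (Finset.univ.filter fun t : Fin p =>
        (p : ℤ) ^ 2 ∣ 2 * b * x1 + p * (2 * ((t : ℕ) : ℤ) * e * x2 - ((t : ℕ) : ℤ) ^ 2 * e * x0)).card =
        (Finset.univ.filter fun x : ZMod p => ((2 * b * y : ℤ) : ZMod p) + ((2 * e * x2 : ℤ) : ZMod p) * x +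
          ((- e * x0 : ℤ) : ZMod p) * x ^ 2 = 0).card := by
      refine Finset.card_bij (fun (t : Fin p) _ => ((t : ℕ) : ZMod p)) ?_ ?_ ?_
      · intro t ht
        rw [Finset.mem_filter] at ht ⊢
        have := (hcond2 _).1 ht.2
        rw [Int.cast_natCast] at this
        exact ⟨Finset.mem_univ _, this⟩
      · intro t _ t' _ h
        rw [ZMod.natCast_eq_natCast_iff] at h
        exact Fin.ext (Nat.ModEq.eq_of_lt_of_lt h t.2 t'.2)
      · intro x hx
        rw [Finset.mem_filter] at hx
        refine ⟨⟨x.val, ZMod.val_lt x⟩, ?_, by simp⟩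
        rw [Finset.mem_filter]
        refine ⟨Finset.mem_univ _, (hcond2 _).2 ?_⟩
        simpa using hx.2
    rw [hcard]
    have h1' : (p : ℤ) ∣ x1 := ⟨y, hy⟩
    simp only [h1', and_true, if_true]
    simp only [hc0] at hrc
    by_cases hx0 : (p : ℤ) ∣ x0 <;> simp only [hx0, if_true, if_false] at hrc ⊢ <;> omega
  · simp only [h1, and_false, if_false, add_zero, Finset.card_eq_zero, Finset.filter_eq_empty_iff]
    intro t _ h
    have h3 := (dvd_pow_self (p : ℤ) two_ne_zero).trans h
    rw [dvd_add_left (dvd_mul_right _ _), hpp.dvd_mul, hpp.dvd_mul] at h3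
    rcases h3 with (h3 | h3) | h3
    · exact h2 h3
    · exact hb h3
    · exact h1 h3

/-- the neighbour condition -/
def PC (p : ℕ) (B T : TernMat) (x : Fin 3 → ℤ) : Prop := ∀ k, (p : ℤ) ^ 2 ∣ (Tᵀ *ᵥ (B *ᵥ x)) k

lemma PC_T0 {k t e : ℤ} {w : Fin 3 → ℤ} (hw2 : (p : ℤ) ∣ w 2) :
    (∀ j, (p : ℤ) ^ 2 ∣ ((T0 p k t)ᵀ *ᵥ w) j) ↔ (p : ℤ) ^ 2 ∣ w 0 + k * w 1 + t * w 2 := by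
  obtain ⟨v, hv⟩ := hw2
  have e0 : ((T0 p k t)ᵀ *ᵥ w) 0 = w 0 + k * w 1 + t * w 2 := by
    simp [T0, Matrix.mulVec, dotProduct, Fin.sum_univ_three]
  constructor
  · intro h; rw [← e0]; exact h 0
  · intro h j
    fin_cases j
    · rw [← e0] at h; exact h
    · exact ⟨w 1, by simp [T0, Matrix.mulVec, dotProduct, Fin.sum_univ_three]⟩
    · exact ⟨v, by simp [T0, Matrix.mulVec, dotProduct, Fin.sum_univ_three, hv]; ring⟩

lemma PC_count {B : TernMat} (hp2 : p ≠ 2) (g : GoodL p B) {n' e : ℤ} (he : B 2 2 = p * e)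
    (hchi : legendreSym p (e * n') = 1) {x : Fin 3 → ℤ} (hx : quadVal B x = p * n') :
    Fintype.card {r : Bool × Fin p // PC p B (Trep p B r) x} = 2 := by
  obtain ⟨⟨m0, hm0⟩, ⟨m1, hm1⟩, ⟨m2, hm2⟩⟩ := g.nf.mulVec g.lat.1 x
  obtain ⟨z, hz⟩ := g.nf.quad g.lat.1 x
  have hk := fun t => kf_spec hp2 g.nf t
  have hw2 : (p : ℤ) ∣ (B *ᵥ x) 2 := by rw [hm2, he]; exact ⟨e * x 2 + p * m2, by ring⟩
  have hsw : sw *ᵥ (B *ᵥ x) = ![(B *ᵥ x) 1, (B *ᵥ x) 0, (B *ᵥ x) 2] := sw_mulVec _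
  have hF : ∀ t : Fin p, PC p B (Trep p B (false, t)) x ↔ (p : ℤ) ^ 2 ∣
      B 0 1 * x 1 + kf p B ((t : ℕ) : ℤ) * (B 0 1 * x 0) + ((t : ℕ) : ℤ) * (p * e * x 2) := by
    intro t
    unfold PC Trep
    simp only [Bool.false_eq_true, if_false]
    rw [PC_T0 (e := e) hw2, hm0, hm1, hm2, he]
    rw [show B 0 1 * x 1 + (p : ℤ) ^ 2 * m0 + kf p B ((t : ℕ) : ℤ) * (B 0 1 * x 0 + p ^ 2 * m1) +
      ((t : ℕ) : ℤ) * (p * e * x 2 + p ^ 2 * m2) = B 0 1 * x 1 + kf p B ((t : ℕ) : ℤ) * (B 0 1 * x 0) +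
      ((t : ℕ) : ℤ) * (p * e * x 2) + p ^ 2 * (m0 + kf p B ((t : ℕ) : ℤ) * m1 + ((t : ℕ) : ℤ) * m2) by ring,
      dvd_add_left (dvd_mul_right _ _)]
  have hT : ∀ t : Fin p, PC p B (Trep p B (true, t)) x ↔ (p : ℤ) ^ 2 ∣
      B 0 1 * x 0 + kf p B ((t : ℕ) : ℤ) * (B 0 1 * x 1) + ((t : ℕ) : ℤ) * (p * e * x 2) := by
    intro t
    unfold PC Trep
    have esw : swᵀ = sw := by ext i j; fin_cases i <;> fin_cases j <;> simp [sw]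
    simp only [if_true, Matrix.transpose_mul, esw]
    rw [← Matrix.mulVec_mulVec, hsw, PC_T0 (e := e) (by simpa using hw2)]
    simp only [Matrix.cons_val_zero, Matrix.cons_val_one, Matrix.cons_val]
    rw [hm0, hm1, hm2, he]
    rw [show B 0 1 * x 0 + (p : ℤ) ^ 2 * m1 + kf p B ((t : ℕ) : ℤ) * (B 0 1 * x 1 + p ^ 2 * m0) +
      ((t : ℕ) : ℤ) * (p * e * x 2 + p ^ 2 * m2) = B 0 1 * x 0 + kf p B ((t : ℕ) : ℤ) * (B 0 1 * x 1) +
      ((t : ℕ) : ℤ) * (p * e * x 2) + p ^ 2 * (m1 + kf p B ((t : ℕ) : ℤ) * m0 + ((t : ℕ) : ℤ) * m2) by ring,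
      dvd_add_left (dvd_mul_right _ _)]
  rw [card_bool_fin]
  simp only [hF, hT]
  rw [he] at hk
  have c1 := E_count (x0 := x 0) (x1 := x 1) (x2 := x 2) hp2 g.nf.h01 hk
    ⟨z, by rw [← hx, hz, he]; ring⟩ hchi
  have c2 := E_count (x0 := x 1) (x1 := x 0) (x2 := x 2) hp2 g.nf.h01 hk
    ⟨z, by rw [← hx, hz, he]; ring⟩ hchi
  have hor := (quad_mod_p hp2 g x).1 (by rw [hx]; exact dvd_mul_right _ _)
  by_cases h0 : (p : ℤ) ∣ x 0 <;> by_cases h1 : (p : ℤ) ∣ x 1 <;> simp only [h0, h1, if_true, if_false, and_true, true_and,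
    and_false, false_and, or_self] at c1 c2 hor ⊢ <;> omega

end

section
variable {p : ℕ} [hp : Fact p.Prime]

lemma dvd_mulVec {a : ℤ} (M : TernMat) {w : Fin 3 → ℤ} (h : ∀ k, a ∣ w k) (k : Fin 3) : a ∣ (M *ᵥ w) k := by
  simp only [Matrix.mulVec, dotProduct]
  exact Finset.dvd_sum fun j _ => (h j).mul_left _

lemma PC_unit {B T : TernMat} (V : TernMatˣ) (x : Fin 3 → ℤ) : PC p B (T * V.1) x ↔ PC p B T x := by
  unfold PC
  constructor
  · intro h
    have e : Tᵀ *ᵥ (B *ᵥ x) = (V⁻¹ : TernMatˣ).1ᵀ *ᵥ ((T * V.1)ᵀ *ᵥ (B *ᵥ x)) := by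
      rw [Matrix.mulVec_mulVec (B *ᵥ x) (V⁻¹ : TernMatˣ).1ᵀ, ← Matrix.transpose_mul, Matrix.mul_assoc, ← Units.val_mul, mul_inv_cancel]
      simp
    rw [e]
    exact dvd_mulVec _ h
  · intro h
    rw [Matrix.transpose_mul, ← Matrix.mulVec_mulVec]
    exact dvd_mulVec _ h

lemma Trepi_dvd (hp2 : p ≠ 2) {B : TernMat} (g : GoodL p B) (r : Bool × Fin p) {y : Fin 3 → ℤ}
    (h0 : (p : ℤ) ∣ y 0) (h1 : (p : ℤ) ∣ y 1) (k : Fin 3) : (p : ℤ) ∣ (Trepi p B r *ᵥ y) k := by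
  obtain ⟨a, ha⟩ := h0
  obtain ⟨b, hb⟩ := h1
  obtain ⟨c, hc⟩ := kf_dvd hp2 g.nf g.c1 ((r.2 : ℕ) : ℤ)
  have key : ∀ t : ℤ, ∀ y : Fin 3 → ℤ, (p : ℤ) ∣ y 1 → ∀ k : Fin 3,
      (p : ℤ) ∣ (T0i p (p * c) t *ᵥ y) k := by
    rintro t y ⟨b, hb⟩ k
    fin_cases k <;> simp [T0i, Matrix.mulVec, dotProduct, Fin.sum_univ_three]
    · exact ⟨p * y 0, by ring⟩
    · exact ⟨-c * y 0 + b, by rw [hb]; ring⟩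
    · exact ⟨t * y 0, by ring⟩
  unfold Trepi
  rw [hc]
  split_ifs
  · rw [← Matrix.mulVec_mulVec, sw_mulVec]
    exact key _ _ (by simpa using ⟨a, ha⟩) k
  · exact key _ _ ⟨b, hb⟩ k

lemma PC_card {B B' T : TernMat} (hp2 : p ≠ 2) (g : GoodL p B) (g' : GoodL p B') (hd : B'.det = B.det)
    (h : PIso p B B' T) (n : ℤ) : ((repF B n).filter (PC p B T)).card = rSh p n B' := by
  have hpp : Prime (p : ℤ) := Nat.prime_iff_prime_int.mp hp.out
  have h0 : (p : ℤ) ≠ 0 := by exact_mod_cast hp.out.ne_zero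
  obtain ⟨T', h1, h2, h3⟩ := iso_dual hp2 g hd h
  have hTB : Tᵀ * B = B' * T' := by
    apply smul_p2_inj (p := p)
    calc (p : ℤ) ^ 2 • (Tᵀ * B) = Tᵀ * B * (T * T') := by rw [h1, Matrix.mul_smul, Matrix.mul_one]
      _ = (Tᵀ * B * T) * T' := by simp only [Matrix.mul_assoc]
      _ = _ := by rw [h.1, Matrix.smul_mul]
  have hPC : ∀ x, Tᵀ *ᵥ (B *ᵥ x) = B' *ᵥ (T' *ᵥ x) := by
    intro x; rw [Matrix.mulVec_mulVec, hTB, ← Matrix.mulVec_mulVec]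
  have hq : ∀ y, quadVal B (T *ᵥ y) = quadVal B' y * (p : ℤ) ^ 2 := by
    intro y; rw [← quadVal_conj, h.1, quadVal_smul_mat, mul_comm]
  have hTi : Function.Injective (fun y : Fin 3 → ℤ => T *ᵥ y) := by
    intro y y' hy
    have := congrArg (fun v => T' *ᵥ v) hy
    simp only [Matrix.mulVec_mulVec, h2, Matrix.smul_mulVec, Matrix.one_mulVec] at this
    exact smul_right_injective _ (pow_ne_zero 2 h0) this
  unfold rSh
  rw [← Finset.card_image_of_injective _ (p_smul_inj (p := p)), ← Finset.card_image_of_injective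
    ((repF B' n).filter fun y => (p : ℤ) ∣ y 0 ∧ (p : ℤ) ∣ y 1) hTi]
  congr 1
  ext v
  simp only [Finset.mem_image, Finset.mem_filter, mem_repF g.lat, mem_repF g'.lat]
  constructor
  · rintro ⟨x, ⟨hx, hpc⟩, rfl⟩
    unfold PC at hpc
    rw [hPC] at hpc
    obtain ⟨⟨m0, hm0⟩, ⟨m1, hm1⟩, ⟨m2, hm2⟩⟩ := g'.nf.mulVec g'.lat.1 (T' *ᵥ x)
    have hcop : IsCoprime ((p : ℤ) ^ 2) (B' 0 1) := ((Prime.coprime_iff_not_dvd hpp).mpr g'.nf.h01).pow_left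
    have z1 : (p : ℤ) ^ 2 ∣ (T' *ᵥ x) 1 := by
      have := hpc 0
      rw [hm0, dvd_add_left (dvd_mul_right _ _)] at this
      exact hcop.dvd_of_dvd_mul_left this
    have z0 : (p : ℤ) ^ 2 ∣ (T' *ᵥ x) 0 := by
      have := hpc 1
      rw [hm1, dvd_add_left (dvd_mul_right _ _)] at this
      exact hcop.dvd_of_dvd_mul_left this
    have z2 : (p : ℤ) ∣ (T' *ᵥ x) 2 := by
      have := hpc 2
      obtain ⟨e, he⟩ := g'.c1
      have hc2 := g'.c2
      rw [hm2, dvd_add_left (dvd_mul_right _ _), he, pow_two, mul_assoc, mul_dvd_mul_iff_left h0, hpp.dvd_mul] at this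
      refine this.resolve_left fun h => hc2 ?_
      rw [he, pow_two]; exact mul_dvd_mul_left _ h
    obtain ⟨a, ha⟩ := z0
    obtain ⟨b, hb⟩ := z1
    obtain ⟨c, hc⟩ := z2
    have hz : T' *ᵥ x = (p : ℤ) • ![p * a, p * b, c] := by
      funext i; fin_cases i
      · simp [ha]; ring
      · simp [hb]; ring
      · simp [hc]
    have hTy : T *ᵥ ![p * a, p * b, c] = (p : ℤ) • x := by
      apply p_smul_inj (p := p)
      simp only
      rw [← Matrix.mulVec_smul, ← hz, Matrix.mulVec_mulVec, h1, Matrix.smul_mulVec, Matrix.one_mulVec, pow_two, smul_smul]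
    refine ⟨![p * a, p * b, c], ⟨?_, by simp, by simp⟩, hTy⟩
    apply mul_right_cancel₀ (pow_ne_zero 2 h0)
    rw [← hq, hTy, quadVal_p_smul, hx]
  · rintro ⟨y, ⟨hy, hy0, hy1⟩, rfl⟩
    obtain ⟨r, V, hV⟩ := iso_classify hp2 g' hd.symm h3
    have hVT : V.1 * T = Trepi p B' r := by
      apply cancel_left (Trepi_mul B' r)
      rw [← Matrix.mul_assoc, ← hV, h2, Trep_mul]
    have hTy : T *ᵥ y = (V⁻¹ : TernMatˣ).1 *ᵥ (Trepi p B' r *ᵥ y) := by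
      rw [← hVT, Matrix.mulVec_mulVec, ← Matrix.mul_assoc, ← Units.val_mul, inv_mul_cancel]
      simp
    have hdv : ∀ k, (p : ℤ) ∣ (T *ᵥ y) k := by
      rw [hTy]; exact dvd_mulVec _ (Trepi_dvd hp2 g' r hy0 hy1)
    choose x hx using hdv
    have hpx : (p : ℤ) • x = T *ᵥ y := by funext k; rw [hx]; rfl
    have hT'x : T' *ᵥ x = (p : ℤ) • y := by
      apply p_smul_inj (p := p)
      simp only
      rw [← Matrix.mulVec_smul, hpx, Matrix.mulVec_mulVec, h2, Matrix.smul_mulVec, Matrix.one_mulVec, pow_two, smul_smul]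
    refine ⟨x, ⟨?_, ?_⟩, hpx⟩
    · apply mul_right_cancel₀ (pow_ne_zero 2 h0)
      rw [← quadVal_p_smul, hpx, hq, hy]
    · unfold PC
      rw [hPC, hT'x, Matrix.mulVec_smul]
      obtain ⟨⟨m0, hm0⟩, ⟨m1, hm1⟩, ⟨m2, hm2⟩⟩ := g'.nf.mulVec g'.lat.1 y
      have hpd := dvd_pow_self (p : ℤ) two_ne_zero
      intro k
      rw [Pi.smul_apply, smul_eq_mul, pow_two]
      apply mul_dvd_mul_left
      fin_cases k
      · show (p : ℤ) ∣ (B' *ᵥ y) 0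
        rw [hm0]; exact dvd_add (hy1.mul_left _) (hpd.mul_right _)
      · show (p : ℤ) ∣ (B' *ᵥ y) 1
        rw [hm1]; exact dvd_add (hy0.mul_left _) (hpd.mul_right _)
      · show (p : ℤ) ∣ (B' *ᵥ y) 2
        rw [hm2]; exact dvd_add (g'.c1.mul_right _) (hpd.mul_right _)

lemma count2 (hp2 : p ≠ 2) {m : ℕ} {ω : Fin m → TernMat} (S : HeckeSys p m ω) {n' : ℤ} {e : Fin m → ℤ}
    (he : ∀ i, ω i 2 2 = p * e i) (hchi : ∀ i, legendreSym p (e i * n') = 1) :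
    Rsum ω (p * n') = p * Rsh p ω (p * n') := by
  have h := hecke_double hp2 S (fun i => repF (ω i) (p * n')) (fun i T x => PC p (ω i) T x)
    (fun i x T V => PC_unit V x) (fun j => rSh p (p * n') (ω j))
    (fun i j T hT => PC_card hp2 (S.good i) (S.good j) (S.det j i) hT _)
  have e1 : ∀ i, ∑ x ∈ repF (ω i) (p * n'), (Fintype.card {r : Bool × Fin p // PC p (ω i) (Trep p (ω i) r) x} : ℝ)
      = 2 * rRep (p * n') (ω i) := by
    intro i
    rw [Finset.sum_congr rfl (fun x hx => by
      rw [PC_count hp2 (S.good i) (he i) (hchi i) ((mem_repF (S.good i).lat).1 hx)]), Finset.sum_const,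
      rRep_eq (S.good i).lat, nsmul_eq_mul]
    push_cast; ring
  unfold Rsum Rsh
  have h3 : (2 : ℝ) * ∑ i, (rRep (p * n') (ω i) : ℝ) / (numAut (ω i) : ℝ) =
      2 * p * ∑ j, (rSh p (p * n') (ω j) : ℝ) / (numAut (ω j) : ℝ) := by
    rw [← h, Finset.mul_sum]
    refine Finset.sum_congr rfl fun i _ => ?_
    rw [e1]; ring
  linarith

lemma chi_det (hp2 : p ≠ 2) {B : TernMat} (g : GoodL p B) {d e n' : ℤ} (he : B 2 2 = p * e) (hd : B.det = p * d) :
    legendreSym p (e * n') = legendreSym p (-d * n') := by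
  have h0 : (p : ℤ) ≠ 0 := by exact_mod_cast hp.out.ne_zero
  obtain ⟨a, ha⟩ := g.nf.h00
  obtain ⟨b, hb⟩ := g.nf.h11
  obtain ⟨c, hc⟩ := g.nf.h02
  obtain ⟨f, hf⟩ := g.nf.h12
  have h1 := hd
  rw [Matrix.det_fin_three, g.lat.e10, g.lat.e20, g.lat.e21, ha, hb, hc, hf, he] at h1
  have h2 : ((-d : ℤ) : ZMod p) = ((B 0 1 ^ 2 * e : ℤ) : ZMod p) := by
    rw [ZMod.intCast_eq_intCast_iff_dvd_sub]
    refine ⟨a * (p ^ 3 * b * e - p ^ 4 * f ^ 2) + 2 * B 0 1 * p ^ 2 * f * c - c ^ 2 * p ^ 4 * b, ?_⟩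
    apply mul_left_cancel₀ h0
    linear_combination -h1
  have h3 : ((B 0 1 : ℤ) : ZMod p) ≠ 0 := by
    intro h; exact g.nf.h01 ((ZMod.intCast_zmod_eq_zero_iff_dvd _ _).1 h)
  rw [legendreSym.mul, legendreSym.mul]
  congr 1
  have h4 : legendreSym p (-d) = legendreSym p (B 0 1 ^ 2 * e) := by
    unfold legendreSym; rw [h2]
  rw [h4, legendreSym.mul, legendreSym.sq_one' p h3, one_mul]

end

section
variable {p : ℕ} [hp : Fact p.Prime]

lemma rec_A (hp2 : p ≠ 2) {m : ℕ} {ω : Fin m → TernMat} (S : HeckeSys p m ω) {n : ℤ} (hn : ¬ (p : ℤ) ∣ n) :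
    Rsum ω (n * (p : ℤ) ^ 2) = (2 * p + 1) * Rsum ω n := by
  have h := count1 hp2 S n
  rw [if_neg hn] at h
  linarith

lemma rec_B (hp2 : p ≠ 2) {m : ℕ} {ω : Fin m → TernMat} (S : HeckeSys p m ω) (n : ℤ) :
    Rsum ω (n * (p : ℤ) ^ 2 * (p : ℤ) ^ 2) = (p + 1) * Rsum ω (n * (p : ℤ) ^ 2) - p * Rsum ω n := by
  have h := count1 hp2 S (n * (p : ℤ) ^ 2)
  rw [if_pos (Dvd.dvd.mul_left (dvd_pow_self _ two_ne_zero) _)] at h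
  have h2 : Rsh p ω (n * (p : ℤ) ^ 2) = Rsum ω n := by
    unfold Rsh Rsum
    exact Finset.sum_congr rfl fun i _ => by rw [rSh_sq (S.good i)]
  rw [h2] at h
  linarith

lemma rec_C (hp2 : p ≠ 2) {m : ℕ} {ω : Fin m → TernMat} (S : HeckeSys p m ω) {n' d : ℤ}
    (hd : ∀ i, (ω i).det = p * d) :
    (legendreSym p (-d * n') = 1 → Rsum ω (p * n' * (p : ℤ) ^ 2) = p * Rsum ω (p * n')) ∧
    (legendreSym p (-d * n') = -1 → Rsum ω (p * n' * (p : ℤ) ^ 2) = (p + 1) * Rsum ω (p * n')) := by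
  have h := count1 hp2 S (p * n')
  rw [if_pos (dvd_mul_right _ _)] at h
  choose e he using fun i => (S.good i).c1
  constructor
  · intro hc
    have h2 := count2 hp2 S (n' := n') he (fun i => by rw [chi_det hp2 (S.good i) (he i) (hd i), hc])
    linarith
  · intro hc
    have h2 : Rsh p ω (p * n') = 0 := by
      unfold Rsh
      apply Finset.sum_eq_zero
      intro i _
      rw [rSh_zero (S.good i) (he i) (by rw [chi_det hp2 (S.good i) (he i) (hd i), hc])]
      simp
    rw [h2] at h
    linarith

/-- the previous term of the Hurwitz sequence -/
noncomputable def hq (p N : ℕ) : ℚ := if p ^ 2 ∣ N then hurwitzNat (N / p ^ 2) else 0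

noncomputable def DD (p N : ℕ) : ℚ := hurwitzNat N + p * hq p N

lemma hq_mul (N : ℕ) : hq p (p ^ 2 * N) = hurwitzNat N := by
  unfold hq
  rw [if_pos (dvd_mul_right _ _), Nat.mul_div_cancel_left _ (pow_pos hp.out.pos 2)]

lemma h_next (hp2 : p ≠ 2) {N : ℕ} (hN : p ∣ N) :
    hurwitzNat (p ^ 2 * N) = (p + 1) * hurwitzNat N - p * hq p N := by
  have := hur_rec1 hp.out hp2 hN
  unfold hq
  linarith

lemma DD_rec (hp2 : p ≠ 2) {N : ℕ} (hN : p ∣ N) :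
    DD p (p ^ 2 * (p ^ 2 * N)) = (p + 1) * DD p (p ^ 2 * N) - p * DD p N := by
  unfold DD
  rw [hq_mul, hq_mul, h_next hp2 (hN.mul_left (p ^ 2)), hq_mul, h_next hp2 hN]
  ring

lemma DD_A (hp2 : p ≠ 2) {N : ℕ} (hN : p ∣ N) (hN2 : ¬ p ^ 2 ∣ N) :
    DD p (p ^ 2 * N) = (2 * p + 1) * DD p N := by
  unfold DD
  rw [hq_mul, h_next hp2 hN]
  unfold hq
  rw [if_neg hN2]
  ring

lemma DD_C (hp2 : p ≠ 2) {M : ℕ} (hM : ¬ p ∣ M) :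
    (legendreSym p (-(M : ℤ)) = 1 → DD p (p ^ 2 * (p ^ 2 * M)) = p * DD p (p ^ 2 * M)) ∧
    (legendreSym p (-(M : ℤ)) = -1 → DD p (p ^ 2 * (p ^ 2 * M)) = (p + 1) * DD p (p ^ 2 * M)) := by
  unfold DD
  rw [hq_mul, hq_mul, h_next hp2 (((dvd_pow_self p two_ne_zero)).mul_right M), hq_mul, hur_rec2 hp2 hM]
  constructor
  · intro h; rw [h]; push_cast; ring
  · intro h; rw [h]; push_cast; ring

/-- comparing the two characters -/
lemma chi_compare (hp2 : p ≠ 2) {f M n' d : ℤ} (hf : ¬ (p : ℤ) ∣ f) (h : f ^ 2 * M = 4 * d * n') :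
    legendreSym p (-M) = legendreSym p (-d * n') := by
  have h2 := two_not_dvd hp.out hp2
  have hf' : ((f : ℤ) : ZMod p) ≠ 0 := fun h => hf ((ZMod.intCast_zmod_eq_zero_iff_dvd _ _).1 h)
  have h2' : ((2 : ℤ) : ZMod p) ≠ 0 := fun h => h2 ((ZMod.intCast_zmod_eq_zero_iff_dvd _ _).1 h)
  have e : f ^ 2 * (-M) = 2 ^ 2 * (-d * n') := by linear_combination -h
  have := congrArg (legendreSym p) e
  rwa [legendreSym.mul, legendreSym.mul p (2 ^ 2), legendreSym.sq_one' p hf', legendreSym.sq_one' p h2', one_mul, one_mul] at this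

lemma leg_pm {a : ℤ} (ha : ¬ (p : ℤ) ∣ a) : legendreSym p a = 1 ∨ legendreSym p a = -1 :=
  legendreSym.eq_one_or_neg_one p (fun h => ha ((ZMod.intCast_zmod_eq_zero_iff_dvd _ _).1 h))

lemma iso_main (hp2 : p ≠ 2) {m : ℕ} {ω : Fin m → TernMat} (S : HeckeSys p m ω) {d f : ℕ}
    (hd : ∀ i, (ω i).det = p * d) (hpd : ¬ p ∣ d) (hf : ¬ p ∣ f) : ∀ (n : ℕ), 0 < n → ∀ N : ℕ, f ^ 2 * N = 4 * (p * d) * n →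
    Rsum ω ((n : ℤ) * (p : ℤ) ^ 2) * (DD p N : ℝ) = Rsum ω n * (DD p (p ^ 2 * N) : ℝ) := by
  have hpp := hp.out
  have h2 : ¬ p ∣ 2 := fun h => hp2 ((Nat.prime_dvd_prime_iff_eq hpp Nat.prime_two).1 h)
  have h4 : ¬ p ∣ 4 := fun h => h2 (hpp.dvd_of_dvd_pow (show p ∣ 2 ^ 2 from h))
  have hcop : Nat.Coprime p f := (Nat.Prime.coprime_iff_not_dvd hpp).2 hf
  intro n
  induction n using Nat.strong_induction_on with
  | _ n ih =>
    intro hn N hN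
    have hpN : p ∣ N := by
      apply Nat.Coprime.dvd_of_dvd_mul_left (hcop.pow_right 2)
      rw [hN]; exact ⟨4 * d * n, by ring⟩
    by_cases h : p ∣ n
    · obtain ⟨n', rfl⟩ := h
      have hp2N : p ^ 2 ∣ N := by
        apply Nat.Coprime.dvd_of_dvd_mul_left ((hcop.pow_right 2).pow_left 2)
        rw [hN]; exact ⟨4 * d * n', by ring⟩
      obtain ⟨M, rfl⟩ := hp2N
      have hM : f ^ 2 * M = 4 * d * n' := by
        apply Nat.eq_of_mul_eq_mul_left (pow_pos hpp.pos 2)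
        linear_combination hN
      by_cases h' : p ∣ n'
      · obtain ⟨n1, rfl⟩ := h'
        have hn1 : 0 < n1 := by
          rcases Nat.eq_zero_or_pos n1 with h | h
          · simp [h] at hn
          · exact h
        have hlt : n1 < p * (p * n1) := by
          have := hpp.two_le
          nlinarith [Nat.mul_le_mul this (Nat.mul_le_mul this (le_refl n1))]
        have hI := ih n1 hlt hn1 M (by rw [hM]; ring)
        have hB := rec_B hp2 S n1
        have hpM : p ∣ M := by
          apply Nat.Coprime.dvd_of_dvd_mul_left (hcop.pow_right 2)
          rw [hM]; exact ⟨4 * d * n1, by ring⟩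
        have hDD := DD_rec hp2 hpM
        have ec : ((p * (p * n1) : ℕ) : ℤ) = (n1 : ℤ) * (p : ℤ) ^ 2 := by push_cast; ring
        rw [ec, hB, hDD]
        push_cast
        linear_combination (p : ℝ) * hI
      · have hpM : ¬ p ∣ M := by
          intro hd2
          have : p ∣ 4 * d * n' := by rw [← hM]; exact hd2.mul_left _
          rcases (hpp.dvd_mul).1 this with h3 | h3
          · rcases (hpp.dvd_mul).1 h3 with h3 | h3
            · exact h4 h3
            · exact hpd h3
          · exact h' h3
        have hch := chi_compare (p := p) hp2 (f := f) (M := M) (n' := n') (d := d)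
          (by exact_mod_cast hf) (by exact_mod_cast hM)
        have hC := rec_C hp2 S (n' := n') (d := d) hd
        have hD := DD_C hp2 hpM
        have ec : ((p * n' : ℕ) : ℤ) = (p : ℤ) * n' := by push_cast; ring
        rw [ec]
        rw [hch] at hD
        rcases leg_pm (p := p) (a := -(M : ℤ)) (by rw [dvd_neg]; exact_mod_cast hpM) with hl | hl
        · rw [hch] at hl
          rw [hC.1 hl, hD.1 hl]; push_cast; ring
        · rw [hch] at hl
          rw [hC.2 hl, hD.2 hl]; push_cast; ring
    · have hp2N : ¬ p ^ 2 ∣ N := by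
        rintro ⟨M, rfl⟩
        have h5 : p * (f ^ 2 * M) = 4 * d * n := by
          apply Nat.eq_of_mul_eq_mul_left hpp.pos
          linear_combination hN
        have : p ∣ 4 * d * n := by rw [← h5]; exact dvd_mul_right _ _
        rcases (hpp.dvd_mul).1 this with h3 | h3
        · rcases (hpp.dvd_mul).1 h3 with h3 | h3
          · exact h4 h3
          · exact hpd h3
        · exact h h3
      rw [rec_A hp2 S (by exact_mod_cast h), DD_A hp2 hpN hp2N]
      push_cast; ring

end

section
variable {p : ℕ} [hp : Fact p.Prime]

lemma iso_int (hp2 : p ≠ 2) {B : TernMat} (hB : B.IsSymm) {x : Fin 3 → ℤ} {i : Fin 3} (h : (p : ℤ) ∣ quadVal B x)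
    (hi : ¬ (p : ℤ) ∣ (B *ᵥ x) i) : IsoM (padicMat p B) := by
  have e : (padicMat p B *ᵥ fun j => ((x j : ℤ) : ℤ_[p])) i = (((B *ᵥ x) i : ℤ) : ℤ_[p]) := by
    simp [Matrix.mulVec, dotProduct, padicMat]
  apply isoM_of_hensel hp2 (padicMat_symm hB) (x := fun j => ((x j : ℤ) : ℤ_[p])) (i := i)
  · rw [quadVal_padicMat, padic_intCast_dvd_iff']; exact h
  · rw [e, padic_isUnit_iff_not_dvd, padic_intCast_dvd_iff']; exact hi

lemma det_identity {B : TernMat} (hB : IsLat B) (x : Fin 3 → ℤ) (i : Fin 3) : ∃ j k, j ≠ k ∧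
    x i ^ 2 * B.det = quadVal B x * (B j j * B k k - B j k ^ 2) - ((B *ᵥ x) j ^ 2 * B k k -
      2 * (B *ᵥ x) j * (B *ᵥ x) k * B j k + (B *ᵥ x) k ^ 2 * B j j) := by
  fin_cases i
  · refine ⟨1, 2, by decide, ?_⟩
    simp only [quadVal_three, Matrix.mulVec, dotProduct, Fin.sum_univ_three, Matrix.det_fin_three, hB.e10, hB.e20, hB.e21]
    simp only [Fin.zero_eta]
    ring
  · refine ⟨0, 2, by decide, ?_⟩
    simp only [quadVal_three, Matrix.mulVec, dotProduct, Fin.sum_univ_three, Matrix.det_fin_three, hB.e10, hB.e20, hB.e21]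
    simp only [Fin.mk_one]
    ring
  · refine ⟨0, 1, by decide, ?_⟩
    simp only [quadVal_three, Matrix.mulVec, dotProduct, Fin.sum_univ_three, Matrix.det_fin_three, hB.e10, hB.e20, hB.e21]
    simp only [Fin.reduceFinMk]
    ring

lemma binary_iso (hp2 : p ≠ 2) {B : TernMat} (hB : IsLat B) {j k : Fin 3} (hjk : j ≠ k) {s : ℤ}
    (hs : (p : ℤ) ∣ s ^ 2 + (B j j * B k k - B j k ^ 2)) (hs0 : ¬ (p : ℤ) ∣ s) : IsoM (padicMat p B) := by
  have hpp : Prime (p : ℤ) := Nat.prime_iff_prime_int.mp hp.out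
  have hsym : B k j = B j k := hB.1.apply j k
  have hq : ∀ u v : ℤ, quadVal B (Pi.single j u + Pi.single k v) = B j j * u ^ 2 + 2 * B j k * u * v + B k k * v ^ 2 := by
    intro u v
    rw [quadVal_dot, Matrix.mulVec_add, Matrix.mulVec_single, Matrix.mulVec_single, add_dotProduct, dotProduct_add,
      dotProduct_add, single_dotProduct, single_dotProduct, single_dotProduct, single_dotProduct]
    simp [hsym]
    ring
  have hw : ∀ u v : ℤ, ∀ i, (B *ᵥ (Pi.single j u + Pi.single k v)) i = B i j * u + B i k * v := by
    intro u v i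
    rw [Matrix.mulVec_add, Matrix.mulVec_single, Matrix.mulVec_single]
    simp
    ring
  by_cases hj : (p : ℤ) ∣ B j j
  · refine iso_int hp2 hB.1 (x := Pi.single j 1 + Pi.single k 0) (i := k) ?_ ?_
    · rw [hq]; simpa using hj
    · rw [hw, hsym]
      intro h
      apply hs0
      apply hpp.dvd_of_dvd_pow (n := 2)
      have h3 : (p : ℤ) ∣ B j k := by simpa using h
      have e : s ^ 2 = (s ^ 2 + (B j j * B k k - B j k ^ 2)) - B j j * B k k + B j k * B j k := by ring
      rw [e]
      exact dvd_add (dvd_sub hs (hj.mul_right _)) (h3.mul_right _)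
  · refine iso_int hp2 hB.1 (x := Pi.single j (s - B j k) + Pi.single k (B j j)) (i := j) ?_ ?_
    · rw [hq]
      rw [show B j j * (s - B j k) ^ 2 + 2 * B j k * (s - B j k) * B j j + B k k * B j j ^ 2 =
        B j j * (s ^ 2 + (B j j * B k k - B j k ^ 2)) by ring]
      exact hs.mul_left _
    · rw [hw, show B j j * (s - B j k) + B j k * B j j = B j j * s by ring]
      intro h
      exact (hpp.dvd_or_dvd h).elim hj hs0

lemma aniso_sq (hp2 : p ≠ 2) {B : TernMat} (hB : IsLat B) (ha : ¬ IsoM (padicMat p B)) (hd : ¬ (p : ℤ) ^ 2 ∣ B.det)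
    {x : Fin 3 → ℤ} (hx : (p : ℤ) ^ 2 ∣ quadVal B x) (i : Fin 3) : (p : ℤ) ∣ x i := by
  have hpp : Prime (p : ℤ) := Nat.prime_iff_prime_int.mp hp.out
  by_contra hi
  have hw : ∀ j, (p : ℤ) ∣ (B *ᵥ x) j := by
    intro j
    by_contra hj
    exact ha (iso_int hp2 hB.1 ((dvd_pow_self _ two_ne_zero).trans hx) hj)
  obtain ⟨j, k, -, h⟩ := det_identity hB x i
  have h3 : (p : ℤ) ^ 2 ∣ x i ^ 2 * B.det := by
    rw [h]
    obtain ⟨a, ha⟩ := hw j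
    obtain ⟨b, hb⟩ := hw k
    rw [ha, hb]
    exact dvd_sub (hx.mul_right _) ⟨a ^ 2 * B k k - 2 * a * b * B j k + b ^ 2 * B j j, by ring⟩
  have hcop : IsCoprime ((p : ℤ) ^ 2) (x i ^ 2) := ((Prime.coprime_iff_not_dvd hpp).mpr hi).pow
  exact hd (hcop.dvd_of_dvd_mul_left h3)

lemma aniso_rep (hp2 : p ≠ 2) {B : TernMat} (hB : IsLat B) (ha : ¬ IsoM (padicMat p B)) (hd : ¬ (p : ℤ) ^ 2 ∣ B.det)
    (n : ℤ) : rRep (n * (p : ℤ) ^ 2) B = rRep n B := by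
  rw [rRep_eq hB, rRep_eq hB, ← Finset.card_image_of_injective (repF B n) (p_smul_inj (p := p)), ← repF_mult hB]
  congr 1
  symm
  rw [Finset.filter_eq_self]
  intro x hx i
  rw [mem_repF hB] at hx
  exact aniso_sq hp2 hB ha hd ⟨n, by rw [hx]; ring⟩ i

lemma aniso_chi (hp2 : p ≠ 2) {B : TernMat} (hB : IsLat B) (ha : ¬ IsoM (padicMat p B)) {d n' : ℤ}
    (hd : B.det = p * d) (hpd : ¬ (p : ℤ) ∣ d) (hn' : ¬ (p : ℤ) ∣ n') {x : Fin 3 → ℤ} (hx : quadVal B x = p * n') :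
    legendreSym p (-d * n') = -1 := by
  have hpp : Prime (p : ℤ) := Nat.prime_iff_prime_int.mp hp.out
  have h0 : (p : ℤ) ≠ 0 := by exact_mod_cast hp.out.ne_zero
  have hdn : ¬ (p : ℤ) ∣ -d * n' := by
    intro h
    exact (hpp.dvd_or_dvd h).elim (fun h => hpd (by rwa [dvd_neg] at h)) hn'
  refine (leg_pm hdn).resolve_left fun hl => ?_
  have hi : ∃ i, ¬ (p : ℤ) ∣ x i := by
    by_contra hcon
    push Not at hcon
    choose y hy using hcon
    have : x = (p : ℤ) • y := by funext i; rw [hy]; rfl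
    rw [this, quadVal_p_smul] at hx
    apply hn'
    refine ⟨quadVal B y, mul_left_cancel₀ h0 ?_⟩
    rw [← hx]; ring
  obtain ⟨i, hi⟩ := hi
  have hw : ∀ j, (p : ℤ) ∣ (B *ᵥ x) j := by
    intro j
    by_contra hj
    exact ha (iso_int hp2 hB.1 (by rw [hx]; exact dvd_mul_right _ _) hj)
  obtain ⟨j, k, hjk, h⟩ := det_identity hB x i
  obtain ⟨a, haa⟩ := hw j
  obtain ⟨b, hbb⟩ := hw k
  rw [haa, hbb, hx, hd] at h
  have h1 : x i ^ 2 * d = n' * (B j j * B k k - B j k ^ 2) - p * (a ^ 2 * B k k - 2 * a * b * B j k + b ^ 2 * B j j) := by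
    apply mul_left_cancel₀ h0
    linear_combination h
  have hn0 : ((n' : ℤ) : ZMod p) ≠ 0 := fun h => hn' ((ZMod.intCast_zmod_eq_zero_iff_dvd _ _).1 h)
  have hx0 : ((x i : ℤ) : ZMod p) ≠ 0 := fun h => hi ((ZMod.intCast_zmod_eq_zero_iff_dvd _ _).1 h)
  have h2 : ((x i ^ 2 * (-d * n') : ℤ) : ZMod p) = ((n' ^ 2 * -(B j j * B k k - B j k ^ 2) : ℤ) : ZMod p) := by
    rw [ZMod.intCast_eq_intCast_iff_dvd_sub]
    exact ⟨-n' * (a ^ 2 * B k k - 2 * a * b * B j k + b ^ 2 * B j j), by linear_combination n' * h1⟩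
  have h3 : legendreSym p (x i ^ 2 * (-d * n')) = legendreSym p (n' ^ 2 * -(B j j * B k k - B j k ^ 2)) := by
    unfold legendreSym; rw [h2]
  rw [legendreSym.mul, legendreSym.mul p (n' ^ 2), legendreSym.sq_one' p hn0, legendreSym.sq_one' p hx0, one_mul, one_mul,
    hl] at h3
  have hδ : ((-(B j j * B k k - B j k ^ 2) : ℤ) : ZMod p) ≠ 0 := by
    intro h
    rw [(legendreSym.eq_zero_iff p _).2 h] at h3
    exact one_ne_zero h3
  obtain ⟨s, hs⟩ := (legendreSym.eq_one_iff p hδ).1 h3.symm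
  obtain ⟨s, rfl⟩ := ZMod.intCast_surjective s
  refine ha (binary_iso hp2 hB hjk (s := s) ?_ ?_)
  · rw [← ZMod.intCast_zmod_eq_zero_iff_dvd]
    push_cast at hs ⊢
    linear_combination -hs
  · intro h
    rw [← ZMod.intCast_zmod_eq_zero_iff_dvd] at h
    rw [h, mul_zero] at hs
    exact hδ hs

lemma hq_nonneg (N : ℕ) : 0 ≤ hq p N := by
  unfold hq; split_ifs
  · exact hurwitzNat_nonneg _
  · exact le_rfl

lemma aniso_main (hp2 : p ≠ 2) {B : TernMat} (hB : IsLat B) (ha : ¬ IsoM (padicMat p B)) {d f : ℕ}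
    (hd : B.det = p * d) (hpd : ¬ p ∣ d) (hf : ¬ p ∣ f) : ∀ (n : ℕ), 0 < n → ∀ x, quadVal B x = n →
    ∀ N : ℕ, f ^ 2 * N = 4 * (p * d) * n → hurwitzNat N ≠ 0 → hurwitzNat N - p * hq p N ≠ 0 := by
  have hpp := hp.out
  have hppz : Prime (p : ℤ) := Nat.prime_iff_prime_int.mp hp.out
  have h0 : (p : ℤ) ≠ 0 := by exact_mod_cast hp.out.ne_zero
  have h2 : ¬ p ∣ 2 := fun h => hp2 ((Nat.prime_dvd_prime_iff_eq hpp Nat.prime_two).1 h)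
  have h4 : ¬ p ∣ 4 := fun h => h2 (hpp.dvd_of_dvd_pow (show p ∣ 2 ^ 2 from h))
  have hcop : Nat.Coprime p f := (Nat.Prime.coprime_iff_not_dvd hpp).2 hf
  have hd2 : ¬ (p : ℤ) ^ 2 ∣ B.det := by
    rw [hd, pow_two, mul_dvd_mul_iff_left h0]
    exact_mod_cast hpd
  intro n
  induction n using Nat.strong_induction_on with
  | _ n ih =>
    intro hn x hx N hN hH
    have hpN : p ∣ N := by
      apply Nat.Coprime.dvd_of_dvd_mul_left (hcop.pow_right 2)
      rw [hN]; exact ⟨4 * d * n, by ring⟩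
    by_cases h : p ∣ n
    · obtain ⟨n', rfl⟩ := h
      have hp2N : p ^ 2 ∣ N := by
        apply Nat.Coprime.dvd_of_dvd_mul_left ((hcop.pow_right 2).pow_left 2)
        rw [hN]; exact ⟨4 * d * n', by ring⟩
      obtain ⟨M, rfl⟩ := hp2N
      have hM : f ^ 2 * M = 4 * d * n' := by
        apply Nat.eq_of_mul_eq_mul_left (pow_pos hpp.pos 2)
        linear_combination hN
      rw [hq_mul]
      by_cases h' : p ∣ n'
      · obtain ⟨n1, rfl⟩ := h'
        have hn1 : 0 < n1 := by
          rcases Nat.eq_zero_or_pos n1 with h | h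
          · simp [h] at hn
          · exact h
        have hlt : n1 < p * (p * n1) := by
          have := hpp.two_le
          nlinarith [Nat.mul_le_mul this (Nat.mul_le_mul this (le_refl n1))]
        have hpM : p ∣ M := by
          apply Nat.Coprime.dvd_of_dvd_mul_left (hcop.pow_right 2)
          rw [hM]; exact ⟨4 * d * n1, by ring⟩
        have hdv := aniso_sq hp2 hB ha hd2 (x := x) ⟨n1, by rw [hx]; push_cast; ring⟩
        choose y hy using hdv
        have hxy : x = (p : ℤ) • y := by funext i; rw [hy]; rfl
        rw [h_next hp2 hpM] at hH ⊢
        have hMne : hurwitzNat M ≠ 0 := by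
          intro h
          rw [h, mul_zero, zero_sub] at hH
          have h5 := hurwitzNat_nonneg (p ^ 2 * M)
          rw [h_next hp2 hpM, h] at h5
          have h6 := hq_nonneg (p := p) M
          have h7 : (0 : ℚ) < p := by exact_mod_cast hpp.pos
          have h8 : (p : ℚ) * hq p M = 0 := le_antisymm (by linarith) (by positivity)
          rw [h8] at hH
          exact hH neg_zero
        have hI := ih n1 hlt hn1 y (by
          apply mul_right_cancel₀ (pow_ne_zero 2 h0)
          rw [← quadVal_p_smul, ← hxy, hx]; push_cast; ring) M (by rw [hM]; ring) hMne
        intro h9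
        apply hI
        linear_combination h9
      · have hpM : ¬ p ∣ M := by
          intro hd2
          have : p ∣ 4 * d * n' := by rw [← hM]; exact hd2.mul_left _
          rcases (hpp.dvd_mul).1 this with h3 | h3
          · rcases (hpp.dvd_mul).1 h3 with h3 | h3
            · exact h4 h3
            · exact hpd h3
          · exact h' h3
        have hch := chi_compare (p := p) hp2 (f := f) (M := M) (n' := n') (d := d)
          (by exact_mod_cast hf) (by exact_mod_cast hM)
        have hl := aniso_chi hp2 hB ha hd (by exact_mod_cast hpd) (n' := n') (by exact_mod_cast h') (x := x)
          (by rw [hx]; push_cast; ring)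
        rw [hl] at hch
        rw [hur_rec2 hp2 hpM, hch] at hH ⊢
        have hMne : hurwitzNat M ≠ 0 := right_ne_zero_of_mul hH
        push_cast
        intro h9
        apply hMne
        linear_combination h9 / 2
    · have hp2N : ¬ p ^ 2 ∣ N := by
        rintro ⟨M, rfl⟩
        have h5 : p * (f ^ 2 * M) = 4 * d * n := by
          apply Nat.eq_of_mul_eq_mul_left hpp.pos
          linear_combination hN
        have : p ∣ 4 * d * n := by rw [← h5]; exact dvd_mul_right _ _
        rcases (hpp.dvd_mul).1 this with h3 | h3
        · rcases (hpp.dvd_mul).1 h3 with h3 | h3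
          · exact h4 h3
          · exact hpd h3
        · exact h h3
      unfold hq
      rw [if_neg hp2N, mul_zero, sub_zero]
      exact hH

end

lemma hurwitz_nat (N : ℕ) : hurwitz (N : ℚ) = hurwitzNat N := by
  simp [hurwitz]

lemma hurwitz_ne {x : ℚ} (h : hurwitz x ≠ 0) : ∃ N : ℕ, x = N := by
  unfold hurwitz at h
  split_ifs at h with hx
  · refine ⟨x.num.toNat, ?_⟩
    have h1 : ((x.num.toNat : ℕ) : ℤ) = x.num := Int.toNat_of_nonneg hx.2
    have h2 : ((x.num : ℤ) : ℚ) = x := Rat.den_eq_one_iff x |>.1 hx.1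
    have h3 := congrArg (Int.cast : ℤ → ℚ) h1
    rw [Int.cast_natCast] at h3
    exact h2.symm.trans h3.symm
  · exact absurd rfl h

lemma hurwitz_div {p : ℕ} (hp : p.Prime) (N : ℕ) : hurwitz ((N : ℚ) / (p : ℚ) ^ 2) = hq p N := by
  have hp0 : (p : ℚ) ≠ 0 := by exact_mod_cast hp.ne_zero
  unfold hq
  split_ifs with h
  · obtain ⟨M, rfl⟩ := h
    rw [Nat.mul_div_cancel_left _ (pow_pos hp.pos 2), ← hurwitz_nat]
    congr 1
    push_cast
    field_simp
  · by_contra hne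
    obtain ⟨M, hM⟩ := hurwitz_ne hne
    apply h
    rw [div_eq_iff (pow_ne_zero 2 hp0)] at hM
    refine ⟨M, ?_⟩
    have : (N : ℚ) = ((p ^ 2 * M : ℕ) : ℚ) := by rw [hM]; push_cast; ring
    exact_mod_cast this

lemma rsum_pos {A : TernMat} {m : ℕ} {ω : Fin m → TernMat} (hlat : ∀ i, IsLat (ω i))
    (hcov : ∀ B, InGenus A B → ∃ i, LatIsom B (ω i)) {n : ℕ} {B : TernMat} (hB : InGenus A B) {x : Fin 3 → ℤ}
    (hx : quadVal B x = n) : Rsum ω n ≠ 0 := by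
  obtain ⟨i, hi⟩ := hcov B hB
  apply ne_of_gt
  unfold Rsum
  apply Finset.sum_pos'
  · intro j _; positivity
  · refine ⟨i, Finset.mem_univ _, ?_⟩
    apply div_pos
    · have h1 : 0 < rRep n B := by
        rw [rRep_eq hB.1]
        exact Finset.card_pos.2 ⟨x, (mem_repF hB.1).2 hx⟩
      rw [rRep_congr hi] at h1
      exact_mod_cast h1
    · exact_mod_cast numAut_pos (hlat i)

theorem main_thm (A : TernMat) (hA : IsLat A)
    (p : ℕ) (hp : p.Prime) (hp2 : p ≠ 2) (hordp : padicValInt p A.det = 1)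
    (n : ℕ) (hn : 0 < n) (hloc : LocallyRepresented n A)
    (f : ℕ) (hf : 0 < f) (hfp : Nat.Coprime f p)
    (hH : hurwitz ((4 * (A.det : ℚ) * (n : ℚ)) / (f : ℚ) ^ 2) ≠ 0) :
    rGenus ((n : ℤ) * (p : ℤ) ^ 2) A / rGenus (n : ℤ) A =
      ((hurwitz ((4 * (A.det : ℚ) * (n : ℚ) * (p : ℚ) ^ 2) / (f : ℚ) ^ 2) : ℝ) +
          (SpStar p A : ℝ) * (p : ℝ) *
            (hurwitz ((4 * (A.det : ℚ) * (n : ℚ)) / (f : ℚ) ^ 2) : ℝ)) /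
        ((hurwitz ((4 * (A.det : ℚ) * (n : ℚ)) / (f : ℚ) ^ 2) : ℝ) +
          (SpStar p A : ℝ) * (p : ℝ) *
            (hurwitz ((4 * (A.det : ℚ) * (n : ℚ)) / ((f : ℚ) ^ 2 * (p : ℚ) ^ 2)) : ℝ)) := by
  have hpF : Fact p.Prime := ⟨hp⟩
  have hppz : Prime (p : ℤ) := Nat.prime_iff_prime_int.mp hp
  have hp0z : (p : ℤ) ≠ 0 := by exact_mod_cast hp.ne_zero
  have hpos := hA.posDet
  -- the determinant
  have hd1 : (p : ℤ) ∣ A.det := by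
    have := (padicValInt_dvd_iff (p := p) 1 A.det).2 (Or.inr (by rw [hordp]))
    simpa using this
  have hd2 : ¬ (p : ℤ) ^ 2 ∣ A.det := by
    intro h
    rcases (padicValInt_dvd_iff (p := p) 2 A.det).1 h with h | h
    · omega
    · omega
  obtain ⟨dz, hdz⟩ := hd1
  have hdzpos : 0 < dz := by
    rw [hdz] at hpos
    exact pos_of_mul_pos_right hpos (by positivity)
  obtain ⟨d, rfl⟩ := Int.eq_ofNat_of_zero_le hdzpos.le
  have hpd : ¬ p ∣ d := by
    intro h
    apply hd2
    rw [hdz, pow_two]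
    exact mul_dvd_mul_left _ (by exact_mod_cast h)
  have hpf : ¬ p ∣ f := (Nat.Prime.coprime_iff_not_dvd hp).1 hfp.symm
  have hf0 : (f : ℚ) ≠ 0 := by exact_mod_cast hf.ne'
  obtain ⟨N, hN⟩ := hurwitz_ne hH
  have hN2 : f ^ 2 * N = 4 * (p * d) * n := by
    rw [div_eq_iff (pow_ne_zero 2 hf0), hdz] at hN
    have : ((f ^ 2 * N : ℕ) : ℚ) = ((4 * (p * d) * n : ℕ) : ℚ) := by
      push_cast
      push_cast at hN
      linear_combination -hN
    exact_mod_cast this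
  have e1 : hurwitz ((4 * (A.det : ℚ) * (n : ℚ) * (p : ℚ) ^ 2) / (f : ℚ) ^ 2) = hurwitzNat (p ^ 2 * N) := by
    rw [← hurwitz_nat, mul_div_right_comm, hN]
    congr 1
    push_cast; ring
  have e2 : hurwitz ((4 * (A.det : ℚ) * (n : ℚ)) / ((f : ℚ) ^ 2 * (p : ℚ) ^ 2)) = hq p N := by
    rw [← div_div, hN, hurwitz_div hp]
  have e0 : hurwitz ((4 * (A.det : ℚ) * (n : ℚ)) / (f : ℚ) ^ 2) = hurwitzNat N := by rw [hN, hurwitz_nat]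
  rw [e0] at hH
  rw [e1, e2, e0]
  have hNnn := hurwitzNat_nonneg N
  have hqnn := hq_nonneg (p := p) N
  have hpN : p ∣ N := by
    apply Nat.Coprime.dvd_of_dvd_mul_left (hfp.symm.pow_right 2)
    rw [hN2]; exact ⟨4 * d * n, by ring⟩
  obtain ⟨B, hB, x, hx⟩ := exists_genus_rep hA hn hloc
  by_cases hiso : IsotropicP p A
  · have hS : SpStar p A = 1 := by
      unfold SpStar
      rw [dif_pos hp]
      exact if_pos hiso
    obtain ⟨m, ω, h1, h2, h3, w, hw, hr⟩ := genus_setup hA (NF p) (by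
      intro B hB
      exact exists_NF hp2 hB.1 (by rw [genus_det hA hB]; exact hd2) (IsoM.congr (hB.2 p hp) hiso))
    have hdet : ∀ i, (ω i).det = p * d := fun i => by rw [genus_det hA (h1 i).1, hdz]
    have hdet2 : ∀ i, ¬ (p : ℤ) ^ 2 ∣ (ω i).det := fun i => by rw [genus_det hA (h1 i).1]; exact hd2
    have S : HeckeSys p m ω := by
      have hg : ∀ i, GoodL p (ω i) := by
        intro i
        have h := NF.det22 (h1 i).1.1 (h1 i).2 (by rw [hdet]; exact dvd_mul_right _ _) (hdet2 i)
        exact ⟨(h1 i).1.1, (h1 i).2, h.1, h.2⟩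
      exact ⟨hg, fun i j => by rw [hdet, hdet], fun i r => h2 _ (Bn_genus hp2 (hg i) (hdet2 i) (h1 i).1 r), h3⟩
    have hmain := iso_main hp2 S hdet hpd hpf n hn N hN2
    have hR := rsum_pos (fun i => (h1 i).1.1) h2 hB hx
    have hr' : ∀ k, rGenus k A = w * Rsum ω k := hr
    rw [hr', hr', hS, mul_div_mul_left _ _ hw]
    have hD : (DD p N : ℝ) ≠ 0 := by
      have : (0 : ℚ) < DD p N := by
        unfold DD
        have : 0 < hurwitzNat N := lt_of_le_of_ne hNnn (Ne.symm hH)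
        positivity
      exact_mod_cast this.ne'
    have hD1 : (DD p N : ℝ) = (hurwitzNat N : ℝ) + ((1 : ℤ) : ℝ) * (p : ℝ) * (hq p N : ℝ) := by
      unfold DD; push_cast; ring
    have hD2 : (DD p (p ^ 2 * N) : ℝ) = (hurwitzNat (p ^ 2 * N) : ℝ) + ((1 : ℤ) : ℝ) * (p : ℝ) * (hurwitzNat N : ℝ) := by
      unfold DD; rw [hq_mul]; push_cast; ring
    rw [← hD1, ← hD2, div_eq_div_iff hR hD, hmain]
    ring
  · have hS : SpStar p A = -1 := by
      unfold SpStar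
      rw [dif_pos hp]
      exact if_neg hiso
    obtain ⟨m, ω, h1, h2, h3, w, hw, hr⟩ := genus_setup hA (fun _ => True) (fun B hB => ⟨B, LatIsom.refl B, trivial⟩)
    have han : ∀ C, InGenus A C → ¬ IsoM (padicMat p C) := fun C hC h =>
      hiso (IsoM.congr (PadicIsomP.symm (hC.2 p hp)) h)
    have hR := rsum_pos (fun i => (h1 i).1.1) h2 hB hx
    have hr' : ∀ k, rGenus k A = w * Rsum ω k := hr
    have hRR : Rsum ω ((n : ℤ) * (p : ℤ) ^ 2) = Rsum ω n := by
      unfold Rsum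
      exact Finset.sum_congr rfl fun i _ => by
        rw [aniso_rep hp2 (h1 i).1.1 (han _ (h1 i).1) (by rw [genus_det hA (h1 i).1]; exact hd2)]
    have hE := aniso_main hp2 hB.1 (han B hB) (by rw [genus_det hA hB, hdz]) hpd hpf n hn x hx N hN2 hH
    rw [hr', hr', hS, hRR, div_self (mul_ne_zero hw hR)]
    have hnum : (hurwitzNat (p ^ 2 * N) : ℝ) + ((-1 : ℤ) : ℝ) * (p : ℝ) * (hurwitzNat N : ℝ) =
        (hurwitzNat N : ℝ) + ((-1 : ℤ) : ℝ) * (p : ℝ) * (hq p N : ℝ) := by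
      rw [h_next hp2 hpN]; push_cast; ring
    have hE' : (hurwitzNat N : ℝ) + ((-1 : ℤ) : ℝ) * (p : ℝ) * (hq p N : ℝ) ≠ 0 := by
      have h5 : ((hurwitzNat N - p * hq p N : ℚ) : ℝ) ≠ 0 := by exact_mod_cast hE
      intro h6
      apply h5
      push_cast at h6 ⊢
      linear_combination h6
    rw [hnum, div_self hE']

/-- For an odd prime `p` with `ord_p(d_L) = 1` and `n` locally represented,
`r(np², gen(L))/r(n, gen(L))
  = (H(4d_Lnp²/f²) + S_p*(L)·p·H(4d_Ln/f²)) / (H(4d_Ln/f²) + S_p*(L)·p·H(4d_Ln/(f²p²)))`. -/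
theorem rGenus_ratio_odd_ramified_prime (A : TernMat) (hA : IsLat A)
    (p : ℕ) (hp : p.Prime) (hp2 : p ≠ 2) (hordp : padicValInt p A.det = 1)
    (n : ℕ) (hn : 0 < n) (hloc : LocallyRepresented n A)
    (f : ℕ) (hf : 0 < f) (hfp : Nat.Coprime f p)
    (hH : hurwitz ((4 * (A.det : ℚ) * (n : ℚ)) / (f : ℚ) ^ 2) ≠ 0) :
    rGenus ((n : ℤ) * (p : ℤ) ^ 2) A / rGenus (n : ℤ) A =
      ((hurwitz ((4 * (A.det : ℚ) * (n : ℚ) * (p : ℚ) ^ 2) / (f : ℚ) ^ 2) : ℝ) +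
          (SpStar p A : ℝ) * (p : ℝ) *
            (hurwitz ((4 * (A.det : ℚ) * (n : ℚ)) / (f : ℚ) ^ 2) : ℝ)) /
        ((hurwitz ((4 * (A.det : ℚ) * (n : ℚ)) / (f : ℚ) ^ 2) : ℝ) +
          (SpStar p A : ℝ) * (p : ℝ) *
            (hurwitz ((4 * (A.det : ℚ) * (n : ℚ)) / ((f : ℚ) ^ 2 * (p : ℚ) ^ 2)) : ℝ)) := 
  main_thm A hA p hp hp2 hordp n hn hloc f hf hfp hH
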